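/- Suppose Assumptions (A1) and (A2) hold. Then for each ε > 0 the discounted MFG system has a unique classical solution (u^ε, m^ε), and it satisfies m^ε > 0 on T^d. -/

import Mathlib

open MeasureTheory Set

noncomputable def pd (d : ℕ) (i : Fin d) (f : (Fin d → ℝ) → ℝ) : (Fin d → ℝ) → ℝ :=
  fun x => fderiv ℝ f x (Pi.single i 1)

noncomputable def gradSq (d : ℕ) (u : (Fin d → ℝ) → ℝ) (x : Fin d → ℝ) : ℝ :=
  ∑ i, pd d i u x ^ 2

noncomputable def divUp (d : ℕ) (m u : (Fin d → ℝ) → ℝ) (x : Fin d → ℝ) : ℝ :=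
  ∑ i, pd d i (fun y => m y * pd d i u y) x

/-- `f` is `ℤ^d`-periodic, i.e. a function on the flat torus `T^d`. -/
def ZPer (d : ℕ) (f : (Fin d → ℝ) → ℝ) : Prop :=
  ∀ (x : Fin d → ℝ) (k : Fin d → ℤ), f (x + fun i => (k i : ℝ)) = f x

/-- `f` has finite `α`-Hölder seminorm. -/
def HolderSemi (α : ℝ) {E : Type*} [PseudoMetricSpace E] (f : E → ℝ) : Prop :=
  ∃ C : ℝ, 0 ≤ C ∧ ∀ x y, |f x - f y| ≤ C * dist x y ^ α

/-- `f` is of class `C^{1,α}`. -/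
def C1Hold (d : ℕ) (α : ℝ) (f : (Fin d → ℝ) → ℝ) : Prop :=
  ContDiff ℝ 1 f ∧ ∀ i, HolderSemi α (pd d i f)

/-- `f` is of class `C^{2,α}`. -/
def C2Hold (d : ℕ) (α : ℝ) (f : (Fin d → ℝ) → ℝ) : Prop :=
  ContDiff ℝ 2 f ∧ ∀ i j, HolderSemi α (pd d i (pd d j f))

/-- `f` is locally `α`-Hölder on `s`. -/
def LocHolderOn (α : ℝ) (f : ℝ → ℝ) (s : Set ℝ) : Prop :=
  ∀ K : Set ℝ, IsCompact K → K ⊆ s →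
    ∃ C : ℝ, 0 ≤ C ∧ ∀ x ∈ K, ∀ y ∈ K, |f x - f y| ≤ C * dist x y ^ α

/-- Standing hypotheses on `g`: strictly increasing and continuous on `[0,∞)`,
of class `C^{1,α}` on `(0,∞)`. -/
def Ghyp (α : ℝ) (g : ℝ → ℝ) : Prop :=
  StrictMonoOn g (Ici 0) ∧ ContinuousOn g (Ici 0) ∧
    DifferentiableOn ℝ g (Ioi 0) ∧ LocHolderOn α (deriv g) (Ioi 0)

/-- Standing hypotheses on `V`: a `C^{1,α}` function on the torus. -/
def Vhyp (d : ℕ) (α : ℝ) (V : (Fin d → ℝ) → ℝ) : Prop :=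
  ZPer d V ∧ C1Hold d α V

/-- The oscillation of `V` over the torus. -/
noncomputable def oscV (d : ℕ) (V : (Fin d → ℝ) → ℝ) : ℝ :=
  sSup (V '' Icc (0 : Fin d → ℝ) 1) - sInf (V '' Icc (0 : Fin d → ℝ) 1)

/-- Assumption (A1): `g⁻¹(g(1) − osc V) > 0`, i.e. `g(1) − osc V` is attained by `g` on `(0,∞)`. -/
def A1 (d : ℕ) (g : ℝ → ℝ) (V : (Fin d → ℝ) → ℝ) : Prop :=
  g 1 - oscV d V ∈ g '' Ioi (0 : ℝ)

/-- Assumption (A2). -/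
def A2 (g : ℝ → ℝ) : Prop :=
  ∃ C₁ C₂ β : ℝ, 0 < C₁ ∧ 0 < C₂ ∧
    (∀ z : ℝ, 0 < z → C₁ * z ^ β ≤ deriv g z) ∧
    (∀ z : ℝ, 0 ≤ z → g z ≤ C₂ + z * g z)

/-- A classical solution `(u, m)` of the discounted MFG system
`ε u + |Du|²/2 + V = g(m)`, `ε m − div(m Du) = ε` on `T^d`. -/
structure DiscSol (d : ℕ) (α : ℝ) (g : ℝ → ℝ) (V : (Fin d → ℝ) → ℝ) (ε : ℝ)
    (u m : (Fin d → ℝ) → ℝ) : Prop where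
  per_u : ZPer d u
  per_m : ZPer d m
  reg_u : C2Hold d α u
  reg_m : C1Hold d α m
  m_nonneg : ∀ x, 0 ≤ m x
  hj : ∀ x, ε * u x + (1 / 2) * gradSq d u x + V x = g (m x)
  fp : ∀ x, ε * m x - divUp d m u x = ε

/-- A classical solution `(u, m, H̄)` of the ergodic MFG system
`|Du|²/2 + V = g(m) + H̄`, `−div(m Du) = 0`, `m ≥ 0`, `∫ m = 1` on `T^d`. -/
structure ErgSol (d : ℕ) (α : ℝ) (g : ℝ → ℝ) (V : (Fin d → ℝ) → ℝ)
    (u m : (Fin d → ℝ) → ℝ) (H : ℝ) : Prop where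
  per_u : ZPer d u
  per_m : ZPer d m
  reg_u : C2Hold d α u
  reg_m : C1Hold d α m
  m_nonneg : ∀ x, 0 ≤ m x
  m_mass : (∫ x in Icc (0 : Fin d → ℝ) 1, m x) = 1
  hj : ∀ x, (1 / 2) * gradSq d u x + V x = g (m x) + H
  fp : ∀ x, divUp d m u x = 0

section S1

open MeasureTheory Set Filter Topology

namespace MFG

abbrev E (d : ℕ) := Fin d → ℝ

/-- the linear form with coefficients `p` -/
noncomputable def lin {d : ℕ} (p : Fin d → ℝ) : E d →L[ℝ] ℝ :=
  ∑ i, p i • ContinuousLinearMap.proj (R := ℝ) (φ := fun _ : Fin d => ℝ) i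

theorem lin_apply {d : ℕ} (p : Fin d → ℝ) (y : E d) : lin p y = ∑ i, p i * y i := by
  simp [lin, ContinuousLinearMap.sum_apply]

theorem eq_lin {d : ℕ} (L : E d →L[ℝ] ℝ) : L = lin (fun i => L (Pi.single i 1)) := by
  ext y
  rw [lin_apply]
  conv_lhs => rw [← Finset.univ_sum_single y]
  rw [map_sum]
  refine Finset.sum_congr rfl fun i _ => ?_
  have : (Pi.single i (y i) : E d) = y i • Pi.single i (1 : ℝ) := by
    rw [← Pi.single_smul]; simp
  rw [this, map_smul, smul_eq_mul, mul_comm]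

theorem lin_single {d : ℕ} (p : Fin d → ℝ) (i : Fin d) : lin p (Pi.single i 1) = p i := by
  rw [lin_apply]; simp [Pi.single_apply]

def HasGrad {d : ℕ} (u : E d → ℝ) (p : Fin d → E d → ℝ) : Prop :=
  ∀ x, HasFDerivAt u (lin (fun i => p i x)) x

variable {d : ℕ}

theorem HasGrad.pd {u : E d → ℝ} {p : Fin d → E d → ℝ} (h : HasGrad u p) (i : Fin d) :
    pd d i u = p i := by
  funext x
  simp only [_root_.pd, (h x).fderiv, lin_single]

theorem HasGrad.of_diff {u : E d → ℝ} (h : Differentiable ℝ u) :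
    HasGrad u (fun i => _root_.pd d i u) := by
  intro x
  have := (h x).hasFDerivAt
  rw [eq_lin (fderiv ℝ u x)] at this
  exact this

theorem HasGrad.differentiable {u : E d → ℝ} {p} (h : HasGrad u p) : Differentiable ℝ u :=
  fun x => (h x).differentiableAt

theorem HasGrad.continuous {u : E d → ℝ} {p} (h : HasGrad u p) : Continuous u :=
  h.differentiable.continuous

theorem HasGrad.congr {u : E d → ℝ} {p q : Fin d → E d → ℝ} (h : HasGrad u p)
    (hq : ∀ i x, p i x = q i x) : HasGrad u q := by
  have : p = q := by funext i x; exact hq i x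
  exact this ▸ h

theorem hasGrad_const (c : ℝ) : HasGrad (fun _ : E d => c) (fun _ _ => 0) := by
  intro x
  have : lin (fun _ : Fin d => (0 : ℝ)) = 0 := by ext y; simp [lin_apply]
  rw [this]
  exact hasFDerivAt_const c x

theorem HasGrad.add {u v : E d → ℝ} {p q} (hu : HasGrad u p) (hv : HasGrad v q) :
    HasGrad (fun x => u x + v x) (fun i x => p i x + q i x) := by
  intro x
  refine ((hu x).add (hv x)).congr_fderiv ?_
  ext y; simp [lin_apply, add_mul, Finset.sum_add_distrib]

theorem HasGrad.sub {u v : E d → ℝ} {p q} (hu : HasGrad u p) (hv : HasGrad v q) :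
    HasGrad (fun x => u x - v x) (fun i x => p i x - q i x) := by
  intro x
  refine ((hu x).sub (hv x)).congr_fderiv ?_
  ext y; simp [lin_apply, sub_mul, Finset.sum_sub_distrib]

theorem HasGrad.neg {u : E d → ℝ} {p} (hu : HasGrad u p) :
    HasGrad (fun x => - u x) (fun i x => - p i x) := by
  intro x
  refine ((hu x).neg).congr_fderiv ?_
  ext y; simp [lin_apply]

theorem HasGrad.mul {u v : E d → ℝ} {p q} (hu : HasGrad u p) (hv : HasGrad v q) :
    HasGrad (fun x => u x * v x) (fun i x => p i x * v x + u x * q i x) := by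
  intro x
  refine ((hu x).mul (hv x)).congr_fderiv ?_
  ext y
  simp only [lin_apply, ContinuousLinearMap.add_apply, ContinuousLinearMap.smul_apply,
    smul_eq_mul, Finset.mul_sum, ← Finset.sum_add_distrib]
  exact Finset.sum_congr rfl fun i _ => by ring

theorem HasGrad.const_mul {u : E d → ℝ} {p} (hu : HasGrad u p) (c : ℝ) :
    HasGrad (fun x => c * u x) (fun i x => c * p i x) := by
  refine ((hasGrad_const c).mul hu).congr fun i x => by ring

theorem HasGrad.sum {ι : Type*} (s : Finset ι) {u : ι → E d → ℝ} {p : ι → Fin d → E d → ℝ}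
    (h : ∀ k ∈ s, HasGrad (u k) (p k)) :
    HasGrad (fun x => ∑ k ∈ s, u k x) (fun i x => ∑ k ∈ s, p k i x) := by
  intro x
  refine (HasFDerivAt.fun_sum fun k hk => h k hk x).congr_fderiv ?_
  ext y
  simp only [lin_apply, ContinuousLinearMap.sum_apply, Finset.sum_mul]
  exact Finset.sum_comm

theorem HasGrad.comp {u : E d → ℝ} {p} (hu : HasGrad u p) {F F' : ℝ → ℝ}
    (hF : ∀ x, HasDerivAt F (F' (u x)) (u x)) :
    HasGrad (fun x => F (u x)) (fun i x => F' (u x) * p i x) := by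
  intro x
  refine ((hF x).comp_hasFDerivAt x (hu x)).congr_fderiv ?_
  ext y
  simp [lin_apply, Finset.mul_sum, mul_assoc]

theorem HasGrad.affine {u : E d → ℝ} {p} (hu : HasGrad u p) (x0 : E d) (r : ℝ) :
    HasGrad (fun x => u (x0 + r • x)) (fun i x => r * p i (x0 + r • x)) := by
  intro x
  have h1 : HasFDerivAt (fun x : E d => x0 + r • x) (r • ContinuousLinearMap.id ℝ (E d)) x :=
    ((hasFDerivAt_id x).const_smul r).const_add x0
  refine ((hu (x0 + r • x)).comp x h1).congr_fderiv ?_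
  ext y
  simp only [lin_apply, ContinuousLinearMap.comp_apply, ContinuousLinearMap.smul_apply,
    ContinuousLinearMap.id_apply, Pi.smul_apply, smul_eq_mul]
  exact Finset.sum_congr rfl fun i _ => by ring

theorem HasGrad.translate {u : E d → ℝ} {p} (hu : HasGrad u p) (y : E d) :
    HasGrad (fun x => u (x + y)) (fun i x => p i (x + y)) := by
  have := hu.affine y 1
  simp only [one_smul, one_mul] at this
  simpa only [add_comm y] using this

theorem HasGrad.line {u : E d → ℝ} {p} (hu : HasGrad u p) (x y : E d) (t : ℝ) :
    HasDerivAt (fun t : ℝ => u (x + t • y)) (∑ i, p i (x + t • y) * y i) t := by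
  have h1 : HasDerivAt (fun t : ℝ => x + t • y) ((1 : ℝ) • y) t :=
    ((hasDerivAt_id t).smul_const y).const_add x
  have := (hu (x + t • y)).comp_hasDerivAt t h1
  rw [lin_apply] at this
  refine HasDerivAt.congr_deriv (f := fun t : ℝ => u (x + t • y)) this ?_
  simp

theorem HasGrad.contDiff_one {u : E d → ℝ} {p} (hu : HasGrad u p) (hp : ∀ i, Continuous (p i)) :
    ContDiff ℝ 1 u := by
  rw [contDiff_one_iff_fderiv]
  refine ⟨hu.differentiable, ?_⟩
  have : fderiv ℝ u = fun x => lin (fun i => p i x) := by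
    funext x; exact (hu x).fderiv
  rw [this]
  unfold lin
  exact continuous_finsetSum _ fun i _ => (hp i).smul continuous_const

theorem HasGrad.contDiff_two {u : E d → ℝ} {p} (hu : HasGrad u p)
    (hp : ∀ i, ContDiff ℝ 1 (p i)) : ContDiff ℝ 2 u := by
  have h2 : (2 : WithTop ℕ∞) = 1 + 1 := by norm_num
  rw [h2, contDiff_succ_iff_fderiv]
  refine ⟨hu.differentiable, by simp, ?_⟩
  have : fderiv ℝ u = fun x => lin (fun i => p i x) := by
    funext x; exact (hu x).fderiv
  rw [this]
  unfold lin
  exact ContDiff.sum fun i _ => (hp i).smul contDiff_const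

theorem ContDiff.continuous_pd {u : E d → ℝ} (h : ContDiff ℝ 1 u) (i : Fin d) :
    Continuous (_root_.pd d i u) :=
  (h.continuous_fderiv (by norm_num)).clm_apply continuous_const

theorem ContDiff.pd_one {u : E d → ℝ} (h : ContDiff ℝ 2 u) (i : Fin d) :
    ContDiff ℝ 1 (_root_.pd d i u) :=
  (h.fderiv_right (m := 1) (by norm_num)).clm_apply contDiff_const

theorem hasGrad_coord (i : Fin d) :
    HasGrad (fun x : E d => x i) (fun j _ => if j = i then 1 else 0) := by
  intro x
  refine (hasFDerivAt_apply (𝕜 := ℝ) i x).congr_fderiv ?_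
  ext y
  simp [lin_apply]

/-- mean value inequality with coordinates -/
theorem HasGrad.lip {u : E d → ℝ} {p} (hu : HasGrad u p) {B : ℝ} (hB : 0 ≤ B)
    (hp : ∀ i x, |p i x| ≤ B) (x y : E d) : |u x - u y| ≤ d * B * dist x y := by
  have h1 : ∀ z ∈ (univ : Set (E d)), HasFDerivWithinAt u (lin (fun i => p i z)) univ z :=
    fun z _ => (hu z).hasFDerivWithinAt
  have h2 : ∀ z ∈ (univ : Set (E d)), ‖lin (fun i => p i z)‖ ≤ d * B := by
    intro z _
    refine ContinuousLinearMap.opNorm_le_bound _ (by positivity) fun y => ?_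
    rw [lin_apply, Real.norm_eq_abs]
    calc |∑ i, p i z * y i| ≤ ∑ i, |p i z * y i| := Finset.abs_sum_le_sum_abs _ _
      _ ≤ ∑ _i : Fin d, B * ‖y‖ := by
          refine Finset.sum_le_sum fun i _ => ?_
          rw [abs_mul]
          exact mul_le_mul (hp i z) (norm_le_pi_norm y i) (abs_nonneg _) hB
      _ = d * B * ‖y‖ := by simp; ring
  have := convex_univ.norm_image_sub_le_of_norm_hasFDerivWithin_le h1 h2 (mem_univ y) (mem_univ x)
  rwa [Real.norm_eq_abs, ← dist_eq_norm] at this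

theorem abs_sum_mul_le (p : Fin d → ℝ) (y : E d) {B : ℝ} (hB : 0 ≤ B) (hp : ∀ i, |p i| ≤ B) :
    |∑ i, p i * y i| ≤ d * B * ‖y‖ := by
  calc |∑ i, p i * y i| ≤ ∑ i, |p i * y i| := Finset.abs_sum_le_sum_abs _ _
      _ ≤ ∑ _i : Fin d, B * ‖y‖ := by
          refine Finset.sum_le_sum fun i _ => ?_
          rw [abs_mul]
          exact mul_le_mul (hp i) (norm_le_pi_norm y i) (abs_nonneg _) hB
      _ = d * B * ‖y‖ := by simp; ring

/-- first order Taylor inequality -/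
theorem HasGrad.taylor {u : E d → ℝ} {p} (hu : HasGrad u p) {B α : ℝ} (hB : 0 ≤ B) (hα : 0 ≤ α)
    (hp : ∀ i x y, |p i x - p i y| ≤ B * dist x y ^ α) (x y : E d) :
    |u (x + y) - u x - ∑ i, p i x * y i| ≤ d * B * ‖y‖ ^ α * ‖y‖ := by
  have h0 : ∀ t ∈ Icc (0:ℝ) 1, HasDerivWithinAt
      (fun t : ℝ => u (x + t • y) - t * ∑ i, p i x * y i)
      (∑ i, (p i (x + t • y) - p i x) * y i) (Icc (0:ℝ) 1) t := by
    intro t _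
    have := (hu.line x y t).sub ((hasDerivAt_id t).mul_const (∑ i, p i x * y i))
    refine HasDerivAt.hasDerivWithinAt (HasDerivAt.congr_deriv
      (f := fun t : ℝ => u (x + t • y) - t * ∑ i, p i x * y i) this ?_)
    simp [sub_mul, Finset.sum_sub_distrib]
  have h1 : ∀ t ∈ Ico (0:ℝ) 1, ‖∑ i, (p i (x + t • y) - p i x) * y i‖ ≤ d * B * ‖y‖ ^ α * ‖y‖ := by
    intro t ht
    rw [Real.norm_eq_abs]
    have := abs_sum_mul_le (fun i => p i (x + t • y) - p i x) y (B := B * ‖y‖ ^ α) (by positivity)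
      (fun i => (hp i _ _).trans ?_)
    · calc _ ≤ _ := this
        _ = _ := by ring
    · refine mul_le_mul_of_nonneg_left ?_ hB
      refine Real.rpow_le_rpow dist_nonneg ?_ hα
      rw [dist_eq_norm, add_sub_cancel_left, norm_smul, Real.norm_eq_abs, abs_of_nonneg ht.1]
      exact mul_le_of_le_one_left (norm_nonneg _) ht.2.le
  have := norm_image_sub_le_of_norm_deriv_le_segment' h0 h1 1 (by simp)
  rw [Real.norm_eq_abs] at this
  simp only [one_smul, one_mul, zero_smul, add_zero, zero_mul, sub_zero, mul_one] at this
  rw [show u (x + y) - u x - ∑ i, p i x * y i = u (x + y) - ∑ i, p i x * y i - u x by ring]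
  exact this

/-- converse: Taylor inequality gives the gradient -/
theorem hasGrad_of_taylor {u : E d → ℝ} {p : Fin d → E d → ℝ} {B α : ℝ} (hα : 0 < α)
    (h : ∀ x y, |u (x + y) - u x - ∑ i, p i x * y i| ≤ B * ‖y‖ ^ α * ‖y‖) : HasGrad u p := by
  intro x
  rw [hasFDerivAt_iff_isLittleO_nhds_zero]
  have h1 : (fun y : E d => u (x + y) - u x - lin (fun i => p i x) y) =O[𝓝 0]
      fun y => ‖y‖ ^ α * ‖y‖ := by
    refine Asymptotics.IsBigO.of_bound B (Eventually.of_forall fun y => ?_)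
    rw [lin_apply, Real.norm_eq_abs, Real.norm_eq_abs, abs_of_nonneg (by positivity : 0 ≤ ‖y‖ ^ α * ‖y‖),
      ← mul_assoc]
    exact h x y
  refine h1.trans_isLittleO ?_
  have h2 : (fun y : E d => ‖y‖ ^ α) =o[𝓝 0] fun _ => (1:ℝ) := by
    rw [Asymptotics.isLittleO_one_iff]
    have : ContinuousAt (fun y : E d => ‖y‖ ^ α) 0 :=
      (continuous_norm.continuousAt).rpow_const (Or.inr hα.le)
    simpa [ContinuousAt, Real.zero_rpow hα.ne'] using this
  have h3 := h2.mul_isBigO (Asymptotics.isBigO_refl (fun y : E d => ‖y‖) (𝓝 0))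
  simp only [one_mul] at h3
  exact h3.trans_isBigO (Asymptotics.isBigO_refl _ _).norm_left

/-- second derivative test in one variable -/
theorem second_deriv_nonpos {f f' : ℝ → ℝ} {c : ℝ} (h1 : ∀ t, HasDerivAt f (f' t) t)
    (h2 : HasDerivAt f' c 0) (hm : IsLocalMax f 0) : c ≤ 0 := by
  by_contra hc
  push Not at hc
  have hd : deriv f = f' := funext fun t => (h1 t).deriv
  have h0 : f' 0 = 0 := by rw [← hd]; exact hm.deriv_eq_zero
  have hmin : IsLocalMin f 0 := by
    refine isLocalMin_of_deriv_deriv_pos ?_ ?_ (h1 0).continuousAt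
    · rw [hd, h2.deriv]; exact hc
    · rw [hd, h0]
  have heq : f =ᶠ[𝓝 0] fun _ => f 0 := by
    filter_upwards [hm, hmin] with t h3 h4 using le_antisymm h3 h4
  have h5 : deriv f =ᶠ[𝓝 0] deriv (fun _ : ℝ => f 0) := heq.deriv
  have h6 : deriv (deriv f) 0 = deriv (deriv fun _ : ℝ => f 0) 0 := h5.deriv_eq
  rw [hd, h2.deriv] at h6
  simp at h6
  linarith

/-- directional second derivative test -/
theorem dir_second_deriv_nonpos {u : E d → ℝ} {p : Fin d → E d → ℝ} {q : Fin d → Fin d → E d → ℝ}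
    (hu : HasGrad u p) (hp : ∀ i, HasGrad (p i) (q i)) {x : E d} (hm : IsLocalMax u x) (ξ : E d) :
    ∑ i, ∑ j, q i j x * ξ i * ξ j ≤ 0 := by
  have h1 : ∀ t : ℝ, HasDerivAt (fun t : ℝ => u (x + t • ξ)) (∑ i, p i (x + t • ξ) * ξ i) t :=
    fun t => hu.line x ξ t
  have h2 : HasDerivAt (fun t : ℝ => ∑ i, p i (x + t • ξ) * ξ i)
      (∑ i, ∑ j, q i j x * ξ i * ξ j) 0 := by
    have : ∀ i ∈ Finset.univ, HasDerivAt (fun t : ℝ => p i (x + t • ξ) * ξ i)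
        (∑ j, q i j x * ξ i * ξ j) 0 := by
      intro i _
      have := ((hp i).line x ξ 0).mul_const (ξ i)
      simp only [zero_smul, add_zero, Finset.sum_mul] at this
      refine this.congr_deriv ?_
      exact Finset.sum_congr rfl fun j _ => by ring
    exact HasDerivAt.fun_sum this
  refine second_deriv_nonpos h1 h2 ?_
  have : Tendsto (fun t : ℝ => x + t • ξ) (𝓝 0) (𝓝 x) := by
    have : Continuous (fun t : ℝ => x + t • ξ) := by fun_prop
    simpa using this.tendsto 0
  have := this.eventually hm
  filter_upwards [this] with t ht
  simpa using ht

theorem grad_zero_of_max {u : E d → ℝ} {p} (hu : HasGrad u p) {x : E d} (hm : IsLocalMax u x)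
    (i : Fin d) : p i x = 0 := by
  have := hm.hasFDerivAt_eq_zero (hu x)
  have h2 := lin_single (fun i => p i x) i
  rw [this] at h2
  simpa using h2.symm

/-! periodic functions -/

theorem ZPer.exists_rep {u : E d → ℝ} (h : ZPer d u) (x : E d) :
    ∃ y ∈ Icc (0 : E d) 1, u y = u x := by
  refine ⟨x + fun i => ((-⌊x i⌋ : ℤ) : ℝ), ?_, h x fun i => -⌊x i⌋⟩
  constructor
  · intro i
    simp only [Pi.zero_apply, Pi.add_apply, Int.cast_neg]
    linarith [Int.floor_le (x i)]
  · intro i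
    simp only [Pi.one_apply, Pi.add_apply, Int.cast_neg]
    linarith [Int.lt_floor_add_one (x i)]

theorem ZPer.exists_max {u : E d → ℝ} (h : ZPer d u) (hc : Continuous u) :
    ∃ x0 ∈ Icc (0 : E d) 1, ∀ x, u x ≤ u x0 := by
  obtain ⟨x0, hx0, hm⟩ := (isCompact_Icc (a := (0 : E d)) (b := 1)).exists_isMaxOn
    ⟨0, by simp⟩ hc.continuousOn
  refine ⟨x0, hx0, fun x => ?_⟩
  obtain ⟨y, hy, hyx⟩ := ZPer.exists_rep h x
  rw [← hyx]
  exact hm hy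

theorem ZPer.neg {u : E d → ℝ} (h : ZPer d u) : ZPer d (fun x => - u x) := fun x k => by
  simp only [h x k]

theorem ZPer.exists_min {u : E d → ℝ} (h : ZPer d u) (hc : Continuous u) :
    ∃ x0 ∈ Icc (0 : E d) 1, ∀ x, u x0 ≤ u x := by
  obtain ⟨x0, hx0, hm⟩ := ZPer.exists_max (ZPer.neg h) hc.neg
  exact ⟨x0, hx0, fun x => neg_le_neg_iff.1 (hm x)⟩

theorem ZPer.bounded {u : E d → ℝ} (h : ZPer d u) (hc : Continuous u) :
    ∃ C, 0 ≤ C ∧ ∀ x, |u x| ≤ C := by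
  obtain ⟨x0, _, hm⟩ := ZPer.exists_max (u := fun x => |u x|) (fun x k => by simp only [h x k]) hc.abs
  exact ⟨|u x0|, abs_nonneg _, hm⟩

theorem HasGrad.zper {u : E d → ℝ} {p} (hu : HasGrad u p) (h : ZPer d u) (i : Fin d) :
    ZPer d (p i) := by
  intro x k
  have h1 := hu.translate (fun i => (k i : ℝ))
  have h2 : (fun x => u (x + fun i => (k i : ℝ))) = u := funext fun x => h x k
  rw [h2] at h1
  have := (h1.pd i).symm.trans (hu.pd i)
  exact congrFun this x

end MFG

end S1

section S2

open MeasureTheory Set Filter Topology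

namespace MFG
variable {d : ℕ}

theorem torus_int_pd {F : E d → ℝ} {p : Fin d → E d → ℝ} (hF : HasGrad F p)
    (hp : ∀ i, Continuous (p i)) (hper : ZPer d F) (i : Fin d) :
    ∫ x in Icc (0 : E d) 1, p i x = 0 := by
  cases d with
  | zero => exact i.elim0
  | succ n =>
    have key := integral_divergence_of_hasFDerivAt_off_countable' (E := ℝ) (n := n)
      (a := (0 : Fin (n+1) → ℝ)) (b := 1) (zero_le_one)
      (fun j x => if j = i then F x else 0)
      (fun j x => if j = i then lin (fun i => p i x) else 0) ∅ countable_empty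
      (fun j => by
        by_cases h : j = i
        · simp only [h, if_true]; exact hF.continuous.continuousOn
        · simp only [h, if_false]; exact continuousOn_const)
      (fun x _ j => by
        by_cases h : j = i
        · simp only [h, if_true]; exact hF x
        · simp only [h, if_false]; exact hasFDerivAt_const _ _)
      (by
        refine Continuous.integrableOn_Icc ?_
        refine continuous_finsetSum _ fun j _ => ?_
        by_cases h : j = i
        · simp only [h, if_true, lin_single]; exact hp i
        · simp only [h, if_false]; exact continuous_const)
    have e1 : ∀ x : E (n+1), ∑ j, (if j = i then lin (fun i => p i x) else 0) (Pi.single j 1) = p i x := by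
      intro x
      rw [Finset.sum_eq_single i]
      · simp [lin_single]
      · intro j _ hj; simp [hj]
      · simp
    simp only [e1] at key
    rw [key]
    refine Finset.sum_eq_zero fun j _ => ?_
    by_cases h : j = i
    · simp only [h, if_true]
      rw [sub_eq_zero]
      refine setIntegral_congr_fun measurableSet_Icc fun x _ => ?_
      simp only [Pi.one_apply, Pi.zero_apply]
      have := hper (i.insertNth (0:ℝ) x) (Pi.single i 1)
      rw [← this]
      congr 1
      funext k
      refine Fin.succAboveCases i ?_ (fun l => ?_) k
      · simp
      · simp [Fin.succAbove_ne]
    · simp [h]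

theorem hasDerivAt_int {X W : E d → ℝ} {P : Fin d → E d → ℝ} (hX : HasGrad X P)
    (hP : ∀ i, Continuous (P i)) (hW : Continuous W) (y : E d) {K : Set (E d)} (hK : IsCompact K)
    (h0 : ∀ s : ℝ, |s| ≤ 1 → ∀ x ∉ K, X (x + s • y) * W x = 0)
    (h1 : ∀ s : ℝ, |s| ≤ 1 → ∀ x ∉ K, (∑ i, P i (x + s • y) * y i) * W x = 0) :
    HasDerivAt (fun s : ℝ => ∫ x, X (x + s • y) * W x) (∫ x, (∑ i, P i x * y i) * W x) 0 := by
  have hXc := hX.continuous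
  have hc : Continuous (fun z : ℝ × E d => (∑ i, P i (z.2 + z.1 • y) * y i) * W z.2) := by
    refine Continuous.mul (continuous_finsetSum _ fun i _ => ?_) (by fun_prop)
    exact ((hP i).comp (by fun_prop)).mul continuous_const
  obtain ⟨C, hC⟩ := ((isCompact_Icc (a := (-1:ℝ)) (b := 1)).prod hK).exists_bound_of_continuousOn
    hc.continuousOn
  have hb : ∀ s : ℝ, |s| ≤ 1 → ∀ x, ‖(∑ i, P i (x + s • y) * y i) * W x‖ ≤ K.indicator (fun _ => C) x := by
    intro s hs x
    by_cases hx : x ∈ K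
    · rw [indicator_of_mem hx]
      exact hC (s, x) ⟨abs_le.1 hs, hx⟩
    · rw [indicator_of_notMem hx, h1 s hs x hx]; simp
  have := hasDerivAt_integral_of_dominated_loc_of_deriv_le (𝕜 := ℝ) (μ := (volume : Measure (E d)))
    (F := fun s x => X (x + s • y) * W x) (F' := fun s x => (∑ i, P i (x + s • y) * y i) * W x)
    (x₀ := 0) (s := Metric.ball 0 1) (bound := K.indicator (fun _ => C)) (Metric.ball_mem_nhds _ one_pos)
    (Eventually.of_forall fun s => by
      refine Continuous.aestronglyMeasurable ?_
      exact (hXc.comp (by fun_prop)).mul hW)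
    (by
      refine Continuous.integrable_of_hasCompactSupport ?_ ?_
      · exact (hXc.comp (by fun_prop)).mul hW
      · refine HasCompactSupport.intro hK fun x hx => h0 0 (by simp) x hx)
    (by
      refine Continuous.aestronglyMeasurable ?_
      exact hc.comp (by fun_prop : Continuous fun x : E d => ((0:ℝ), x)))
    (Eventually.of_forall fun x s hs => hb s (by
      rw [mem_ball_zero_iff, Real.norm_eq_abs] at hs; exact hs.le) x)
    ((integrable_indicator_iff hK.measurableSet).2 (integrableOn_const hK.measure_lt_top.ne))
    (Eventually.of_forall fun x s _ => (hX.line x y s).mul_const (W x))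
  simpa using this.2

theorem int_by_parts {X φ : E d → ℝ} {P Q : Fin d → E d → ℝ} (hX : HasGrad X P)
    (hP : ∀ i, Continuous (P i)) (hφ : HasGrad φ Q) (hQ : ∀ i, Continuous (Q i))
    (hs : HasCompactSupport φ) (i : Fin d) : ∫ x, P i x * φ x = - ∫ x, X x * Q i x := by
  have hQs : HasCompactSupport (Q i) := by
    rw [← hφ.pd i]
    exact (hs.fderiv (𝕜 := ℝ)).comp_left (g := fun L : E d →L[ℝ] ℝ => L (Pi.single i 1)) (by simp)
  have hf : ∀ x, fderiv ℝ X x (Pi.single i 1) = P i x := fun x => congrFun (hX.pd i) x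
  have hg : ∀ x, fderiv ℝ φ x (Pi.single i 1) = Q i x := fun x => congrFun (hφ.pd i) x
  have := integral_mul_fderiv_eq_neg_fderiv_mul_of_integrable (𝕜 := ℝ)
    (μ := (volume : Measure (E d))) (f := X) (g := φ) (v := Pi.single i 1)
    (by simp only [hf]; exact ((hP i).mul hφ.continuous).integrable_of_hasCompactSupport hs.mul_left)
    (by simp only [hg]; exact (hX.continuous.mul (hQ i)).integrable_of_hasCompactSupport hQs.mul_left)
    ((hX.continuous.mul hφ.continuous).integrable_of_hasCompactSupport hs.mul_left)
    (fun x _ => hX.differentiable x) (fun x _ => hφ.differentiable x)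
  simp only [hf, hg] at this
  rw [this, neg_neg]

theorem grad_compact {φ : E d → ℝ} {Q : Fin d → E d → ℝ} (hφ : HasGrad φ Q)
    (hs : HasCompactSupport φ) (i : Fin d) : HasCompactSupport (Q i) := by
  rw [← hφ.pd i]
  exact (hs.fderiv (𝕜 := ℝ)).comp_left (g := fun L : E d →L[ℝ] ℝ => L (Pi.single i 1)) (by simp)

theorem commute_pd {X φ : E d → ℝ} {P Q : Fin d → E d → ℝ} (hX : HasGrad X P)
    (hP : ∀ i, Continuous (P i)) (hφ : HasGrad φ Q) (hQ : ∀ i, Continuous (Q i))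
    (hs : HasCompactSupport φ) (i k : Fin d) : ∫ x, P i x * Q k x = ∫ x, P k x * Q i x := by
  set e : E d := Pi.single k 1 with he
  have hsum : ∀ a : Fin d → ℝ, ∑ j, a j * e j = a k := by
    intro a; simp [he, Pi.single_apply]
  -- compact set containing all the translates
  set K : Set (E d) := (fun z : E d × ℝ => z.1 - z.2 • e) '' (tsupport φ ×ˢ Icc (-1:ℝ) 1) with hK
  have hKc : IsCompact K := (hs.isCompact.prod isCompact_Icc).image (by fun_prop)
  have hnot : ∀ s : ℝ, |s| ≤ 1 → ∀ x ∉ K, x + s • e ∉ tsupport φ := by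
    intro s hs1 x hx hmem
    exact hx ⟨(x + s • e, s), ⟨hmem, abs_le.1 hs1⟩, by simp⟩
  have hQsupp : ∀ j x, x ∉ tsupport φ → Q j x = 0 := by
    intro j x hx
    rw [← hφ.pd j]
    have : x ∉ tsupport (fderiv ℝ φ) := fun h => hx (tsupport_fderiv_subset ℝ h)
    simp [_root_.pd, image_eq_zero_of_notMem_tsupport this]
  have d1 := hasDerivAt_int hφ hQ (hP i) e hKc
    (fun s h x hx => by rw [image_eq_zero_of_notMem_tsupport (hnot s h x hx), zero_mul])
    (fun s h x hx => by rw [hsum (fun j => Q j (x + s • e)), hQsupp k _ (hnot s h x hx), zero_mul])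
  have d2 := hasDerivAt_int hX hP (hQ i) (-e) (K := tsupport φ) hs.isCompact
    (fun s h x hx => by rw [hQsupp i x hx, mul_zero])
    (fun s h x hx => by rw [hQsupp i x hx, mul_zero])
  have heq : (fun s : ℝ => ∫ x, φ (x + s • e) * P i x) =
      fun s : ℝ => - ∫ x, X (x + s • (-e)) * Q i x := by
    funext s
    have h1 := int_by_parts hX hP (hφ.translate (s • e)) (fun j => (hQ j).comp (by fun_prop))
      (hs.comp_homeomorph (Homeomorph.addRight (s • e))) i
    have h2 : ∫ x, X x * Q i (x + s • e) = ∫ x, X (x + s • (-e)) * Q i x := by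
      rw [← integral_add_right_eq_self (μ := (volume : Measure (E d)))
        (fun x => X x * Q i (x + s • e)) (s • (-e))]
      refine integral_congr_ae (Eventually.of_forall fun x => ?_)
      simp
    rw [← h2, ← h1]
    exact integral_congr_ae (Eventually.of_forall fun x => mul_comm _ _)
  rw [heq] at d1
  have := d1.unique d2.neg
  simp only [Pi.neg_apply, mul_neg, Finset.sum_neg_distrib, hsum, neg_mul, integral_neg, neg_neg] at this
  rw [← this]
  exact integral_congr_ae (Eventually.of_forall fun x => mul_comm _ _)

end MFG

end S2

section S3

open MeasureTheory Set Filter Topology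

namespace MFG
variable {d : ℕ}
open scoped ENNReal NNReal

theorem sobolev_aux (hd : 1 ≤ d) : ∃ C : ℝ, 0 ≤ C ∧ ∀ f : E d → ℝ, ContDiff ℝ 1 f → HasCompactSupport f →
    ∫ x, |f x| ^ (((d:ℝ) + 1) / d) ≤ C * (∫ x, (‖fderiv ℝ f x‖ + |f x|)) ^ (((d:ℝ) + 1) / d) := by
  set χ : ℝ := ((d:ℝ) + 1) / d with hχ
  have hd0 : (0:ℝ) < d := by exact_mod_cast hd
  have hχ0 : 0 < χ := by positivity
  let ψ : ContDiffBump (0:ℝ) := ⟨1, 2, one_pos, one_lt_two⟩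
  have hψc : HasCompactSupport ψ := ψ.hasCompactSupport
  have hψs : ContDiff ℝ 1 ψ := ψ.contDiff
  have hconj : Real.HolderConjugate (Module.finrank ℝ (E d × ℝ) : ℝ) χ := by
    rw [Real.holderConjugate_iff]
    simp only [Module.finrank_prod, Module.finrank_fin_fun, Module.finrank_self, hχ]
    push_cast
    refine ⟨by linarith, ?_⟩
    field_simp
    ring
  haveI : (volume : Measure (E d × ℝ)).IsAddHaarMeasure := by
    rw [Measure.volume_eq_prod]; infer_instance
  set C0 : ℝ≥0 := lintegralPowLePowLIntegralFDerivConst (volume : Measure (E d × ℝ)) χ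
  set B : ℝ≥0∞ := ∫⁻ t, ‖ψ t‖ₑ ^ χ with hB
  set b1 : ℝ≥0∞ := ∫⁻ t, ‖ψ t‖ₑ with hb1
  set b2 : ℝ≥0∞ := ∫⁻ t, ‖fderiv ℝ ψ t‖ₑ with hb2
  have hb1t : b1 ≠ ∞ := by
    exact ((hψs.continuous.integrable_of_hasCompactSupport hψc).hasFiniteIntegral).ne
  have hb2t : b2 ≠ ∞ := by
    exact (((hψs.continuous_fderiv (by norm_num)).integrable_of_hasCompactSupport
      (hψc.fderiv (𝕜 := ℝ))).hasFiniteIntegral).ne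
  have hB1 : 1 ≤ B := by
    have : ∫⁻ t in Icc (0:ℝ) 1, (1:ℝ≥0∞) ≤ B := by
      rw [hB]
      refine (setLIntegral_mono' measurableSet_Icc fun t ht => ?_).trans (setLIntegral_le_lintegral _ _)
      have : ψ t = 1 := ψ.one_of_mem_closedBall (by
        simp only [Metric.mem_closedBall, dist_zero_right, Real.norm_eq_abs]
        rw [abs_of_nonneg ht.1]; exact ht.2)
      simp [this]
    simpa using this
  refine ⟨((C0 : ℝ≥0∞) * (b1 + b2) ^ χ).toReal, ENNReal.toReal_nonneg, fun f hf hfc => ?_⟩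
  have hfin : (C0 : ℝ≥0∞) * (b1 + b2) ^ χ ≠ ∞ :=
    ENNReal.mul_ne_top ENNReal.coe_ne_top
      (ENNReal.rpow_ne_top_of_nonneg hχ0.le (ENNReal.add_ne_top.2 ⟨hb1t, hb2t⟩))
  have hu : ContDiff ℝ 1 (fun z : E d × ℝ => f z.1 * ψ z.2) :=
    (hf.comp contDiff_fst).mul (hψs.comp contDiff_snd)
  have huc : HasCompactSupport (fun z : E d × ℝ => f z.1 * ψ z.2) := by
    refine HasCompactSupport.intro (hfc.isCompact.prod hψc.isCompact) fun z hz => ?_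
    by_cases h1 : z.1 ∈ tsupport f
    · have : z.2 ∉ tsupport ψ := fun h => hz ⟨h1, h⟩
      rw [image_eq_zero_of_notMem_tsupport this, mul_zero]
    · rw [image_eq_zero_of_notMem_tsupport h1, zero_mul]
  have key := lintegral_pow_le_pow_lintegral_fderiv (volume : Measure (E d × ℝ)) hu huc hconj
  have hL : ∫⁻ z : E d × ℝ, ‖f z.1 * ψ z.2‖ₑ ^ χ = (∫⁻ x, ‖f x‖ₑ ^ χ) * B := by
    rw [hB, Measure.volume_eq_prod, ← lintegral_prod_mul]
    · refine lintegral_congr fun z => ?_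
      rw [enorm_mul, ENNReal.mul_rpow_of_nonneg _ _ hχ0.le]
    · exact (hf.continuous.enorm.measurable.pow_const χ).aemeasurable
    · exact (hψs.continuous.enorm.measurable.pow_const χ).aemeasurable
  have hfd := hf.continuous_fderiv (by norm_num : (1 : WithTop ℕ∞) ≠ 0)
  have hψd := hψs.continuous_fderiv (by norm_num : (1 : WithTop ℕ∞) ≠ 0)
  have hR : ∫⁻ z : E d × ℝ, ‖fderiv ℝ (fun z : E d × ℝ => f z.1 * ψ z.2) z‖ₑ ≤
      (∫⁻ x, ‖fderiv ℝ f x‖ₑ) * b1 + (∫⁻ x, ‖f x‖ₑ) * b2 := by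
    rw [hb1, hb2, ← lintegral_prod_mul (hfd.enorm.measurable.aemeasurable)
      (hψs.continuous.enorm.measurable.aemeasurable),
      ← lintegral_prod_mul (hf.continuous.enorm.measurable.aemeasurable)
      (hψd.enorm.measurable.aemeasurable), ← lintegral_add_left, Measure.volume_eq_prod]
    · refine lintegral_mono fun z => ?_
      have h1 : HasFDerivAt (fun z : E d × ℝ => f z.1)
          ((fderiv ℝ f z.1).comp (ContinuousLinearMap.fst ℝ (E d) ℝ)) z :=
        ((hf.differentiable (by norm_num) z.1).hasFDerivAt).comp z hasFDerivAt_fst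
      have h2 : HasFDerivAt (fun z : E d × ℝ => ψ z.2)
          ((fderiv ℝ ψ z.2).comp (ContinuousLinearMap.snd ℝ (E d) ℝ)) z :=
        ((hψs.differentiable (by norm_num) z.2).hasFDerivAt).comp z hasFDerivAt_snd
      rw [(h1.fun_mul h2).fderiv]
      refine (enorm_add_le (f z.1 • (fderiv ℝ ψ z.2).comp (ContinuousLinearMap.snd ℝ (E d) ℝ))
        (ψ z.2 • (fderiv ℝ f z.1).comp (ContinuousLinearMap.fst ℝ (E d) ℝ))).trans ?_
      rw [enorm_smul, enorm_smul, add_comm, mul_comm ‖ψ z.2‖ₑ]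
      gcongr
      · rw [← ofReal_norm, ← ofReal_norm]
        refine ENNReal.ofReal_le_ofReal ?_
        refine (ContinuousLinearMap.opNorm_comp_le _ _).trans ?_
        exact mul_le_of_le_one_right (norm_nonneg _) (ContinuousLinearMap.norm_fst_le _ _ _)
      · rw [← ofReal_norm, ← ofReal_norm]
        refine ENNReal.ofReal_le_ofReal ?_
        refine (ContinuousLinearMap.opNorm_comp_le _ _).trans ?_
        exact mul_le_of_le_one_right (norm_nonneg _) (ContinuousLinearMap.norm_snd_le _ _ _)
    · exact (hfd.enorm.measurable.comp measurable_fst).mul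
        (hψs.continuous.enorm.measurable.comp measurable_snd)
  have hint1 : Integrable (fun x => ‖fderiv ℝ f x‖ + |f x|) :=
    (hfd.integrable_of_hasCompactSupport (hfc.fderiv (𝕜 := ℝ))).norm.add
      (hf.continuous.integrable_of_hasCompactSupport hfc).norm
  have hS : ENNReal.ofReal (∫ x, (‖fderiv ℝ f x‖ + |f x|)) =
      (∫⁻ x, ‖fderiv ℝ f x‖ₑ) + ∫⁻ x, ‖f x‖ₑ := by
    rw [ofReal_integral_eq_lintegral_ofReal hint1 (Eventually.of_forall fun x => by positivity),
      ← lintegral_add_left hfd.enorm.measurable]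
    refine lintegral_congr fun x => ?_
    rw [ENNReal.ofReal_add (norm_nonneg _) (abs_nonneg _), ofReal_norm, ← Real.norm_eq_abs, ofReal_norm]
  have hcχ : Continuous fun x => |f x| ^ χ :=
    hf.continuous.abs.rpow_const fun x => Or.inr hχ0.le
  have hint2 : Integrable (fun x => |f x| ^ χ) := by
    refine hcχ.integrable_of_hasCompactSupport ?_
    refine HasCompactSupport.intro hfc.isCompact fun x hx => ?_
    rw [image_eq_zero_of_notMem_tsupport hx, abs_zero, Real.zero_rpow hχ0.ne']
  have hA : ENNReal.ofReal (∫ x, |f x| ^ χ) = ∫⁻ x, ‖f x‖ₑ ^ χ := by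
    rw [ofReal_integral_eq_lintegral_ofReal hint2 (Eventually.of_forall fun x => by positivity)]
    refine lintegral_congr fun x => ?_
    rw [← ENNReal.ofReal_rpow_of_nonneg (abs_nonneg _) hχ0.le, ← Real.norm_eq_abs, ofReal_norm]
  have hS0 : 0 ≤ ∫ x, (‖fderiv ℝ f x‖ + |f x|) := integral_nonneg fun x => by positivity
  have main : ENNReal.ofReal (∫ x, |f x| ^ χ) ≤
      ENNReal.ofReal (((C0 : ℝ≥0∞) * (b1 + b2) ^ χ).toReal * (∫ x, (‖fderiv ℝ f x‖ + |f x|)) ^ χ) := by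
    rw [ENNReal.ofReal_mul ENNReal.toReal_nonneg, ENNReal.ofReal_toReal hfin,
      ← ENNReal.ofReal_rpow_of_nonneg hS0 hχ0.le, hS, hA]
    calc ∫⁻ x, ‖f x‖ₑ ^ χ ≤ (∫⁻ x, ‖f x‖ₑ ^ χ) * B := le_mul_of_one_le_right' hB1
      _ = _ := hL.symm
      _ ≤ _ := key
      _ ≤ C0 * ((∫⁻ x, ‖fderiv ℝ f x‖ₑ) * b1 + (∫⁻ x, ‖f x‖ₑ) * b2) ^ χ := by gcongr
      _ ≤ C0 * (((∫⁻ x, ‖fderiv ℝ f x‖ₑ) + ∫⁻ x, ‖f x‖ₑ) * (b1 + b2)) ^ χ := by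
          gcongr
          rw [add_mul]
          gcongr
          · exact le_self_add
          · exact le_add_self
      _ = _ := by
          rw [ENNReal.mul_rpow_of_nonneg _ _ hχ0.le]; ring
  exact (ENNReal.ofReal_le_ofReal_iff (by positivity)).1 main

theorem norm_lin_le (p : Fin d → ℝ) : ‖lin p‖ ≤ ∑ i, |p i| := by
  refine ContinuousLinearMap.opNorm_le_bound _ (Finset.sum_nonneg fun _ _ => abs_nonneg _) fun y => ?_
  rw [lin_apply, Real.norm_eq_abs, Finset.sum_mul]
  refine (Finset.abs_sum_le_sum_abs _ _).trans (Finset.sum_le_sum fun i _ => ?_)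
  rw [abs_mul]
  exact mul_le_mul_of_nonneg_left (norm_le_pi_norm y i) (abs_nonneg _)

theorem sobolev (hd : 1 ≤ d) : ∃ C : ℝ, 0 ≤ C ∧ ∀ (f : E d → ℝ) (P : Fin d → E d → ℝ), HasGrad f P →
    (∀ i, Continuous (P i)) → HasCompactSupport f →
    ∫ x, (f x ^ 2) ^ (((d:ℝ) + 1) / d) ≤
      C * (∫ x, ((∑ i, P i x ^ 2) + f x ^ 2)) ^ (((d:ℝ) + 1) / d) := by
  obtain ⟨C, hC, h⟩ := sobolev_aux hd
  have hχ0 : 0 ≤ ((d:ℝ) + 1) / d := by positivity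
  refine ⟨C * ((d:ℝ) + 1) ^ (((d:ℝ) + 1) / d), by positivity, fun f P hf hP hfc => ?_⟩
  have hc1 := hf.contDiff_one hP
  have hc2 : ContDiff ℝ 1 (fun x => f x ^ 2) := hc1.pow 2
  have hs : HasCompactSupport (fun x => f x ^ 2) :=
    HasCompactSupport.intro hfc.isCompact (fun x hx => by simp [image_eq_zero_of_notMem_tsupport hx])
  have hs' : ∀ i, HasCompactSupport (fun x => P i x ^ 2) := fun i =>
    HasCompactSupport.intro (grad_compact hf hfc i).isCompact
      (fun x hx => by simp [image_eq_zero_of_notMem_tsupport hx])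
  have hcP : ∀ i, Continuous (fun x => P i x ^ 2) := fun i => (hP i).pow 2
  have h2 := h (fun x => f x ^ 2) hc2 hs
  simp only [abs_pow, sq_abs] at h2
  refine h2.trans ?_
  rw [mul_assoc, ← Real.mul_rpow (by positivity) (integral_nonneg fun x => by positivity)]
  have hgr : HasGrad (fun x => f x ^ 2) (fun i x => 2 * f x * P i x) := by
    have := hf.mul hf
    simp only [← sq] at this
    exact this.congr fun i x => by ring
  have hi0 : Integrable (fun x => f x ^ 2) := hc2.continuous.integrable_of_hasCompactSupport hs
  have hi1 : Integrable (fderiv ℝ (fun x => f x ^ 2)) :=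
    (hc2.continuous_fderiv (by norm_num)).integrable_of_hasCompactSupport (hs.fderiv (𝕜 := ℝ))
  have hi2 : ∀ i, Integrable (fun x => P i x ^ 2) := fun i =>
    (hcP i).integrable_of_hasCompactSupport (hs' i)
  have hint1 : Integrable (fun x => ‖fderiv ℝ (fun x => f x ^ 2) x‖ + f x ^ 2) := hi1.norm.add hi0
  have hint2 : Integrable (fun x => (∑ i, P i x ^ 2) + f x ^ 2) :=
    (integrable_finsetSum _ fun i _ => hi2 i).add hi0
  refine mul_le_mul_of_nonneg_left (Real.rpow_le_rpow (integral_nonneg fun x => by positivity) ?_ hχ0) hC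
  rw [← integral_const_mul]
  refine integral_mono hint1 (hint2.const_mul _) fun x => ?_
  simp only
  rw [(hgr x).fderiv]
  have h3 := norm_lin_le (fun i => 2 * f x * P i x)
  have h4 : ∑ i, |2 * f x * P i x| ≤ ∑ i, (P i x ^ 2 + f x ^ 2) :=
    Finset.sum_le_sum fun i _ => by
      rw [abs_le]; constructor <;> nlinarith [sq_nonneg (f x - P i x), sq_nonneg (f x + P i x)]
  rw [Finset.sum_add_distrib] at h4
  simp only [Finset.sum_const, Finset.card_univ, Fintype.card_fin, nsmul_eq_mul] at h4
  have h5 : 0 ≤ ∑ i, P i x ^ 2 := Finset.sum_nonneg fun _ _ => sq_nonneg _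
  have h6 : (0:ℝ) ≤ d := Nat.cast_nonneg d
  nlinarith [sq_nonneg (f x), mul_nonneg h6 h5]

end MFG

end S3

section S4

open MeasureTheory Set Filter Topology

namespace MFG
variable {d : ℕ}

def Cac (C0 : ℝ) (z : E d → ℝ) (zr : Fin d → E d → ℝ) : Prop :=
  HasGrad z zr ∧ (∀ i, Continuous (zr i)) ∧ (∀ x, 1 ≤ z x) ∧
  ∀ q : ℝ, 0 ≤ q → ∀ (η : E d → ℝ) (N : Fin d → E d → ℝ), HasGrad η N → (∀ i, Continuous (N i)) →
    HasCompactSupport η →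
    ∫ x, η x ^ 2 * (z x ^ q * ∑ i, zr i x ^ 2) ≤ C0 * ∫ x, z x ^ q * ∑ i, N i x ^ 2

theorem exists_cutoff (d : ℕ) {R : ℝ} (hR : 0 < R) : ∃ (η : E d → ℝ) (N : Fin d → E d → ℝ) (K : ℝ), HasGrad η N ∧
    (∀ i, Continuous (N i)) ∧ HasCompactSupport η ∧ (∀ x, 0 ≤ η x) ∧ (∀ x, η x ≤ 1) ∧
    (∀ x, ‖x‖ ≤ R → η x = 1) ∧ (∀ x, 2 * R ≤ ‖x‖ → η x = 0) ∧ 0 ≤ K ∧ ∀ x, ∑ i, N i x ^ 2 ≤ K := by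
  let ψ : ContDiffBump (0 : E d) := ⟨R, 2 * R, hR, by linarith⟩
  have hs : ContDiff ℝ 1 ψ := ψ.contDiff
  have hg : HasGrad ψ (fun i => pd d i ψ) := HasGrad.of_diff (hs.differentiable (by norm_num))
  have hc : ∀ i, Continuous (pd d i ψ) := fun i => ContDiff.continuous_pd hs i
  have hcs : HasCompactSupport ψ := ψ.hasCompactSupport
  have hcont : Continuous fun x => ∑ i, pd d i ψ x ^ 2 := continuous_finsetSum _ fun i _ => (hc i).pow 2
  have hcomp : HasCompactSupport fun x => ∑ i, pd d i ψ x ^ 2 := by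
    refine HasCompactSupport.intro hcs.isCompact fun x hx => ?_
    refine Finset.sum_eq_zero fun i _ => ?_
    have : fderiv ℝ ψ x = 0 := image_eq_zero_of_notMem_tsupport
      (fun h => hx (tsupport_fderiv_subset ℝ h))
    simp [pd, this]
  obtain ⟨K, hK⟩ := hcont.bounded_above_of_compact_support hcomp
  refine ⟨ψ, _, K, hg, hc, hcs, fun x => ψ.nonneg, fun x => ψ.le_one, fun x hx => ?_, fun x hx => ?_,
    (norm_nonneg _).trans (hK 0), fun x => (Real.le_norm_self _).trans (hK x)⟩
  · exact ψ.one_of_mem_closedBall (by simpa using hx)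
  · exact ψ.zero_of_le_dist (by simpa using hx)

theorem iter_lemma {C B χ : ℝ} (hC : 1 ≤ C) (hB : 1 ≤ B) (hχ : 1 < χ) :
    ∃ D : ℝ, 0 < D ∧ ∀ I : ℕ → ℝ, (∀ k, 0 ≤ I k) → (∀ k, I (k+1) ≤ C * (B ^ k * I k) ^ χ) →
      ∀ k, I k ≤ (D * I 0) ^ (χ ^ k) := by
  set e : ℝ := B ^ (χ / (χ - 1)) with he
  have hχ1 : 0 < χ - 1 := by linarith
  have hB0 : 0 < B := by linarith
  have he1 : 1 ≤ e := Real.one_le_rpow hB (by positivity)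
  have he0 : 0 < e := by linarith
  have heq : e * B ^ χ = e ^ χ := by
    rw [he, ← Real.rpow_mul hB0.le, ← Real.rpow_add hB0]
    congr 1; field_simp; ring
  set D : ℝ := (e * C) ^ (1 / (χ - 1)) with hD
  have heC : 0 < e * C := by positivity
  have hD0 : 0 < D := Real.rpow_pos_of_pos heC _
  have hD1 : 1 ≤ D := Real.one_le_rpow (by nlinarith) (by positivity)
  have hDeq : D * (e * C) = D ^ χ := by
    have : e * C = D ^ (χ - 1) := by
      rw [hD, ← Real.rpow_mul heC.le]; rw [one_div, inv_mul_cancel₀ hχ1.ne', Real.rpow_one]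
    rw [this, ← Real.rpow_one_add' hD0.le (by linarith)]
    congr 1; ring
  refine ⟨D, hD0, fun I hI h k => ?_⟩
  have key : ∀ k, D * e ^ k * I k ≤ (D * I 0) ^ (χ ^ k) := by
    intro k
    induction k with
    | zero => simp
    | succ k ih =>
      have h0 : 0 ≤ D * e ^ k * I k := mul_nonneg (by positivity) (hI k)
      calc D * e ^ (k+1) * I (k+1) ≤ D * e ^ (k+1) * (C * (B ^ k * I k) ^ χ) :=
            mul_le_mul_of_nonneg_left (h k) (by positivity)
        _ = (D * e ^ k * I k) ^ χ := by
            rw [Real.mul_rpow (by positivity) (hI k), Real.mul_rpow (by positivity) (hI k),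
              Real.mul_rpow hD0.le (by positivity), ← hDeq, ← Real.rpow_pow_comm he0.le,
              ← Real.rpow_pow_comm hB0.le, ← heq, mul_pow]
            ring
        _ ≤ ((D * I 0) ^ (χ ^ k)) ^ χ := Real.rpow_le_rpow h0 ih (by linarith)
        _ = _ := by
            rw [← Real.rpow_mul (mul_nonneg hD0.le (hI 0)), pow_succ]
  refine le_trans ?_ (key k)
  have : 1 ≤ D * e ^ k := by nlinarith [one_le_pow₀ he1 (n := k)]
  exact le_mul_of_one_le_left (hI k) this

theorem moser_step (hd : 1 ≤ d) {C0 : ℝ} (hC0 : 0 ≤ C0) {K : ℝ} (hK : 0 ≤ K) : ∃ C : ℝ, 0 ≤ C ∧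
    ∀ (z : E d → ℝ) (zr : Fin d → E d → ℝ), Cac C0 z zr → ∀ (η : E d → ℝ) (N : Fin d → E d → ℝ),
    HasGrad η N → (∀ i, Continuous (N i)) → HasCompactSupport η → (∀ x, 0 ≤ η x) → (∀ x, η x ≤ 1) →
    (∀ x, ∑ i, N i x ^ 2 ≤ K) → ∀ m s : ℝ, 2 ≤ m → 2 ≤ s →
    ∫ x, η x ^ (2 * m * (((d:ℝ) + 1) / d)) * z x ^ (s * (((d:ℝ) + 1) / d)) ≤
      C * (s ^ 2 * m ^ 2 * ∫ x, η x ^ (2 * m - 2) * z x ^ s) ^ (((d:ℝ) + 1) / d) := by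
  obtain ⟨Cs, hCs, hsob⟩ := sobolev hd
  set χ : ℝ := ((d:ℝ) + 1) / d with hχ
  have hd0 : (0:ℝ) < d := by exact_mod_cast hd
  have hχ0 : 0 < χ := by positivity
  refine ⟨Cs * (K * (2 + C0) + 1) ^ χ, by positivity, ?_⟩
  intro z zr ⟨hz, hzc, hz1, hcac⟩ η N hη hN hηc hη0 hη1 hNK m s hm hs
  have hzp : ∀ x, 0 < z x := fun x => by linarith [hz1 x]
  have hηm : HasGrad (fun x => η x ^ m) (fun i x => m * η x ^ (m - 1) * N i x) :=
    hη.comp (F := fun t => t ^ m) (F' := fun t => m * t ^ (m-1))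
      fun x => Real.hasDerivAt_rpow_const (Or.inr (by linarith))
  have hzs : HasGrad (fun x => z x ^ (s/2)) (fun i x => s/2 * z x ^ (s/2 - 1) * zr i x) :=
    hz.comp (F := fun t => t ^ (s/2)) (F' := fun t => s/2 * t ^ (s/2-1))
      fun x => Real.hasDerivAt_rpow_const (Or.inl (hzp x).ne')
  have hf := hηm.mul hzs
  have cη := hη.continuous
  have cz := hz.continuous
  have cηp : ∀ a : ℝ, 0 ≤ a → Continuous fun x => η x ^ a := fun a ha =>
    cη.rpow_const fun x => Or.inr ha
  have czp : ∀ a : ℝ, Continuous fun x => z x ^ a := fun a =>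
    cz.rpow_const fun x => Or.inl (hzp x).ne'
  have cηm : ∀ i, Continuous (fun x => m * η x ^ (m - 1) * N i x) := fun i =>
    (continuous_const.mul (cηp _ (by linarith))).mul (hN i)
  have czs : ∀ i, Continuous (fun x => s/2 * z x ^ (s/2 - 1) * zr i x) := fun i =>
    (continuous_const.mul (czp _)).mul (hzc i)
  have csm : HasCompactSupport (fun x => η x ^ m) :=
    HasCompactSupport.intro hηc.isCompact fun x hx => by
      rw [image_eq_zero_of_notMem_tsupport hx, Real.zero_rpow (by linarith)]
  have csf : HasCompactSupport (fun x => η x ^ m * z x ^ (s/2)) :=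
    HasCompactSupport.intro hηc.isCompact fun x hx => by
      rw [image_eq_zero_of_notMem_tsupport hx, Real.zero_rpow (by linarith), zero_mul]
  have hG0 : ∀ x, 0 ≤ η x ^ (2 * m - 2) * z x ^ s := fun x =>
    mul_nonneg (Real.rpow_nonneg (hη0 x) _) (Real.rpow_nonneg (hzp x).le _)
  have hGc : Continuous fun x => η x ^ (2 * m - 2) * z x ^ s := (cηp _ (by linarith)).mul (czp _)
  have hGi : Integrable fun x => η x ^ (2 * m - 2) * z x ^ s := by
    refine hGc.integrable_of_hasCompactSupport (HasCompactSupport.intro hηc.isCompact fun x hx => ?_)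
    rw [image_eq_zero_of_notMem_tsupport hx, Real.zero_rpow (by linarith), zero_mul]
  have hTi : Integrable fun x => (η x ^ m) ^ 2 * (z x ^ (s - 2) * ∑ i, zr i x ^ 2) := by
    have hc : Continuous fun x => (η x ^ m) ^ 2 * (z x ^ (s - 2) * ∑ i, zr i x ^ 2) :=
      ((cηp m (by linarith)).pow 2).mul ((czp _).mul (continuous_finsetSum _ fun i _ => (hzc i).pow 2))
    refine hc.integrable_of_hasCompactSupport (HasCompactSupport.intro hηc.isCompact fun x hx => ?_)
    rw [image_eq_zero_of_notMem_tsupport hx, Real.zero_rpow (by linarith)]; simp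
  have hRi : Integrable fun x => z x ^ (s - 2) * ∑ i, (m * η x ^ (m - 1) * N i x) ^ 2 := by
    have hc : Continuous fun x => z x ^ (s - 2) * ∑ i, (m * η x ^ (m - 1) * N i x) ^ 2 :=
      (czp _).mul (continuous_finsetSum _ fun i _ => (cηm i).pow 2)
    refine hc.integrable_of_hasCompactSupport (HasCompactSupport.intro hηc.isCompact fun x hx => ?_)
    rw [image_eq_zero_of_notMem_tsupport hx, Real.zero_rpow (by linarith)]; simp
  have p1 : ∀ x, (η x ^ (m - 1)) ^ 2 = η x ^ (2 * m - 2) := fun x => by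
    rw [← Real.rpow_natCast, ← Real.rpow_mul (hη0 x)]; congr 1; push_cast; ring
  have p2 : ∀ x, (η x ^ m) ^ 2 = η x ^ (2 * m) := fun x => by
    rw [← Real.rpow_natCast, ← Real.rpow_mul (hη0 x)]; congr 1; push_cast; ring
  have p3 : ∀ x, (z x ^ (s/2)) ^ 2 = z x ^ s := fun x => by
    rw [← Real.rpow_natCast, ← Real.rpow_mul (hzp x).le]; congr 1; push_cast; ring
  have p4 : ∀ x, (z x ^ (s/2 - 1)) ^ 2 = z x ^ (s - 2) := fun x => by
    rw [← Real.rpow_natCast, ← Real.rpow_mul (hzp x).le]; congr 1; push_cast; ring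
  have p5 : ∀ x, η x ^ (2 * m) ≤ η x ^ (2 * m - 2) := fun x => by
    rcases (hη0 x).eq_or_lt with h | h
    · rw [← h, Real.zero_rpow (by linarith), Real.zero_rpow (by linarith)]
    · exact Real.rpow_le_rpow_of_exponent_ge h (hη1 x) (by linarith)
  have p6 : ∀ x, z x ^ (s - 2) ≤ z x ^ s := fun x =>
    Real.rpow_le_rpow_of_exponent_le (hz1 x) (by linarith)
  set G : ℝ := ∫ x, η x ^ (2 * m - 2) * z x ^ s with hG
  have hGn : 0 ≤ G := integral_nonneg hG0
  have hcc := hcac (s - 2) (by linarith) _ _ hηm cηm csm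
  have hR : ∫ x, z x ^ (s - 2) * ∑ i, (m * η x ^ (m - 1) * N i x) ^ 2 ≤ m ^ 2 * K * G := by
    rw [hG, ← integral_const_mul]
    refine integral_mono hRi (hGi.const_mul _) fun x => ?_
    have e1 : ∑ i, (m * η x ^ (m - 1) * N i x) ^ 2 = m ^ 2 * η x ^ (2 * m - 2) * ∑ i, N i x ^ 2 := by
      rw [Finset.mul_sum]; refine Finset.sum_congr rfl fun i _ => ?_
      rw [← p1]; ring
    simp only
    rw [e1]
    have h1 : 0 ≤ z x ^ (s - 2) := Real.rpow_nonneg (hzp x).le _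
    have h2 : 0 ≤ η x ^ (2 * m - 2) := Real.rpow_nonneg (hη0 x) _
    have h3 : 0 ≤ ∑ i, N i x ^ 2 := Finset.sum_nonneg fun _ _ => sq_nonneg _
    calc z x ^ (s - 2) * (m ^ 2 * η x ^ (2 * m - 2) * ∑ i, N i x ^ 2)
        ≤ z x ^ s * (m ^ 2 * η x ^ (2 * m - 2) * K) := by
          refine mul_le_mul (p6 x) (mul_le_mul_of_nonneg_left (hNK x) (by positivity)) (by positivity)
            (Real.rpow_nonneg (hzp x).le _)
      _ = _ := by ring
  have hT := hcc.trans (mul_le_mul_of_nonneg_left hR hC0)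
  have hpt : ∀ x, (∑ i, ((m * η x ^ (m - 1) * N i x) * z x ^ (s/2) +
      η x ^ m * (s/2 * z x ^ (s/2 - 1) * zr i x)) ^ 2) + (η x ^ m * z x ^ (s/2)) ^ 2 ≤
      (2 * m ^ 2 * K + 1) * (η x ^ (2 * m - 2) * z x ^ s) +
      s ^ 2 / 2 * ((η x ^ m) ^ 2 * (z x ^ (s - 2) * ∑ i, zr i x ^ 2)) := by
    intro x
    have h1 : 0 ≤ z x ^ s := Real.rpow_nonneg (hzp x).le _
    have h2 : 0 ≤ η x ^ (2 * m - 2) := Real.rpow_nonneg (hη0 x) _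
    have e1 : (∑ i, ((m * η x ^ (m - 1) * N i x) * z x ^ (s/2) +
      η x ^ m * (s/2 * z x ^ (s/2 - 1) * zr i x)) ^ 2) ≤
      2 * m ^ 2 * (η x ^ (2 * m - 2) * z x ^ s) * ∑ i, N i x ^ 2 +
      s ^ 2 / 2 * ((η x ^ m) ^ 2 * (z x ^ (s - 2) * ∑ i, zr i x ^ 2)) := by
      simp only [Finset.mul_sum]
      rw [← Finset.sum_add_distrib]
      refine Finset.sum_le_sum fun i _ => ?_
      rw [← p1, ← p3, ← p4]
      nlinarith [sq_nonneg ((m * η x ^ (m - 1) * N i x) * z x ^ (s/2) -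
        η x ^ m * (s/2 * z x ^ (s/2 - 1) * zr i x))]
    have e2 : (η x ^ m * z x ^ (s/2)) ^ 2 ≤ η x ^ (2 * m - 2) * z x ^ s := by
      rw [mul_pow, p2, p3]; exact mul_le_mul_of_nonneg_right (p5 x) h1
    have e3 : 2 * m ^ 2 * (η x ^ (2 * m - 2) * z x ^ s) * ∑ i, N i x ^ 2 ≤
        2 * m ^ 2 * (η x ^ (2 * m - 2) * z x ^ s) * K :=
      mul_le_mul_of_nonneg_left (hNK x) (by positivity)
    linarith
  have hS := hsob _ _ hf (fun i => ((cηm i).mul (czp _)).add ((cηp m (by linarith)).mul (czs i))) csf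
  have hL : ∀ x, ((η x ^ m * z x ^ (s/2)) ^ 2) ^ χ = η x ^ (2 * m * χ) * z x ^ (s * χ) := fun x => by
    rw [mul_pow, p2, p3, Real.mul_rpow (Real.rpow_nonneg (hη0 x) _) (Real.rpow_nonneg (hzp x).le _),
      ← Real.rpow_mul (hη0 x), ← Real.rpow_mul (hzp x).le]
  simp only [hL] at hS
  refine hS.trans ?_
  rw [mul_assoc, ← Real.mul_rpow (by positivity) (by positivity)]
  refine mul_le_mul_of_nonneg_left (Real.rpow_le_rpow (integral_nonneg fun x => by positivity) ?_ hχ0.le) hCs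
  have hU : ∫ x, ((∑ i, ((m * η x ^ (m - 1) * N i x) * z x ^ (s/2) +
      η x ^ m * (s/2 * z x ^ (s/2 - 1) * zr i x)) ^ 2) + (η x ^ m * z x ^ (s/2)) ^ 2) ≤
      (2 * m ^ 2 * K + 1) * G +
      s ^ 2 / 2 * ∫ x, ((η x ^ m) ^ 2 * (z x ^ (s - 2) * ∑ i, zr i x ^ 2)) := by
    rw [hG, ← integral_const_mul, ← integral_const_mul, ← integral_add (hGi.const_mul _) (hTi.const_mul _)]
    exact integral_mono_of_nonneg (Eventually.of_forall fun x => by positivity)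
      ((hGi.const_mul _).add (hTi.const_mul _)) (Eventually.of_forall hpt)
  refine hU.trans ?_
  have hs2 : 4 ≤ s ^ 2 := by nlinarith
  have hm2 : 4 ≤ m ^ 2 := by nlinarith
  have a1 : s ^ 2 / 2 * ∫ x, ((η x ^ m) ^ 2 * (z x ^ (s - 2) * ∑ i, zr i x ^ 2)) ≤
    s ^ 2 / 2 * (C0 * (m ^ 2 * K * G)) := mul_le_mul_of_nonneg_left hT (by positivity)
  have a2 : (2 * m ^ 2 * K + 1) * G ≤ s ^ 2 * m ^ 2 * (K * 2 + 1) * G := by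
    refine mul_le_mul_of_nonneg_right ?_ hGn
    nlinarith [mul_nonneg (mul_nonneg (sq_nonneg m) hK) (by linarith : 0 ≤ s ^ 2 - 1)]
  have a3 : 0 ≤ s ^ 2 * C0 * (m ^ 2 * K * G) := by positivity
  nlinarith

theorem moser (hd : 1 ≤ d) {C0 : ℝ} (hC0 : 0 ≤ C0) : ∃ D : ℝ, 0 ≤ D ∧
    ∀ (z : E d → ℝ) (zr : Fin d → E d → ℝ), Cac C0 z zr → ∀ x, ‖x‖ ≤ 1 →
      z x ^ 2 ≤ D * ∫ x in Metric.closedBall (0 : E d) 4, z x ^ 2 := by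
  obtain ⟨η, N, K, hη, hN, hηc, hη0, hη1, hηo, hηz, hK, hNK⟩ := exists_cutoff d (R := 2) (by norm_num)
  obtain ⟨C, hC, hst⟩ := moser_step hd hC0 hK
  set χ : ℝ := ((d:ℝ) + 1) / d with hχ
  have hd0 : (0:ℝ) < d := by exact_mod_cast hd
  have hχ1 : 1 < χ := by rw [hχ, lt_div_iff₀ hd0]; linarith
  have hχ0 : 0 < χ := by positivity
  have hχd : (χ - 1) * d = 1 := by rw [hχ]; field_simp; ring
  have hB : 1 ≤ χ ^ 4 := one_le_pow₀ hχ1.le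
  set A : ℝ := 4 * (2 + d) ^ 2 with hA
  have hA0 : 0 < A := by positivity
  obtain ⟨D, hD, hit⟩ := iter_lemma (C := max 1 (C * A ^ χ)) (le_max_left _ _) hB hχ1
  refine ⟨D, hD.le, fun z zr hz => ?_⟩
  have hcz := hz.1.continuous
  have hzp : ∀ x, 0 < z x := fun x => by linarith [hz.2.2.1 x]
  let m : ℕ → ℝ := fun k => Nat.rec 2 (fun _ a => χ * a + 1) k
  have m0 : m 0 = 2 := rfl
  have ms : ∀ k, m (k+1) = χ * m k + 1 := fun k => rfl
  have hm2 : ∀ k, 2 ≤ m k := by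
    intro k; induction k with
    | zero => exact le_rfl
    | succ k ih => rw [ms]; nlinarith
  have hmu : ∀ k, m k ≤ (2 + d) * χ ^ k - d := by
    intro k; induction k with
    | zero => rw [m0]; simp
    | succ k ih =>
      rw [ms, pow_succ]
      nlinarith
  have hs2 : ∀ k : ℕ, 2 ≤ 2 * χ ^ k := fun k => by nlinarith [one_le_pow₀ hχ1.le (n := k)]
  let I : ℕ → ℝ := fun k => ∫ x, η x ^ (2 * m k - 2) * z x ^ (2 * χ ^ k)
  have hI0 : ∀ k, 0 ≤ I k := fun k => integral_nonneg fun x =>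
    mul_nonneg (Real.rpow_nonneg (hη0 x) _) (Real.rpow_nonneg (hzp x).le _)
  have hI : ∀ k, I (k+1) ≤ max 1 (C * A ^ χ) * ((χ ^ 4) ^ k * I k) ^ χ := by
    intro k
    have h1 := hst z zr hz η N hη hN hηc hη0 hη1 hNK (m k) (2 * χ ^ k) (hm2 k) (hs2 k)
    have e1 : I (k+1) = ∫ x, η x ^ (2 * m k * χ) * z x ^ (2 * χ ^ k * χ) := by
      show ∫ x, η x ^ (2 * m (k+1) - 2) * z x ^ (2 * χ ^ (k+1)) = _
      rw [ms, pow_succ]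
      congr 1; ext x; congr 2 <;> ring
    rw [e1]
    refine h1.trans ?_
    have h2 : (2 * χ ^ k) ^ 2 * m k ^ 2 * I k ≤ A * ((χ ^ 4) ^ k * I k) := by
      rw [← mul_assoc]
      refine mul_le_mul_of_nonneg_right ?_ (hI0 k)
      have h3 : m k ^ 2 ≤ ((2 + d) * χ ^ k) ^ 2 := pow_le_pow_left₀ (by linarith [hm2 k])
        (by linarith [hmu k]) 2
      calc (2 * χ ^ k) ^ 2 * m k ^ 2 ≤ (2 * χ ^ k) ^ 2 * ((2 + d) * χ ^ k) ^ 2 := by gcongr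
        _ = _ := by rw [hA]; ring
    calc C * ((2 * χ ^ k) ^ 2 * m k ^ 2 * I k) ^ χ ≤ C * (A * ((χ ^ 4) ^ k * I k)) ^ χ := by
          refine mul_le_mul_of_nonneg_left (Real.rpow_le_rpow ?_ h2 hχ0.le) hC
          exact mul_nonneg (by positivity) (hI0 k)
      _ = C * A ^ χ * ((χ ^ 4) ^ k * I k) ^ χ := by
          rw [Real.mul_rpow hA0.le (mul_nonneg (by positivity) (hI0 k))]; ring
      _ ≤ _ := mul_le_mul_of_nonneg_right (le_max_right _ _)
          (Real.rpow_nonneg (mul_nonneg (by positivity) (hI0 k)) _)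
  have hfin := hit I hI0 hI
  have hI00 : I 0 ≤ ∫ x in Metric.closedBall (0 : E d) 4, z x ^ 2 := by
    have e1 : I 0 = ∫ x, η x ^ 2 * z x ^ 2 := by
      show ∫ x, η x ^ (2 * m 0 - 2) * z x ^ (2 * χ ^ 0) = _
      rw [m0]
      congr 1; ext x
      rw [← Real.rpow_natCast, ← Real.rpow_natCast]; norm_num
    have e2 : ∫ x, η x ^ 2 * z x ^ 2 = ∫ x in Metric.closedBall (0 : E d) 4, η x ^ 2 * z x ^ 2 := by
      symm
      refine setIntegral_eq_integral_of_forall_compl_eq_zero fun x hx => ?_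
      rw [hηz x (by simp at hx; linarith)]; simp
    rw [e1, e2]
    refine setIntegral_mono_on ?_ ?_ Metric.isClosed_closedBall.measurableSet fun x _ => ?_
    · exact ((hη.continuous.pow 2).mul (hcz.pow 2)).continuousOn.integrableOn_compact (isCompact_closedBall _ _)
    · exact (hcz.pow 2).continuousOn.integrableOn_compact (isCompact_closedBall _ _)
    · exact mul_le_of_le_one_left (sq_nonneg _) (pow_le_one₀ (hη0 x) (hη1 x))
  intro x hx
  refine le_trans ?_ (mul_le_mul_of_nonneg_left hI00 hD.le)
  by_contra hcon
  push_neg at hcon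
  obtain ⟨a, ha1, ha2⟩ := exists_between hcon
  have hDI : 0 ≤ D * I 0 := mul_nonneg hD.le (hI0 0)
  have ha0 : 0 < a := hDI.trans_lt ha1
  have hnb : ∀ᶠ y in 𝓝 x, a < z y ^ 2 := (hcz.pow 2).continuousAt.eventually (lt_mem_nhds ha2)
  obtain ⟨δ, hδ, hδb⟩ := Metric.eventually_nhds_iff_ball.1 hnb
  set ρ := min δ 1 with hρ
  have hρ0 : 0 < ρ := lt_min hδ one_pos
  set vol : ℝ := (volume (Metric.ball x ρ)).toReal with hvol
  have hvol0 : 0 < vol := ENNReal.toReal_pos (Metric.measure_ball_pos _ _ hρ0).ne' measure_ball_lt_top.ne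
  have hlow : ∀ k, a ^ (χ ^ k) * vol ≤ I k := by
    intro k
    have hIntg : Integrable fun x => η x ^ (2 * m k - 2) * z x ^ (2 * χ ^ k) := by
      have hc : Continuous fun x => η x ^ (2 * m k - 2) * z x ^ (2 * χ ^ k) :=
        (hη.continuous.rpow_const fun x => Or.inr (by linarith [hm2 k])).mul
          (hcz.rpow_const fun x => Or.inl (hzp x).ne')
      refine hc.integrable_of_hasCompactSupport (HasCompactSupport.intro hηc.isCompact fun x hx => ?_)
      rw [image_eq_zero_of_notMem_tsupport hx, Real.zero_rpow (by linarith [hm2 k]), zero_mul]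
    have h1 : ∫ y in Metric.ball x ρ, a ^ (χ ^ k) ≤
        ∫ y in Metric.ball x ρ, η y ^ (2 * m k - 2) * z y ^ (2 * χ ^ k) := by
      refine setIntegral_mono_on (by simp [measure_ball_lt_top]) hIntg.integrableOn measurableSet_ball
        fun y hy => ?_
      have hy1 : ‖y‖ ≤ 2 := by
        have h2 : ‖y - x‖ < ρ := by simpa [dist_eq_norm] using hy
        have : ‖y‖ ≤ ‖y - x‖ + ‖x‖ := by simpa using norm_add_le (y - x) x
        have := min_le_right δ 1
        linarith
      rw [hηo y hy1, Real.one_rpow, one_mul, Real.rpow_mul (hzp y).le]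
      refine Real.rpow_le_rpow ha0.le ?_ (by positivity)
      have := hδb y (Metric.ball_subset_ball (min_le_left _ _) hy)
      rw [Real.rpow_two]; exact this.le
    have h2 : ∫ y in Metric.ball x ρ, η y ^ (2 * m k - 2) * z y ^ (2 * χ ^ k) ≤ I k :=
      setIntegral_le_integral hIntg (Eventually.of_forall fun x =>
        mul_nonneg (Real.rpow_nonneg (hη0 x) _) (Real.rpow_nonneg (hzp x).le _))
    rw [setIntegral_const, smul_eq_mul, mul_comm] at h1
    exact h1.trans h2
  have hlim : Tendsto (fun k : ℕ => ((D * I 0) / a) ^ (χ ^ k)) atTop (𝓝 0) := by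
    exact (tendsto_rpow_atTop_of_base_lt_one _ (by
      have : 0 ≤ D * I 0 / a := by positivity
      linarith) (by rw [div_lt_one ha0]; exact ha1)).comp (tendsto_pow_atTop_atTop_of_one_lt hχ1)
  have hge : ∀ k : ℕ, vol ≤ ((D * I 0) / a) ^ (χ ^ k) := fun k => by
    rw [Real.div_rpow hDI ha0.le, le_div_iff₀ (Real.rpow_pos_of_pos ha0 _), mul_comm]
    exact (hlow k).trans (hfin k)
  have := ge_of_tendsto' hlim hge
  linarith

end MFG

end S4

section S5

open MeasureTheory Set Filter Topology

namespace MFG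
variable {d : ℕ}

structure WeakSol (lam Lam : ℝ) (A : Fin d → Fin d → E d → ℝ) (v : E d → ℝ) (r : Fin d → E d → ℝ) : Prop where
  grad : HasGrad v r
  rc : ∀ i, Continuous (r i)
  Ac : ∀ i j, Continuous (A i j)
  ell : ∀ x (ξ : Fin d → ℝ), lam * ∑ i, ξ i ^ 2 ≤ ∑ i, ∑ j, A i j x * ξ j * ξ i
  bd : ∀ i j x, |A i j x| ≤ Lam
  weak : ∀ (φ : E d → ℝ) (Q : Fin d → E d → ℝ), HasGrad φ Q → (∀ i, Continuous (Q i)) →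
    HasCompactSupport φ → ∫ x, ∑ i, ∑ j, A i j x * r j x * Q i x = 0

theorem bilin_young {lam Lam : ℝ} (hl : 0 < lam) (hd : 1 ≤ d) (A : Fin d → Fin d → ℝ)
    (hA : ∀ i j, |A i j| ≤ Lam) (η : ℝ) (a b : Fin d → ℝ) :
    -(lam / 2 * (η ^ 2 * ∑ i, a i ^ 2)) - (2 * d ^ 2 * Lam ^ 2 / lam) * ∑ i, b i ^ 2 ≤
      ∑ i, ∑ j, A i j * a j * (2 * η * b i) := by
  have hd0 : (0:ℝ) < d := by exact_mod_cast hd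
  set δ : ℝ := lam / (2 * d) with hδ
  have hδ0 : 0 < δ := by positivity
  have h1 : ∀ i j, -(δ * (η ^ 2 * a j ^ 2)) - Lam ^ 2 / δ * b i ^ 2 ≤ A i j * a j * (2 * η * b i) := by
    intro i j
    have h2 : (A i j * b i) ^ 2 ≤ Lam ^ 2 * b i ^ 2 := by
      rw [mul_pow]; exact mul_le_mul_of_nonneg_right (sq_le_sq' (abs_le.1 (hA i j)).1 (abs_le.1 (hA i j)).2) (sq_nonneg _)
    have h3 : 0 ≤ (δ * (η * a j) + A i j * b i) ^ 2 / δ := by positivity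
    have h4 : (δ * (η * a j) + A i j * b i) ^ 2 / δ =
      δ * (η ^ 2 * a j ^ 2) + A i j * a j * (2 * η * b i) + (A i j * b i) ^ 2 / δ := by
      field_simp; ring
    have h5 : (A i j * b i) ^ 2 / δ ≤ Lam ^ 2 / δ * b i ^ 2 := by
      rw [div_mul_eq_mul_div]; exact div_le_div_of_nonneg_right h2 hδ0.le
    linarith
  refine le_trans (le_of_eq ?_) (Finset.sum_le_sum fun i _ => Finset.sum_le_sum fun j _ => h1 i j)
  simp only [Finset.sum_sub_distrib, Finset.sum_neg_distrib, ← Finset.mul_sum, Finset.sum_const,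
    Finset.card_univ, Fintype.card_fin, nsmul_eq_mul]
  rw [hδ]; field_simp

theorem WeakSol.cac (hd : 1 ≤ d) {lam Lam : ℝ} (hl : 0 < lam) {A : Fin d → Fin d → E d → ℝ} {v : E d → ℝ}
    {r : Fin d → E d → ℝ} (h : WeakSol lam Lam A v r) {κ : ℝ} (hκ : 0 < κ) (hv1 : ∀ x, v x ≤ 1)
    (hv2 : ∀ x, -1 ≤ v x) :
    Cac (4 * d ^ 2 * Lam ^ 2 / lam ^ 2) (fun x => 1 + Real.log (2 + κ) - Real.log (1 - v x + κ))
      (fun i x => (1 - v x + κ)⁻¹ * r i x) := by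
  have hW : ∀ x, 0 < 1 - v x + κ := fun x => by linarith [hv1 x]
  set z : E d → ℝ := fun x => 1 + Real.log (2 + κ) - Real.log (1 - v x + κ) with hz
  set zr : Fin d → E d → ℝ := fun i x => (1 - v x + κ)⁻¹ * r i x with hzr
  have cv := h.grad.continuous
  have cW : Continuous fun x => 1 - v x + κ := (continuous_const.sub cv).add continuous_const
  have ciW : Continuous fun x => (1 - v x + κ)⁻¹ := cW.inv₀ fun x => (hW x).ne'
  have gz : HasGrad z zr := by
    refine (h.grad.comp (F := fun t => 1 + Real.log (2 + κ) - Real.log (1 - t + κ))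
      (F' := fun t => (1 - t + κ)⁻¹) fun x => ?_)
    have h1 : HasDerivAt (fun t => 1 - t + κ) (-1) (v x) := by
      simpa using ((hasDerivAt_id (v x)).const_sub 1).add_const κ
    have h2 := (h1.log (hW x).ne').const_sub (1 + Real.log (2 + κ))
    refine h2.congr_deriv ?_
    rw [neg_div, neg_neg, one_div]
  have giW : HasGrad (fun x => (1 - v x + κ)⁻¹) (fun i x => (1 - v x + κ)⁻¹ * zr i x) := by
    refine (h.grad.comp (F := fun t => (1 - t + κ)⁻¹)
      (F' := fun t => (1 - t + κ)⁻¹ * (1 - t + κ)⁻¹) fun x => ?_).congr fun i x => by simp [hzr, mul_assoc]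
    have h1 : HasDerivAt (fun t => 1 - t + κ) (-1) (v x) := by
      simpa using ((hasDerivAt_id (v x)).const_sub 1).add_const κ
    refine (h1.inv (hW x).ne').congr_deriv ?_
    rw [neg_neg, sq, one_div, mul_inv]
  have czr : ∀ i, Continuous (zr i) := fun i => ciW.mul (h.rc i)
  have hz1 : ∀ x, 1 ≤ z x := fun x => by
    have : Real.log (1 - v x + κ) ≤ Real.log (2 + κ) := Real.log_le_log (hW x) (by linarith [hv2 x])
    simp only [hz]; linarith
  have hzp : ∀ x, 0 < z x := fun x => by linarith [hz1 x]
  refine ⟨gz, czr, hz1, fun q hq η N hη hN hηc => ?_⟩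
  have cz := gz.continuous
  have czp : ∀ a : ℝ, Continuous fun x => z x ^ a := fun a =>
    cz.rpow_const fun x => Or.inl (hzp x).ne'
  have gzq : HasGrad (fun x => z x ^ q) (fun i x => q * z x ^ (q - 1) * zr i x) :=
    gz.comp (F := fun t => t ^ q) (F' := fun t => q * t ^ (q-1))
      fun x => Real.hasDerivAt_rpow_const (Or.inl (hzp x).ne')
  have gφ := (hη.mul hη).mul (gzq.mul giW)
  have cη := hη.continuous
  have hw := h.weak _ _ gφ (fun i => (((hN i).mul cη).add (cη.mul (hN i))).mul ((czp q).mul ciW) |>.add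
    ((cη.mul cη).mul ((((continuous_const.mul (czp _)).mul (czr i)).mul ciW).add
      ((czp q).mul (ciW.mul (czr i)))))) (HasCompactSupport.intro hηc.isCompact fun x hx => by
      rw [image_eq_zero_of_notMem_tsupport hx]; simp)
  have csN : ∀ i x, x ∉ tsupport η → N i x = 0 := fun i x hx => by
    have := (hη x).fderiv
    have h0 : fderiv ℝ η x = 0 := image_eq_zero_of_notMem_tsupport
      (fun h => hx (tsupport_fderiv_subset ℝ h))
    rw [← lin_single (fun i => N i x) i, ← this, h0]; rfl
  have hi1 : Integrable fun x => η x ^ 2 * (z x ^ q * ∑ i, zr i x ^ 2) := by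
    have hc : Continuous fun x => η x ^ 2 * (z x ^ q * ∑ i, zr i x ^ 2) :=
      (cη.pow 2).mul ((czp _).mul (continuous_finsetSum _ fun i _ => (czr i).pow 2))
    refine hc.integrable_of_hasCompactSupport (HasCompactSupport.intro hηc.isCompact fun x hx => ?_)
    rw [image_eq_zero_of_notMem_tsupport hx]; simp
  have hi2 : Integrable fun x => z x ^ q * ∑ i, N i x ^ 2 := by
    have hc : Continuous fun x => z x ^ q * ∑ i, N i x ^ 2 :=
      ((czp _).mul (continuous_finsetSum _ fun i _ => (hN i).pow 2))
    refine hc.integrable_of_hasCompactSupport (HasCompactSupport.intro hηc.isCompact fun x hx => ?_)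
    simp [csN _ x hx]
  have hpt : ∀ x, lam / 2 * (η x ^ 2 * (z x ^ q * ∑ i, zr i x ^ 2)) -
      (2 * d ^ 2 * Lam ^ 2 / lam) * (z x ^ q * ∑ i, N i x ^ 2) ≤ ∑ i, ∑ j, A i j x * r j x *
      ((N i x * η x + η x * N i x) * (z x ^ q * (1 - v x + κ)⁻¹) +
        η x * η x * (q * z x ^ (q - 1) * zr i x * (1 - v x + κ)⁻¹ +
          z x ^ q * ((1 - v x + κ)⁻¹ * zr i x))) := by
    intro x
    have e1 : ∑ i, ∑ j, A i j x * r j x *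
      ((N i x * η x + η x * N i x) * (z x ^ q * (1 - v x + κ)⁻¹) +
        η x * η x * (q * z x ^ (q - 1) * zr i x * (1 - v x + κ)⁻¹ +
          z x ^ q * ((1 - v x + κ)⁻¹ * zr i x))) =
       z x ^ q * (∑ i, ∑ j, A i j x * zr j x * (2 * η x * N i x)) +
       η x ^ 2 * (q * z x ^ (q - 1) + z x ^ q) * ∑ i, ∑ j, A i j x * zr j x * zr i x := by
      simp only [Finset.mul_sum, ← Finset.sum_add_distrib]
      refine Finset.sum_congr rfl fun i _ => Finset.sum_congr rfl fun j _ => ?_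
      simp only [hzr]; ring
    rw [e1]
    have h1 := bilin_young hl hd (fun i j => A i j x) (fun i j => h.bd i j x) (η x) (fun i => zr i x)
      (fun i => N i x)
    have h2 := h.ell x (fun i => zr i x)
    have h3 : 0 ≤ z x ^ q := Real.rpow_nonneg (hzp x).le _
    have h4 : 0 ≤ q * z x ^ (q - 1) := mul_nonneg hq (Real.rpow_nonneg (hzp x).le _)
    have h5 : 0 ≤ ∑ i, zr i x ^ 2 := Finset.sum_nonneg fun _ _ => sq_nonneg _
    have h6 := mul_le_mul_of_nonneg_left h1 h3
    have h7 := mul_le_mul_of_nonneg_left h2 (mul_nonneg (sq_nonneg (η x)) h3)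
    have h8 : 0 ≤ η x ^ 2 * (q * z x ^ (q - 1)) * ∑ i, ∑ j, A i j x * zr j x * zr i x :=
      mul_nonneg (mul_nonneg (sq_nonneg _) h4) (le_trans (mul_nonneg hl.le h5) h2)
    linarith
  have hmono : ∫ x, (lam / 2 * (η x ^ 2 * (z x ^ q * ∑ i, zr i x ^ 2)) -
      (2 * d ^ 2 * Lam ^ 2 / lam) * (z x ^ q * ∑ i, N i x ^ 2)) ≤ 0 := by
    refine (integral_mono ((hi1.const_mul _).sub (hi2.const_mul _)) ?_ hpt).trans hw.le
    refine Continuous.integrable_of_hasCompactSupport ?_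
      (HasCompactSupport.intro hηc.isCompact fun x hx => ?_)
    · refine continuous_finsetSum _ fun i _ => continuous_finsetSum _ fun j _ =>
        ((h.Ac i j).mul (h.rc j)).mul ?_
      exact (((hN i).mul cη).add (cη.mul (hN i))).mul ((czp q).mul ciW) |>.add
        ((cη.mul cη).mul ((((continuous_const.mul (czp _)).mul (czr i)).mul ciW).add
        ((czp q).mul (ciW.mul (czr i)))))
    · rw [image_eq_zero_of_notMem_tsupport hx]; simp
  rw [integral_sub (hi1.const_mul _) (hi2.const_mul _), integral_const_mul, integral_const_mul] at hmono
  have e : (4 * (d:ℝ) ^ 2 * Lam ^ 2 / lam ^ 2) = 2 / lam * (2 * d ^ 2 * Lam ^ 2 / lam) := by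
    field_simp; ring
  rw [e, mul_assoc]
  have : ∫ x, η x ^ 2 * (z x ^ q * ∑ i, zr i x ^ 2) =
      2 / lam * (lam / 2 * ∫ x, η x ^ 2 * (z x ^ q * ∑ i, zr i x ^ 2)) := by field_simp
  rw [this]
  exact mul_le_mul_of_nonneg_left (by linarith) (by positivity)

theorem sq_diff_le {z : E d → ℝ} {zr : Fin d → E d → ℝ} (hz : HasGrad z zr) (hc : ∀ i, Continuous (zr i))
    (x h : E d) : (z x - z (x + h)) ^ 2 ≤
      ∫ t in Icc (0:ℝ) 1, (∑ i, h i ^ 2) * ∑ i, zr i (x + t • h) ^ 2 := by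
  have hl : Continuous fun t : ℝ => x + t • h := by fun_prop
  have hcf : Continuous fun t : ℝ => ∑ i, zr i (x + t • h) * h i :=
    continuous_finsetSum _ fun i _ => ((hc i).comp hl).mul continuous_const
  have hcg : Continuous fun t : ℝ => (∑ i, h i ^ 2) * ∑ i, zr i (x + t • h) ^ 2 :=
    continuous_const.mul (continuous_finsetSum _ fun i _ => ((hc i).comp hl).pow 2)
  rw [integral_Icc_eq_integral_Ioc, ← intervalIntegral.integral_of_le zero_le_one]
  have h1 : ∫ t in (0:ℝ)..1, ∑ i, zr i (x + t • h) * h i = z (x + h) - z x := by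
    rw [intervalIntegral.integral_eq_sub_of_hasDerivAt (f := fun t : ℝ => z (x + t • h))
      (fun t _ => hz.line x h t) (hcf.intervalIntegrable _ _)]
    simp
  set c := z (x + h) - z x with hcdef
  have h2 : ∫ t in (0:ℝ)..1, (2 * c * (∑ i, zr i (x + t • h) * h i) - c ^ 2) ≤
      ∫ t in (0:ℝ)..1, (∑ i, h i ^ 2) * ∑ i, zr i (x + t • h) ^ 2 := by
    refine intervalIntegral.integral_mono_on zero_le_one
      (((continuous_const.mul hcf).sub continuous_const).intervalIntegrable _ _)
      (hcg.intervalIntegrable _ _) fun t _ => ?_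
    have := Finset.sum_mul_sq_le_sq_mul_sq Finset.univ (fun i => zr i (x + t • h)) h
    nlinarith [sq_nonneg ((∑ i, zr i (x + t • h) * h i) - c)]
  have hcf2 : Continuous fun t : ℝ => 2 * c * ∑ i, zr i (x + t • h) * h i := continuous_const.mul hcf
  rw [intervalIntegral.integral_sub (hcf2.intervalIntegrable _ _)
    (continuous_const.intervalIntegrable _ _), intervalIntegral.integral_const_mul, h1] at h2
  simp only [intervalIntegral.integral_const, sub_zero, one_smul] at h2
  have h3 : (z x - z (x + h)) ^ 2 = c ^ 2 := by rw [hcdef]; ring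
  rw [h3]
  linarith

set_option maxHeartbeats 1000000 in
open scoped ENNReal in
theorem poincare (d : ℕ) {C0 : ℝ} (hC0 : 0 ≤ C0) : ∃ C : ℝ≥0∞, C ≠ ∞ ∧
    ∀ (z : E d → ℝ) (zr : Fin d → E d → ℝ), Cac C0 z zr →
      ∫⁻ y in Metric.closedBall (0 : E d) 4, ∫⁻ x in Metric.closedBall (0 : E d) 4,
        ENNReal.ofReal ((z x - z y) ^ 2) ≤ C := by
  obtain ⟨η, N, K, hη, hN, hηc, hη0, hη1, hηo, hηz, hK, hNK⟩ := exists_cutoff d (R := 4) (by norm_num)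
  set S : Set (E d) := Metric.closedBall 0 4 with hS
  have hSm : MeasurableSet S := Metric.isClosed_closedBall.measurableSet
  set G0 : ℝ≥0∞ := ENNReal.ofReal (C0 * ∫ x, (∑ i, N i x ^ 2)) with hG0
  set V8 : ℝ≥0∞ := volume (Metric.closedBall (0 : E d) 8) with hV8
  refine ⟨V8 * (ENNReal.ofReal (d * 64) * G0), ENNReal.mul_ne_top (measure_closedBall_lt_top).ne
    (ENNReal.mul_ne_top ENNReal.ofReal_ne_top ENNReal.ofReal_ne_top), fun z zr hz => ?_⟩
  obtain ⟨gz, czr, hz1, hcac⟩ := hz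
  have cz := gz.continuous
  set G : E d → ℝ := fun x => η x ^ 2 * ∑ i, zr i x ^ 2 with hG
  have cG : Continuous G := (hη.continuous.pow 2).mul (continuous_finsetSum _ fun i _ => (czr i).pow 2)
  have hG0' : ∀ x, 0 ≤ G x := fun x => by simp only [hG]; positivity
  have hGi : Integrable G := by
    refine cG.integrable_of_hasCompactSupport (HasCompactSupport.intro hηc.isCompact fun x hx => ?_)
    simp only [hG]
    rw [image_eq_zero_of_notMem_tsupport hx]; simp
  have hGle : ∫⁻ x, ENNReal.ofReal (G x) ≤ G0 := by
    rw [← ofReal_integral_eq_lintegral_ofReal hGi (Eventually.of_forall hG0')]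
    refine ENNReal.ofReal_le_ofReal ?_
    have := hcac 0 le_rfl η N hη hN hηc
    simpa only [Real.rpow_zero, one_mul] using this
  let Φ : E d → E d → ℝ≥0∞ := fun x y => S.indicator (fun y => S.indicator (fun x =>
    ENNReal.ofReal ((z x - z y) ^ 2)) x) y
  have hΦm : Measurable (fun p : E d × E d => Φ p.1 p.2) := by
    have e : (fun p : E d × E d => Φ p.1 p.2) = (S ×ˢ S).indicator
        (fun p => ENNReal.ofReal ((z p.1 - z p.2) ^ 2)) := by
      ext p
      by_cases h1 : p.1 ∈ S <;> by_cases h2 : p.2 ∈ S <;> simp [Φ, Set.indicator, h1, h2]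
    rw [e]
    refine Measurable.indicator ?_ (hSm.prod hSm)
    exact ENNReal.measurable_ofReal.comp
      (((cz.comp continuous_fst).sub (cz.comp continuous_snd)).pow 2).measurable
  have e1 : ∫⁻ y in S, ∫⁻ x in S, ENNReal.ofReal ((z x - z y) ^ 2) = ∫⁻ y, ∫⁻ x, Φ x y := by
    rw [← lintegral_indicator hSm]
    refine lintegral_congr fun y => ?_
    by_cases hy : y ∈ S
    · rw [Set.indicator_of_mem hy, ← lintegral_indicator hSm]
      refine lintegral_congr fun x => ?_
      simp [Φ, Set.indicator_of_mem hy]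
    · rw [Set.indicator_of_notMem hy]
      simp [Φ, Set.indicator_of_notMem hy]
  rw [e1, lintegral_lintegral_swap (f := fun y x => Φ x y) (hΦm.comp measurable_swap).aemeasurable]
  have e2 : ∫⁻ x, ∫⁻ y, Φ x y = ∫⁻ x, ∫⁻ h, Φ x (x + h) :=
    lintegral_congr fun x => (lintegral_add_left_eq_self (Φ x) x).symm
  have hm2 : Measurable (fun p : E d × E d => Φ p.1 (p.1 + p.2)) :=
    hΦm.comp (measurable_fst.prodMk (measurable_fst.add measurable_snd))
  rw [e2, lintegral_lintegral_swap (f := fun x h => Φ x (x + h)) hm2.aemeasurable]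
  have key : ∀ h : E d, ∫⁻ x, Φ x (x + h) ≤ (Metric.closedBall (0 : E d) 8).indicator
      (fun _ => ENNReal.ofReal (d * 64) * G0) h := by
    intro h
    by_cases hh : h ∈ Metric.closedBall (0 : E d) 8
    · rw [Set.indicator_of_mem hh]
      have hn : ‖h‖ ≤ 8 := by simpa using hh
      have hsum : ∑ i, h i ^ 2 ≤ d * 64 := by
        calc ∑ i, h i ^ 2 ≤ ∑ i : Fin d, (64:ℝ) := Finset.sum_le_sum fun i _ => by
              have := (norm_le_pi_norm h i).trans hn
              rw [Real.norm_eq_abs] at this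
              nlinarith [abs_le.1 this]
          _ = _ := by simp
      have cGl : Continuous fun p : E d × ℝ => G (p.1 + p.2 • h) := cG.comp (by fun_prop)
      have hpt : ∀ x, Φ x (x + h) ≤ ∫⁻ t in Icc (0:ℝ) 1,
          ENNReal.ofReal (d * 64) * ENNReal.ofReal (G (x + t • h)) := by
        intro x
        by_cases h1 : x ∈ S
        swap
        · simp [Φ, Set.indicator, h1]
        by_cases h2 : x + h ∈ S
        swap
        · simp [Φ, Set.indicator, h2]
        have : Φ x (x + h) = ENNReal.ofReal ((z x - z (x + h)) ^ 2) := by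
          simp [Φ, Set.indicator, h1, h2]
        rw [this]
        have hl : Continuous fun t : ℝ => x + t • h := by fun_prop
        have hcg : Continuous fun t : ℝ => (∑ i, h i ^ 2) * ∑ i, zr i (x + t • h) ^ 2 :=
          continuous_const.mul (continuous_finsetSum _ fun i _ => ((czr i).comp hl).pow 2)
        refine (ENNReal.ofReal_le_ofReal (sq_diff_le gz czr x h)).trans ?_
        rw [ofReal_integral_eq_lintegral_ofReal (hcg.continuousOn.integrableOn_compact isCompact_Icc)
          (Eventually.of_forall fun t => by positivity)]
        refine setLIntegral_mono' measurableSet_Icc fun t ht => ?_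
        rw [← ENNReal.ofReal_mul (by positivity)]
        refine ENNReal.ofReal_le_ofReal ?_
        have hmem : x + t • h ∈ S := by
          have := (convex_closedBall (0 : E d) 4).add_smul_mem h1 h2 ht
          exact this
        have : G (x + t • h) = ∑ i, zr i (x + t • h) ^ 2 := by
          simp only [hG]; rw [hηo _ (by simpa [hS] using hmem)]; simp
        rw [this]
        exact mul_le_mul_of_nonneg_right hsum (Finset.sum_nonneg fun _ _ => sq_nonneg _)
      refine (lintegral_mono hpt).trans ?_
      rw [lintegral_lintegral_swap (f := fun (x : E d) (t : ℝ) =>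
          ENNReal.ofReal (d * 64) * ENNReal.ofReal (G (x + t • h)))
        ((measurable_const.mul (ENNReal.measurable_ofReal.comp cGl.measurable)).aemeasurable)]
      have : ∀ t : ℝ, ∫⁻ x, ENNReal.ofReal (d * 64) * ENNReal.ofReal (G (x + t • h)) ≤
          ENNReal.ofReal (d * 64) * G0 := fun t => by
        rw [lintegral_const_mul' _ _ ENNReal.ofReal_ne_top,
          lintegral_add_right_eq_self (fun x => ENNReal.ofReal (G x)) (t • h)]
        gcongr
      refine (lintegral_mono this).trans ?_
      simp
    · rw [Set.indicator_of_notMem hh]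
      have : ∀ x, Φ x (x + h) = 0 := fun x => by
        by_cases h1 : x ∈ S
        swap
        · simp [Φ, Set.indicator, h1]
        by_cases h2 : x + h ∈ S
        swap
        · simp [Φ, Set.indicator, h2]
        exfalso
        apply hh
        simp only [hS, Metric.mem_closedBall, dist_zero_right] at h1 h2 ⊢
        have := norm_sub_le (x + h) x
        simp at this
        linarith
      simp [this]
  refine (lintegral_mono key).trans ?_
  rw [lintegral_indicator Metric.isClosed_closedBall.measurableSet, setLIntegral_const, mul_comm]

open scoped ENNReal in
theorem log_pair (d : ℕ) {C0 : ℝ} (hC0 : 0 ≤ C0) : ∃ K : ℝ,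
    ∀ (z : E d → ℝ) (zr : Fin d → E d → ℝ) (z' : E d → ℝ) (zr' : Fin d → E d → ℝ),
      Cac C0 z zr → Cac C0 z' zr' → (∀ x, z x ≤ 2 ∨ z' x ≤ 2) →
      (∫ x in Metric.closedBall (0 : E d) 4, z x ^ 2 ≤ K) ∨
      (∫ x in Metric.closedBall (0 : E d) 4, z' x ^ 2 ≤ K) := by
  obtain ⟨C, hC, hp⟩ := poincare d hC0
  set S : Set (E d) := Metric.closedBall 0 4 with hS
  have hSm : MeasurableSet S := Metric.isClosed_closedBall.measurableSet
  set w : ℝ≥0∞ := volume S with hw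
  have hwt : w ≠ ∞ := measure_closedBall_lt_top.ne
  have hw0 : w ≠ 0 := (Metric.measure_closedBall_pos _ _ (by norm_num)).ne'
  have hKt : (4 * C + 8 * w * w) / w ≠ ∞ := by
    refine ENNReal.div_ne_top (ENNReal.add_ne_top.2 ⟨?_, ?_⟩) hw0
    · exact ENNReal.mul_ne_top (by simp) hC
    · exact ENNReal.mul_ne_top (ENNReal.mul_ne_top (by simp) hwt) hwt
  refine ⟨((4 * C + 8 * w * w) / w).toReal, fun z zr z' zr' hz hz' hmin => ?_⟩
  have aux : ∀ (z : E d → ℝ), Continuous z → ∀ y, (0 ≤ z y ∧ z y ≤ 2) → ∫⁻ x in S, ENNReal.ofReal (z x ^ 2) ≤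
      2 * (∫⁻ x in S, ENNReal.ofReal ((z x - z y) ^ 2)) + 8 * w := by
    intro z cz y ⟨hy0, hy⟩
    have hm : Measurable fun x => ENNReal.ofReal ((z x - z y) ^ 2) :=
      ENNReal.measurable_ofReal.comp ((cz.sub continuous_const).pow 2).measurable
    calc ∫⁻ x in S, ENNReal.ofReal (z x ^ 2) ≤ ∫⁻ x in S, (2 * ENNReal.ofReal ((z x - z y) ^ 2) + 8) := by
          refine lintegral_mono fun x => ?_
          have : z x ^ 2 ≤ 2 * (z x - z y) ^ 2 + 8 := by
            nlinarith [sq_nonneg (z x - 2 * z y)]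
          refine (ENNReal.ofReal_le_ofReal this).trans ?_
          rw [ENNReal.ofReal_add (by positivity) (by norm_num), ENNReal.ofReal_mul (by norm_num)]
          simp
      _ = _ := by
          rw [lintegral_add_right _ measurable_const, lintegral_const_mul _ hm, setLIntegral_const]
  set P := ∫⁻ x in S, ENNReal.ofReal (z x ^ 2) with hP
  set P' := ∫⁻ x in S, ENNReal.ofReal (z' x ^ 2) with hP'
  set L : E d → ℝ≥0∞ := fun y => ∫⁻ x in S, ENNReal.ofReal ((z x - z y) ^ 2) with hL
  set L' : E d → ℝ≥0∞ := fun y => ∫⁻ x in S, ENNReal.ofReal ((z' x - z' y) ^ 2) with hL'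
  have cz := hz.1.continuous
  have cz' := hz'.1.continuous
  have hmin' : ∀ y, min P P' ≤ 2 * L y + (2 * L' y + 8 * w) := by
    intro y
    rcases hmin y with h | h
    · refine (min_le_left _ _).trans ((aux z cz y ⟨by linarith [hz.2.2.1 y], h⟩).trans ?_)
      gcongr
      exact le_add_self
    · refine (min_le_right _ _).trans ((aux z' cz' y ⟨by linarith [hz'.2.2.1 y], h⟩).trans ?_)
      exact le_add_self
  have hLm : ∀ (z : E d → ℝ), Continuous z → Measurable fun y => ∫⁻ x in S, ENNReal.ofReal ((z x - z y) ^ 2) := by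
    intro z cz
    have : Measurable fun p : E d × E d => ENNReal.ofReal ((z p.2 - z p.1) ^ 2) :=
      ENNReal.measurable_ofReal.comp
        (((cz.comp continuous_snd).sub (cz.comp continuous_fst)).pow 2).measurable
    exact this.lintegral_prod_right'
  have hmain : min P P' * w ≤ 4 * C + 8 * w * w := by
    calc min P P' * w = ∫⁻ y in S, min P P' := by rw [setLIntegral_const]
      _ ≤ ∫⁻ y in S, (2 * L y + (2 * L' y + 8 * w)) := lintegral_mono hmin'
      _ = 2 * (∫⁻ y in S, L y) + (2 * (∫⁻ y in S, L' y) + 8 * w * w) := by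
          rw [lintegral_add_left ((hLm z cz).const_mul 2), lintegral_add_right _ measurable_const,
            lintegral_const_mul _ (hLm z cz), lintegral_const_mul _ (hLm z' cz'), setLIntegral_const]
      _ ≤ 2 * C + (2 * C + 8 * w * w) := by
          gcongr
          · exact hp z zr hz
          · exact hp z' zr' hz'
      _ = _ := by ring
  have hle : min P P' ≤ (4 * C + 8 * w * w) / w := (ENNReal.le_div_iff_mul_le (Or.inl hw0) (Or.inl hwt)).2 hmain
  have conv : ∀ (z : E d → ℝ), Continuous z → ∫⁻ x in S, ENNReal.ofReal (z x ^ 2) ≤ (4 * C + 8 * w * w) / w →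
      ∫ x in S, z x ^ 2 ≤ ((4 * C + 8 * w * w) / w).toReal := by
    intro z cz h
    have hi : IntegrableOn (fun x => z x ^ 2) S :=
      (cz.pow 2).continuousOn.integrableOn_compact (isCompact_closedBall _ _)
    rw [← ofReal_integral_eq_lintegral_ofReal hi (Eventually.of_forall fun x => sq_nonneg _)] at h
    exact (ENNReal.ofReal_le_iff_le_toReal hKt).1 h
  rcases min_le_iff.1 hle with h | h
  · exact Or.inl (conv z cz h)
  · exact Or.inr (conv z' cz' h)

end MFG

end S5

section S6

open MeasureTheory Set Filter Topology

namespace MFG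
variable {d : ℕ}

theorem WeakSol.affine {lam Lam : ℝ} {A : Fin d → Fin d → E d → ℝ} {v : E d → ℝ}
    {r : Fin d → E d → ℝ} (h : WeakSol lam Lam A v r) (x0 : E d) {R : ℝ} (hR : 0 < R) :
    WeakSol lam Lam (fun i j x => A i j (x0 + R • x)) (fun x => v (x0 + R • x))
      (fun i x => R * r i (x0 + R • x)) := by
  have hl : Continuous fun x : E d => x0 + R • x := by fun_prop
  refine ⟨h.grad.affine x0 R, fun i => continuous_const.mul ((h.rc i).comp hl), fun i j => (h.Ac i j).comp hl,
    fun x ξ => h.ell _ ξ, fun i j x => h.bd i j _, fun φ Q hφ hQ hφc => ?_⟩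
  have h1 := hφ.affine (-(R⁻¹ • x0)) R⁻¹
  have hl2 : Continuous fun x : E d => -(R⁻¹ • x0) + R⁻¹ • x := by fun_prop
  have hinv : ∀ x : E d, -(R⁻¹ • x0) + R⁻¹ • (x0 + R • x) = x := fun x => by
    rw [smul_add, smul_smul, inv_mul_cancel₀ hR.ne', one_smul]; abel
  have hinv2 : ∀ y : E d, x0 + R • (-(R⁻¹ • x0) + R⁻¹ • y) = y := fun y => by
    rw [smul_add, smul_neg, smul_smul, smul_smul, mul_inv_cancel₀ hR.ne', one_smul, one_smul]; abel
  have hcs : HasCompactSupport fun x => φ (-(R⁻¹ • x0) + R⁻¹ • x) := by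
    refine HasCompactSupport.intro (hφc.isCompact.image hl) fun y hy => ?_
    by_contra hne
    apply hy
    exact ⟨_, subset_tsupport _ hne, hinv2 y⟩
  have hw := h.weak _ _ h1 (fun i => continuous_const.mul ((hQ i).comp hl2)) hcs
  set H : E d → ℝ := fun x => ∑ i, ∑ j, A i j x * r j x * (R⁻¹ * Q i (-(R⁻¹ • x0) + R⁻¹ • x)) with hH
  have e1 : ∀ x, ∑ i, ∑ j, A i j (x0 + R • x) * (R * r j (x0 + R • x)) * Q i x = R ^ 2 * H (x0 + R • x) := by
    intro x
    simp only [hH, hinv, Finset.mul_sum]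
    refine Finset.sum_congr rfl fun i _ => Finset.sum_congr rfl fun j _ => ?_
    field_simp
  simp only [e1]
  rw [integral_const_mul, Measure.integral_comp_smul volume (fun y => H (x0 + y)) R,
    integral_add_left_eq_self H x0, hw]
  simp

theorem WeakSol.lincomb {lam Lam : ℝ} {A : Fin d → Fin d → E d → ℝ} {v : E d → ℝ}
    {r : Fin d → E d → ℝ} (h : WeakSol lam Lam A v r) (a b : ℝ) :
    WeakSol lam Lam A (fun x => a * v x + b) (fun i x => a * r i x) := by
  refine ⟨((h.grad.const_mul a).add (hasGrad_const b)).congr fun i x => by ring,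
    fun i => continuous_const.mul (h.rc i), h.Ac, h.ell, h.bd, fun φ Q hφ hQ hφc => ?_⟩
  have : ∀ x, ∑ i, ∑ j, A i j x * (a * r j x) * Q i x = a * ∑ i, ∑ j, A i j x * r j x * Q i x := fun x => by
    simp only [Finset.mul_sum]
    exact Finset.sum_congr rfl fun i _ => Finset.sum_congr rfl fun j _ => by ring
  simp only [this]
  rw [integral_const_mul, h.weak φ Q hφ hQ hφc, mul_zero]

theorem log_z_le {κ t : ℝ} (hκ : 0 < κ) (ht : t ≤ 0) :
    1 + Real.log (2 + κ) - Real.log (1 - t + κ) ≤ 2 := by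
  have h1 : 0 < 1 - t + κ := by linarith
  have h2 := Real.log_le_sub_one_of_pos (x := (2 + κ) / (1 - t + κ)) (by positivity)
  rw [Real.log_div (by positivity) h1.ne'] at h2
  have h3 : (2 + κ) / (1 - t + κ) ≤ 2 := by rw [div_le_iff₀ h1]; nlinarith
  linarith

theorem log_z_ge {T t : ℝ} (ht : t ≤ 1) (h : 1 - Real.exp (-T) < t) :
    1 + T ≤ 1 + Real.log (2 + Real.exp (-T)) - Real.log (1 - t + Real.exp (-T)) := by
  have h0 := Real.exp_pos (-T)
  have h1 : Real.log (1 - t + Real.exp (-T)) ≤ Real.log (2 * Real.exp (-T)) :=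
    Real.log_le_log (by linarith) (by linarith)
  rw [Real.log_mul (by norm_num) h0.ne', Real.log_exp] at h1
  have h2 : Real.log 2 ≤ Real.log (2 + Real.exp (-T)) := Real.log_le_log (by norm_num) (by linarith)
  linarith

theorem liouville {lam Lam : ℝ} (hl : 0 < lam) {A : Fin d → Fin d → E d → ℝ} {v : E d → ℝ}
    {r : Fin d → E d → ℝ} (h : WeakSol lam Lam A v r) {B : ℝ} (hB : ∀ x, |v x| ≤ B) (x y : E d) :
    v x = v y := by
  rcases Nat.eq_zero_or_pos d with rfl | hd
  · rw [Subsingleton.elim x y]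
  have hd : 1 ≤ d := hd
  by_contra hne
  have hbdA : BddAbove (range v) := ⟨B, by rintro _ ⟨x, rfl⟩; exact (abs_le.1 (hB x)).2⟩
  have hbdB : BddBelow (range v) := ⟨-B, by rintro _ ⟨x, rfl⟩; exact (abs_le.1 (hB x)).1⟩
  set S := sSup (range v) with hS
  set I := sInf (range v) with hI
  have hvS : ∀ x, v x ≤ S := fun x => le_csSup hbdA ⟨x, rfl⟩
  have hvI : ∀ x, I ≤ v x := fun x => csInf_le hbdB ⟨x, rfl⟩
  have hSI : 0 < S - I := by
    rcases lt_or_gt_of_ne hne with hlt | hlt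
    · linarith [hvS y, hvI x]
    · linarith [hvS x, hvI y]
  set C0 : ℝ := 4 * d ^ 2 * Lam ^ 2 / lam ^ 2 with hC0
  have hC00 : 0 ≤ C0 := by positivity
  obtain ⟨D, hD, hmos⟩ := moser hd hC00
  obtain ⟨K, hK⟩ := log_pair d hC00
  set T : ℝ := |D * K| with hT
  set κ : ℝ := Real.exp (-T) with hκ
  have hκ0 : 0 < κ := Real.exp_pos _
  obtain ⟨_, ⟨x0, rfl⟩, hx0⟩ := exists_lt_of_lt_csSup (range_nonempty v)
    (show S - κ * (S - I) / 2 < sSup (range v) by rw [← hS]; have : 0 < κ * (S - I) / 2 := by positivity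
                                                  linarith)
  obtain ⟨_, ⟨y0, rfl⟩, hy0⟩ := exists_lt_of_csInf_lt (range_nonempty v)
    (show sInf (range v) < I + κ * (S - I) / 2 by rw [← hI]; have : 0 < κ * (S - I) / 2 := by positivity
                                                  linarith)
  set R : ℝ := ‖y0 - x0‖ + 1 with hR
  have hR0 : 0 < R := by positivity
  have h1 := ((h.lincomb (2 / (S - I)) (-(S + I) / (S - I))).affine x0 hR0)
  set w : E d → ℝ := fun x => 2 / (S - I) * v (x0 + R • x) + -(S + I) / (S - I) with hw
  have hwe : ∀ x, w x = (2 * v (x0 + R • x) - (S + I)) / (S - I) := fun x => by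
    simp only [hw]; ring
  have hw1 : ∀ x, w x ≤ 1 := fun x => by
    rw [hwe, div_le_one hSI]; linarith [hvS (x0 + R • x)]
  have hw2 : ∀ x, -1 ≤ w x := fun x => by
    rw [hwe, le_div_iff₀ hSI]; linarith [hvI (x0 + R • x)]
  have hwx : 1 - κ < w 0 := by
    rw [hwe, lt_div_iff₀ hSI]; simp only [smul_zero, add_zero]; linarith
  set yy : E d := R⁻¹ • (y0 - x0) with hyy
  have hyn : ‖yy‖ ≤ 1 := by
    rw [hyy, norm_smul, norm_inv, Real.norm_of_nonneg hR0.le, inv_mul_le_iff₀ hR0]; linarith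
  have hwy : 1 - κ < - w yy := by
    have : x0 + R • yy = y0 := by rw [hyy, smul_smul, mul_inv_cancel₀ hR0.ne']; simp
    rw [hwe, this, ← neg_div, lt_div_iff₀ hSI]; linarith
  have c1 := h1.cac hd hl hκ0 hw1 hw2
  have c2 := (h1.lincomb (-1) 0).cac hd hl hκ0 (fun x => by have := hw2 x; simp only [hw] at this; linarith)
    (fun x => by have := hw1 x; simp only [hw] at this; linarith)
  have hTK : D * K < (1 + T) ^ 2 := by
    have := le_abs_self (D * K)
    nlinarith [abs_nonneg (D * K)]
  have hT0 : 0 ≤ T := abs_nonneg _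
  rcases hK _ _ _ _ c1 c2 (fun x => by
    rcases le_total (w x) 0 with hx | hx
    · exact Or.inl (log_z_le hκ0 hx)
    · exact Or.inr (log_z_le hκ0 (by simp only [hw] at hx; linarith))) with hk | hk
  · have := (hmos _ _ c1 0 (by simp)).trans (mul_le_mul_of_nonneg_left hk hD)
    have h2 := log_z_ge (hw1 0) hwx
    have h3 := pow_le_pow_left₀ (by linarith) h2 2
    linarith
  · have := (hmos _ _ c2 yy hyn).trans (mul_le_mul_of_nonneg_left hk hD)
    have h2 := log_z_ge (T := T) (t := -1 * w yy + 0) (by linarith [hw2 yy]) (by linarith)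
    have h3 := pow_le_pow_left₀ (by linarith) h2 2
    linarith

end MFG

end S6

section S7

open MeasureTheory Set Filter Topology

namespace MFG
variable {d : ℕ}

noncomputable def uf : Filter ℕ := ((hyperfilter ℕ : Ultrafilter ℕ) : Filter ℕ)

instance : NeBot uf := (hyperfilter ℕ : Ultrafilter ℕ).neBot'

theorem uf_le : uf ≤ atTop := Nat.hyperfilter_le_atTop

theorem exists_ulim_compact {X : Type*} [TopologicalSpace X] {K : Set X} (hK : IsCompact K) {a : ℕ → X}
    (h : ∀ n, a n ∈ K) : ∃ l ∈ K, Tendsto a uf (𝓝 l) := by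
  obtain ⟨l, hl, h2⟩ := hK.ultrafilter_le_nhds ((hyperfilter ℕ).map a)
    (by rw [le_principal_iff, Ultrafilter.mem_coe, Ultrafilter.mem_map]; exact Eventually.of_forall h)
  exact ⟨l, hl, h2⟩

noncomputable def ulim (a : ℕ → ℝ) : ℝ := limUnder uf a

theorem tendsto_ulim {a : ℕ → ℝ} {C : ℝ} (h : ∀ n, |a n| ≤ C) : Tendsto a uf (𝓝 (ulim a)) := by
  obtain ⟨l, _, hl⟩ := exists_ulim_compact (K := Icc (-C) C) isCompact_Icc (a := a) (fun n => abs_le.1 (h n))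
  exact tendsto_nhds_limUnder ⟨l, hl⟩

theorem HasGrad.of_tendsto {l : Filter ℕ} [NeBot l] {u : ℕ → E d → ℝ} {p : ℕ → Fin d → E d → ℝ}
    {u' : E d → ℝ} {p' : Fin d → E d → ℝ} {B α : ℝ} (hB : 0 ≤ B) (hα : 0 < α)
    (h1 : ∀ n, HasGrad (u n) (p n)) (h2 : ∀ n i x y, |p n i x - p n i y| ≤ B * dist x y ^ α)
    (h3 : ∀ x, Tendsto (fun n => u n x) l (𝓝 (u' x)))
    (h4 : ∀ i x, Tendsto (fun n => p n i x) l (𝓝 (p' i x))) : HasGrad u' p' := by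
  refine hasGrad_of_taylor (B := d * B) hα fun x y => ?_
  have h5 : Tendsto (fun n => |u n (x + y) - u n x - ∑ i, p n i x * y i|) l
      (𝓝 |u' (x + y) - u' x - ∑ i, p' i x * y i|) :=
    (((h3 _).sub (h3 _)).sub (tendsto_finsetSum _ fun i _ => (h4 i x).mul_const _)).abs
  exact le_of_tendsto' h5 fun n => (h1 n).taylor hB hα.le (h2 n) x y

theorem holder_of_tendsto {X : Type*} [PseudoMetricSpace X] {l : Filter ℕ} [NeBot l] {f : ℕ → X → ℝ} {f' : X → ℝ} {B α : ℝ}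
    (h2 : ∀ n x y, |f n x - f n y| ≤ B * dist x y ^ α)
    (h3 : ∀ x, Tendsto (fun n => f n x) l (𝓝 (f' x))) (x y : X) : |f' x - f' y| ≤ B * dist x y ^ α :=
  le_of_tendsto' ((h3 x).sub (h3 y)).abs fun n => h2 n x y

theorem holder_continuous {X : Type*} [PseudoMetricSpace X] {f : X → ℝ} {B α : ℝ} (hα : 0 < α)
    (h : ∀ x y, |f x - f y| ≤ B * dist x y ^ α) : Continuous f := by
  refine continuous_iff_continuousAt.2 fun x => ?_
  rw [ContinuousAt, tendsto_iff_dist_tendsto_zero]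
  have h1 : Tendsto (fun y => B * dist y x ^ α) (𝓝 x) (𝓝 0) := by
    have h2 : ContinuousAt (fun y => B * dist y x ^ α) x :=
      continuousAt_const.mul ((continuous_id.dist continuous_const).continuousAt.rpow_const (Or.inr hα.le))
    have := h2.tendsto
    simpa [Real.zero_rpow hα.ne'] using this
  exact squeeze_zero (fun y => dist_nonneg) (fun y => by rw [Real.dist_eq]; exact h y x) h1

/-- almost maximal element -/
theorem near_max {ι : Type*} {g : ι → ℝ} {B c : ℝ} (hc : 0 ≤ c) (hB : ∀ i, g i ≤ B) {i0 : ι} (h0 : c < g i0) :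
    ∃ N, c < N ∧ (∀ i, g i ≤ N) ∧ ∃ i, N / 2 < g i := by
  have hb : BddAbove (range g) := ⟨B, by rintro _ ⟨i, rfl⟩; exact hB i⟩
  refine ⟨sSup (range g), h0.trans_le (le_csSup hb ⟨i0, rfl⟩), fun i => le_csSup hb ⟨i, rfl⟩, ?_⟩
  have : c < sSup (range g) := h0.trans_le (le_csSup hb ⟨i0, rfl⟩)
  obtain ⟨_, ⟨i, rfl⟩, hi⟩ := exists_lt_of_lt_csSup ⟨g i0, mem_range_self i0⟩
    (show sSup (range g) / 2 < sSup (range g) by linarith)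
  exact ⟨i, hi⟩

theorem weakSol_of_div {lam Lam : ℝ} {A : Fin d → Fin d → ℝ} {P : Fin d → E d → ℝ}
    {q : Fin d → Fin d → E d → ℝ} (hP : ∀ i, HasGrad (P i) (q i)) (hq : ∀ i j, Continuous (q i j))
    (hs : ∀ i j x, q i j x = q j i x) (ell : ∀ (ξ : Fin d → ℝ), lam * ∑ i, ξ i ^ 2 ≤ ∑ i, ∑ j, A i j * ξ j * ξ i)
    (bd : ∀ i j, |A i j| ≤ Lam) (heq : ∀ x, ∑ i, ∑ j, A i j * q i j x = 0) (k : Fin d) :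
    WeakSol lam Lam (fun i j _ => A i j) (P k) (q k) := by
  refine ⟨hP k, hq k, fun i j => continuous_const, fun _ => ell, fun i j _ => bd i j, fun φ Q hφ hQ hφc => ?_⟩
  have hQc : ∀ i, HasCompactSupport (Q i) := fun i => grad_compact hφ hφc i
  have hIntg : ∀ i j k l, Integrable fun x => A i j * (q k l x * Q i x) := fun i j k l =>
    (((hq k l).mul (hQ i)).integrable_of_hasCompactSupport (hQc i).mul_left).const_mul _
  have hint2 : ∀ i j k l m, Integrable fun x => A i j * (q k l x * Q m x) := fun i j k l m =>
    (((hq k l).mul (hQ m)).integrable_of_hasCompactSupport (hQc m).mul_left).const_mul _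
  have e1 : ∫ x, ∑ i, ∑ j, A i j * q k j x * Q i x = ∑ i, ∑ j, A i j * ∫ x, q k j x * Q i x := by
    simp only [mul_assoc]
    rw [integral_finsetSum _ fun i _ => integrable_finsetSum _ fun j _ => hIntg i j k j]
    refine Finset.sum_congr rfl fun i _ => ?_
    rw [integral_finsetSum _ fun j _ => hIntg i j k j]
    exact Finset.sum_congr rfl fun j _ => integral_const_mul _ _
  have e2 : ∑ i, ∑ j, A i j * ∫ x, q k j x * Q i x = ∫ x, ∑ i, ∑ j, A i j * (q j i x * Q k x) := by
    rw [integral_finsetSum _ fun i _ => integrable_finsetSum _ fun j _ => hint2 i j j i k]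
    refine Finset.sum_congr rfl fun i _ => ?_
    rw [integral_finsetSum _ fun j _ => hint2 i j j i k]
    refine Finset.sum_congr rfl fun j _ => ?_
    rw [integral_const_mul]
    congr 1
    simp only [hs k j]
    exact commute_pd (hP j) (hq j) hφ hQ hφc k i
  rw [e1, e2]
  have e3 : ∀ x, ∑ i, ∑ j, A i j * (q j i x * Q k x) = 0 := fun x => by
    have := heq x
    calc ∑ i, ∑ j, A i j * (q j i x * Q k x) = (∑ i, ∑ j, A i j * q i j x) * Q k x := by
          simp only [Finset.sum_mul]
          exact Finset.sum_congr rfl fun i _ => Finset.sum_congr rfl fun j _ => by rw [hs j i]; ring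
      _ = 0 := by rw [this, zero_mul]
  simp [e3]

theorem HasGrad.diff {u : E d → ℝ} {p} (hu : HasGrad u p) (a : E d) :
    HasGrad (fun x => u (x + a) - u x) (fun i x => p i (x + a) - p i x) := (hu.translate a).sub hu

theorem additive_zero {g : E d → ℝ} {α B : ℝ} (hα1 : α < 1) (hadd : ∀ x y, g (x + y) = g x + g y)
    (hg : ∀ x, |g x| ≤ B * ‖x‖ ^ α) (x : E d) : g x = 0 := by
  have h1 : ∀ n : ℕ, g ((n:ℝ) • x) = n * g x := by
    intro n; induction n with
    | zero =>
      have := hadd 0 0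
      simp at this
      simpa using this
    | succ n ih => push_cast; rw [add_smul, one_smul, hadd, ih]; ring
  have h2 : ∀ n : ℕ, 1 ≤ n → |g x| ≤ B * ‖x‖ ^ α * (n:ℝ) ^ (-(1 - α)) := by
    intro n hn
    have hn0 : (0:ℝ) < n := by exact_mod_cast hn
    have h3 := hg ((n:ℝ) • x)
    rw [h1, norm_smul, Real.norm_of_nonneg hn0.le, Real.mul_rpow hn0.le (norm_nonneg _), abs_mul,
      abs_of_pos hn0] at h3
    have e : -(1 - α) = α - 1 := by ring
    rw [e, Real.rpow_sub_one hn0.ne', ← mul_div_assoc, le_div_iff₀ hn0]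
    linarith
  have h4 : Tendsto (fun n : ℕ => B * ‖x‖ ^ α * (n:ℝ) ^ (-(1 - α))) atTop (𝓝 (B * ‖x‖ ^ α * 0)) :=
    ((tendsto_rpow_neg_atTop (by linarith)).comp tendsto_natCast_atTop_atTop).const_mul _
  rw [mul_zero] at h4
  have := ge_of_tendsto h4 (eventually_ge_atTop 1 |>.mono h2)
  exact abs_eq_zero.1 (le_antisymm this (abs_nonneg _))

theorem rigidity {lam Lam α : ℝ} (hl : 0 < lam) (hα : 0 < α) (hα1 : α < 1) {A : Fin d → Fin d → ℝ}
    {P : Fin d → E d → ℝ}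
    {q : Fin d → Fin d → E d → ℝ} (hP : ∀ i, HasGrad (P i) (q i))
    (hq : ∀ i j x y, |q i j x - q i j y| ≤ 1 * dist x y ^ α) (hq0 : ∀ i j, q i j 0 = 0)
    (hs : ∀ i j x, q i j x = q j i x) (ell : ∀ (ξ : Fin d → ℝ), lam * ∑ i, ξ i ^ 2 ≤ ∑ i, ∑ j, A i j * ξ j * ξ i)
    (bd : ∀ i j, |A i j| ≤ Lam) (heq : ∀ x, ∑ i, ∑ j, A i j * q i j x = 0) (k j : Fin d) (x : E d) :
    q k j x = 0 := by
  have hqc : ∀ i j, Continuous (q i j) := fun i j => holder_continuous hα (hq i j)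
  refine additive_zero (B := 1) hα1 (fun a b => ?_) (fun x => by
    have := hq k j x 0
    rwa [hq0, sub_zero, dist_zero_right] at this) x
  -- second differences
  have hw := weakSol_of_div (P := fun i x => (P i (x + b + a) - P i (x + b)) - (P i (x + a) - P i x))
    (q := fun i j x => (q i j (x + b + a) - q i j (x + b)) - (q i j (x + a) - q i j x))
    (fun i => ((hP i).diff a).diff b)
    (fun i j => by
      have c1 : Continuous fun x : E d => x + b + a := by fun_prop
      have c2 : Continuous fun x : E d => x + b := by fun_prop
      have c3 : Continuous fun x : E d => x + a := by fun_prop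
      exact (((hqc i j).comp c1).sub ((hqc i j).comp c2)).sub (((hqc i j).comp c3).sub (hqc i j)))
    (fun i j x => by rw [hs i j, hs i j, hs i j, hs i j]) ell bd
    (fun x => by
      simp only [mul_sub, Finset.sum_sub_distrib, heq, sub_zero]) k
  have hbd : ∀ x, |(P k (x + b + a) - P k (x + b)) - (P k (x + a) - P k x)| ≤ d * ‖a‖ ^ α * ‖b‖ := by
    intro x
    have h1 := ((hP k).diff a).lip (B := ‖a‖ ^ α) (by positivity) (fun i x => by
      have := hq k i (x + a) x
      simpa [dist_eq_norm] using this) (x + b) x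
    simpa [dist_eq_norm] using h1
  have hconst := liouville hl hw hbd
  have hz : HasGrad (fun x => (P k (x + b + a) - P k (x + b)) - (P k (x + a) - P k x)) (fun _ _ => 0) := by
    have : (fun x => (P k (x + b + a) - P k (x + b)) - (P k (x + a) - P k x)) =
      fun _ => (P k (0 + b + a) - P k (0 + b)) - (P k (0 + a) - P k 0) := funext fun x => hconst x 0
    rw [this]; exact hasGrad_const _
  have e1 := congrFun (hz.pd j) 0
  have e2 := congrFun (hw.grad.pd j) 0
  rw [e1] at e2
  simp only [zero_add, hq0, sub_zero] at e2
  rw [add_comm a b]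
  linarith

end MFG

end S7

section S8

open MeasureTheory Set Filter Topology

namespace MFG
variable {d : ℕ}

theorem sum2_abs_le {a : Fin d → Fin d → ℝ} {B : ℝ} (h : ∀ i j, |a i j| ≤ B) :
    |∑ i, ∑ j, a i j| ≤ d * d * B := by
  refine (Finset.abs_sum_le_sum_abs _ _).trans ?_
  refine (Finset.sum_le_sum fun i _ => (Finset.abs_sum_le_sum_abs _ _).trans
    (Finset.sum_le_sum fun j _ => h i j)).trans ?_
  simp [mul_assoc]

/-- one rescaling step -/
theorem schauder_step {α lam Lam c H : ℝ} (hα : 0 < α) (hc : 0 < c) (hL : 0 ≤ Lam)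
    {p : Fin d → E d → ℝ} {q : Fin d → Fin d → E d → ℝ} {A : Fin d → Fin d → E d → ℝ} {f : E d → ℝ}
    (hp : ∀ i, HasGrad (p i) (q i)) (hs : ∀ i j x, q i j x = q j i x) (hq1 : ∀ i j x, |q i j x| ≤ 1)
    (hH : ∀ i j x y, |q i j x - q i j y| ≤ H * dist x y ^ α)
    (ell : ∀ x (ξ : Fin d → ℝ), lam * ∑ i, ξ i ^ 2 ≤ ∑ i, ∑ j, A i j x * ξ j * ξ i)
    (bd : ∀ i j x, |A i j x| ≤ Lam) (hA : ∀ i j x y, |A i j x - A i j y| ≤ Lam * dist x y ^ α)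
    (heq : ∀ x, ∑ i, ∑ j, A i j x * q i j x = f x) (hf : ∀ x y, |f x - f y| ≤ Lam * dist x y ^ α)
    (hbad : ∃ i j x y, c * dist x y ^ α < |q i j x - q i j y|) :
    ∃ (P : Fin d → E d → ℝ) (Q : Fin d → Fin d → E d → ℝ) (A0 : Fin d → Fin d → ℝ) (ζ : E d),
      (∀ i, HasGrad (P i) (Q i)) ∧ (∀ i j x, Q i j x = Q j i x) ∧
      (∀ i j x y, |Q i j x - Q i j y| ≤ 1 * dist x y ^ α) ∧ (∀ i j, Q i j 0 = 0) ∧ (∀ i, P i 0 = 0) ∧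
      (∀ (ξ : Fin d → ℝ), lam * ∑ i, ξ i ^ 2 ≤ ∑ i, ∑ j, A0 i j * ξ j * ξ i) ∧ (∀ i j, |A0 i j| ≤ Lam) ∧
      (∀ z, |∑ i, ∑ j, A0 i j * Q i j z| ≤ (Lam + d * d * Lam) * ‖z‖ ^ α / c) ∧
      ‖ζ‖ = 1 ∧ 1 / 2 ≤ ∑ i, ∑ j, |Q i j ζ| := by
  obtain ⟨i0, j0, x0, y0, h0⟩ := hbad
  have hd0 : 0 < dist x0 y0 := by
    rcases dist_nonneg.eq_or_lt (a := (0:ℝ)) (b := dist x0 y0) with h | h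
    · have : x0 = y0 := dist_eq_zero.1 h.symm
      subst this; simp [Real.zero_rpow hα.ne'] at h0
    · exact h
  obtain ⟨N, hN, hmax, ⟨⟨i, j, x, y⟩, hi⟩⟩ := near_max (ι := Fin d × Fin d × E d × E d)
    (g := fun t => |q t.1 t.2.1 t.2.2.1 - q t.1 t.2.1 t.2.2.2| / dist t.2.2.1 t.2.2.2 ^ α) (B := |H|) hc.le
    (fun t => div_le_of_le_mul₀ (by positivity) (abs_nonneg _)
      ((hH _ _ _ _).trans (by gcongr; exact le_abs_self H)))
    (i0 := (i0, j0, x0, y0)) (by rw [lt_div_iff₀ (by positivity)]; exact h0)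
  have hN0 : 0 < N := hc.trans hN
  have hd : 0 < dist x y := by
    rcases dist_nonneg.eq_or_lt (a := (0:ℝ)) (b := dist x y) with h | h
    · have : x = y := dist_eq_zero.1 h.symm
      subst this; simp at hi; linarith
    · exact h
  have hqN : ∀ i j x y, |q i j x - q i j y| ≤ N * dist x y ^ α := by
    intro i j x y
    rcases dist_nonneg.eq_or_lt (a := (0:ℝ)) (b := dist x y) with h | h
    · have : x = y := dist_eq_zero.1 h.symm
      subst this; simp [Real.zero_rpow hα.ne']
    · have := hmax (i, j, x, y)
      rwa [div_le_iff₀ (by positivity)] at this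
  simp only at hi
  rw [lt_div_iff₀ (by positivity)] at hi
  set ρ := dist x y with hρ
  set k : ℝ := (ρ ^ α * N)⁻¹ with hk
  have hk0 : 0 < k := by positivity
  have hkN : k * (N * ρ ^ α) = 1 := by rw [hk, mul_comm N]; exact inv_mul_cancel₀ (by positivity)
  have hdist : ∀ a b : E d, dist (x + ρ • a) (x + ρ • b) = ρ * dist a b := fun a b => by
    rw [dist_add_left, dist_smul₀, Real.norm_of_nonneg hd.le]
  refine ⟨fun i z => k * (ρ⁻¹ * (p i (x + ρ • z)) - ρ⁻¹ * p i x - ∑ j, q i j x * z j),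
    fun i j z => k * (q i j (x + ρ • z) - q i j x), fun i j => A i j x, ρ⁻¹ • (y - x), ?_, ?_, ?_, ?_, ?_, ell x,
    fun i j => bd i j x, ?_, ?_, ?_⟩
  · intro i
    have h1 := (((hp i).affine x ρ).const_mul ρ⁻¹).sub (hasGrad_const (d := d) (ρ⁻¹ * p i x))
    have h2 := (h1.sub (HasGrad.sum Finset.univ fun j _ => (hasGrad_coord (d := d) j).const_mul (q i j x))).const_mul k
    refine h2.congr fun j z => ?_
    simp [mul_ite, hd.ne']
  · intro i j z; simp only [hs i j]
  · intro i j a b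
    rw [← mul_sub, abs_mul, abs_of_pos hk0, sub_sub_sub_cancel_right]
    calc _ ≤ k * (N * (ρ * dist a b) ^ α) := by
          have := hqN i j (x + ρ • a) (x + ρ • b)
          rw [hdist] at this; gcongr
      _ = (k * (N * ρ ^ α)) * dist a b ^ α := by rw [Real.mul_rpow hd.le dist_nonneg]; ring
      _ = _ := by rw [hkN]
  · intro i j; simp
  · intro i; simp
  · intro z
    have e1 : ∑ i, ∑ j, A i j x * (k * (q i j (x + ρ • z) - q i j x)) =
        k * ((f (x + ρ • z) - f x) - ∑ i, ∑ j, (A i j (x + ρ • z) - A i j x) * q i j (x + ρ • z)) := by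
      rw [← heq, ← heq]
      simp only [← Finset.sum_sub_distrib, Finset.mul_sum]
      exact Finset.sum_congr rfl fun i _ => Finset.sum_congr rfl fun j _ => by ring
    have hdz : dist (x + ρ • z) x = ρ * ‖z‖ := by
      have := hdist z 0
      simpa using this
    have e2 : |∑ i, ∑ j, (A i j (x + ρ • z) - A i j x) * q i j (x + ρ • z)| ≤ d * d * (Lam * (ρ * ‖z‖) ^ α) := by
      refine sum2_abs_le fun i j => ?_
      rw [abs_mul]
      have h1 := hA i j (x + ρ • z) x
      rw [hdz] at h1
      calc _ ≤ (Lam * (ρ * ‖z‖) ^ α) * 1 := mul_le_mul h1 (hq1 _ _ _) (abs_nonneg _) (by positivity)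
        _ = _ := mul_one _
    have e3 := hf (x + ρ • z) x
    rw [hdz] at e3
    rw [e1, abs_mul, abs_of_pos hk0]
    calc _ ≤ k * (Lam * (ρ * ‖z‖) ^ α + d * d * (Lam * (ρ * ‖z‖) ^ α)) := by
          gcongr; exact (abs_sub _ _).trans (add_le_add e3 e2)
      _ = (k * (N * ρ ^ α)) * ((Lam + d * d * Lam) * ‖z‖ ^ α / N) := by
          rw [Real.mul_rpow hd.le (norm_nonneg _)]; field_simp
      _ ≤ _ := by rw [hkN, one_mul]; gcongr
  · rw [norm_smul, norm_inv, Real.norm_of_nonneg hd.le, ← dist_eq_norm, dist_comm, ← hρ, inv_mul_cancel₀ hd.ne']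
  · have h1 : x + ρ • (ρ⁻¹ • (y - x)) = y := by rw [smul_inv_smul₀ hd.ne']; abel
    simp only [h1]
    refine le_trans ?_ (Finset.single_le_sum (f := fun i => ∑ j, |k * (q i j y - q i j x)|)
      (fun i _ => Finset.sum_nonneg fun j _ => abs_nonneg _) (Finset.mem_univ i))
    refine le_trans ?_ (Finset.single_le_sum (f := fun j => |k * (q i j y - q i j x)|)
      (fun j _ => abs_nonneg _) (Finset.mem_univ j))
    rw [abs_mul, abs_of_pos hk0, abs_sub_comm]
    calc (1:ℝ) / 2 = k * (N / 2 * ρ ^ α) := by linarith [hkN]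
      _ ≤ _ := by gcongr

theorem schauder (d : ℕ) {α lam Lam : ℝ} (hα : 0 < α) (hα1 : α < 1) (hl : 0 < lam) (hL : 0 ≤ Lam) :
    ∃ C, 0 ≤ C ∧ ∀ (p : Fin d → E d → ℝ) (q : Fin d → Fin d → E d → ℝ) (A : Fin d → Fin d → E d → ℝ) (f : E d → ℝ),
    (∀ i, HasGrad (p i) (q i)) → (∀ i j x, q i j x = q j i x) → (∀ i j x, |q i j x| ≤ 1) →
    (∃ H, ∀ i j x y, |q i j x - q i j y| ≤ H * dist x y ^ α) →
    (∀ x (ξ : Fin d → ℝ), lam * ∑ i, ξ i ^ 2 ≤ ∑ i, ∑ j, A i j x * ξ j * ξ i) →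
    (∀ i j x, |A i j x| ≤ Lam) → (∀ i j x y, |A i j x - A i j y| ≤ Lam * dist x y ^ α) →
    (∀ x, ∑ i, ∑ j, A i j x * q i j x = f x) → (∀ x y, |f x - f y| ≤ Lam * dist x y ^ α) →
    ∀ i j x y, |q i j x - q i j y| ≤ C * dist x y ^ α := by
  by_contra hcon
  have key : ∀ n : ℕ, ∃ (P : Fin d → E d → ℝ) (Q : Fin d → Fin d → E d → ℝ) (A0 : Fin d → Fin d → ℝ) (ζ : E d),
      (∀ i, HasGrad (P i) (Q i)) ∧ (∀ i j x, Q i j x = Q j i x) ∧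
      (∀ i j x y, |Q i j x - Q i j y| ≤ 1 * dist x y ^ α) ∧ (∀ i j, Q i j 0 = 0) ∧ (∀ i, P i 0 = 0) ∧
      (∀ (ξ : Fin d → ℝ), lam * ∑ i, ξ i ^ 2 ≤ ∑ i, ∑ j, A0 i j * ξ j * ξ i) ∧ (∀ i j, |A0 i j| ≤ Lam) ∧
      (∀ z, |∑ i, ∑ j, A0 i j * Q i j z| ≤ (Lam + d * d * Lam) * ‖z‖ ^ α / ((n:ℝ) + 1)) ∧
      ‖ζ‖ = 1 ∧ 1 / 2 ≤ ∑ i, ∑ j, |Q i j ζ| := by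
    intro n
    by_contra hc
    refine hcon ⟨(n:ℝ) + 1, by positivity, fun p q A f hp hs hq1 ⟨H, hH⟩ ell bd hA heq hf => ?_⟩
    by_contra hb
    push Not at hb
    exact hc (schauder_step hα (by positivity) hL hp hs hq1 hH ell bd hA heq hf hb)
  choose P Q A0 ζ hP hs hH hQ0 hP0 ell bd heq hζ hbig using key
  have hQb : ∀ n i j z, |Q n i j z| ≤ ‖z‖ ^ α := fun n i j z => by
    have := hH n i j z 0
    rwa [hQ0, sub_zero, dist_zero_right, one_mul] at this
  have hPb : ∀ n i z, |P n i z| ≤ d * 1 * ‖z‖ ^ α * ‖z‖ := fun n i z => by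
    have := (hP n i).taylor zero_le_one hα.le (hH n i) 0 z
    simpa [hP0, hQ0] using this
  obtain ⟨ζ', hζ', htζ⟩ := exists_ulim_compact (isCompact_sphere (0 : E d) 1) (a := ζ) (fun n => by simp [hζ])
  have tQ : ∀ i j z, Tendsto (fun n => Q n i j z) uf (𝓝 (ulim fun n => Q n i j z)) := fun i j z =>
    tendsto_ulim (fun n => hQb n i j z)
  have tP : ∀ i z, Tendsto (fun n => P n i z) uf (𝓝 (ulim fun n => P n i z)) := fun i z =>
    tendsto_ulim (fun n => hPb n i z)
  have tA : ∀ i j, Tendsto (fun n => A0 n i j) uf (𝓝 (ulim fun n => A0 n i j)) := fun i j =>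
    tendsto_ulim (fun n => bd n i j)
  have hrig := rigidity (P := fun i z => ulim fun n => P n i z) (q := fun i j z => ulim fun n => Q n i j z)
    (A := fun i j => ulim fun n => A0 n i j) (Lam := Lam) hl hα hα1
    (fun i => HasGrad.of_tendsto zero_le_one hα (fun n => hP n i) (fun n => hH n i) (tP i) (tQ i))
    (fun i j => holder_of_tendsto (fun n => hH n i j) (tQ i j))
    (fun i j => tendsto_nhds_unique (tQ i j 0) (by simp [hQ0]))
    (fun i j z => by simp only [hs _ i j])
    (fun ξ => ge_of_tendsto' (tendsto_finsetSum _ fun i _ => tendsto_finsetSum _ fun j _ =>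
          ((tA i j).mul_const (ξ j)).mul_const (ξ i)) (fun n => ell n ξ))
    (fun i j => le_of_tendsto' (tA i j).abs fun n => bd n i j)
    (fun z => by
      have h1 : Tendsto (fun n => ∑ i, ∑ j, A0 n i j * Q n i j z) uf (𝓝 (∑ i, ∑ j, (ulim fun n => A0 n i j) *
        (ulim fun n => Q n i j z))) :=
        tendsto_finsetSum _ fun i _ => tendsto_finsetSum _ fun j _ => (tA i j).mul (tQ i j z)
      have h2 : Tendsto (fun n : ℕ => (Lam + d * d * Lam) * ‖z‖ ^ α / ((n:ℝ) + 1)) uf (𝓝 0) :=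
        ((tendsto_const_nhds.div_atTop (tendsto_atTop_add_const_right _ _ tendsto_natCast_atTop_atTop))).mono_left uf_le
      exact tendsto_nhds_unique h1 (squeeze_zero_norm (fun n => heq n z) h2))
  have h3 : Tendsto (fun n => ∑ i, ∑ j, |Q n i j (ζ n)|) uf (𝓝 0) := by
    have h4 : ∀ i j, Tendsto (fun n => |Q n i j (ζ n)|) uf (𝓝 0) := by
      intro i j
      have h5 : Tendsto (fun n => |Q n i j ζ'| + 1 * dist (ζ n) ζ' ^ α) uf (𝓝 (|0| + 1 * 0 ^ α)) := by
        refine Tendsto.add ?_ (Tendsto.const_mul _ ((tendsto_iff_dist_tendsto_zero.1 htζ).rpow_const (Or.inr hα.le)))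
        have := tQ i j ζ'
        rw [hrig i j ζ'] at this
        exact this.abs
      rw [abs_zero, Real.zero_rpow hα.ne', mul_zero, add_zero] at h5
      refine squeeze_zero (fun n => abs_nonneg _) (fun n => ?_) h5
      have := hH n i j (ζ n) ζ'
      have h6 := abs_add_le (Q n i j (ζ n) - Q n i j ζ') (Q n i j ζ')
      rw [sub_add_cancel] at h6
      linarith
    have := tendsto_finsetSum (Finset.univ : Finset (Fin d)) fun i _ => tendsto_finsetSum (Finset.univ : Finset (Fin d)) fun j _ => h4 i j
    simpa using this
  have := ge_of_tendsto' h3 hbig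
  linarith

theorem schauder_hom (d : ℕ) {α lam Lam : ℝ} (hα : 0 < α) (hα1 : α < 1) (hl : 0 < lam) (hL : 1 ≤ Lam) :
    ∃ C, 0 ≤ C ∧ ∀ (p : Fin d → E d → ℝ) (q : Fin d → Fin d → E d → ℝ) (A : Fin d → Fin d → E d → ℝ) (f : E d → ℝ)
    (K : ℝ), 0 < K → (∀ i, HasGrad (p i) (q i)) → (∀ i j x, q i j x = q j i x) → (∀ i j x, |q i j x| ≤ K) →
    (∃ H, ∀ i j x y, |q i j x - q i j y| ≤ H * dist x y ^ α) →
    (∀ x (ξ : Fin d → ℝ), lam * ∑ i, ξ i ^ 2 ≤ ∑ i, ∑ j, A i j x * ξ j * ξ i) →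
    (∀ i j x, |A i j x| ≤ Lam) → (∀ i j x y, |A i j x - A i j y| ≤ Lam * dist x y ^ α) →
    (∀ x, ∑ i, ∑ j, A i j x * q i j x = f x) → (∀ x y, |f x - f y| ≤ K * dist x y ^ α) →
    ∀ i j x y, |q i j x - q i j y| ≤ C * K * dist x y ^ α := by
  obtain ⟨C, hC, h⟩ := schauder d hα hα1 hl (zero_le_one.trans hL)
  refine ⟨C, hC, fun p q A f K hK hp hs hq ⟨H, hH⟩ ell bd hA heq hf i j x y => ?_⟩
  have hK' : 0 < K⁻¹ := by positivity
  have aux : ∀ a b B : ℝ, |a - b| ≤ B → |K⁻¹ * a - K⁻¹ * b| ≤ K⁻¹ * B := fun a b B hab => by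
    rw [← mul_sub, abs_mul, abs_of_pos hK']; gcongr
  have := h (fun i x => K⁻¹ * p i x) (fun i j x => K⁻¹ * q i j x) A (fun x => K⁻¹ * f x)
    (fun i => (hp i).const_mul _) (fun i j x => by rw [hs]) (fun i j x => by
      rw [abs_mul, abs_of_pos hK', inv_mul_le_iff₀ hK, mul_one]; exact hq i j x)
    ⟨K⁻¹ * H, fun i j x y => by rw [mul_assoc]; exact aux _ _ _ (hH i j x y)⟩ ell bd hA
    (fun x => by
      rw [← heq]; simp only [Finset.mul_sum]
      exact Finset.sum_congr rfl fun i _ => Finset.sum_congr rfl fun j _ => by ring)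
    (fun x y => (aux _ _ _ (hf x y)).trans (by
      rw [← mul_assoc, inv_mul_cancel₀ hK.ne']; gcongr)) i j x y
  rw [← mul_sub, abs_mul, abs_of_pos hK', inv_mul_le_iff₀ hK] at this
  linarith

theorem halving {ι : Type*} {g : ι → ℝ} {X : ℝ} (hX : 0 ≤ X) (h0 : ∃ H, ∀ i, g i ≤ H)
    (h : ∀ H, 0 ≤ H → (∀ i, g i ≤ H) → ∀ i, g i ≤ X + H / 2) (i : ι) : g i ≤ 2 * X := by
  obtain ⟨H, hH⟩ := h0
  have h1 : ∀ n : ℕ, ∀ i, g i ≤ 2 * X + |H| * (1 / 2) ^ n := by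
    intro n; induction n with
    | zero => intro i; simpa using (hH i).trans (by linarith [le_abs_self H])
    | succ n ih =>
      intro i
      have := h _ (by positivity) ih i
      rw [pow_succ]; linarith
  have h2 : Tendsto (fun n : ℕ => 2 * X + |H| * (1 / 2 : ℝ) ^ n) atTop (𝓝 (2 * X + |H| * 0)) :=
    ((tendsto_pow_atTop_nhds_zero_of_lt_one (by norm_num) (by norm_num)).const_mul _).const_add _
  rw [mul_zero, add_zero] at h2
  exact ge_of_tendsto' h2 fun n => h1 n i

theorem HasGrad.interp {u : E d → ℝ} {p} (hu : HasGrad u p) {U H α δ : ℝ} (hH : 0 ≤ H) (hα : 0 ≤ α) (hδ : 0 < δ)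
    (hU : ∀ x, |u x| ≤ U) (hp : ∀ i x y, |p i x - p i y| ≤ H * dist x y ^ α) (j : Fin d) (x : E d) :
    |p j x| ≤ 2 * U / δ + d * H * δ ^ α := by
  have h1 := hu.taylor hH hα hp x (δ • Pi.single j 1)
  have hn : ‖δ • (Pi.single j 1 : E d)‖ = δ := by
    rw [norm_smul, Real.norm_of_nonneg hδ.le, Pi.norm_single, norm_one, mul_one]
  rw [hn] at h1
  have e : ∑ i, p i x * (δ • (Pi.single j 1 : E d)) i = p j x * δ := by
    simp [Pi.single_apply]
  rw [e] at h1
  have h2 : |p j x| * δ ≤ 2 * U + d * H * δ ^ α * δ := by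
    rw [← abs_of_pos hδ, ← abs_mul, abs_of_pos hδ]
    have h3 := hU (x + δ • Pi.single j 1)
    have h4 := hU x
    rw [abs_le] at *
    constructor <;> linarith [h1.1, h1.2, h3.1, h3.2, h4.1, h4.2]
  rw [← sub_nonneg]
  have : 0 ≤ (2 * U / δ + d * H * δ ^ α - |p j x|) * δ := by
    rw [sub_mul, add_mul, div_mul_cancel₀ _ hδ.ne']; linarith
  exact nonneg_of_mul_nonneg_left this hδ

end MFG

end S8

section S9

open MeasureTheory Set Filter Topology

namespace MFG
variable {d : ℕ}

/-- discrete resolvent equation with step `h` -/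
def Res (h : ℝ) (u f : E d → ℝ) : Prop :=
  ∀ x, u x - (h⁻¹) ^ 2 * ∑ i, (u (x + h • Pi.single i 1) + u (x - h • Pi.single i 1) - 2 * u x) = f x

theorem Res.sub {h : ℝ} {u f v g : E d → ℝ} (hu : Res h u f) (hv : Res h v g) :
    Res h (fun x => u x - v x) (fun x => f x - g x) := fun x => by
  beta_reduce
  rw [← hu x, ← hv x]
  rw [show ∀ a b c e s : ℝ, (a - c ^ 2 * b) - (e - c ^ 2 * s) = (a - e) - c ^ 2 * (b - s) by intros; ring,
    ← Finset.sum_sub_distrib]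
  congr 2
  exact Finset.sum_congr rfl fun i _ => by ring

theorem Res.const_mul {h : ℝ} {u f : E d → ℝ} (hu : Res h u f) (a : ℝ) :
    Res h (fun x => a * u x) (fun x => a * f x) := fun x => by
  beta_reduce
  rw [← hu x]
  simp only [mul_sub, Finset.mul_sum]
  congr 1
  exact Finset.sum_congr rfl fun i _ => by ring

theorem Res.zero {h : ℝ} : Res h (fun _ : E d => 0) (fun _ => 0) := fun x => by simp

theorem Res.add {h : ℝ} {u f v g : E d → ℝ} (hu : Res h u f) (hv : Res h v g) :
    Res h (fun x => u x + v x) (fun x => f x + g x) := by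
  have := hu.sub (Res.zero.sub hv)
  simpa using this

theorem Res.sum {h : ℝ} {ι : Type*} (s : Finset ι) {u f : ι → E d → ℝ} (hu : ∀ i ∈ s, Res h (u i) (f i)) :
    Res h (fun x => ∑ i ∈ s, u i x) (fun x => ∑ i ∈ s, f i x) := by
  classical
  induction s using Finset.induction_on with
  | empty => simpa using Res.zero
  | insert a s ha ih =>
    simp only [Finset.sum_insert ha]
    exact (hu a (by simp)).add (ih fun i hi => hu i (by simp [hi]))

theorem Res.translate {h : ℝ} {u f : E d → ℝ} (hu : Res h u f) (y : E d) :
    Res h (fun x => u (x + y)) (fun x => f (x + y)) := fun x => by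
  beta_reduce
  rw [← hu (x + y)]
  congr 2
  exact Finset.sum_congr rfl fun i _ => by
    rw [show x + y + h • (Pi.single i 1 : E d) = x + h • Pi.single i 1 + y by abel,
      show x + y - h • (Pi.single i 1 : E d) = x - h • Pi.single i 1 + y by abel]

theorem Res.bound {h : ℝ} {u f : E d → ℝ} (hu : Res h u f) {B : ℝ} (hb : ∃ H, ∀ x, |u x| ≤ H)
    (hf : ∀ x, |f x| ≤ B) (x : E d) : |u x| ≤ B := by
  obtain ⟨H, hH⟩ := hb
  have hbd : BddAbove (range fun x => |u x|) := ⟨H, by rintro _ ⟨x, rfl⟩; exact hH x⟩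
  set S := sSup (range fun x => |u x|) with hS
  have h1 : ∀ x, |u x| ≤ S := fun x => le_csSup hbd ⟨x, rfl⟩
  set c := (h⁻¹) ^ 2 * d * 2 with hc
  have hc0 : 0 ≤ c := by positivity
  have h2 : ∀ x, |u x| ≤ (B + c * S) / (1 + c) := by
    intro x
    rw [le_div_iff₀ (by positivity)]
    have e : (1 + c) * u x = f x + (h⁻¹) ^ 2 * ∑ i, (u (x + h • Pi.single i 1) + u (x - h • Pi.single i 1)) := by
      have := hu x
      rw [Finset.sum_sub_distrib, Finset.sum_const, Finset.card_univ, Fintype.card_fin, nsmul_eq_mul] at this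
      rw [hc]; linarith
    have e2 : |∑ i, (u (x + h • Pi.single i 1) + u (x - h • Pi.single i 1))| ≤ d * (2 * S) := by
      refine (Finset.abs_sum_le_sum_abs _ _).trans ?_
      refine (Finset.sum_le_sum fun i _ => (abs_add_le _ _).trans (add_le_add (h1 _) (h1 _))).trans ?_
      simp; linarith
    rw [mul_comm, ← abs_of_pos (show 0 < 1 + c by positivity), ← abs_mul, e]
    refine (abs_add_le _ _).trans (add_le_add (hf x) ?_)
    rw [abs_mul, abs_of_nonneg (by positivity)]
    calc _ ≤ (h⁻¹) ^ 2 * (d * (2 * S)) := by gcongr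
      _ = c * S := by rw [hc]; ring
  have h3 : S ≤ (B + c * S) / (1 + c) := csSup_le (range_nonempty _) (by rintro _ ⟨x, rfl⟩; exact h2 x)
  rw [le_div_iff₀ (by positivity)] at h3
  linarith [h1 x]

theorem res_exists {h : ℝ} {f : E d → ℝ} (hf : Continuous f) (hb : ∃ B, ∀ x, |f x| ≤ B) :
    ∃ u, Continuous u ∧ (∃ B, ∀ x, |u x| ≤ B) ∧ Res h u f := by
  obtain ⟨B, hB⟩ := hb
  set c := (h⁻¹) ^ 2 * d * 2 with hc
  have hc0 : 0 ≤ c := by positivity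
  let f' : BoundedContinuousFunction (E d) ℝ := BoundedContinuousFunction.ofNormedAddCommGroup f hf B hB
  let τ : E d → C(E d, E d) := fun y => ⟨fun x => x + y, by fun_prop⟩
  let T : BoundedContinuousFunction (E d) ℝ → BoundedContinuousFunction (E d) ℝ := fun u =>
    (1 + c)⁻¹ • (f' + (h⁻¹) ^ 2 • ∑ i, (u.compContinuous (τ (h • Pi.single i 1)) + u.compContinuous (τ (-(h • Pi.single i 1)))))
  have hT : ∀ u x, T u x = (1 + c)⁻¹ * (f x + (h⁻¹) ^ 2 * ∑ i, (u (x + h • Pi.single i 1) + u (x - h • Pi.single i 1))) := by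
    intro u x
    simp [T, f', τ, sub_eq_add_neg, mul_add]
  have hk : ContractingWith (NNReal.mk (c / (1 + c)) (by positivity)) T := by
    refine ⟨?_, LipschitzWith.of_dist_le_mul fun u v => ?_⟩
    · rw [← NNReal.coe_lt_coe]; simp only [NNReal.coe_mk, NNReal.coe_one]
      rw [div_lt_one (by positivity)]; linarith
    · rw [NNReal.coe_mk]
      refine (BoundedContinuousFunction.dist_le (by positivity)).2 fun x => ?_
      have hd : ∀ z, |u z - v z| ≤ dist u v := fun z => by
        rw [← Real.dist_eq]; exact BoundedContinuousFunction.dist_coe_le_dist z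
      rw [Real.dist_eq, hT, hT, ← mul_sub, add_sub_add_left_eq_sub, ← mul_sub, ← Finset.sum_sub_distrib, abs_mul,
        abs_mul, abs_of_nonneg (by positivity : (0:ℝ) ≤ (1 + c)⁻¹), abs_of_nonneg (by positivity : (0:ℝ) ≤ h⁻¹ ^ 2)]
      have e2 : |∑ i, ((u (x + h • Pi.single i 1) + u (x - h • Pi.single i 1)) -
          (v (x + h • Pi.single i 1) + v (x - h • Pi.single i 1)))| ≤ d * (2 * dist u v) := by
        refine (Finset.abs_sum_le_sum_abs _ _).trans ?_
        refine (Finset.sum_le_sum fun i _ => (show _ ≤ 2 * dist u v from ?_)).trans ?_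
        · rw [add_sub_add_comm]
          refine (abs_add_le _ _).trans ((add_le_add (hd _) (hd _)).trans (by linarith))
        · simp
      calc _ ≤ (1 + c)⁻¹ * ((h⁻¹) ^ 2 * (d * (2 * dist u v))) := by gcongr
        _ = _ := by rw [hc]; field_simp
  let u := ContractingWith.fixedPoint T hk
  have hu : T u = u := hk.fixedPoint_isFixedPt
  refine ⟨u, u.continuous, ⟨‖u‖, u.norm_coe_le_norm⟩, fun x => ?_⟩
  have e := hT u x
  rw [hu, eq_inv_mul_iff_mul_eq₀ (by positivity)] at e
  rw [Finset.sum_sub_distrib, Finset.sum_const, Finset.card_univ, Fintype.card_fin, nsmul_eq_mul]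
  rw [hc] at e
  linarith

/-- second difference quotient -/
theorem second_diff {u : E d → ℝ} {p : Fin d → E d → ℝ} {q : Fin d → Fin d → E d → ℝ} (hu : HasGrad u p)
    (hp : ∀ i, HasGrad (p i) (q i)) {B α h : ℝ} (hB : 0 ≤ B) (hα : 0 < α) (hh : 0 < h)
    (hq : ∀ i j x y, |q i j x - q i j y| ≤ B * dist x y ^ α) (i : Fin d) (x : E d) :
    |(h⁻¹) ^ 2 * (u (x + h • Pi.single i 1) + u (x - h • Pi.single i 1) - 2 * u x) - q i i x| ≤ 2 * d * B * h ^ α := by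
  set e : E d := Pi.single i 1 with he
  have hsum : ∀ (r : Fin d → ℝ) (s : ℝ), ∑ j, r j * (s • e) j = r i * s := fun r s => by
    simp [he, Pi.single_apply]
  have hsum' : ∀ (r : Fin d → ℝ), ∑ j, r j * e j = r i := fun r => by
    simp [he, Pi.single_apply]
  have hn : ∀ t : ℝ, ‖t • e‖ = |t| := fun t => by rw [norm_smul, he, Pi.norm_single]; simp
  have hd : ∀ t, HasDerivAt (fun t : ℝ => u (x + t • e) + u (x + t • (-e)) - t ^ 2 * q i i x)
      (p i (x + t • e) - p i (x + t • (-e)) - 2 * t * q i i x) t := by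
    intro t
    have h1 := ((hu.line x e t).add (hu.line x (-e) t)).sub ((hasDerivAt_pow 2 t).mul_const (q i i x))
    refine h1.congr_deriv ?_
    simp only [hsum', Pi.neg_apply, mul_neg, Finset.sum_neg_distrib]
    simp; ring
  have hb : ∀ t ∈ Icc 0 h, ‖p i (x + t • e) - p i (x + t • (-e)) - 2 * t * q i i x‖ ≤ 2 * d * B * h ^ α * h := by
    intro t ht
    have h1 := (hp i).taylor hB hα.le (hq i) x (t • e)
    have h2 := (hp i).taylor hB hα.le (hq i) x (t • (-e))
    rw [smul_neg, ← neg_smul] at h2 ⊢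
    rw [hsum, hn] at h1 h2
    rw [abs_neg] at h2
    have h3 : d * B * |t| ^ α * |t| ≤ d * B * h ^ α * h := by
      rw [abs_of_nonneg ht.1]
      have : t ^ α ≤ h ^ α := Real.rpow_le_rpow ht.1 ht.2 hα.le
      have h5 := ht.1
      have h6 := ht.2
      gcongr
    rw [Real.norm_eq_abs]
    rw [abs_le] at *
    constructor <;> linarith [h1.1, h1.2, h2.1, h2.2]
  have := (convex_Icc (0:ℝ) h).norm_image_sub_le_of_norm_hasDerivWithin_le (fun t _ => (hd t).hasDerivWithinAt) hb
    (left_mem_Icc.2 hh.le) (right_mem_Icc.2 hh.le)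
  rw [sub_zero, Real.norm_of_nonneg hh.le, Real.norm_eq_abs] at this
  have e1 : (h⁻¹) ^ 2 * (u (x + h • e) + u (x - h • e) - 2 * u x) - q i i x =
    (h⁻¹) ^ 2 * (u (x + h • e) + u (x + h • (-e)) - h ^ 2 * q i i x - (u (x + (0:ℝ) • e) + u (x + (0:ℝ) • (-e)) - 0 ^ 2 * q i i x)) := by
    rw [smul_neg, ← sub_eq_add_neg]; simp; field_simp; ring
  rw [e1, abs_mul, abs_of_nonneg (by positivity)]
  calc _ ≤ (h⁻¹) ^ 2 * (2 * d * B * h ^ α * h * h) := by gcongr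
    _ = _ := by field_simp

structure C2A (α : ℝ) (u : E d → ℝ) (p : Fin d → E d → ℝ) (q : Fin d → Fin d → E d → ℝ) : Prop where
  per : ZPer d u
  gu : HasGrad u p
  gp : ∀ i, HasGrad (p i) (q i)
  sym : ∀ i j x, q i j x = q j i x
  hol : ∃ H, ∀ i j x y, |q i j x - q i j y| ≤ H * dist x y ^ α

theorem base_smooth {α B : ℝ} (hα : 0 < α) (hB : 0 ≤ B) {f : E d → ℝ} {F : Fin d → E d → ℝ} {FF : Fin d → Fin d → E d → ℝ}
    (hf : HasGrad f F) (hF : ∀ i, HasGrad (F i) (FF i)) (hs : ∀ i j x, FF i j x = FF j i x) (hper : ZPer d f)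
    (b0 : ∀ x, |f x| ≤ B) (b1 : ∀ i x, |F i x| ≤ B) (b2 : ∀ i j x, |FF i j x| ≤ B)
    (h1 : ∀ i x y, |F i x - F i y| ≤ B * dist x y ^ α)
    (h2 : ∀ i j x y, |FF i j x - FF i j y| ≤ B * dist x y ^ α) :
    ∃ u p q, C2A α u p q ∧ ∀ x, u x - ∑ i, q i i x = f x := by
  have hFFc : ∀ i j, Continuous (FF i j) := fun i j => holder_continuous hα (h2 i j)
  let h : ℕ → ℝ := fun n => ((n:ℝ) + 1)⁻¹
  have hpos : ∀ n, 0 < h n := fun n => by positivity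
  choose u uc ub ur using fun n => res_exists (h := h n) hf.continuous ⟨B, b0⟩
  choose p pc pb pr using fun n i => res_exists (h := h n) (hF i).continuous ⟨B, b1 i⟩
  choose q qc qb qr using fun n i j => res_exists (h := h n) (hFFc i j) ⟨B, b2 i j⟩
  have ub' := fun n => (ur n).bound (ub n) b0
  have pb' := fun n i => (pr n i).bound (pb n i) (b1 i)
  have qb' := fun n i j => (qr n i j).bound (qb n i j) (b2 i j)
  have qs : ∀ n i j x, q n i j x = q n j i x := by
    intro n i j x
    have := ((qr n i j).sub (qr n j i)).bound (B := 0) ⟨B + B, fun x => (abs_sub _ _).trans (add_le_add (qb' n i j x) (qb' n j i x))⟩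
      (fun x => by rw [hs i j]; simp) x
    exact sub_eq_zero.1 (abs_eq_zero.1 (le_antisymm this (abs_nonneg _)))
  have qh : ∀ n i j x y, |q n i j x - q n i j y| ≤ B * dist x y ^ α := by
    intro n i j x y
    have := (((qr n i j).translate (y - x)).sub (qr n i j)).bound (B := B * dist x y ^ α)
      ⟨B + B, fun x => (abs_sub _ _).trans (add_le_add (qb' n i j _) (qb' n i j x))⟩
      (fun z => by
        have := h2 i j (z + (y - x)) z
        rwa [dist_eq_norm, add_sub_cancel_left, ← dist_eq_norm, dist_comm] at this) x
    rw [add_sub_cancel] at this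
    rwa [abs_sub_comm]
  have up : ∀ n x (k : Fin d → ℤ), u n (x + fun i => (k i : ℝ)) = u n x := by
    intro n x k
    have := (((ur n).translate (fun i => (k i : ℝ))).sub (ur n)).bound (B := 0)
      ⟨B + B, fun x => (abs_sub _ _).trans (add_le_add (ub' n _) (ub' n x))⟩ (fun x => by simp [hper x k]) x
    exact sub_eq_zero.1 (abs_eq_zero.1 (le_antisymm this (abs_nonneg _)))
  have gen : ∀ n {v : E d → ℝ} {r : Fin d → E d → ℝ} {g G}, Res (h n) v g → (∀ x, |v x| ≤ B) → (∀ i, Res (h n) (r i) (G i)) →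
      (∀ i x, |r i x| ≤ B) → HasGrad g G → (∀ i x y, |G i x - G i y| ≤ B * dist x y ^ α) → HasGrad v r := by
    intro n v r g G hv vb hr rb hg hG
    refine hasGrad_of_taylor (B := d * B) hα fun x y => ?_
    exact (((hv.translate y).sub hv).sub (Res.sum Finset.univ (u := fun i x => r i x * y i) (f := fun i x => G i x * y i)
      (fun i _ => by have := (hr i).const_mul (y i); simpa only [mul_comm] using this))).bound
      (B := d * B * ‖y‖ ^ α * ‖y‖)
      ⟨(B + B) + ∑ i, B * |y i|, fun x => (abs_sub _ _).trans (add_le_add ((abs_sub _ _).trans (add_le_add (vb _) (vb _)))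
        ((Finset.abs_sum_le_sum_abs _ _).trans (Finset.sum_le_sum fun i _ => by rw [abs_mul]; gcongr; exact rb i x)))⟩
      (fun z => hg.taylor hB hα.le hG z y) x
  have gu : ∀ n, HasGrad (u n) (p n) := fun n => gen n (ur n) (ub' n) (pr n) (pb' n) hf h1
  have gp : ∀ n i, HasGrad (p n i) (q n i) := fun n i => gen n (pr n i) (pb' n i) (qr n i) (qb' n i) (hF i) (h2 i)
  have ph : ∀ n i x y, |p n i x - p n i y| ≤ B * dist x y ^ α := by
    intro n i x y
    have := (((pr n i).translate (y - x)).sub (pr n i)).bound (B := B * dist x y ^ α)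
      ⟨B + B, fun x => (abs_sub _ _).trans (add_le_add (pb' n i _) (pb' n i x))⟩
      (fun z => by
        have := h1 i (z + (y - x)) z
        rwa [dist_eq_norm, add_sub_cancel_left, ← dist_eq_norm, dist_comm] at this) x
    rw [add_sub_cancel] at this
    rwa [abs_sub_comm]
  have tu := fun x => tendsto_ulim (fun n => ub' n x)
  have tp := fun i x => tendsto_ulim (fun n => pb' n i x)
  have tq := fun i j x => tendsto_ulim (fun n => qb' n i j x)
  refine ⟨fun x => ulim fun n => u n x, fun i x => ulim fun n => p n i x, fun i j x => ulim fun n => q n i j x,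
    ⟨fun x k => by simp only [up], HasGrad.of_tendsto hB hα gu ph tu tp,
      fun i => HasGrad.of_tendsto hB hα (fun n => gp n i) (fun n => qh n i) (tp i) (tq i),
      fun i j x => by simp only [qs _ i j], B, fun i j => holder_of_tendsto (fun n => qh n i j) (tq i j)⟩, fun x => ?_⟩
  have ht : Tendsto h uf (𝓝 0) := by
    refine Tendsto.mono_left ?_ uf_le
    exact tendsto_inv_atTop_zero.comp (tendsto_atTop_add_const_right _ _ tendsto_natCast_atTop_atTop)
  have ts : ∀ i, Tendsto (fun n => (h n)⁻¹ ^ 2 * (u n (x + h n • Pi.single i 1) + u n (x - h n • Pi.single i 1) - 2 * u n x))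
      uf (𝓝 (ulim fun n => q n i i x)) := by
    intro i
    have h3 : Tendsto (fun n => (h n)⁻¹ ^ 2 * (u n (x + h n • Pi.single i 1) + u n (x - h n • Pi.single i 1) - 2 * u n x)
        - q n i i x) uf (𝓝 0) := by
      refine squeeze_zero_norm (fun n => second_diff (gu n) (gp n) hB hα (hpos n) (qh n) i x) ?_
      have := (ht.rpow_const (p := α) (Or.inr hα.le)).const_mul (2 * d * B)
      rwa [Real.zero_rpow hα.ne', mul_zero] at this
    simpa using h3.add (tq i i x)
  have := (tu x).sub (tendsto_finsetSum Finset.univ fun i _ => ts i)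
  refine tendsto_nhds_unique this ?_
  simp only [← Finset.mul_sum, ur _ x]
  exact tendsto_const_nhds

end MFG

end S9

section S10

open MeasureTheory Set Filter Topology

namespace MFG
variable {d : ℕ}

theorem C2A.neg {α : ℝ} {u : E d → ℝ} {p q} (h : C2A α u p q) :
    C2A α (fun x => - u x) (fun i x => - p i x) (fun i j x => - q i j x) :=
  ⟨ZPer.neg h.per, h.gu.neg, fun i => (h.gp i).neg, fun i j x => by rw [h.sym], by
    obtain ⟨H, hH⟩ := h.hol
    exact ⟨H, fun i j x y => by rw [← neg_sub', abs_neg]; exact hH i j x y⟩⟩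

theorem C2A.cq {α : ℝ} (hα : 0 < α) {u : E d → ℝ} {p q} (h : C2A α u p q) (i j : Fin d) : Continuous (q i j) := by
  obtain ⟨H, hH⟩ := h.hol
  exact holder_continuous hα (hH i j)

theorem C2A.cp {α : ℝ} {u : E d → ℝ} {p q} (h : C2A α u p q) (i : Fin d) : Continuous (p i) := (h.gp i).continuous

theorem C2A.perp {α : ℝ} {u : E d → ℝ} {p q} (h : C2A α u p q) (i : Fin d) : ZPer d (p i) := h.gu.zper h.per i
theorem C2A.perq {α : ℝ} {u : E d → ℝ} {p q} (h : C2A α u p q) (i j : Fin d) : ZPer d (q i j) :=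
  (h.gp i).zper (h.perp i) j

theorem trace_nonpos {u : E d → ℝ} {p : Fin d → E d → ℝ} {q : Fin d → Fin d → E d → ℝ}
    (hu : HasGrad u p) (hp : ∀ i, HasGrad (p i) (q i)) {x : E d} (hm : IsLocalMax u x) (i : Fin d) : q i i x ≤ 0 := by
  have := dir_second_deriv_nonpos hu hp hm (Pi.single i 1)
  simpa [Pi.single_apply] using this

theorem base_max {α B : ℝ} {u : E d → ℝ} {p q} {f : E d → ℝ} (h : C2A α u p q) (he : ∀ x, u x - ∑ i, q i i x = f x)
    (hf : ∀ x, |f x| ≤ B) (x : E d) : |u x| ≤ B := by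
  have key : ∀ {u : E d → ℝ} {p q} {f : E d → ℝ}, C2A α u p q → (∀ x, u x - ∑ i, q i i x = f x) → (∀ x, |f x| ≤ B) → ∀ x, u x ≤ B := by
    intro u p q f h he hf x
    obtain ⟨x0, _, hm⟩ := ZPer.exists_max h.per h.gu.continuous
    have h1 : ∑ i, q i i x0 ≤ 0 := Finset.sum_nonpos fun i _ =>
      trace_nonpos h.gu h.gp (Eventually.of_forall hm) i
    linarith [he x0, (abs_le.1 (hf x0)).2, hm x]
  refine abs_le.2 ⟨?_, key h he hf x⟩
  have := key h.neg (f := fun x => - f x) (fun x => by rw [← he]; simp; ring) (fun x => by rw [abs_neg]; exact hf x) x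
  linarith

theorem hol_of_lip {X : Type*} [PseudoMetricSpace X] {v : X → ℝ} {L S α : ℝ} (hα : 0 < α) (hα1 : α ≤ 1) (hL : 0 ≤ L)
    (hS : ∀ x, |v x| ≤ S) (hv : ∀ x y, |v x - v y| ≤ L * dist x y) (x y : X) :
    |v x - v y| ≤ (L + 2 * S) * dist x y ^ α := by
  have hS0 : 0 ≤ S := (abs_nonneg _).trans (hS x)
  rcases le_total (dist x y) 1 with h | h
  · have h1 : dist x y ≤ dist x y ^ α := by
      calc dist x y = dist x y ^ (1:ℝ) := (Real.rpow_one _).symm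
        _ ≤ _ := Real.rpow_le_rpow_of_exponent_ge_of_imp dist_nonneg h hα1 (fun h1 h2 => absurd h2 one_ne_zero)
    calc _ ≤ L * dist x y := hv x y
      _ ≤ L * dist x y ^ α := by gcongr
      _ ≤ _ := by gcongr; linarith
  · have h1 : 1 ≤ dist x y ^ α := Real.one_le_rpow h hα.le
    have h2 : |v x - v y| ≤ 2 * S := (abs_sub _ _).trans (by linarith [hS x, hS y])
    calc _ ≤ (2 * S) * 1 := by linarith
      _ ≤ (L + 2 * S) * dist x y ^ α := by gcongr; linarith

theorem exists_rpow_small {α X : ℝ} (hα : 0 < α) (hX : 0 ≤ X) {e : ℝ} (he : 0 < e) : ∃ δ, 0 < δ ∧ X * δ ^ α ≤ e := by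
  refine ⟨(e / (X + 1)) ^ α⁻¹, by positivity, ?_⟩
  rw [Real.rpow_inv_rpow (by positivity) hα.ne', mul_div_assoc', div_le_iff₀ (by positivity)]
  nlinarith

theorem C2A.lipp {α : ℝ} {u : E d → ℝ} {p q} (h : C2A α u p q) {K : ℝ} (hK : 0 ≤ K) (hq : ∀ i j x, |q i j x| ≤ K)
    (i : Fin d) (x y : E d) : |p i x - p i y| ≤ d * K * dist x y :=
  (h.gp i).lip hK (hq i) x y

theorem base_apriori (d : ℕ) {α : ℝ} (hα : 0 < α) (hα1 : α < 1) :
    ∃ C, 0 ≤ C ∧ ∀ (B : ℝ), 0 < B → ∀ (u : E d → ℝ) p q (f : E d → ℝ), C2A α u p q → (∀ x, u x - ∑ i, q i i x = f x) →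
      (∀ x, |f x| ≤ B) → (∀ x y, |f x - f y| ≤ B * dist x y ^ α) →
      (∀ i x, |p i x| ≤ C * B) ∧ (∀ i j x, |q i j x| ≤ C * B) ∧
      ∀ i j x y, |q i j x - q i j y| ≤ C * B * dist x y ^ α := by
  obtain ⟨C, hC, hS⟩ := schauder_hom d hα hα1 one_pos le_rfl
  obtain ⟨δ, hδ, hδ2⟩ := exists_rpow_small hα (X := d * C * (1 + d ^ 3)) (by positivity) (e := 1 / 4) (by norm_num)
  set η := δ / (8 * (d ^ 2 + 1)) with hη
  have hη0 : 0 < η := by positivity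
  set X := 4 / (η * δ) + d * C * (3 + 2 * d) * δ ^ α with hX
  have hX0 : 0 ≤ X := by positivity
  have main : ∀ (B : ℝ), 0 < B → ∀ (u : E d → ℝ) p q (f : E d → ℝ), C2A α u p q → (∀ x, u x - ∑ i, q i i x = f x) →
      (∀ x, |f x| ≤ B) → (∀ x y, |f x - f y| ≤ B * dist x y ^ α) → ∀ K, 0 ≤ K → (∀ i j x, |q i j x| ≤ K) →
      (∀ ζ, 0 < ζ → ∀ i x, |p i x| ≤ 2 * B / ζ + d ^ 2 * K * ζ) ∧ 
      ∀ i j x y, |q i j x - q i j y| ≤ C * ((1 + d ^ 3) * K + (3 + 2 * d) * B) * dist x y ^ α := by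
    intro B hB u p q f h he hf hf2 K hK hq
    have hu := base_max h he hf
    have hp : ∀ ζ, 0 < ζ → ∀ i x, |p i x| ≤ 2 * B / ζ + d ^ 2 * K * ζ := by
      intro ζ hζ i x
      have := h.gu.interp (H := d * K) (α := 1) (δ := ζ) (by positivity) zero_le_one hζ hu
        (fun i x y => by rw [Real.rpow_one]; exact h.lipp hK hq i x y) i x
      rw [Real.rpow_one] at this
      convert this using 2; ring
    refine ⟨hp, ?_⟩
    have hp1 : ∀ i x, |p i x| ≤ 2 * B + d ^ 2 * K := fun i x => by simpa using hp 1 one_pos i x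
    have hu2 := hol_of_lip hα hα1.le (by positivity) hu (fun x y => h.gu.lip (B := 2 * B + d ^ 2 * K) (by positivity) hp1 x y)
    refine hS p q (fun i j _ => if i = j then 1 else 0) (fun x => u x - f x) ((1 + d ^ 3) * K + (3 + 2 * d) * B) (by positivity)
      h.gp h.sym (fun i j x => (hq i j x).trans ?_) h.hol (fun x ξ => ?_) (fun i j x => ?_) (fun i j x y => ?_) (fun x => ?_) (fun x y => ?_)
    · have : 0 ≤ (d:ℝ) ^ 3 * K + (3 + 2 * d) * B := by positivity
      linarith
    · simp [pow_two]
    · split_ifs <;> simp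
    · simp; positivity
    · simp [← he x]
    · rw [show u x - f x - (u y - f y) = (u x - u y) - (f x - f y) by ring]
      refine (abs_sub _ _).trans ((add_le_add (hu2 x y) (hf2 x y)).trans ?_)
      rw [← add_mul]
      refine mul_le_mul_of_nonneg_right ?_ (by positivity)
      have : d * (2 * B + d ^ 2 * K) = 2 * d * B + d ^ 3 * K := by ring
      linarith
  refine ⟨2 + d ^ 2 * (2 * X) + 2 * X + C * ((1 + d ^ 3) * (2 * X) + (3 + 2 * d)), by positivity, fun B hB u p q f h he hf hf2 => ?_⟩
  have hqb : ∀ t : Fin d × Fin d × E d, |q t.1 t.2.1 t.2.2| ≤ 2 * (X * B) := by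
    refine halving (by positivity) ?_ ?_
    · choose K hK0 hK using fun i j => ZPer.bounded (h.perq i j) (h.cq hα i j)
      refine ⟨∑ i, ∑ j, K i j, fun t => (hK t.1 t.2.1 t.2.2).trans ?_⟩
      refine le_trans ?_ (Finset.single_le_sum (f := fun i => ∑ j, K i j)
        (fun i _ => Finset.sum_nonneg fun j _ => hK0 i j) (Finset.mem_univ t.1))
      exact (Finset.single_le_sum (f := fun j => K t.1 j)
        (fun j _ => hK0 _ j) (Finset.mem_univ t.2.1))
    · rintro K hK hq ⟨i, j, x⟩
      have hq' : ∀ i j x, |q i j x| ≤ K := fun i j x => hq (i, j, x)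
      obtain ⟨m1, m2⟩ := main B hB u p q f h he hf hf2 K hK hq'
      have := (h.gp i).interp (δ := δ) (by positivity) hα.le hδ (m1 η hη0 i) (m2 i) j x
      refine this.trans ?_
      have e1 : 2 * (2 * B / η + d ^ 2 * K * η) / δ ≤ 4 / (η * δ) * B + K / 4 := by
        have : 2 * (d ^ 2 * K * η) / δ ≤ K / 4 := by
          rw [hη]
          have e3 : 2 * (d ^ 2 * K * (δ / (8 * ((d:ℝ) ^ 2 + 1)))) / δ = K / 4 * (d ^ 2 / (d ^ 2 + 1)) := by field_simp; ring
          rw [e3]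
          have : (d:ℝ) ^ 2 / (d ^ 2 + 1) ≤ 1 := by rw [div_le_one (by positivity)]; linarith
          calc K / 4 * (d ^ 2 / (d ^ 2 + 1)) ≤ K / 4 * 1 := by gcongr
            _ = _ := mul_one _
        calc 2 * (2 * B / η + d ^ 2 * K * η) / δ = 4 / (η * δ) * B + 2 * (d ^ 2 * K * η) / δ := by field_simp; ring
          _ ≤ _ := by linarith
      have e2 : d * (C * ((1 + d ^ 3) * K + (3 + 2 * d) * B)) * δ ^ α ≤ K / 4 + d * C * (3 + 2 * d) * δ ^ α * B := by
        have := mul_le_mul_of_nonneg_right hδ2 hK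
        linarith
      calc _ ≤ (4 / (η * δ) * B + K / 4) + (K / 4 + d * C * (3 + 2 * d) * δ ^ α * B) := add_le_add e1 e2
        _ = _ := by rw [hX]; ring
  obtain ⟨m1, m2⟩ := main B hB u p q f h he hf hf2 (2 * (X * B)) (by positivity) (fun i j x => hqb (i, j, x))
  have n1 : 0 ≤ d ^ 2 * (2 * X) * B := by positivity
  have n2 : 0 ≤ X * B := by positivity
  have n3 : 0 ≤ C * ((1 + d ^ 3) * (2 * X) + (3 + 2 * d)) * B := by positivity
  refine ⟨fun i x => (m1 1 one_pos i x).trans ?_, fun i j x => (hqb (i, j, x)).trans ?_, fun i j x y => (m2 i j x y).trans ?_⟩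
  · simp only [div_one, mul_one]; linarith
  · linarith
  · refine mul_le_mul_of_nonneg_right ?_ (by positivity)
    linarith

/-- derivative data of a smooth periodic function -/
theorem smooth_data {α : ℝ} (hα : 0 < α) (hα1 : α < 1) {f : E d → ℝ} (hf : ContDiff ℝ 3 f) (hper : ZPer d f) :
    ∃ u p q, C2A α u p q ∧ ∀ x, u x - ∑ i, q i i x = f x := by
  have c2 : ∀ i, ContDiff ℝ 2 (pd d i f) := fun i => (hf.fderiv_right (m := 2) (by norm_num)).clm_apply contDiff_const
  have c1 : ∀ i j, ContDiff ℝ 1 (pd d j (pd d i f)) := fun i j => ContDiff.pd_one (c2 i) j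
  have g0 : HasGrad f (fun i => pd d i f) := HasGrad.of_diff (hf.differentiable (by norm_num))
  have g1 : ∀ i, HasGrad (pd d i f) (fun j => pd d j (pd d i f)) := fun i => HasGrad.of_diff ((c2 i).differentiable (by norm_num))
  have g2 : ∀ i j, HasGrad (pd d j (pd d i f)) (fun k => pd d k (pd d j (pd d i f))) := fun i j =>
    HasGrad.of_diff ((c1 i j).differentiable (by norm_num))
  have p1 := fun i => g0.zper hper i
  have p2 := fun i j => (g1 i).zper (p1 i) j
  have p3 := fun i j k => (g2 i j).zper (p2 i j) k
  obtain ⟨B0, hB0, b0⟩ := ZPer.bounded hper hf.continuous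
  choose B1 hB1 b1 using fun i => ZPer.bounded (p1 i) (c2 i).continuous
  choose B2 hB2 b2 using fun i j => ZPer.bounded (p2 i j) (c1 i j).continuous
  choose B3 hB3 b3 using fun i j k => ZPer.bounded (p3 i j k) (ContDiff.continuous_pd (c1 i j) k)
  set S1 := ∑ i, B1 i with hS1
  set S2 := ∑ i, ∑ j, B2 i j with hS2
  set S3 := ∑ i, ∑ j, ∑ k, B3 i j k with hS3
  have le1 : ∀ i, B1 i ≤ S1 := fun i => Finset.single_le_sum (f := B1) (fun i _ => hB1 i) (Finset.mem_univ i)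
  have le2 : ∀ i j, B2 i j ≤ S2 := fun i j =>
    (Finset.single_le_sum (f := B2 i) (fun j _ => hB2 i j) (Finset.mem_univ j)).trans
    (Finset.single_le_sum (f := fun i => ∑ j, B2 i j) (fun i _ => Finset.sum_nonneg fun j _ => hB2 i j) (Finset.mem_univ i))
  have le3 : ∀ i j k, B3 i j k ≤ S3 := fun i j k =>
    (Finset.single_le_sum (f := B3 i j) (fun k _ => hB3 i j k) (Finset.mem_univ k)).trans
    ((Finset.single_le_sum (f := fun j => ∑ k, B3 i j k) (fun j _ => Finset.sum_nonneg fun k _ => hB3 i j k) (Finset.mem_univ j)).trans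
    (Finset.single_le_sum (f := fun i => ∑ j, ∑ k, B3 i j k)
      (fun i _ => Finset.sum_nonneg fun j _ => Finset.sum_nonneg fun k _ => hB3 i j k) (Finset.mem_univ i)))
  have hS1' : 0 ≤ S1 := Finset.sum_nonneg fun i _ => hB1 i
  have hS2' : 0 ≤ S2 := Finset.sum_nonneg fun i _ => Finset.sum_nonneg fun j _ => hB2 i j
  have hS3' : 0 ≤ S3 := Finset.sum_nonneg fun i _ => Finset.sum_nonneg fun j _ => Finset.sum_nonneg fun k _ => hB3 i j k
  have nd : (0:ℝ) ≤ d := by positivity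
  have n2 : 0 ≤ d * S2 := by positivity
  have n3 : 0 ≤ d * S3 := by positivity
  refine base_smooth (B := B0 + (d * S2 + 2 * S1) + (d * S3 + 2 * S2)) hα (by positivity) g0 g1 (fun i j x => ?_) hper
    (fun x => (b0 x).trans (by linarith)) (fun i x => (b1 i x).trans (by linarith [le1 i]))
    (fun i j x => (b2 i j x).trans (by linarith [le2 i j]))
    (fun i x y => (hol_of_lip hα hα1.le n2 (fun x => (b1 i x).trans (le1 i)) (fun x y => (g1 i).lip hS2' (fun j x => (b2 i j x).trans (le2 i j)) x y) x y).trans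
      (mul_le_mul_of_nonneg_right (by linarith) (by positivity)))
    (fun i j x y => (hol_of_lip hα hα1.le n3 (fun x => (b2 i j x).trans (le2 i j)) (fun x y => (g2 i j).lip hS3' (fun k x => (b3 i j k x).trans (le3 i j k)) x y) x y).trans
      (mul_le_mul_of_nonneg_right (by linarith) (by positivity)))
  have hs := (hf.contDiffAt (x := x)).isSymmSndFDerivAt (by simp; norm_num)
  have hd : Differentiable ℝ (fderiv ℝ f) := (hf.fderiv_right (m := 2) (by norm_num)).differentiable (by norm_num)
  have e : ∀ i j, pd d j (pd d i f) x = fderiv ℝ (fderiv ℝ f) x (Pi.single j 1) (Pi.single i 1) := fun i j => by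
    change fderiv ℝ (fun y => fderiv ℝ f y (Pi.single i 1)) x (Pi.single j 1) = _
    rw [fderiv_clm_apply (hd x) (differentiableAt_const _)]
    simp
  rw [e, e]
  exact hs _ _

open scoped Convolution in
theorem mollify {α B : ℝ} (hα : 0 < α) {f : E d → ℝ} (hper : ZPer d f) (hB : ∀ x, |f x| ≤ B)
    (hf : ∀ x y, |f x - f y| ≤ B * dist x y ^ α) {r : ℝ} (hr : 0 < r) :
    ∃ g : E d → ℝ, ContDiff ℝ 3 g ∧ ZPer d g ∧ (∀ x, |g x| ≤ B) ∧ (∀ x y, |g x - g y| ≤ B * dist x y ^ α) ∧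
      ∀ x, |g x - f x| ≤ B * r ^ α := by
  have hfc : Continuous f := holder_continuous hα hf
  have hB0 : 0 ≤ B := (abs_nonneg _).trans (hB 0)
  let φ : ContDiffBump (0 : E d) := ⟨r / 2, r, by positivity, by linarith⟩
  let k : E d → ℝ := φ.normed volume
  have hk0 : ∀ x, 0 ≤ k x := fun x => φ.nonneg_normed x
  have hk1 : ∫ x, k x = 1 := φ.integral_normed
  have hkc : Continuous k := φ.continuous_normed
  have hks : HasCompactSupport k := φ.hasCompactSupport_normed
  have hki : Integrable k := hkc.integrable_of_hasCompactSupport hks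
  have e : ∀ x, (k ⋆[ContinuousLinearMap.lsmul ℝ ℝ, volume] f) x = ∫ t, k t * f (x - t) := fun x => rfl
  have hIntg : ∀ x, Integrable fun t => k t * f (x - t) := fun x =>
    (hkc.mul (hfc.comp (by fun_prop : Continuous fun t : E d => x - t))).integrable_of_hasCompactSupport hks.mul_right
  have bnd : ∀ (F : E d → ℝ) (S : ℝ), (∀ t, |F t| ≤ S) → |∫ t, k t * F t| ≤ S := by
    intro F S hF
    have := norm_integral_le_of_norm_le (f := fun t => k t * F t) (g := fun t => k t * S) (hki.mul_const S)
      (Eventually.of_forall fun t => by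
        rw [norm_mul, Real.norm_of_nonneg (hk0 t)]
        exact mul_le_mul_of_nonneg_left (hF t) (hk0 t))
    rwa [integral_mul_const, hk1, one_mul] at this
  refine ⟨k ⋆[ContinuousLinearMap.lsmul ℝ ℝ, volume] f, ?_, ?_, ?_, ?_, ?_⟩
  · exact hks.contDiff_convolution_left _ φ.contDiff_normed hfc.locallyIntegrable
  · intro x n
    rw [e, e]
    congr 1; funext t
    rw [show x + (fun i => (n i : ℝ)) - t = (x - t) + fun i => (n i : ℝ) by abel, hper]
  · intro x; rw [e]; exact bnd _ _ fun t => hB _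
  · intro x y
    rw [e, e, ← integral_sub (hIntg x) (hIntg y)]
    simp only [← mul_sub]
    refine bnd _ _ fun t => ?_
    have := hf (x - t) (y - t)
    rwa [dist_sub_right] at this
  · intro x
    rw [← Real.dist_eq]
    refine φ.dist_normed_convolution_le hfc.aestronglyMeasurable fun y hy => ?_
    rw [Real.dist_eq]
    refine (hf y x).trans ?_
    have : dist y x ≤ r := (Metric.mem_ball.1 hy).le
    gcongr

theorem base_solve (d : ℕ) {α : ℝ} (hα : 0 < α) (hα1 : α < 1) :
    ∃ C, 0 ≤ C ∧ ∀ (B : ℝ), 0 < B → ∀ f : E d → ℝ, ZPer d f →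
      (∀ x, |f x| ≤ B) → (∀ x y, |f x - f y| ≤ B * dist x y ^ α) → ∃ u p q, C2A α u p q ∧ (∀ x, u x - ∑ i, q i i x = f x) ∧
      (∀ x, |u x| ≤ B) ∧ (∀ i x, |p i x| ≤ C * B) ∧ (∀ i j x, |q i j x| ≤ C * B) ∧
      ∀ i j x y, |q i j x - q i j y| ≤ C * B * dist x y ^ α := by
  obtain ⟨C, hC, hap⟩ := base_apriori d hα hα1
  refine ⟨C, hC, fun B hB f hper hf1 hf2 => ?_⟩
  choose g gc gper g1 g2 g3 using fun n : ℕ => mollify hα hper hf1 hf2 (r := ((n:ℝ) + 1)⁻¹) (by positivity)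
  choose u p q hu he using fun n => smooth_data hα hα1 (gc n) (gper n)
  have hap' := fun n => hap B hB (u n) (p n) (q n) (g n) (hu n) (he n) (g1 n) (g2 n)
  have bu := fun n => base_max (hu n) (he n) (g1 n)
  have bp := fun n => (hap' n).1
  have bq := fun n => (hap' n).2.1
  have hq := fun n => (hap' n).2.2
  have tu := fun x => tendsto_ulim (fun n => bu n x)
  have tp := fun i x => tendsto_ulim (fun n => bp n i x)
  have tq := fun i j x => tendsto_ulim (fun n => bq n i j x)
  have tg : ∀ x, Tendsto (fun n => g n x) uf (𝓝 (f x)) := by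
    intro x
    rw [tendsto_iff_dist_tendsto_zero]
    have ht : Tendsto (fun n : ℕ => ((n:ℝ) + 1)⁻¹) uf (𝓝 0) := by
      refine Tendsto.mono_left ?_ uf_le
      exact tendsto_inv_atTop_zero.comp (tendsto_atTop_add_const_right _ _ tendsto_natCast_atTop_atTop)
    have := (ht.rpow_const (p := α) (Or.inr hα.le)).const_mul B
    rw [Real.zero_rpow hα.ne', mul_zero] at this
    exact squeeze_zero (fun _ => dist_nonneg) (fun n => g3 n x) this
  have hp2 : ∀ n i x y, |p n i x - p n i y| ≤ (d * (C * B) + 2 * (C * B)) * dist x y ^ α := fun n i x y =>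
    hol_of_lip hα hα1.le (by positivity) (bp n i) (fun x y => (hu n).lipp (by positivity) (bq n) i x y) x y
  refine ⟨fun x => ulim fun n => u n x, fun i x => ulim fun n => p n i x, fun i j x => ulim fun n => q n i j x,
    ⟨fun x k => by simp only [(hu _).per x k], HasGrad.of_tendsto (by positivity) hα (fun n => (hu n).gu) hp2 tu tp,
      fun i => HasGrad.of_tendsto (by positivity) hα (fun n => (hu n).gp i) (fun n => hq n i) (tp i) (tq i),
      fun i j x => by simp only [(hu _).sym i j], C * B, fun i j => holder_of_tendsto (fun n => hq n i j) (tq i j)⟩,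
    fun x => ?_, fun x => le_of_tendsto' (tu x).abs fun n => bu n x, fun i x => le_of_tendsto' (tp i x).abs fun n => bp n i x,
    fun i j x => le_of_tendsto' (tq i j x).abs fun n => bq n i j x, fun i j => holder_of_tendsto (fun n => hq n i j) (tq i j)⟩
  refine tendsto_nhds_unique ((tu x).sub (tendsto_finsetSum Finset.univ fun i _ => tq i i x)) ?_
  simp only [he]
  exact tg x

end MFG

end S10

section S11

open MeasureTheory Set Filter Topology

namespace MFG
variable {d : ℕ}

open scoped ENNReal

abbrev Amb (d : ℕ) := lp (fun _ : E d => ℝ) ∞ × lp (fun _ : E d × E d => ℝ) ∞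

/-- the Banach space of periodic Hölder functions -/
noncomputable def YS (d : ℕ) (α : ℝ) : Submodule ℝ (Amb d) where
  carrier := {F | (∀ x y, F.1 x - F.1 y = F.2 (x, y) * dist x y ^ α) ∧ (∀ x, F.2 (x, x) = 0) ∧
    ∀ (x : E d) (k : Fin d → ℤ), F.1 (x + fun i => (k i : ℝ)) = F.1 x}
  add_mem' := by
    rintro F G ⟨h1, h2, h3⟩ ⟨h4, h5, h6⟩
    refine ⟨fun x y => ?_, fun x => ?_, fun x k => ?_⟩
    · have a := h1 x y
      have b := h4 x y
      simp only [Prod.fst_add, Prod.snd_add, lp.coeFn_add, Pi.add_apply]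
      linarith
    · simp [h2, h5]
    · simp [h3, h6]
  zero_mem' := by
    refine ⟨fun x y => ?_, fun x => ?_, fun x k => ?_⟩ <;> simp
  smul_mem' := by
    rintro c F ⟨h1, h2, h3⟩
    refine ⟨fun x y => ?_, fun x => ?_, fun x k => ?_⟩
    · have a := h1 x y
      simp only [Prod.smul_fst, Prod.smul_snd, lp.coeFn_smul, Pi.smul_apply, smul_eq_mul]
      rw [← mul_sub, a]; ring
    · simp [h2]
    · simp [h3]

def Y (d : ℕ) (α : ℝ) : Type := ↥(YS d α)

noncomputable instance instYN (d : ℕ) (α : ℝ) : NormedAddCommGroup (Y d α) := inferInstanceAs (NormedAddCommGroup ↥(YS d α))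

noncomputable instance instYS (d : ℕ) (α : ℝ) : NormedSpace ℝ (Y d α) := inferInstanceAs (NormedSpace ℝ ↥(YS d α))

/-- evaluation -/
noncomputable def ev {α : ℝ} (f : Y d α) (x : E d) : ℝ := f.1.1 x

variable {α : ℝ}

theorem ev_add (f g : Y d α) (x : E d) : ev (f + g) x = ev f x + ev g x := rfl
theorem ev_sub (f g : Y d α) (x : E d) : ev (f - g) x = ev f x - ev g x := rfl
theorem ev_neg (f : Y d α) (x : E d) : ev (-f) x = - ev f x := rfl
theorem ev_smul (c : ℝ) (f : Y d α) (x : E d) : ev (c • f) x = c * ev f x := rfl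
theorem ev_zero (x : E d) : ev (0 : Y d α) x = 0 := rfl

theorem ev_abs (f : Y d α) (x : E d) : |ev f x| ≤ ‖f‖ :=
  (lp.norm_apply_le_norm (p := ∞) (by simp) f.1.1 x).trans (norm_fst_le f.1)

theorem ev_hol (f : Y d α) (x y : E d) : |ev f x - ev f y| ≤ ‖f‖ * dist x y ^ α := by
  have h := f.2.1 x y
  rw [ev, ev, h, abs_mul, abs_of_nonneg (by positivity : 0 ≤ dist x y ^ α)]
  gcongr
  exact (lp.norm_apply_le_norm (p := ∞) (by simp) f.1.2 (x, y)).trans (norm_snd_le f.1)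

theorem ev_per (f : Y d α) : ZPer d (ev f) := f.2.2.2

theorem ev_cont (hα : 0 < α) (f : Y d α) : Continuous (ev f) := holder_continuous hα (ev_hol f)

theorem Y_ext {f g : Y d α} (h : ∀ x, ev f x = ev g x) (hα : 0 < α) : f = g := by
  apply Subtype.ext
  have h1 : f.1.1 = g.1.1 := lp.ext (funext h)
  refine Prod.ext h1 (lp.ext (funext fun t => ?_))
  obtain ⟨x, y⟩ := t
  by_cases hxy : x = y
  · subst hxy; rw [f.2.2.1, g.2.2.1]
  · have a := f.2.1 x y
    have b := g.2.1 x y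
    rw [h1] at a
    have : 0 < dist x y ^ α := Real.rpow_pos_of_pos (dist_pos.2 hxy) _
    exact mul_right_cancel₀ this.ne' (a.symm.trans b)

theorem Y_norm_le (f : Y d α) {C : ℝ} (hC : 0 ≤ C) (h1 : ∀ x, |ev f x| ≤ C)
    (h2 : ∀ x y, |ev f x - ev f y| ≤ C * dist x y ^ α) : ‖f‖ ≤ C := by
  change ‖f.1‖ ≤ C
  rw [Prod.norm_def]
  refine max_le (lp.norm_le_of_forall_le hC h1) (lp.norm_le_of_forall_le hC ?_)
  rintro ⟨x, y⟩
  by_cases hxy : x = y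
  · subst hxy; rw [f.2.2.1]; simpa
  · have := h2 x y
    have hp : 0 < dist x y ^ α := Real.rpow_pos_of_pos (dist_pos.2 hxy) _
    rw [ev, ev, f.2.1, abs_mul, abs_of_pos hp] at this
    exact le_of_mul_le_mul_right this hp

theorem Y_exists {f : E d → ℝ} (hper : ZPer d f) (C : ℝ) (h1 : ∀ x, |f x| ≤ C)
    (h2 : ∀ x y, |f x - f y| ≤ C * dist x y ^ α) : ∃ F : Y d α, ∀ x, ev F x = f x := by
  classical
  have hC : 0 ≤ C := (abs_nonneg _).trans (h1 0)
  let G : E d × E d → ℝ := fun t => if t.1 = t.2 then 0 else (f t.1 - f t.2) / dist t.1 t.2 ^ α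
  have hF : Memℓp f ∞ := memℓp_infty ⟨C, by rintro _ ⟨x, rfl⟩; exact h1 x⟩
  have hG : Memℓp G ∞ := memℓp_infty ⟨C, by
    rintro _ ⟨⟨x, y⟩, rfl⟩
    simp only [G]
    split_ifs with h
    · simpa
    · have hp : 0 < dist x y ^ α := Real.rpow_pos_of_pos (dist_pos.2 h) _
      rw [Real.norm_eq_abs, abs_div, abs_of_pos hp, div_le_iff₀ hp]
      exact h2 x y⟩
  refine ⟨⟨(⟨f, hF⟩, ⟨G, hG⟩), fun x y => ?_, fun x => ?_, hper⟩, fun x => rfl⟩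
  · change f x - f y = G (x, y) * _
    simp only [G]
    split_ifs with h
    · subst h; simp
    · have hp : 0 < dist x y ^ α := Real.rpow_pos_of_pos (dist_pos.2 h) _
      rw [div_mul_cancel₀ _ hp.ne']
  · change G (x, x) = 0
    simp [G]

instance instYC (d : ℕ) (α : ℝ) : CompleteSpace (Y d α) := by
  have hc1 : ∀ x, Continuous fun F : Amb d => F.1 x := fun x =>
    (LipschitzWith.of_dist_le_mul (K := 1) (f := fun F : lp (fun _ : E d => ℝ) ∞ => F x) fun F G => by
      rw [NNReal.coe_one, one_mul, dist_eq_norm, dist_eq_norm]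
      exact lp.norm_apply_le_norm (p := ∞) (by simp) (F - G) x).continuous.comp continuous_fst
  have hc2 : ∀ x, Continuous fun F : Amb d => F.2 x := fun x =>
    (LipschitzWith.of_dist_le_mul (K := 1) (f := fun F : lp (fun _ : E d × E d => ℝ) ∞ => F x) fun F G => by
      rw [NNReal.coe_one, one_mul, dist_eq_norm, dist_eq_norm]
      exact lp.norm_apply_le_norm (p := ∞) (by simp) (F - G) x).continuous.comp continuous_snd
  have : IsClosed (YS d α : Set (Amb d)) := by
    have e : (YS d α : Set (Amb d)) = (⋂ x, ⋂ y, {F : Amb d | F.1 x - F.1 y = F.2 (x, y) * dist x y ^ α}) ∩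
        ((⋂ x, {F : Amb d | F.2 (x, x) = 0}) ∩ ⋂ x, ⋂ k : Fin d → ℤ, {F : Amb d | F.1 (x + fun i => (k i : ℝ)) = F.1 x}) := by
      ext F; simp only [mem_inter_iff, mem_iInter, mem_setOf_eq]; rfl
    rw [e]
    refine IsClosed.inter (isClosed_iInter fun x => isClosed_iInter fun y => isClosed_eq ((hc1 x).sub (hc1 y)) ((hc2 _).mul_const _))
      (IsClosed.inter (isClosed_iInter fun x => isClosed_eq (hc2 _) continuous_const)
        (isClosed_iInter fun x => isClosed_iInter fun k => isClosed_eq (hc1 _) (hc1 _)))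
  exact this.completeSpace_coe

/-- evaluation as a continuous linear map -/
noncomputable def evL (x : E d) : Y d α →L[ℝ] ℝ :=
  LinearMap.mkContinuous ⟨⟨fun f => ev f x, fun f g => ev_add f g x⟩, fun c f => ev_smul c f x⟩ 1
    (fun f => by rw [one_mul]; exact ev_abs f x)

theorem evL_apply (x : E d) (f : Y d α) : evL x f = ev f x := rfl

theorem ev_sum {ι : Type*} (s : Finset ι) (f : ι → Y d α) (x : E d) : ev (∑ i ∈ s, f i) x = ∑ i ∈ s, ev (f i) x := by
  simp only [← evL_apply, map_sum]

/-- construct a continuous linear map from its values -/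
theorem Y_clm (hα : 0 < α) (T : Y d α → E d → ℝ) (C : ℝ) (hC : 0 ≤ C) (hadd : ∀ f g x, T (f + g) x = T f x + T g x)
    (hsm : ∀ (c : ℝ) f x, T (c • f) x = c * T f x) (hper : ∀ f, ZPer d (T f)) (h1 : ∀ f x, |T f x| ≤ C * ‖f‖)
    (h2 : ∀ f x y, |T f x - T f y| ≤ C * ‖f‖ * dist x y ^ α) : ∃ L : Y d α →L[ℝ] Y d α, ∀ f x, ev (L f) x = T f x := by
  choose L hL using fun f => Y_exists (hper f) (C * ‖f‖) (h1 f) (h2 f)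
  refine ⟨LinearMap.mkContinuous ⟨⟨L, fun f g => Y_ext (fun x => ?_) hα⟩, fun c f => Y_ext (fun x => ?_) hα⟩ C (fun f => ?_), hL⟩
  · rw [ev_add, hL, hL, hL, hadd]
  · simp only [RingHom.id_apply]; rw [ev_smul, hL, hL, hsm]
  · exact Y_norm_le _ (by positivity) (fun x => by change |ev (L f) x| ≤ _; rw [hL]; exact h1 f x)
      (fun x y => by change |ev (L f) x - ev (L f) y| ≤ _; rw [hL, hL]; exact h2 f x y)

theorem mul_hol {X : Type*} [PseudoMetricSpace X] {f g : X → ℝ} {A B : ℝ} (f1 : ∀ x, |f x| ≤ A) (g1 : ∀ x, |g x| ≤ B)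
    (f2 : ∀ x y, |f x - f y| ≤ A * dist x y ^ α) (g2 : ∀ x y, |g x - g y| ≤ B * dist x y ^ α) (x y : X) :
    |f x * g x - f y * g y| ≤ 2 * A * B * dist x y ^ α := by
  rw [show f x * g x - f y * g y = f x * (g x - g y) + (f x - f y) * g y by ring]
  refine (abs_add_le _ _).trans ?_
  rw [abs_mul, abs_mul]
  have hA : 0 ≤ A := (abs_nonneg _).trans (f1 x)
  have hp : 0 ≤ dist x y ^ α := by positivity
  have e1 := mul_le_mul (f1 x) (g2 x y) (abs_nonneg _) hA
  have e2 := mul_le_mul (f2 x y) (g1 y) (abs_nonneg _) (by positivity)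
  linarith

theorem mulY_exists (d : ℕ) (hα : 0 < α) : ∃ m : Y d α →L[ℝ] Y d α →L[ℝ] Y d α, ∀ f g x, ev (m f g) x = ev f x * ev g x := by
  have hp : ∀ f g : Y d α, ZPer d fun x => ev f x * ev g x := fun f g x k => by
    simp only [ev_per f x k, ev_per g x k]
  have b1 : ∀ (f g : Y d α) x, |ev f x * ev g x| ≤ 2 * ‖f‖ * ‖g‖ := fun f g x => by
    rw [abs_mul]
    have := mul_le_mul (ev_abs f x) (ev_abs g x) (abs_nonneg _) (norm_nonneg f)
    nlinarith [mul_nonneg (norm_nonneg f) (norm_nonneg g)]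
  have b2 := fun (f g : Y d α) => mul_hol (ev_abs f) (ev_abs g) (ev_hol f) (ev_hol g)
  choose m hm using fun f g => Y_exists (hp f g) (2 * ‖f‖ * ‖g‖) (b1 f g) (b2 f g)
  refine ⟨LinearMap.mkContinuous₂ (LinearMap.mk₂ ℝ m (fun f g h => Y_ext (fun x => ?_) hα) (fun c f g => Y_ext (fun x => ?_) hα)
    (fun f g h => Y_ext (fun x => ?_) hα) (fun c f g => Y_ext (fun x => ?_) hα)) 2 (fun f g => ?_), hm⟩
  · simp only [hm, ev_add]; ring
  · simp only [hm, ev_smul]; ring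
  · simp only [hm, ev_add]; ring
  · simp only [hm, ev_smul]; ring
  · exact Y_norm_le _ (by positivity) (fun x => by change |ev (m f g) x| ≤ _; rw [hm]; exact b1 f g x)
      (fun x y => by change |ev (m f g) x - ev (m f g) y| ≤ _; rw [hm, hm]; exact b2 f g x y)

noncomputable def mulY (d : ℕ) (hα : 0 < α) : Y d α →L[ℝ] Y d α →L[ℝ] Y d α := (mulY_exists d hα).choose

theorem ev_mulY (hα : 0 < α) (f g : Y d α) (x : E d) : ev (mulY d hα f g) x = ev f x * ev g x :=
  (mulY_exists d hα).choose_spec f g x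

theorem const_exists (d : ℕ) (α c : ℝ) : ∃ F : Y d α, ∀ x, ev F x = c :=
  Y_exists (f := fun _ => c) (fun _ _ => rfl) |c| (fun _ => le_rfl) (fun x y => by simp; positivity)

theorem poly_exists (d : ℕ) (hα : 0 < α) (P : Polynomial ℝ) : ∃ Ψ : Y d α → Y d α, ContDiff ℝ 1 Ψ ∧ ∀ f x, ev (Ψ f) x = P.eval (ev f x) := by
  induction P using Polynomial.induction_on with
  | C a =>
    obtain ⟨F, hF⟩ := const_exists d α a
    exact ⟨fun _ => F, contDiff_const, fun f x => by simp [hF]⟩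
  | add p q hp hq =>
    obtain ⟨F, c1, h1⟩ := hp
    obtain ⟨G, c2, h2⟩ := hq
    exact ⟨fun f => F f + G f, c1.add c2, fun f x => by rw [ev_add, h1, h2, Polynomial.eval_add]⟩
  | monomial n a h =>
    obtain ⟨F, c1, h1⟩ := h
    have c2 : ContDiff ℝ 1 fun f => mulY d hα (F f) := (mulY d hα).contDiff.comp c1
    refine ⟨fun f => mulY d hα (F f) f, c2.clm_apply contDiff_id, fun f x => ?_⟩
    rw [ev_mulY, h1]
    simp [pow_succ, mul_assoc]

theorem C2A.sub {α : ℝ} {u v : E d → ℝ} {p q r s} (h : C2A α u p q) (h' : C2A α v r s) :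
    C2A α (fun x => u x - v x) (fun i x => p i x - r i x) (fun i j x => q i j x - s i j x) :=
  ⟨fun x k => by simp only [h.per x k, h'.per x k], h.gu.sub h'.gu, fun i => (h.gp i).sub (h'.gp i),
    fun i j x => by rw [h.sym, h'.sym], by
    obtain ⟨H, hH⟩ := h.hol
    obtain ⟨G, hG⟩ := h'.hol
    exact ⟨H + G, fun i j x y => by
      rw [sub_sub_sub_comm, add_mul]; exact (abs_sub _ _).trans (add_le_add (hH i j x y) (hG i j x y))⟩⟩

theorem C2A.smul {α : ℝ} {u : E d → ℝ} {p q} (h : C2A α u p q) (c : ℝ) :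
    C2A α (fun x => c * u x) (fun i x => c * p i x) (fun i j x => c * q i j x) :=
  ⟨fun x k => by simp only [h.per x k], h.gu.const_mul c, fun i => (h.gp i).const_mul c,
    fun i j x => by rw [h.sym], by
    obtain ⟨H, hH⟩ := h.hol
    exact ⟨|c| * H, fun i j x y => by
      rw [← mul_sub, abs_mul, mul_assoc]; gcongr; exact hH i j x y⟩⟩

theorem C2A.add {α : ℝ} {u v : E d → ℝ} {p q r s} (h : C2A α u p q) (h' : C2A α v r s) :
    C2A α (fun x => u x + v x) (fun i x => p i x + r i x) (fun i j x => q i j x + s i j x) := by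
  have := h.sub h'.neg
  simpa only [sub_neg_eq_add] using this

theorem C2A.zero {α : ℝ} : C2A α (fun _ : E d => 0) (fun _ _ => 0) (fun _ _ _ => 0) :=
  ⟨fun _ _ => rfl, hasGrad_const 0, fun _ => hasGrad_const 0, fun _ _ _ => rfl, 0, fun _ _ _ _ => by simp⟩

theorem base_unique {α : ℝ} {u v : E d → ℝ} {p q r s} {f : E d → ℝ} (h : C2A α u p q) (h' : C2A α v r s)
    (e1 : ∀ x, u x - ∑ i, q i i x = f x) (e2 : ∀ x, v x - ∑ i, s i i x = f x) : u = v ∧ p = r ∧ q = s := by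
  have h1 : u = v := by
    funext x
    have := base_max (B := 0) (f := fun _ => 0) (h.sub h') (fun x => by
      rw [Finset.sum_sub_distrib]; linarith [e1 x, e2 x]) (fun x => by simp) x
    exact sub_eq_zero.1 (abs_eq_zero.1 (le_antisymm this (abs_nonneg _)))
  subst h1
  have h2 : p = r := funext fun i => (h.gu.pd i).symm.trans (h'.gu.pd i)
  subst h2
  exact ⟨rfl, rfl, funext fun i => funext fun j => ((h.gp i).pd j).symm.trans ((h'.gp i).pd j)⟩

/-- the resolvent operators on `Y` -/
theorem R_exists (d : ℕ) (hα : 0 < α) (hα1 : α < 1) : ∃ (R : Y d α →L[ℝ] Y d α) (Rp : Fin d → Y d α →L[ℝ] Y d α)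
    (Rq : Fin d → Fin d → Y d α →L[ℝ] Y d α), ∀ f, C2A α (ev (R f)) (fun i => ev (Rp i f)) (fun i j => ev (Rq i j f)) ∧
      ∀ x, ev (R f) x - ∑ i, ev (Rq i i f) x = ev f x := by
  obtain ⟨C, hC, hs⟩ := base_solve d hα hα1
  have key : ∀ f : Y d α, ∃ u p q, C2A α u p q ∧ (∀ x, u x - ∑ i, q i i x = ev f x) ∧
      (∀ x, |u x| ≤ ‖f‖) ∧ (∀ i x, |p i x| ≤ C * ‖f‖) ∧ (∀ i j x, |q i j x| ≤ C * ‖f‖) ∧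
      ∀ i j x y, |q i j x - q i j y| ≤ C * ‖f‖ * dist x y ^ α := by
    intro f
    rcases eq_or_ne f 0 with rfl | hf
    · exact ⟨_, _, _, C2A.zero, fun x => by simp [ev_zero], by simp, by simp, by simp, by simp⟩
    · exact hs ‖f‖ (norm_pos_iff.2 hf) (ev f) (ev_per f) (ev_abs f) (ev_hol f)
  choose u p q h he b0 b1 b2 b3 using key
  have add : ∀ f g, _ := fun f g => base_unique (h (f + g)) ((h f).add (h g)) (he (f + g)) (fun x => by
    rw [ev_add, ← he f x, ← he g x, Finset.sum_add_distrib]; ring)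
  have smul : ∀ (c : ℝ) f, _ := fun c f => base_unique (h (c • f)) ((h f).smul c) (he (c • f)) (fun x => by
    rw [ev_smul, ← he f x, mul_sub, Finset.mul_sum])
  have lp : ∀ f i x y, |p f i x - p f i y| ≤ (d * C + 2 * C) * ‖f‖ * dist x y ^ α := fun f i x y =>
    (hol_of_lip hα hα1.le (by positivity) (b1 f i) (fun x y => (h f).lipp (by positivity) (b2 f) i x y) x y).trans_eq (by ring)
  have lu : ∀ f x y, |u f x - u f y| ≤ (d * C + 2) * ‖f‖ * dist x y ^ α := fun f x y =>
    (hol_of_lip hα hα1.le (by positivity) (b0 f) (fun x y => (h f).gu.lip (by positivity) (b1 f) x y) x y).trans_eq (by ring)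
  have n1 : 0 ≤ (d:ℝ) * C := by positivity
  obtain ⟨R, hR⟩ := Y_clm hα u (d * C + 2) (by positivity) (fun f g x => congrFun (add f g).1 x)
    (fun c f x => congrFun (smul c f).1 x) (fun f => (h f).per)
    (fun f x => (b0 f x).trans (by nlinarith [norm_nonneg f, mul_nonneg n1 (norm_nonneg f)])) lu
  choose Rp hRp using fun i => Y_clm hα (fun f => p f i) (d * C + 2 * C) (by positivity)
    (fun f g x => congrFun (congrFun (add f g).2.1 i) x)
    (fun c f x => congrFun (congrFun (smul c f).2.1 i) x) (fun f => (h f).perp i)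
    (fun f x => (b1 f i x).trans (mul_le_mul_of_nonneg_right (by linarith) (norm_nonneg f))) (fun f => lp f i)
  choose Rq hRq using fun i j => Y_clm hα (fun f => q f i j) C hC
    (fun f g x => congrFun (congrFun (congrFun (add f g).2.2 i) j) x)
    (fun c f x => congrFun (congrFun (congrFun (smul c f).2.2 i) j) x) (fun f => (h f).perq i j)
    (fun f x => b2 f i j x) (fun f => b3 f i j)
  refine ⟨R, Rp, Rq, fun f => ?_⟩
  have e1 : ev (R f) = u f := funext fun x => hR f x
  have e2 : (fun i => ev (Rp i f)) = p f := funext fun i => funext fun x => hRp i f x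
  have e3 : (fun i j => ev (Rq i j f)) = q f := funext fun i => funext fun j => funext fun x => hRq i j f x
  refine ⟨by rw [e1, e2, e3]; exact h f, fun x => ?_⟩
  rw [← he f x, hR]
  simp only [hRq]

end MFG

end S11

section S12

open MeasureTheory Set Filter Topology

namespace MFG
variable {d : ℕ} {α : ℝ}

theorem C2A.of_tendsto (hα : 0 < α) {u : ℕ → E d → ℝ} {p : ℕ → Fin d → E d → ℝ} {q : ℕ → Fin d → Fin d → E d → ℝ}
    (h : ∀ n, C2A α (u n) (p n) (q n)) {K : ℝ} (b0 : ∀ n x, |u n x| ≤ K) (b1 : ∀ n i x, |p n i x| ≤ K)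
    (b2 : ∀ n i j x, |q n i j x| ≤ K) (b3 : ∀ n i j x y, |q n i j x - q n i j y| ≤ K * dist x y ^ α) :
    ∃ u' p' q', C2A α u' p' q' ∧ (∀ x, Tendsto (fun n => u n x) uf (𝓝 (u' x))) ∧
      (∀ i x, Tendsto (fun n => p n i x) uf (𝓝 (p' i x))) ∧
      (∀ i j x, Tendsto (fun n => q n i j x) uf (𝓝 (q' i j x))) := by
  have hK : 0 ≤ K := (abs_nonneg _).trans (b0 0 0)
  have t0 : ∀ x, Tendsto (fun n => u n x) uf (𝓝 (ulim fun n => u n x)) := fun x => tendsto_ulim fun n => b0 n x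
  have t1 : ∀ i x, Tendsto (fun n => p n i x) uf (𝓝 (ulim fun n => p n i x)) := fun i x => tendsto_ulim fun n => b1 n i x
  have t2 : ∀ i j x, Tendsto (fun n => q n i j x) uf (𝓝 (ulim fun n => q n i j x)) := fun i j x => tendsto_ulim fun n => b2 n i j x
  refine ⟨_, _, _, ⟨fun x k => ?_, HasGrad.of_tendsto (B := d * K) (α := 1) (by positivity) one_pos (fun n => (h n).gu)
    (fun n i x y => ?_) t0 t1, fun i => HasGrad.of_tendsto hK hα (fun n => (h n).gp i) (fun n j => b3 n i j) (t1 i) (t2 i),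
    fun i j x => ?_, K, fun i j x y => holder_of_tendsto (fun n => b3 n i j) (t2 i j) x y⟩, t0, t1, t2⟩
  · congr 1; funext n; exact (h n).per x k
  · rw [Real.rpow_one]; exact (h n).lipp hK (b2 n) i x y
  · congr 1; funext n; exact (h n).sym i j x

theorem unif_zero (hα : 0 < α) {v : ℕ → E d → ℝ} {H : ℝ} (hper : ∀ n, ZPer d (v n))
    (hH : ∀ n x y, |v n x - v n y| ≤ H * dist x y ^ α) (h0 : ∀ x, Tendsto (fun n => v n x) uf (𝓝 0)) {η : ℝ} (hη : 0 < η) :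
    ∀ᶠ n in uf, ∀ x, |v n x| ≤ η := by
  choose X hX hm using fun n => ZPer.exists_max (u := fun x => |v n x|) (fun x k => by simp only [hper n x k])
    (holder_continuous hα (hH n)).abs
  obtain ⟨l, -, hl⟩ := exists_ulim_compact (isCompact_Icc (a := (0 : E d)) (b := 1)) hX
  have t1 : Tendsto (fun n => |v n l| + H * dist (X n) l ^ α) uf (𝓝 0) := by
    have a : Tendsto (fun n => dist (X n) l ^ α) uf (𝓝 0) := by
      have := (tendsto_iff_dist_tendsto_zero.1 hl).rpow_const (p := α) (Or.inr hα.le)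
      rwa [Real.zero_rpow hα.ne'] at this
    simpa using (h0 l).abs.add (a.const_mul H)
  filter_upwards [t1.eventually (gt_mem_nhds hη)] with n hn x
  have h1 := hm n x
  have h2 := hH n (X n) l
  have h3 := abs_sub_abs_le_abs_sub (v n (X n)) (v n l)
  linarith

/-- abbreviation for the resolvent operators -/
def IsR (α : ℝ) (R : Y d α →L[ℝ] Y d α) (Rp : Fin d → Y d α →L[ℝ] Y d α) (Rq : Fin d → Fin d → Y d α →L[ℝ] Y d α) : Prop :=
  ∀ f, C2A α (ev (R f)) (fun i => ev (Rp i f)) (fun i j => ev (Rq i j f)) ∧ ∀ x, ev (R f) x - ∑ i, ev (Rq i i f) x = ev f x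

theorem cont_method {X : Type*} [NormedAddCommGroup X] [NormedSpace ℝ X] [CompleteSpace X] [Nontrivial X] (T : X →L[ℝ] X)
    {C : ℝ} (hC : 0 < C) (h : ∀ s : ℝ, 0 ≤ s → s ≤ 1 → ∀ f : X, ‖f‖ ≤ C * ‖(1 - s) • f + s • T f‖) : IsUnit T := by
  let L : ℝ → X →L[ℝ] X := fun s => (1 - s) • (1 : X →L[ℝ] X) + s • T
  obtain ⟨N, hN⟩ := exists_nat_gt (C * ‖T - 1‖)
  have hN0 : (0:ℝ) < N + 1 := by positivity
  have key : ∀ k : ℕ, k ≤ N + 1 → IsUnit (L (k / (N + 1))) := by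
    intro k
    induction k with
    | zero => intro _; simp [L]
    | succ k ih =>
      intro hk
      obtain ⟨U, hU⟩ := ih (by omega)
      have hs0 : (0:ℝ) ≤ k / (N + 1) := by positivity
      have hs1 : (k:ℝ) / (N + 1) ≤ 1 := by
        rw [div_le_one hN0]; exact_mod_cast (by omega : k ≤ N + 1)
      have hi : ‖(↑U⁻¹ : X →L[ℝ] X)‖ ≤ C := by
        refine ContinuousLinearMap.opNorm_le_bound _ hC.le fun f => ?_
        refine (h _ hs0 hs1 _).trans_eq ?_
        have e : (U : X →L[ℝ] X) ((↑U⁻¹ : X →L[ℝ] X) f) = f := by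
          rw [← ContinuousLinearMap.mul_apply, Units.mul_inv]; rfl
        rw [hU] at e
        simp only [L, ContinuousLinearMap.add_apply, ContinuousLinearMap.smul_apply, ContinuousLinearMap.one_apply] at e
        rw [e]
      have hp : 0 < ‖(↑U⁻¹ : X →L[ℝ] X)‖ := norm_pos_iff.2 (Units.ne_zero _)
      have hd : L ((k + 1 : ℕ) / (N + 1)) - U = (1 / ((N:ℝ) + 1)) • (T - 1) := by
        rw [hU]; simp only [L]; push_cast
        rw [add_div]; module
      refine ⟨U.ofNearby (L ((k + 1 : ℕ) / (N + 1))) ?_, rfl⟩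
      rw [hd, norm_smul, Real.norm_of_nonneg (by positivity)]
      refine lt_of_lt_of_le ?_ (inv_anti₀ hp hi)
      rw [one_div, inv_mul_lt_iff₀ hN0, ← div_eq_mul_inv, lt_div_iff₀ hC]
      linarith
  have := key (N + 1) le_rfl
  push_cast at this
  rw [div_self hN0.ne'] at this
  simpa [L] using this

theorem sum_delta (a : Fin d → Fin d → ℝ) : ∑ i, ∑ j, (if i = j then (1:ℝ) else 0) * a i j = ∑ i, a i i := by
  simp

theorem instYnt (d : ℕ) (α : ℝ) : Nontrivial (Y d α) := by
  obtain ⟨F, hF⟩ := const_exists d α 1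
  refine ⟨F, 0, fun h => ?_⟩
  have := hF 0
  rw [h, ev_zero] at this
  norm_num at this

/-- the linear operator -/
noncomputable def Tlin (hα : 0 < α) (R : Y d α →L[ℝ] Y d α) (Rp : Fin d → Y d α →L[ℝ] Y d α)
    (Rq : Fin d → Fin d → Y d α →L[ℝ] Y d α) (A : Fin d → Fin d → Y d α) (b : Fin d → Y d α) (c : Y d α) (f : Y d α) : Y d α :=
  - (∑ i, ∑ j, mulY d hα (A i j) (Rq i j f)) + ∑ i, mulY d hα (b i) (Rp i f) + mulY d hα c (R f)

theorem ev_Tlin (hα : 0 < α) (R : Y d α →L[ℝ] Y d α) (Rp : Fin d → Y d α →L[ℝ] Y d α)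
    (Rq : Fin d → Fin d → Y d α →L[ℝ] Y d α) (A : Fin d → Fin d → Y d α) (b : Fin d → Y d α) (c : Y d α) (f : Y d α) (x : E d) :
    ev (Tlin hα R Rp Rq A b c f) x = - (∑ i, ∑ j, ev (A i j) x * ev (Rq i j f) x) + ∑ i, ev (b i) x * ev (Rp i f) x +
      ev c x * ev (R f) x := by
  simp only [Tlin, ev_add, ev_neg, ev_sum, ev_mulY]

/-- quantitative step -/
theorem lin_small (hα : 0 < α) (hα1 : α < 1) {R : Y d α →L[ℝ] Y d α} {Rp : Fin d → Y d α →L[ℝ] Y d α}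
    {Rq : Fin d → Fin d → Y d α →L[ℝ] Y d α} (hR : IsR α R Rp Rq) (A : Fin d → Fin d → Y d α) (b : Fin d → Y d α) (c : Y d α)
    {lam : ℝ} (hl : 0 < lam)
    (ell : ∀ x (ξ : Fin d → ℝ), lam * ∑ i, ξ i ^ 2 ≤ ∑ i, ∑ j, ev (A i j) x * ξ j * ξ i) :
    ∃ C, 0 < C ∧ ∀ s : ℝ, 0 ≤ s → s ≤ 1 → ∀ f η, 0 < η → (∀ x, |ev (R f) x| ≤ η) → (∀ i x, |ev (Rp i f) x| ≤ η) →
      (∀ i j x, |ev (Rq i j f) x| ≤ η) → ‖(1 - s) • f + s • Tlin hα R Rp Rq A b c f‖ ≤ η → ‖f‖ ≤ C * η := by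
  set Lam : ℝ := 1 + ∑ i, ∑ j, ‖A i j‖ with hLam
  have hA : ∀ i j, ‖A i j‖ ≤ ∑ i, ∑ j, ‖A i j‖ := fun i j =>
    (Finset.single_le_sum (f := fun j => ‖A i j‖) (fun _ _ => norm_nonneg _) (Finset.mem_univ j)).trans
    (Finset.single_le_sum (f := fun i => ∑ j, ‖A i j‖) (fun _ _ => Finset.sum_nonneg fun _ _ => norm_nonneg _) (Finset.mem_univ i))
  have hA0 : 0 ≤ ∑ i, ∑ j, ‖A i j‖ := Finset.sum_nonneg fun _ _ => Finset.sum_nonneg fun _ _ => norm_nonneg _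
  obtain ⟨C, hC, hS⟩ := schauder_hom d (lam := min 1 lam) (Lam := Lam) hα hα1 (by positivity) (by linarith)
  set M : ℝ := (1 + ∑ i, ‖mulY d hα (b i)‖ + ‖mulY d hα c‖) * (d + 2) + 1 with hM
  have hb0 : 0 ≤ ∑ i, ‖mulY d hα (b i)‖ := Finset.sum_nonneg fun _ _ => norm_nonneg _
  have hM1 : 1 ≤ M := by
    have : 0 ≤ (1 + ∑ i, ‖mulY d hα (b i)‖ + ‖mulY d hα c‖) * (d + 2) := by positivity
    linarith
  refine ⟨(d + 2) + d * (C + 1) * M + 1, by positivity, fun s hs0 hs1 f η hη b0 b1 b2 hL => ?_⟩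
  obtain ⟨h, he⟩ := hR f
  have nR : ‖R f‖ ≤ (d + 2) * η := Y_norm_le _ (by positivity) (fun x => (b0 x).trans (by nlinarith [(Nat.cast_nonneg d : (0:ℝ) ≤ d)]))
    (fun x y => (hol_of_lip hα hα1.le (by positivity) b0 (fun x y => h.gu.lip hη.le b1 x y) x y).trans_eq (by ring))
  have nP : ∀ i, ‖Rp i f‖ ≤ (d + 2) * η := fun i => Y_norm_le _ (by positivity) (fun x => (b1 i x).trans (by nlinarith [(Nat.cast_nonneg d : (0:ℝ) ≤ d)]))
    (fun x y => (hol_of_lip hα hα1.le (by positivity) (b1 i) (fun x y => h.lipp hη.le b2 i x y) x y).trans_eq (by ring))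
  set F : Y d α := (1 - s) • R f + s • (∑ i, mulY d hα (b i) (Rp i f) + mulY d hα c (R f)) -
    ((1 - s) • f + s • Tlin hα R Rp Rq A b c f) with hF
  have nF : ‖F‖ ≤ M * η := by
    have e1 : ‖(1 - s) • R f‖ ≤ (d + 2) * η := by
      rw [norm_smul, Real.norm_of_nonneg (by linarith)]
      exact (mul_le_of_le_one_left (norm_nonneg _) (by linarith)).trans nR
    have e2 : ‖s • (∑ i, mulY d hα (b i) (Rp i f) + mulY d hα c (R f))‖ ≤
        ((∑ i, ‖mulY d hα (b i)‖) + ‖mulY d hα c‖) * ((d + 2) * η) := by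
      rw [norm_smul, Real.norm_of_nonneg hs0]
      refine (mul_le_of_le_one_left (norm_nonneg _) hs1).trans ((norm_add_le _ _).trans ?_)
      rw [add_mul, Finset.sum_mul]
      refine add_le_add ((norm_sum_le _ _).trans (Finset.sum_le_sum fun i _ => ?_)) ?_
      · exact ((mulY d hα (b i)).le_opNorm _).trans (mul_le_mul_of_nonneg_left (nP i) (norm_nonneg _))
      · exact ((mulY d hα c).le_opNorm _).trans (mul_le_mul_of_nonneg_left nR (norm_nonneg _))
    calc ‖F‖ ≤ _ := norm_sub_le _ _
      _ ≤ _ := add_le_add (norm_add_le _ _) hL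
      _ ≤ (d + 2) * η + ((∑ i, ‖mulY d hα (b i)‖) + ‖mulY d hα c‖) * ((d + 2) * η) + η := by linarith
      _ = M * η := by rw [hM]; ring
  have hMη : 0 < M * η := by positivity
  have hq := hS (fun i => ev (Rp i f)) (fun i j => ev (Rq i j f))
    (fun i j x => (1 - s) * (if i = j then 1 else 0) + s * ev (A i j) x) (ev F) (M * η) hMη h.gp h.sym
    (fun i j x => (b2 i j x).trans (by nlinarith)) h.hol (fun x ξ => ?_) (fun i j x => ?_) (fun i j x y => ?_)
    (fun x => ?_) (fun x y => (ev_hol F x y).trans (mul_le_mul_of_nonneg_right nF (by positivity)))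
  · have nQ : ∀ i, ‖Rq i i f‖ ≤ (C + 1) * M * η := fun i => Y_norm_le _ (by positivity)
      (fun x => (b2 i i x).trans (by nlinarith [mul_nonneg hC hMη.le]))
      (fun x y => (hq i i x y).trans (mul_le_mul_of_nonneg_right (by nlinarith) (by positivity)))
    have e : f = R f - ∑ i, Rq i i f := Y_ext (fun x => by rw [ev_sub, ev_sum, he]) hα
    have := Finset.sum_le_sum fun i (_ : i ∈ Finset.univ) => nQ i
    rw [Finset.sum_const, Finset.card_univ, Fintype.card_fin, nsmul_eq_mul] at this
    calc ‖f‖ = ‖R f - ∑ i, Rq i i f‖ := by rw [← e]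
      _ ≤ ‖R f‖ + ∑ i, ‖Rq i i f‖ := (norm_sub_le _ _).trans (add_le_add le_rfl (norm_sum_le _ _))
      _ ≤ (d + 2) * η + d * ((C + 1) * M * η) := add_le_add nR this
      _ ≤ _ := by nlinarith
  · have e : ∑ i, ∑ j, ((1 - s) * (if i = j then 1 else 0) + s * ev (A i j) x) * ξ j * ξ i =
        (1 - s) * ∑ i, ξ i ^ 2 + s * ∑ i, ∑ j, ev (A i j) x * ξ j * ξ i := by
      have e1 := sum_delta (fun i j => (1 - s) * (ξ j * ξ i))
      simp only [Finset.mul_sum]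
      rw [show ∑ i, (1 - s) * ξ i ^ 2 = ∑ i, (1 - s) * (ξ i * ξ i) by simp only [sq], ← e1, ← Finset.sum_add_distrib]
      refine Finset.sum_congr rfl fun i _ => ?_
      rw [← Finset.sum_add_distrib]
      refine Finset.sum_congr rfl fun j _ => by ring
    rw [e]
    have S : 0 ≤ ∑ i, ξ i ^ 2 := Finset.sum_nonneg fun _ _ => sq_nonneg _
    have a1 := mul_le_mul_of_nonneg_right (min_le_left 1 lam) S
    have a2 := (mul_le_mul_of_nonneg_right (min_le_right 1 lam) S).trans (ell x ξ)
    have a3 := mul_le_mul_of_nonneg_left a1 (by linarith : 0 ≤ 1 - s)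
    have a4 := mul_le_mul_of_nonneg_left a2 hs0
    linarith
  · have a1 := (ev_abs (A i j) x).trans (hA i j)
    refine (abs_add_le _ _).trans ?_
    rw [abs_mul, abs_mul, abs_of_nonneg hs0, abs_of_nonneg (by linarith : 0 ≤ 1 - s)]
    have a2 : |(if i = j then (1:ℝ) else 0)| ≤ 1 := by split_ifs <;> simp
    have a3 := mul_le_mul_of_nonneg_left a2 (by linarith : 0 ≤ 1 - s)
    have a4 : s * |ev (A i j) x| ≤ ∑ i, ∑ j, ‖A i j‖ := (mul_le_of_le_one_left (abs_nonneg _) hs1).trans a1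
    linarith
  · rw [add_sub_add_left_eq_sub, ← mul_sub, abs_mul, abs_of_nonneg hs0]
    refine (mul_le_of_le_one_left (abs_nonneg _) hs1).trans ((ev_hol (A i j) x y).trans (mul_le_mul_of_nonneg_right ?_ (by positivity)))
    linarith [hA i j]
  · have e : ∑ i, ∑ j, ((1 - s) * (if i = j then 1 else 0) + s * ev (A i j) x) * ev (Rq i j f) x =
        (1 - s) * ∑ i, ev (Rq i i f) x + s * ∑ i, ∑ j, ev (A i j) x * ev (Rq i j f) x := by
      have e1 := sum_delta (fun i j => (1 - s) * ev (Rq i j f) x)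
      simp only [Finset.mul_sum]
      rw [← e1, ← Finset.sum_add_distrib]
      refine Finset.sum_congr rfl fun i _ => ?_
      rw [← Finset.sum_add_distrib]
      refine Finset.sum_congr rfl fun j _ => by ring
    rw [e, hF]
    simp only [ev_sub, ev_add, ev_smul, ev_sum, ev_mulY, ev_Tlin, ← he x]
    ring

theorem lin_surj (hα : 0 < α) (hα1 : α < 1) {R : Y d α →L[ℝ] Y d α} {Rp : Fin d → Y d α →L[ℝ] Y d α}
    {Rq : Fin d → Fin d → Y d α →L[ℝ] Y d α} (hR : IsR α R Rp Rq) (A : Fin d → Fin d → Y d α) (b : Fin d → Y d α) (c : Y d α)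
    {lam : ℝ} (hl : 0 < lam)
    (ell : ∀ x (ξ : Fin d → ℝ), lam * ∑ i, ξ i ^ 2 ≤ ∑ i, ∑ j, ev (A i j) x * ξ j * ξ i)
    (hinj : ∀ s : ℝ, 0 ≤ s → s ≤ 1 → ∀ φ p q, C2A α φ p q → (∀ x, (1 - s) * (φ x - ∑ i, q i i x) +
      s * (- (∑ i, ∑ j, ev (A i j) x * q i j x) + ∑ i, ev (b i) x * p i x + ev c x * φ x) = 0) → ∀ x, φ x = 0)
    (T : Y d α →L[ℝ] Y d α) (hT : ∀ f, T f = Tlin hα R Rp Rq A b c f) : Function.Surjective T := by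
  haveI := instYnt d α
  suffices h : ∃ C, 0 < C ∧ ∀ s : ℝ, 0 ≤ s → s ≤ 1 → ∀ f, ‖f‖ ≤ C * ‖(1 - s) • f + s • T f‖ by
    obtain ⟨C, hC, h⟩ := h
    obtain ⟨U, hU⟩ := cont_method T hC h
    intro g
    refine ⟨(↑U⁻¹ : Y d α →L[ℝ] Y d α) g, ?_⟩
    rw [← hU, ← ContinuousLinearMap.mul_apply, Units.mul_inv]; rfl
  by_contra hcon
  push Not at hcon
  choose s hs0 hs1 f hf using fun n : ℕ => hcon (n + 1) (by positivity)
  have hfpos : ∀ n, 0 < ‖f n‖ := fun n => lt_of_le_of_lt (by positivity) (hf n)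
  set e : ℕ → Y d α := fun n => ‖f n‖⁻¹ • f n with he
  have ne : ∀ n, ‖e n‖ = 1 := fun n => by
    simp only [he]; rw [norm_smul, norm_inv, norm_norm, inv_mul_cancel₀ (hfpos n).ne']
  have hL : ∀ n, ‖(1 - s n) • e n + s n • T (e n)‖ ≤ 1 / ((n:ℝ) + 1) := fun n => by
    have e1 : (1 - s n) • e n + s n • T (e n) = ‖f n‖⁻¹ • ((1 - s n) • f n + s n • T (f n)) := by
      simp only [he, map_smul]; module
    rw [e1, norm_smul, norm_inv, norm_norm, inv_mul_le_iff₀ (hfpos n), mul_one_div, le_div_iff₀ (by positivity), mul_comm]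
    exact (hf n).le
  obtain ⟨C, hC, hsm⟩ := lin_small hα hα1 hR A b c hl ell
  set K : ℝ := ‖R‖ + ∑ i, ‖Rp i‖ + ∑ i, ∑ j, ‖Rq i j‖ with hK
  have s1 : 0 ≤ ∑ i, ‖Rp i‖ := Finset.sum_nonneg fun _ _ => norm_nonneg _
  have s2 : 0 ≤ ∑ i, ∑ j, ‖Rq i j‖ := Finset.sum_nonneg fun _ _ => Finset.sum_nonneg fun _ _ => norm_nonneg _
  have nR : ∀ n, ‖R (e n)‖ ≤ K := fun n => (R.le_opNorm _).trans (by rw [ne, mul_one]; linarith)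
  have nP : ∀ n i, ‖Rp i (e n)‖ ≤ K := fun n i => ((Rp i).le_opNorm _).trans (by
    have := Finset.single_le_sum (f := fun i => ‖Rp i‖) (fun _ _ => norm_nonneg _) (Finset.mem_univ i)
    rw [ne, mul_one]; linarith [norm_nonneg R])
  have nQ : ∀ n i j, ‖Rq i j (e n)‖ ≤ K := fun n i j => ((Rq i j).le_opNorm _).trans (by
    have := (Finset.single_le_sum (f := fun j => ‖Rq i j‖) (fun _ _ => norm_nonneg _) (Finset.mem_univ j)).trans
      (Finset.single_le_sum (f := fun i => ∑ j, ‖Rq i j‖) (fun _ _ => Finset.sum_nonneg fun _ _ => norm_nonneg _) (Finset.mem_univ i))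
    rw [ne, mul_one]; linarith [norm_nonneg R])
  have hp : ∀ x y : E d, 0 ≤ dist x y ^ α := fun x y => by positivity
  obtain ⟨φ, p, q, hC2, t0, t1, t2⟩ := C2A.of_tendsto hα (fun n => (hR (e n)).1) (K := K)
    (fun n x => (ev_abs _ x).trans (nR n)) (fun n i x => (ev_abs _ x).trans (nP n i))
    (fun n i j x => (ev_abs _ x).trans (nQ n i j))
    (fun n i j x y => (ev_hol _ x y).trans (mul_le_mul_of_nonneg_right (nQ n i j) (hp x y)))
  have ts : Tendsto s uf (𝓝 (ulim s)) := tendsto_ulim (C := 1) fun n => abs_le.2 ⟨by linarith [hs0 n], hs1 n⟩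
  have hz : Tendsto (fun n : ℕ => 1 / ((n:ℝ) + 1)) uf (𝓝 0) := tendsto_one_div_add_atTop_nhds_zero_nat.mono_left uf_le
  have hφ : ∀ x, φ x = 0 := hinj (ulim s) (ge_of_tendsto' ts hs0) (le_of_tendsto' ts hs1) φ p q hC2 fun x => by
    have l1 : Tendsto (fun n => ev ((1 - s n) • e n + s n • T (e n)) x) uf (𝓝 0) :=
      squeeze_zero_norm (fun n => (ev_abs _ x).trans (hL n)) hz
    refine tendsto_nhds_unique ?_ l1
    have he' : ∀ n, ev (e n) x = ev (R (e n)) x - ∑ i, ev (Rq i i (e n)) x := fun n => ((hR (e n)).2 x).symm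
    simp only [ev_add, ev_smul, hT, ev_Tlin, he']
    refine Tendsto.add (Tendsto.mul (ts.const_sub 1) ((t0 x).sub (tendsto_finsetSum _ fun i _ => t2 i i x)))
      (ts.mul (Tendsto.add (Tendsto.add (tendsto_finsetSum _ fun i _ => tendsto_finsetSum _ fun j _ => (t2 i j x).const_mul _).neg
        (tendsto_finsetSum _ fun i _ => (t1 i x).const_mul _)) ((t0 x).const_mul _)))
  have hφ' : φ = fun _ => 0 := funext hφ
  have hp0 : ∀ i x, p i x = 0 := fun i x => by
    have := hC2.gu; rw [hφ'] at this
    exact congrFun ((this.pd i).symm.trans ((hasGrad_const 0).pd i)) x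
  have hq0 : ∀ i j x, q i j x = 0 := fun i j x => by
    have := hC2.gp i; rw [show p i = fun _ => 0 from funext (hp0 i)] at this
    exact congrFun ((this.pd j).symm.trans ((hasGrad_const 0).pd j)) x
  simp only [hφ] at t0
  simp only [hp0] at t1
  simp only [hq0] at t2
  have hη : 0 < 1 / (2 * C) := by positivity
  have v0 := unif_zero hα (fun n => ev_per (R (e n))) (fun n x y => (ev_hol _ x y).trans (mul_le_mul_of_nonneg_right (nR n) (hp x y))) t0 hη
  have v1 := eventually_all.2 fun i => unif_zero hα (fun n => ev_per (Rp i (e n))) (fun n x y => (ev_hol _ x y).trans (mul_le_mul_of_nonneg_right (nP n i) (hp x y))) (t1 i) hη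
  have v2 := eventually_all.2 fun i => eventually_all.2 fun j => unif_zero hα (fun n => ev_per (Rq i j (e n))) (fun n x y => (ev_hol _ x y).trans (mul_le_mul_of_nonneg_right (nQ n i j) (hp x y))) (t2 i j) hη
  obtain ⟨n, h0, h1, h2, h3⟩ := (v0.and (v1.and (v2.and (hz.eventually (gt_mem_nhds hη))))).exists
  have := hsm (s n) (hs0 n) (hs1 n) (e n) _ hη h0 h1 h2 (by rw [← hT]; exact (hL n).trans h3.le)
  rw [ne] at this
  have : (1:ℝ) ≤ 1 / 2 := this.trans_eq (by field_simp)
  norm_num at this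

end MFG

end S12

section S13

open MeasureTheory Set Filter Topology

namespace MFG
variable {d : ℕ} {α : ℝ}

/-- `ε u + |Du|²/2 + t V` -/
noncomputable def WW (ε t : ℝ) (V : E d → ℝ) (u : E d → ℝ) (p : Fin d → E d → ℝ) (x : E d) : ℝ :=
  ε * u x + 1 / 2 * ∑ i, p i x * p i x + t * V x

/-- gradient of `WW` -/
noncomputable def WG (ε t : ℝ) (Vp : Fin d → E d → ℝ) (p : Fin d → E d → ℝ) (q : Fin d → Fin d → E d → ℝ) (i : Fin d) (x : E d) : ℝ :=
  ε * p i x + ∑ j, p j x * q j i x + t * Vp i x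

theorem WW_grad {ε t : ℝ} {V : E d → ℝ} {Vp} (hV : HasGrad V Vp) {u : E d → ℝ} {p q} (hu : HasGrad u p) (hp : ∀ i, HasGrad (p i) (q i)) :
    HasGrad (WW ε t V u p) (WG ε t Vp p q) := by
  refine HasGrad.congr (((hu.const_mul ε).add ((HasGrad.sum Finset.univ fun i _ => (hp i).mul (hp i)).const_mul (1/2))).add (hV.const_mul t))
    fun i x => ?_
  simp only [WG, Finset.mul_sum]
  congr 2
  refine Finset.sum_congr rfl fun j _ => by ring

structure PSol (P : Polynomial ℝ) (ε t : ℝ) (V : E d → ℝ) (Vp : Fin d → E d → ℝ) (α : ℝ) (u : E d → ℝ) (p : Fin d → E d → ℝ)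
    (q : Fin d → Fin d → E d → ℝ) : Prop where
  c2 : C2A α u p q
  eq : ∀ x, ε * (P.eval (WW ε t V u p x) - 1) - ∑ i, (P.eval (WW ε t V u p x) * q i i x +
    P.derivative.eval (WW ε t V u p x) * WG ε t Vp p q i x * p i x) = 0

/-- the linearised operator, pointwise -/
noncomputable def LL (ε m μ μ2 φ : ℝ) (u w φ' : Fin d → ℝ) (D D' : Fin d → Fin d → ℝ) : ℝ :=
  ε * (μ * (ε * φ + ∑ i, u i * φ' i)) - ∑ i, (μ * (ε * φ + ∑ i, u i * φ' i) * D i i + m * D' i i +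
    (μ2 * (ε * φ + ∑ i, u i * φ' i) * w i * u i + μ * (ε * φ' i + ∑ j, (φ' j * D j i + u j * D' j i)) * u i + μ * w i * φ' i))

theorem LL_lin (ε m μ μ2 φ : ℝ) (u w φ' : Fin d → ℝ) (D D' : Fin d → Fin d → ℝ) (hs : ∀ i j, D' i j = D' j i) :
    LL ε m μ μ2 φ u w φ' D D' = - (∑ i, ∑ j, (m * (if i = j then 1 else 0) + μ * u i * u j) * D' i j) +
      ∑ j, (- (∑ i, (μ * D i i + μ2 * w i * u i)) * u j - μ * (∑ i, D j i * u i) - μ * w j) * φ' j +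
      (ε * ε * μ - ε * ∑ i, (μ * D i i + μ2 * w i * u i)) * φ := by
  have e1 : ∑ i, ∑ j, (m * (if i = j then 1 else 0) + μ * u i * u j) * D' i j = m * ∑ i, D' i i + μ * ∑ i, (∑ j, u j * D' j i) * u i := by
    rw [← sum_delta, Finset.mul_sum, Finset.mul_sum, ← Finset.sum_add_distrib]
    refine Finset.sum_congr rfl fun i _ => ?_
    rw [Finset.mul_sum, Finset.sum_mul, Finset.mul_sum, ← Finset.sum_add_distrib]
    refine Finset.sum_congr rfl fun j _ => ?_
    rw [hs j i]; ring
  have e2 : ∑ j, μ * (∑ i, D j i * u i) * φ' j = μ * ∑ i, (∑ j, φ' j * D j i) * u i := by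
    simp only [Finset.mul_sum, Finset.sum_mul]
    rw [Finset.sum_comm]
    exact Finset.sum_congr rfl fun i _ => Finset.sum_congr rfl fun j _ => by ring
  rw [e1, LL]
  simp only [sub_mul, Finset.sum_sub_distrib, e2]
  have e3 : ∑ j, - (∑ i, (μ * D i i + μ2 * w i * u i)) * u j * φ' j = - (∑ i, (μ * D i i + μ2 * w i * u i)) * ∑ i, u i * φ' i := by
    rw [Finset.mul_sum]; exact Finset.sum_congr rfl fun j _ => by ring
  rw [e3]
  set s := ∑ i, u i * φ' i with hs'
  have e4 : ∑ i, (μ * (ε * φ + s) * D i i + m * D' i i +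
    (μ2 * (ε * φ + s) * w i * u i + μ * (ε * φ' i + ∑ j, (φ' j * D j i + u j * D' j i)) * u i + μ * w i * φ' i)) =
    (ε * φ + s) * ∑ i, (μ * D i i + μ2 * w i * u i) + m * ∑ i, D' i i + μ * ε * s + μ * ∑ i, (∑ j, φ' j * D j i) * u i +
     μ * ∑ i, (∑ j, u j * D' j i) * u i + ∑ i, μ * w i * φ' i := by
    rw [hs']
    rw [Finset.mul_sum (a := μ * ε), ← hs']
    simp only [Finset.mul_sum (a := m), Finset.mul_sum (a := μ), Finset.mul_sum (a := ε * φ + s), ← Finset.sum_add_distrib]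
    refine Finset.sum_congr rfl fun i _ => ?_
    rw [Finset.sum_add_distrib]; ring
  rw [e4]; ring

theorem int_zero {G : E d → ℝ} (hG : Continuous G) (h0 : ∀ x, 0 ≤ G x) (hp : ZPer d G)
    (hi : ∫ x in Icc (0 : E d) 1, G x = 0) (x : E d) : G x = 0 := by
  obtain ⟨y, hy, e⟩ := ZPer.exists_rep hp x
  rw [← e]
  have h1 := (setIntegral_eq_zero_iff_of_nonneg_ae (Eventually.of_forall h0)
    (hG.continuousOn.integrableOn_compact isCompact_Icc)).1 hi
  refine Measure.eqOn_of_ae_eq (μ := volume) (f := G) (g := fun _ => 0) h1 hG.continuousOn continuousOn_const ?_ hy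
  rw [← Set.pi_univ_Icc, interior_pi_set finite_univ, closure_pi_set]
  refine Set.pi_mono fun i _ => ?_
  simp [closure_Ioo]

/-- energy identity gives injectivity -/
theorem energy_inj {ε : ℝ} (hε : 0 < ε) (hα : 0 < α) {u : E d → ℝ} {p q} (h : C2A α u p q) {m μ μ2 : E d → ℝ} {w : Fin d → E d → ℝ}
    (hw : ∀ i, Continuous (w i)) (hm : HasGrad m (fun i x => μ x * w i x)) (hμ : HasGrad μ (fun i x => μ2 x * w i x))
    (hμ2 : Continuous μ2) (pm : ZPer d m) (pμ : ZPer d μ)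
    (m0 : ∀ x, 0 < m x) (μ0 : ∀ x, 0 < μ x) {s : ℝ} (hs0 : 0 ≤ s) (hs1 : s ≤ 1) {φ : E d → ℝ} {r D} (hφ : C2A α φ r D)
    (he : ∀ x, (1 - s) * (φ x - ∑ i, D i i x) + s * LL ε (m x) (μ x) (μ2 x) (φ x) (fun i => p i x) (fun i => w i x)
      (fun i => r i x) (fun i j => q i j x) (fun i j => D i j x) = 0) (x : E d) : φ x = 0 := by
  have cu := h.gu.continuous
  have cp := h.cp
  have cq := h.cq hα
  have cφ := hφ.gu.continuous
  have cr := hφ.cp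
  have cD := hφ.cq hα
  have cm := hm.continuous
  have cμ := hμ.continuous
  -- `w'`
  set z : E d → ℝ := fun x => ε * φ x + ∑ i, p i x * r i x with hz
  have gz : HasGrad z (fun i x => ε * r i x + ∑ j, (q j i x * r j x + p j x * D j i x)) :=
    (hφ.gu.const_mul ε).add (HasGrad.sum Finset.univ fun j _ => (h.gp j).mul (hφ.gp j))
  have cz := gz.continuous
  have pz : ZPer d z := fun x k => by simp only [hz, hφ.per x k, fun i => h.perp i x k, fun i => hφ.perp i x k]
  -- fluxes
  have gF : ∀ i, HasGrad (fun x => φ x * ((1 - s) * r i x + s * (μ x * z x * p i x + m x * r i x))) _ := fun i =>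
    hφ.gu.mul (((hφ.gp i).const_mul (1 - s)).add ((((hμ.mul gz).mul (h.gp i)).add (hm.mul (hφ.gp i))).const_mul s))
  have pF : ∀ i, ZPer d (fun x => φ x * ((1 - s) * r i x + s * (μ x * z x * p i x + m x * r i x))) := fun i x k => by
    simp only [hφ.per x k, h.perp i x k, hφ.perp i x k, pz x k, pm x k, pμ x k]
  have gS := HasGrad.sum Finset.univ fun i (_ : i ∈ Finset.univ) => gF i
  set G : E d → ℝ := fun x => (1 - s) * (φ x ^ 2 + ∑ i, r i x ^ 2) + s * (μ x * z x ^ 2 + m x * ∑ i, r i x ^ 2) with hG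
  have cG : Continuous G := by
    simp only [hG]; fun_prop
  have G0 : ∀ x, 0 ≤ G x := fun x => by
    have a1 : 0 ≤ ∑ i, r i x ^ 2 := Finset.sum_nonneg fun _ _ => sq_nonneg _
    have := m0 x; have := μ0 x
    have : 0 ≤ 1 - s := by linarith
    simp only [hG]; positivity
  have key : ∀ x, G x = ∑ i, (r i x * ((1 - s) * r i x + s * (μ x * z x * p i x + m x * r i x)) + φ x * ((1 - s) * D i i x +
      s * ((μ2 x * w i x * z x + μ x * (ε * r i x + ∑ j, (q j i x * r j x + p j x * D j i x))) * p i x + μ x * z x * q i i x +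
        (μ x * w i x * r i x + m x * D i i x)))) := fun x => by
    have e := he x
    rw [LL] at e
    have e2 : ∑ i, (r i x * ((1 - s) * r i x + s * (μ x * z x * p i x + m x * r i x)) + φ x * ((1 - s) * D i i x +
      s * ((μ2 x * w i x * z x + μ x * (ε * r i x + ∑ j, (q j i x * r j x + p j x * D j i x))) * p i x + μ x * z x * q i i x +
        (μ x * w i x * r i x + m x * D i i x)))) = (1 - s) * ∑ i, r i x ^ 2 + s * (μ x * z x * (∑ i, p i x * r i x) + m x * ∑ i, r i x ^ 2) +
        φ x * ((1 - s) * ∑ i, D i i x + s * ∑ i, (μ x * z x * q i i x + m x * D i i x + (μ2 x * z x * w i x * p i x +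
          μ x * (ε * r i x + ∑ j, (r j x * q j i x + p j x * D j i x)) * p i x + μ x * w i x * r i x))) := by
      simp only [Finset.mul_sum, ← Finset.sum_add_distrib]
      refine Finset.sum_congr rfl fun i _ => ?_
      rw [show ∑ j, (r j x * q j i x + p j x * D j i x) = ∑ j, (q j i x * r j x + p j x * D j i x) from
        Finset.sum_congr rfl fun j _ => by ring]
      ring
    rw [e2]
    have e3 : ∑ i, p i x * r i x = z x - ε * φ x := by simp only [hz]; ring
    simp only [e3] at e ⊢
    simp only [hG]
    set S1 := ∑ i, D i i x
    set S3 := ∑ i, r i x ^ 2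
    have e4 : ε * φ x + (z x - ε * φ x) = z x := by ring
    simp only [e4] at e
    linear_combination (φ x) * e
  have int0 : ∫ x in Icc (0 : E d) 1, G x = 0 := by
    simp only [key]
    rw [integral_finset_sum]
    · refine Finset.sum_eq_zero fun i _ => ?_
      refine torus_int_pd (gF i) (fun j => ?_) (pF i) i
      fun_prop
    · intro i _
      refine ContinuousOn.integrableOn_compact isCompact_Icc (Continuous.continuousOn ?_)
      fun_prop
  have Gz : ∀ x, G x = 0 := by
    have pG : ZPer d G := fun x k => by
      simp only [hG, hφ.per x k, fun i => hφ.perp i x k, pz x k, pm x k, pμ x k]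
    exact int_zero cG G0 pG int0
  have g := Gz x
  have a1 : 0 ≤ ∑ i, r i x ^ 2 := Finset.sum_nonneg fun _ _ => sq_nonneg _
  have m1 := m0 x
  have μ1 := μ0 x
  rcases hs1.lt_or_eq with h1 | h1
  · have : 0 < 1 - s := by linarith
    simp only [hG] at g
    have b1 : 0 ≤ s * (μ x * z x ^ 2 + m x * ∑ i, r i x ^ 2) := by positivity
    have b2 : 0 ≤ (1 - s) * ∑ i, r i x ^ 2 := by positivity
    have b3 : (1 - s) * φ x ^ 2 ≤ 0 := by linarith
    have b4 : φ x ^ 2 ≤ 0 := by by_contra hh; push Not at hh; nlinarith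
    exact pow_eq_zero_iff (two_ne_zero) |>.1 (le_antisymm b4 (sq_nonneg _))
  · subst h1
    simp only [hG, sub_self, zero_mul, zero_add, one_mul] at g
    have b1 : 0 ≤ μ x * z x ^ 2 := by positivity
    have b2 : 0 ≤ m x * ∑ i, r i x ^ 2 := by positivity
    have b3 : z x = 0 := by
      have : μ x * z x ^ 2 = 0 := by linarith
      simpa [μ1.ne'] using this
    have b4 : ∑ i, r i x ^ 2 = 0 := by
      have : m x * ∑ i, r i x ^ 2 = 0 := by linarith
      simpa [m1.ne'] using this
    have b5 : ∀ i, r i x = 0 := fun i => by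
      have := (Finset.sum_eq_zero_iff_of_nonneg (fun i _ => sq_nonneg (r i x))).1 b4 i (Finset.mem_univ i)
      simpa using this
    simp only [hz, b5, mul_zero, Finset.sum_const_zero, add_zero] at b3
    simpa [hε.ne'] using b3

end MFG

end S13

section S14

open MeasureTheory Set Filter Topology

namespace MFG
variable {d : ℕ} {α : ℝ}

theorem mulY_contDiff (hα : 0 < α) {Z : Type*} [NormedAddCommGroup Z] [NormedSpace ℝ Z] {F G : Z → Y d α}
    (hF : ContDiff ℝ 1 F) (hG : ContDiff ℝ 1 G) : ContDiff ℝ 1 fun z => mulY d hα (F z) (G z) := by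
  have c2 : ContDiff ℝ 1 fun z => mulY d hα (F z) := (mulY d hα).contDiff.comp hF
  exact c2.clm_apply hG

theorem curve_deriv {P : Polynomial ℝ} (ε t V x : ℝ) (u φ : ℝ) (p r Vp : Fin d → ℝ) (q D : Fin d → Fin d → ℝ) :
    HasDerivAt (fun s : ℝ => ε * (P.eval (ε * (u + s * φ) + 1 / 2 * ∑ i, (p i + s * r i) * (p i + s * r i) + t * V) - 1) -
      ∑ i, (P.eval (ε * (u + s * φ) + 1 / 2 * ∑ i, (p i + s * r i) * (p i + s * r i) + t * V) * (q i i + s * D i i) +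
      P.derivative.eval (ε * (u + s * φ) + 1 / 2 * ∑ i, (p i + s * r i) * (p i + s * r i) + t * V) *
       (ε * (p i + s * r i) + ∑ j, (p j + s * r j) * (q j i + s * D j i) + t * Vp i) * (p i + s * r i)))
      (LL ε (P.eval (ε * u + 1 / 2 * ∑ i, p i * p i + t * V)) (P.derivative.eval (ε * u + 1 / 2 * ∑ i, p i * p i + t * V))
        (P.derivative.derivative.eval (ε * u + 1 / 2 * ∑ i, p i * p i + t * V)) φ p
        (fun i => ε * p i + ∑ j, p j * q j i + t * Vp i) r q D) 0 := by
  have l : ∀ a b : ℝ, HasDerivAt (fun s : ℝ => a + s * b) b 0 := fun a b => by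
    simpa using ((hasDerivAt_id (0:ℝ)).mul_const b).const_add a
  have hw : HasDerivAt (fun s : ℝ => ε * (u + s * φ) + 1 / 2 * ∑ i, (p i + s * r i) * (p i + s * r i) + t * V)
      (ε * φ + ∑ i, p i * r i) 0 := by
    have := (((l u φ).const_mul ε).add ((HasDerivAt.fun_sum (u := Finset.univ) fun i _ => (l (p i) (r i)).mul (l (p i) (r i))).const_mul (1/2))).add_const (t * V)
    refine this.congr_deriv ?_
    rw [Finset.mul_sum]
    congr 1
    refine Finset.sum_congr rfl fun i _ => by simp; ring
  have e0 : ε * (u + 0 * φ) + 1 / 2 * ∑ i, (p i + 0 * r i) * (p i + 0 * r i) + t * V = ε * u + 1 / 2 * ∑ i, p i * p i + t * V := by simp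
  have hP : ∀ Q : Polynomial ℝ, HasDerivAt (fun s : ℝ => Q.eval (ε * (u + s * φ) + 1 / 2 * ∑ i, (p i + s * r i) * (p i + s * r i) + t * V))
      (Q.derivative.eval (ε * u + 1 / 2 * ∑ i, p i * p i + t * V) * (ε * φ + ∑ i, p i * r i)) 0 := fun Q => by
    have := (Q.hasDerivAt (ε * (u + 0 * φ) + 1 / 2 * ∑ i, (p i + 0 * r i) * (p i + 0 * r i) + t * V)).comp 0 hw
    rw [e0] at this
    exact this
  have hg : ∀ i, HasDerivAt (fun s : ℝ => ε * (p i + s * r i) + ∑ j, (p j + s * r j) * (q j i + s * D j i) + t * Vp i)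
      (ε * r i + ∑ j, (r j * q j i + p j * D j i)) 0 := fun i => by
    refine ((((l (p i) (r i)).const_mul ε).add (HasDerivAt.fun_sum (u := Finset.univ) fun j _ => (l (p j) (r j)).mul (l (q j i) (D j i)))).add_const (t * Vp i)).congr_deriv ?_
    simp
  refine ((((hP P).sub_const 1).const_mul ε).sub (HasDerivAt.fun_sum (u := Finset.univ) fun i _ =>
    ((hP P).mul (l (q i i) (D i i))).add (((hP P.derivative).mul (hg i)).mul (l (p i) (r i))))).congr_deriv ?_
  simp only [Pi.mul_apply, e0, zero_mul, add_zero, LL]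
  congr 1
  refine Finset.sum_congr rfl fun i _ => ?_
  ring

/-- local solvability in `t` -/
theorem open_step (hα : 0 < α) (hα1 : α < 1) {P : Polynomial ℝ} {ε t : ℝ} (hε : 0 < ε) {V : E d → ℝ} {Vp} (hV : HasGrad V Vp)
    (pV : ZPer d V) {K : ℝ} (hVp : ∀ i x y, |Vp i x - Vp i y| ≤ K * dist x y ^ α) {u : E d → ℝ} {p q}
    (h : PSol P ε t V Vp α u p q) (h0 : ∀ x, 0 < P.eval (WW ε t V u p x)) (h1 : ∀ x, 0 < P.derivative.eval (WW ε t V u p x))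
    {η : ℝ} (hη : 0 < η) : ∀ᶠ t' in 𝓝 t, ∃ u' p' q', PSol P ε t' V Vp α u' p' q' ∧
      ∀ x, |WW ε t' V u' p' x - WW ε t V u p x| < η := by
  obtain ⟨R, Rp, Rq, hR⟩ := R_exists d hα hα1
  -- data in `Y`
  have mkY : ∀ {f : E d → ℝ} {H : ℝ}, ZPer d f → (∀ x y, |f x - f y| ≤ H * dist x y ^ α) → ∃ F : Y d α, ∀ x, ev F x = f x := by
    intro f H pf hf
    obtain ⟨C, hC, hb⟩ := ZPer.bounded pf (holder_continuous hα hf)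
    exact Y_exists pf (max C H) (fun x => (hb x).trans (le_max_left _ _))
      (fun x y => (hf x y).trans (mul_le_mul_of_nonneg_right (le_max_right _ _) (by positivity)))
  have pVp : ∀ i, ZPer d (Vp i) := hV.zper pV
  have mkY1 : ∀ {f : E d → ℝ} {r}, HasGrad f r → ZPer d f → (∀ i, Continuous (r i)) → ∃ F : Y d α, ∀ x, ev F x = f x := by
    intro f r hf pf cr
    choose C hC hb using fun i => ZPer.bounded (hf.zper pf i) (cr i)
    obtain ⟨S, hS0, hS⟩ := ZPer.bounded pf hf.continuous
    have b : ∀ i x, |r i x| ≤ ∑ i, C i := fun i x => (hb i x).trans (Finset.single_le_sum (fun i _ => hC i) (Finset.mem_univ i))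
    have n : 0 ≤ ∑ i, C i := Finset.sum_nonneg fun i _ => hC i
    exact mkY pf (hol_of_lip hα hα1.le (by positivity) hS (hf.lip n b))
  obtain ⟨FV, hFV⟩ := mkY1 hV pV (fun i => holder_continuous hα (hVp i))
  choose FG hFG using fun i => mkY (pVp i) (hVp i)
  obtain ⟨Fu, hFu⟩ := mkY1 h.c2.gu h.c2.per h.c2.cp
  obtain ⟨H, hH⟩ := h.c2.hol
  choose Fq hFq using fun i j => mkY (h.c2.perq i j) (hH i j)
  obtain ⟨one, hone⟩ := const_exists d α 1
  obtain ⟨Ψ, cΨ, hΨ⟩ := poly_exists d hα P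
  obtain ⟨Ψ1, cΨ1, hΨ1⟩ := poly_exists d hα P.derivative
  obtain ⟨Ψ2, -, hΨ2⟩ := poly_exists d hα P.derivative.derivative
  -- the maps
  set Wm : ℝ × Y d α → Y d α := fun z => ε • R z.2 + (1 / 2 : ℝ) • ∑ i, mulY d hα (Rp i z.2) (Rp i z.2) + z.1 • FV with hWm
  set Wg : Fin d → ℝ × Y d α → Y d α := fun i z => ε • Rp i z.2 + ∑ j, mulY d hα (Rp j z.2) (Rq j i z.2) + z.1 • FG i with hWg
  set Φ : ℝ × Y d α → Y d α := fun z => ε • (Ψ (Wm z) - one) - ∑ i, (mulY d hα (Ψ (Wm z)) (Rq i i z.2) +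
    mulY d hα (mulY d hα (Ψ1 (Wm z)) (Wg i z)) (Rp i z.2)) with hΦ
  have cL : ∀ L : Y d α →L[ℝ] Y d α, ContDiff ℝ 1 fun z : ℝ × Y d α => L z.2 := fun L => L.contDiff.comp contDiff_snd
  have cW : ContDiff ℝ 1 Wm := (((cL R).const_smul ε).add ((ContDiff.sum fun i _ => mulY_contDiff hα (cL (Rp i)) (cL (Rp i))).const_smul (1/2:ℝ))).add
    (contDiff_fst.smul contDiff_const)
  have cg : ∀ i, ContDiff ℝ 1 (Wg i) := fun i => (((cL (Rp i)).const_smul ε).add (ContDiff.sum fun j _ => mulY_contDiff hα (cL (Rp j)) (cL (Rq j i)))).add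
    (contDiff_fst.smul contDiff_const)
  have cΦ : ContDiff ℝ 1 Φ := (((cΨ.comp cW).sub contDiff_const).const_smul ε).sub (ContDiff.sum fun i _ =>
    (mulY_contDiff hα (cΨ.comp cW) (cL (Rq i i))).add (mulY_contDiff hα (mulY_contDiff hα (cΨ1.comp cW) (cg i)) (cL (Rp i))))
  have evW : ∀ z x, ev (Wm z) x = WW ε z.1 V (ev (R z.2)) (fun i => ev (Rp i z.2)) x := fun z x => by
    simp only [hWm, ev_add, ev_smul, ev_sum, ev_mulY, hFV, WW]
  have evg : ∀ i z x, ev (Wg i z) x = WG ε z.1 Vp (fun i => ev (Rp i z.2)) (fun i j => ev (Rq i j z.2)) i x := fun i z x => by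
    simp only [hWg, ev_add, ev_smul, ev_sum, ev_mulY, hFG, WG]
  have evΦ : ∀ z x, ev (Φ z) x = ε * (P.eval (ev (Wm z) x) - 1) - ∑ i, (P.eval (ev (Wm z) x) * ev (Rq i i z.2) x +
      P.derivative.eval (ev (Wm z) x) * ev (Wg i z) x * ev (Rp i z.2) x) := fun z x => by
    simp only [hΦ, ev_sub, ev_smul, ev_sum, ev_add, ev_mulY, hΨ, hΨ1, hone]
  -- base point
  set f : Y d α := Fu - ∑ i, Fq i i with hf
  obtain ⟨eu, ep, eq⟩ := base_unique (hR f).1 h.c2 (hR f).2 (fun x => by simp only [hf, ev_sub, ev_sum, hFu, hFq])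
  have eW : ∀ x, ev (Wm (t, f)) x = WW ε t V u p x := fun x => by rw [evW]; simp only [eu, ep]
  have eWg : ∀ i x, ev (Wg i (t, f)) x = WG ε t Vp p q i x := fun i x => by rw [evg]; simp only [ep, eq]
  have ep' : ∀ i, ev (Rp i f) = p i := fun i => congrFun ep i
  have eq' : ∀ i j, ev (Rq i j f) = q i j := fun i j => congrFun (congrFun eq i) j
  have hΦ0 : Φ (t, f) = 0 := Y_ext (fun x => by
    rw [evΦ, ev_zero, ← h.eq x]; simp only [eW, eWg, ep', eq']) hα
  -- derivative
  set D := fderiv ℝ Φ (t, f) with hD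
  have hDΦ : HasStrictFDerivAt Φ D (t, f) := cΦ.contDiffAt.hasStrictFDerivAt (by norm_num)
  have evD : ∀ g x, ev (D (0, g)) x = LL ε (P.eval (WW ε t V u p x)) (P.derivative.eval (WW ε t V u p x))
      (P.derivative.derivative.eval (WW ε t V u p x)) (ev (R g) x) (fun i => p i x) (fun i => WG ε t Vp p q i x)
      (fun i => ev (Rp i g) x) (fun i j => q i j x) (fun i j => ev (Rq i j g) x) := fun g x => by
    have c1 : HasDerivAt (fun s : ℝ => ((t, f + s • g) : ℝ × Y d α)) (0, g) 0 := by
      have := ((hasDerivAt_id (0:ℝ)).smul_const g).const_add f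
      rw [one_smul] at this
      exact (hasDerivAt_const _ _).prodMk this
    have h2 : HasFDerivAt Φ D (t, f + (0:ℝ) • g) := by rw [zero_smul, add_zero]; exact hDΦ.hasFDerivAt
    have c2 := ((evL x).hasFDerivAt.comp _ h2).comp_hasDerivAt (0:ℝ) c1
    have c3 := curve_deriv (P := P) ε t (V x) 0 (u x) (ev (R g) x) (fun i => p i x) (fun i => ev (Rp i g) x) (fun i => Vp i x) (fun i j => q i j x)
      (fun i j => ev (Rq i j g) x)
    refine HasDerivAt.unique c2 (c3.congr_of_eventuallyEq (Eventually.of_forall fun s => ?_))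
    simp only [Function.comp, evL_apply, evΦ, evW, evg, WW, WG, map_add, map_smul, ev_add, ev_smul, eu, ep', eq']
  have cWcont : Continuous fun x => WW ε t V u p x := (WW_grad hV h.c2.gu h.c2.gp).continuous
  have pW : ZPer d fun x => WW ε t V u p x := fun x k => by
    simp only [WW, h.c2.per x k, fun i => h.c2.perp i x k, pV x k]
  obtain ⟨x0, -, hx0⟩ := ZPer.exists_min (u := fun x => P.eval (WW ε t V u p x)) (fun x k => congrArg (fun s => P.eval s) (pW x k))
    (P.continuous.comp cWcont)
  -- coefficients
  set A : Fin d → Fin d → Y d α := fun i j => (if i = j then (1:ℝ) else 0) • Ψ (Wm (t, f)) +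
    mulY d hα (mulY d hα (Ψ1 (Wm (t, f))) (Rp i f)) (Rp j f) with hA
  set S : Y d α := ∑ i, (mulY d hα (Ψ1 (Wm (t, f))) (Rq i i f) + mulY d hα (mulY d hα (Ψ2 (Wm (t, f))) (Wg i (t, f))) (Rp i f)) with hS
  set b : Fin d → Y d α := fun j => - mulY d hα S (Rp j f) - mulY d hα (Ψ1 (Wm (t, f))) (∑ i, mulY d hα (Rq j i f) (Rp i f)) -
    mulY d hα (Ψ1 (Wm (t, f))) (Wg j (t, f)) with hb
  set c : Y d α := (ε * ε) • Ψ1 (Wm (t, f)) - ε • S with hc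
  have eL : ∀ x φ (r : Fin d → E d → ℝ) (Q : Fin d → Fin d → E d → ℝ), (∀ i j x, Q i j x = Q j i x) →
     LL ε (P.eval (WW ε t V u p x)) (P.derivative.eval (WW ε t V u p x))
      (P.derivative.derivative.eval (WW ε t V u p x)) φ (fun i => p i x) (fun i => WG ε t Vp p q i x)
      (fun i => r i x) (fun i j => q i j x) (fun i j => Q i j x) =
      - (∑ i, ∑ j, ev (A i j) x * Q i j x) + ∑ i, ev (b i) x * r i x + ev c x * φ := fun x φ r Q hs => by
    rw [LL_lin _ _ _ _ _ _ _ _ _ _ (fun i j => hs i j x)]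
    simp only [hA, hb, hc, hS, ev_add, ev_sub, ev_neg, ev_smul, ev_sum, ev_mulY, hΨ, hΨ1, hΨ2, eW, eWg, ep', eq']
    congr 2
    · congr 1
      refine Finset.sum_congr rfl fun i _ => Finset.sum_congr rfl fun j _ => by ring
    · refine Finset.sum_congr rfl fun i _ => by ring
  have hsurj : Function.Surjective (D.comp (ContinuousLinearMap.inr ℝ ℝ (Y d α))) := by
    refine lin_surj hα hα1 hR A b c (h0 x0) (fun x ξ => ?_) (fun s hs0 hs1 φ r Q hφ he => ?_) _ (fun g => Y_ext (fun x => ?_) hα)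
    · have e : ∑ i, ∑ j, ev (A i j) x * ξ j * ξ i = P.eval (WW ε t V u p x) * ∑ i, ξ i ^ 2 +
          P.derivative.eval (WW ε t V u p x) * (∑ i, p i x * ξ i) ^ 2 := by
        rw [sq, Finset.sum_mul_sum]
        have e1 := sum_delta (fun i j => P.eval (WW ε t V u p x) * (ξ j * ξ i))
        rw [Finset.mul_sum, Finset.mul_sum, show ∑ i, P.eval (WW ε t V u p x) * ξ i ^ 2 = ∑ i, P.eval (WW ε t V u p x) * (ξ i * ξ i) by simp only [sq],
          ← e1, ← Finset.sum_add_distrib]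
        refine Finset.sum_congr rfl fun i _ => ?_
        rw [Finset.mul_sum, ← Finset.sum_add_distrib]
        refine Finset.sum_congr rfl fun j _ => ?_
        simp only [hA, ev_add, ev_smul, ev_mulY, hΨ, hΨ1, eW, ep']
        ring
      rw [e]
      have a1 := mul_le_mul_of_nonneg_right (hx0 x) (Finset.sum_nonneg fun i (_ : i ∈ Finset.univ) => sq_nonneg (ξ i))
      have a2 := mul_nonneg (h1 x).le (sq_nonneg (∑ i, p i x * ξ i))
      linarith
    · refine energy_inj hε hα h.c2 (m := fun x => P.eval (WW ε t V u p x)) (μ := fun x => P.derivative.eval (WW ε t V u p x))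
        (μ2 := fun x => P.derivative.derivative.eval (WW ε t V u p x)) (w := WG ε t Vp p q) (fun i => ?_) ?_ ?_ ?_ ?_ ?_ h0 h1 hs0 hs1 hφ (fun x => ?_)
      · have := fun i => holder_continuous hα (hVp i)
        have := h.c2.cp
        have := h.c2.cq hα
        unfold WG; fun_prop
      · exact (WW_grad hV h.c2.gu h.c2.gp).comp (F := fun s => P.eval s) (F' := fun s => P.derivative.eval s) fun x => P.hasDerivAt _
      · exact (WW_grad hV h.c2.gu h.c2.gp).comp (F := fun s => P.derivative.eval s) (F' := fun s => P.derivative.derivative.eval s) fun x => P.derivative.hasDerivAt _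
      · exact P.derivative.derivative.continuous.comp cWcont
      · exact fun x k => congrArg (fun s => P.eval s) (pW x k)
      · exact fun x k => congrArg (fun s => P.derivative.eval s) (pW x k)
      · rw [eL x (φ x) r Q hφ.sym]; exact he x
    · rw [ev_Tlin, ← eL x (ev (R g) x) (fun i => ev (Rp i g)) (fun i j => ev (Rq i j g)) (hR g).1.sym, ← evD]
      rfl
  -- inverse function theorem
  have hstr : HasStrictFDerivAt (fun z : ℝ × Y d α => (z.1, Φ z)) ((ContinuousLinearMap.fst ℝ ℝ (Y d α)).prod D) (t, f) :=
    hasStrictFDerivAt_fst.prodMk hDΦ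
  have hmap := hstr.map_nhds_eq_of_surj (LinearMap.range_eq_top.2 fun ⟨τ, g⟩ => by
    obtain ⟨k, hk⟩ := hsurj (g - D (τ, 0))
    refine ⟨(τ, k), Prod.ext rfl ?_⟩
    change D (τ, k) = g
    rw [show ((τ, k) : ℝ × Y d α) = (τ, 0) + (0, k) by simp, map_add]
    have : D (0, k) = g - D (τ, 0) := hk
    rw [this]; abel)
  have hopen : ∀ᶠ z in 𝓝 (t, f), ‖Wm z - Wm (t, f)‖ < η := by
    have := (cW.continuous.tendsto (t, f)).eventually (Metric.ball_mem_nhds _ hη)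
    simpa [dist_eq_norm] using this
  have himg := image_mem_map (m := fun z : ℝ × Y d α => (z.1, Φ z)) hopen
  rw [hmap, hΦ0] at himg
  have hc0 : Tendsto (fun t' : ℝ => ((t', 0) : ℝ × Y d α)) (𝓝 t) (𝓝 (t, 0)) := (Continuous.prodMk_left (0 : Y d α)).tendsto t
  filter_upwards [hc0 himg] with t' ht'
  obtain ⟨⟨a, g⟩, hz, hzz⟩ := ht'
  obtain ⟨rfl, hz0⟩ := Prod.mk.inj hzz
  refine ⟨_, _, _, ⟨(hR g).1, fun x => ?_⟩, fun x => ?_⟩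
  · have := evΦ (a, g) x
    rw [show Φ (a, g) = 0 from hz0, ev_zero] at this
    simp only [evW, evg] at this
    exact this.symm
  · rw [← eW, ← evW (a, g), ← ev_sub]
    exact (ev_abs _ x).trans_lt hz

end MFG

end S14

section S15

open MeasureTheory Set Filter Topology

namespace MFG
variable {d : ℕ} {α : ℝ}

/-- Euclidean length -/
noncomputable def el (z : Fin d → ℝ) : ℝ := √(∑ i, z i * z i)

theorem el_sq (z : Fin d → ℝ) : el z * el z = ∑ i, z i * z i :=
  Real.mul_self_sqrt (Finset.sum_nonneg fun _ _ => mul_self_nonneg _)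

theorem el_nonneg (z : Fin d → ℝ) : 0 ≤ el z := Real.sqrt_nonneg _

theorem el_smul (c : ℝ) (z : Fin d → ℝ) : el (fun i => c * z i) = |c| * el z := by
  unfold el
  rw [show ∑ i, c * z i * (c * z i) = c ^ 2 * ∑ i, z i * z i by
    rw [Finset.mul_sum]; exact Finset.sum_congr rfl fun i _ => by ring, Real.sqrt_mul (sq_nonneg c), Real.sqrt_sq_eq_abs]

theorem el_cont {X : Type*} [TopologicalSpace X] {f : X → Fin d → ℝ} (hf : Continuous f) : Continuous fun x => el (f x) := by
  unfold el
  have : ∀ i, Continuous fun x => f x i := fun i => (continuous_apply i).comp hf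
  fun_prop

theorem el_dot (a b : Fin d → ℝ) : |∑ i, a i * b i| ≤ el a * el b := by
  have h := Finset.sum_mul_sq_le_sq_mul_sq Finset.univ a b
  simp only [sq] at h
  rw [← el_sq a, ← el_sq b] at h
  refine abs_le_of_sq_le_sq ?_ (mul_nonneg (el_nonneg _) (el_nonneg _))
  nlinarith

theorem line2 {u : E d → ℝ} {p : Fin d → E d → ℝ} {q : Fin d → Fin d → E d → ℝ} (hp : ∀ i, HasGrad (p i) (q i)) (x ξ : E d) :
    HasDerivAt (fun s : ℝ => ∑ i, p i (x + s • ξ) * ξ i) (∑ i, ∑ j, q i j x * ξ j * ξ i) 0 := by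
  refine (HasDerivAt.fun_sum (u := Finset.univ) fun i _ => ((hp i).line x ξ 0).mul_const (ξ i)).congr_deriv ?_
  simp only [zero_smul, add_zero, Finset.sum_mul]

set_option maxHeartbeats 1600000 in
theorem lip_est {u : E d → ℝ} {p q} (h : C2A α u p q) (hα : 0 < α) {ε t CV c O : ℝ} (hε : 0 < ε) (ht0 : 0 ≤ t) (ht1 : t ≤ 1)
    {Vp : Fin d → E d → ℝ} (hV : ∀ x, el (fun i => Vp i x) ≤ CV) (hc : 0 < c) {m μ : E d → ℝ} (hm : ∀ x, c ≤ m x) (hμ : ∀ x, 0 < μ x)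
    (he : ∀ x, ε * (m x - 1) - ∑ i, (m x * q i i x + μ x * WG ε t Vp p q i x * p i x) = 0) (hO : ∀ x y, u x - u y ≤ O) (x : E d) :
    el (fun i => p i x) ≤ O + (ε + CV + ε / c) + 1 := by
  set N : ℝ := ε + CV + ε / c with hN
  set K : ℝ := O + N + 1 with hK
  have hCV : 0 ≤ CV := (el_nonneg _).trans (hV 0)
  have hO0 : 0 ≤ O := by have := hO 0 0; linarith
  have hεc : 0 < ε / c := by positivity
  have hN0 : 0 < N := by positivity
  have hcu := h.gu.continuous
  let ψ : ℝ → ℝ := fun r => K * r - N / 2 * r ^ 2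
  -- the main claim
  have main : ∀ x z : E d, el z ≤ 1 → u x - u (x - z) ≤ ψ (el z) := by
    by_contra hcon
    push Not at hcon
    obtain ⟨x1, z1, hz1, hb⟩ := hcon
    let B : Set (E d) := {z | el z ≤ 1}
    have hB : IsCompact B := by
      refine (isCompact_Icc (a := fun _ => (-1:ℝ)) (b := fun _ => (1:ℝ))).of_isClosed_subset
        (isClosed_le (el_cont continuous_id) continuous_const) fun z hz => ?_
      have hz' : el z ≤ 1 := hz
      have : ∀ i, |z i| ≤ 1 := fun i => by
        have a := Finset.single_le_sum (f := fun i => z i * z i) (fun i _ => mul_self_nonneg _) (Finset.mem_univ i)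
        rw [← el_sq] at a
        have := el_nonneg z
        exact abs_le_of_sq_le_sq (by nlinarith) zero_le_one
      exact ⟨fun i => (abs_le.1 (this i)).1, fun i => (abs_le.1 (this i)).2⟩
    let F : E d × E d → ℝ := fun s => u s.1 - u (s.1 - s.2) - ψ (el s.2)
    have hF : Continuous F := by
      have : Continuous fun s : E d × E d => el s.2 := el_cont continuous_snd
      simp only [F, ψ]; fun_prop
    obtain ⟨⟨x, z⟩, ⟨hx, hz⟩, hmax⟩ := ((isCompact_Icc (a := (0 : E d)) (b := 1)).prod hB).exists_isMaxOn
      ⟨(0, z1), ⟨⟨le_rfl, zero_le_one⟩, hz1⟩⟩ hF.continuousOn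
    have hmax' : ∀ x' z' : E d, el z' ≤ 1 → F (x', z') ≤ F (x, z) := fun x' z' hz' => by
      obtain ⟨y, hy, e⟩ := ZPer.exists_rep (u := fun x' => F (x', z')) (fun a k => by
        simp only [F]
        rw [h.per a k, add_sub_right_comm, h.per (a - z') k]) x'
      rw [← e]
      exact hmax (show (y, z') ∈ _ from ⟨hy, hz'⟩)
    have hpos : 0 < F (x, z) := lt_of_lt_of_le (by simp only [F]; linarith) (hmax' x1 z1 hz1)
    set r := el z with hr
    have hr1 : r < 1 := by
      refine lt_of_le_of_ne hz fun h1 => ?_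
      simp only [F, ψ, ← hr, h1] at hpos
      have := hO x (x - z)
      nlinarith
    have hr0 : 0 < r := by
      refine lt_of_le_of_ne (el_nonneg z) fun h1 => ?_
      have hz0 : z = 0 := by
        funext i
        have a := Finset.single_le_sum (f := fun i => z i * z i) (fun i _ => mul_self_nonneg _) (Finset.mem_univ i)
        rw [← el_sq, ← hr, ← h1] at a
        exact mul_self_eq_zero.1 (le_antisymm (by simpa using a) (mul_self_nonneg _))
      simp only [F, ψ, ← hr, ← h1] at hpos
      rw [hz0] at hpos
      simp at hpos
    set y := x - z with hy
    set e : E d := fun i => z i / r with hedef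
    have hee : ∑ i, e i * e i = 1 := by
      have : ∑ i, e i * e i = (∑ i, z i * z i) / (r * r) := by
        rw [Finset.sum_div]; exact Finset.sum_congr rfl fun i _ => by simp only [hedef]; field_simp
      rw [this, ← el_sq, ← hr]; field_simp
    have ze : ∀ i, z i = r * e i := fun i => by simp only [hedef]; field_simp
    set D : ℝ := K - N * r with hD
    have hD1 : 1 ≤ D := by nlinarith
    -- general second order inequality
    have sec : ∀ (ξ ζ : E d) (k : ℝ), (∀ i, ξ i - ζ i = k * e i) →
        IsLocalMax (fun s : ℝ => u (x + s • ξ) - u (y + s • ζ) - ψ (r + s * k)) 0 := by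
      intro ξ ζ k hk
      have c1 : Continuous fun s : ℝ => r + s * k := by fun_prop
      have e1 : ∀ᶠ s : ℝ in 𝓝 0, 0 < r + s * k := c1.continuousAt.eventually (lt_mem_nhds (by simpa))
      have e2 : ∀ᶠ s : ℝ in 𝓝 0, r + s * k < 1 := c1.continuousAt.eventually (gt_mem_nhds (by simpa))
      filter_upwards [e1, e2] with s h1 h2
      have ez : z + s • (ξ - ζ) = fun i => (r + s * k) * e i := by
        funext i
        simp only [Pi.add_apply, Pi.smul_apply, Pi.sub_apply, smul_eq_mul]
        rw [hk i, ze i]; ring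
      have ele : el (z + s • (ξ - ζ)) = r + s * k := by
        rw [ez, el_smul, abs_of_pos h1, el, hee, Real.sqrt_one, mul_one]
      have := hmax' (x + s • ξ) (z + s • (ξ - ζ)) (by rw [ele]; exact h2.le)
      simp only [F, ele] at this
      rw [show x + s • ξ - (z + s • (ξ - ζ)) = y + s • ζ by rw [hy]; module] at this
      simpa [← hr, ← hy] using this
    have hψ : ∀ k s : ℝ, HasDerivAt (fun s : ℝ => ψ (r + s * k)) ((K - N * (r + s * k)) * k) s := fun k s => by
      have l : HasDerivAt (fun s : ℝ => r + s * k) k s := by simpa using ((hasDerivAt_id s).mul_const k).const_add r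
      refine ((l.const_mul K).sub ((l.pow 2).const_mul (N / 2))).congr_deriv ?_
      simp; ring
    have hψ2 : ∀ k : ℝ, HasDerivAt (fun s : ℝ => (K - N * (r + s * k)) * k) (- N * k * k) 0 := fun k => by
      have l : HasDerivAt (fun s : ℝ => r + s * k) k 0 := by simpa using ((hasDerivAt_id (0:ℝ)).mul_const k).const_add r
      refine (((l.const_mul N).const_sub K).mul_const k).congr_deriv (by ring)
    have fst : ∀ (ξ ζ : E d) (k : ℝ), (∀ i, ξ i - ζ i = k * e i) → ∑ i, p i x * ξ i - ∑ i, p i y * ζ i = D * k := by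
      intro ξ ζ k hk
      have := (sec ξ ζ k hk).hasDerivAt_eq_zero (((h.gu.line x ξ 0).sub (h.gu.line y ζ 0)).sub (hψ k 0))
      simp only [zero_smul, add_zero, zero_mul] at this
      linarith
    have snd : ∀ (ξ ζ : E d) (k : ℝ), (∀ i, ξ i - ζ i = k * e i) →
        ∑ i, ∑ j, q i j x * ξ j * ξ i - ∑ i, ∑ j, q i j y * ζ j * ζ i ≤ - N * k * k := by
      intro ξ ζ k hk
      have := second_deriv_nonpos (fun s => ((h.gu.line x ξ s).sub (h.gu.line y ζ s)).sub (hψ k s))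
        (((line2 (u := u) h.gp x ξ).sub (line2 (u := u) h.gp y ζ)).sub (hψ2 k)) (sec ξ ζ k hk)
      linarith
    -- gradient
    have hpx : ∀ i, p i x = D * e i := fun i => by
      have hlm : IsLocalMax (fun s : ℝ => u (x + s • Pi.single i 1) - u y - ψ (el (z + s • Pi.single i 1))) 0 := by
        have c1 : Continuous fun s : ℝ => el (z + s • (Pi.single i 1 : E d)) := el_cont (by fun_prop)
        have e2 : ∀ᶠ s : ℝ in 𝓝 0, el (z + s • (Pi.single i 1 : E d)) < 1 := c1.continuousAt.eventually (gt_mem_nhds (by simpa))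
        filter_upwards [e2] with s h2
        have := hmax' (x + s • Pi.single i 1) (z + s • Pi.single i 1) h2.le
        simp only [F] at this
        rw [show x + s • Pi.single i 1 - (z + s • Pi.single i 1) = y by rw [hy]; module] at this
        simpa [← hr, ← hy] using this
      have hs : HasDerivAt (fun s : ℝ => ∑ j, (z + s • (Pi.single i 1 : E d)) j * (z + s • (Pi.single i 1 : E d)) j) (2 * z i) 0 := by
        have l : ∀ j, HasDerivAt (fun s : ℝ => (z + s • (Pi.single i 1 : E d)) j) ((Pi.single i 1 : E d) j) 0 := fun j => by
          simpa using ((hasDerivAt_id (0:ℝ)).mul_const ((Pi.single i 1 : E d) j)).const_add (z j)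
        refine (HasDerivAt.fun_sum (u := Finset.univ) fun j _ => (l j).mul (l j)).congr_deriv ?_
        simp [Finset.sum_add_distrib, Pi.single_apply]; ring
      have hel : HasDerivAt (fun s : ℝ => el (z + s • (Pi.single i 1 : E d))) (e i) 0 := by
        have hne : ∑ j, (z + (0:ℝ) • (Pi.single i 1 : E d)) j * (z + (0:ℝ) • (Pi.single i 1 : E d)) j ≠ 0 := by
          simp only [zero_smul, add_zero, ← el_sq, ← hr]; positivity
        refine (hs.sqrt hne).congr_deriv ?_
        simp only [zero_smul, add_zero]
        change 2 * z i / (2 * el z) = _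
        rw [← hr, hedef]; field_simp
      have hd : HasDerivAt (fun s : ℝ => ψ (el (z + s • (Pi.single i 1 : E d)))) (D * e i) 0 := by
        refine ((hel.const_mul K).sub ((hel.pow 2).const_mul (N / 2))).congr_deriv ?_
        simp [← hr, hD]; ring
      have := hlm.hasDerivAt_eq_zero (((h.gu.line x (Pi.single i 1) 0).sub_const (u y)).sub hd)
      simp [Pi.single_apply] at this
      linarith
    have hpy : ∀ i, p i y = D * e i := fun i => by
      have := fst (Pi.single i 1) (Pi.single i 1) 0 (fun j => by simp)
      simp [Pi.single_apply] at this
      linarith [hpx i]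
    -- second order
    set κx := μ x / m x with hκx
    set κy := μ y / m y with hκy
    have mx := hc.trans_le (hm x)
    have my := hc.trans_le (hm y)
    have κx0 : 0 < κx := div_pos (hμ x) mx
    have κy0 : 0 < κy := div_pos (hμ y) my
    have tr : ∑ k, q k k x - ∑ k, q k k y ≤ - 4 * N := by
      have h1 := Finset.sum_le_sum fun k (_ : k ∈ Finset.univ) => snd (Pi.single k 1) (Pi.single k 1 - (2 * e k) • e) (2 * e k)
        (fun i => by simp)
      have e1 : ∑ k, - N * (2 * e k) * (2 * e k) = - 4 * N := by
        rw [show ∑ k, - N * (2 * e k) * (2 * e k) = - 4 * N * ∑ k, e k * e k by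
          rw [Finset.mul_sum]; exact Finset.sum_congr rfl fun i _ => by ring, hee, mul_one]
      rw [e1, Finset.sum_sub_distrib] at h1
      have e2 : ∑ k, ∑ i, ∑ j, q i j x * (Pi.single k 1 : E d) j * (Pi.single k 1 : E d) i = ∑ k, q k k x := by
        simp [Pi.single_apply]
      set G := ∑ i, ∑ j, q i j y * e j * e i with hG
      have e3 : ∀ k, ∑ i, ∑ j, q i j y * ((Pi.single k 1 : E d) - (2 * e k) • e) j * ((Pi.single k 1 : E d) - (2 * e k) • e) i =
          q k k y - 2 * (e k * ∑ i, q i k y * e i) - 2 * (e k * ∑ j, q k j y * e j) + 4 * (e k * e k) * G := fun k => by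
        have a : ∀ i j, q i j y * ((Pi.single k 1 : E d) - (2 * e k) • e) j * ((Pi.single k 1 : E d) - (2 * e k) • e) i =
          q i j y * (Pi.single k 1 : E d) j * (Pi.single k 1 : E d) i - 2 * e k * (q i j y * (Pi.single k 1 : E d) j * e i) -
          2 * e k * (q i j y * (Pi.single k 1 : E d) i * e j) + 4 * (e k * e k) * (q i j y * e j * e i) := fun i j => by
          simp; ring
        simp only [a, Finset.sum_add_distrib, Finset.sum_sub_distrib, ← Finset.mul_sum]
        rw [hG]
        simp [Pi.single_apply]
        ring
      have e4 : ∑ k, e k * ∑ i, q i k y * e i = G := by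
        rw [hG, Finset.sum_comm]; simp only [Finset.mul_sum]
        exact Finset.sum_congr rfl fun i _ => Finset.sum_congr rfl fun j _ => by ring
      have e5 : ∑ k, e k * ∑ j, q k j y * e j = G := by
        rw [hG]; simp only [Finset.mul_sum]
        exact Finset.sum_congr rfl fun i _ => Finset.sum_congr rfl fun j _ => by ring
      have e6 : ∑ k, ∑ i, ∑ j, q i j y * ((Pi.single k 1 : E d) - (2 * e k) • e) j * ((Pi.single k 1 : E d) - (2 * e k) • e) i = ∑ k, q k k y := by
        rw [Finset.sum_congr rfl fun k _ => e3 k]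
        rw [Finset.sum_add_distrib, Finset.sum_sub_distrib, Finset.sum_sub_distrib, ← Finset.mul_sum, ← Finset.mul_sum, ← Finset.sum_mul,
          ← Finset.mul_sum, e4, e5, hee]
        ring
      rw [e2, e6] at h1
      exact h1
    set Qx := ∑ i, ∑ j, q i j x * e j * e i with hQx
    set Qy := ∑ i, ∑ j, q i j y * e j * e i with hQy
    have dd : κx * Qx - κy * Qy ≤ - N * (κx + κy) := by
      have h1 := snd (√κx • e) (- (√κy • e)) (√κx + √κy) (fun i => by simp; ring)
      have e1 : ∀ (w : E d) (a : ℝ), ∑ i, ∑ j, q i j w * (a • e) j * (a • e) i = a * a * ∑ i, ∑ j, q i j w * e j * e i := fun w a => by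
        simp only [Finset.mul_sum]
        exact Finset.sum_congr rfl fun i _ => Finset.sum_congr rfl fun j _ => by simp; ring
      rw [← neg_smul, e1, e1, neg_mul_neg, Real.mul_self_sqrt κx0.le, Real.mul_self_sqrt κy0.le] at h1
      have h2 : κx + κy ≤ (√κx + √κy) * (√κx + √κy) := by
        have a := Real.mul_self_sqrt κx0.le
        have b := Real.mul_self_sqrt κy0.le
        nlinarith [mul_nonneg (Real.sqrt_nonneg κx) (Real.sqrt_nonneg κy)]
      nlinarith
    -- the equations
    have eqn : ∀ w : E d, (∀ i, p i w = D * e i) → 0 < m w → ε * (1 - 1 / m w) = ∑ i, q i i w + μ w / m w * (D * D * ∑ i, ∑ j, q i j w * e j * e i) +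
        μ w / m w * (ε * (D * D) + t * D * ∑ i, Vp i w * e i) := fun w hw mw => by
      have e0 := he w
      have e1 : ∑ i, (m w * q i i w + μ w * WG ε t Vp p q i w * p i w) = m w * ∑ i, q i i w + μ w * (D * D * ∑ i, ∑ j, q i j w * e j * e i) +
        μ w * (ε * (D * D) + t * D * ∑ i, Vp i w * e i) := by
        have e4 : ∀ i, WG ε t Vp p q i w * p i w = ε * (D * D) * (e i * e i) + D * D * (∑ j, q i j w * e j * e i) + t * D * (Vp i w * e i) := fun i => by
          have e3 : (∑ j, p j w * q j i w) * p i w = D * D * (∑ j, q i j w * e j * e i) := by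
            rw [Finset.sum_mul, Finset.mul_sum]
            exact Finset.sum_congr rfl fun j _ => by rw [hw, hw, h.sym j i]; ring
          rw [← e3, WG, hw i]; ring
        rw [Finset.sum_add_distrib, ← Finset.mul_sum]
        simp only [mul_assoc (μ w) _ (p _ w), e4]
        rw [← Finset.mul_sum, Finset.sum_add_distrib, Finset.sum_add_distrib, ← Finset.mul_sum, ← Finset.mul_sum, ← Finset.mul_sum, hee]
        ring
      rw [e1] at e0
      field_simp
      linarith
    have ex := eqn x hpx mx
    have ey := eqn y hpy my
    rw [← hκx, ← hQx] at ex
    rw [← hκy, ← hQy] at ey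
    have Vb : ∀ w, |∑ i, Vp i w * e i| ≤ CV := fun w => by
      have := el_dot (fun i => Vp i w) e
      rw [show el e = 1 by rw [el, hee, Real.sqrt_one], mul_one] at this
      exact this.trans (hV w)
    have vx : t * D * ∑ i, Vp i x * e i ≤ CV * (D * D) := by
      have b := (abs_le.1 (Vb x)).2
      have a : t * D * ∑ i, Vp i x * e i ≤ t * D * CV := mul_le_mul_of_nonneg_left b (by positivity)
      have a2 : t * (D * CV) ≤ 1 * (D * CV) := mul_le_mul_of_nonneg_right ht1 (by positivity)
      have a3 : 1 * (D * CV) ≤ D * (D * CV) := mul_le_mul_of_nonneg_right hD1 (by positivity)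
      linarith
    have vy : - (CV * (D * D)) ≤ t * D * ∑ i, Vp i y * e i := by
      have b := (abs_le.1 (Vb y)).1
      have a : t * D * (- CV) ≤ t * D * ∑ i, Vp i y * e i := mul_le_mul_of_nonneg_left b (by positivity)
      have a2 : t * (D * CV) ≤ 1 * (D * CV) := mul_le_mul_of_nonneg_right ht1 (by positivity)
      have a3 : 1 * (D * CV) ≤ D * (D * CV) := mul_le_mul_of_nonneg_right hD1 (by positivity)
      linarith
    have m1 : 1 / m x ≤ 1 / c := one_div_le_one_div_of_le hc (hm x)
    have m2 : 0 < 1 / m y := by positivity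
    have dd2 := mul_le_mul_of_nonneg_left dd (by positivity : 0 ≤ D * D)
    have wx := mul_le_mul_of_nonneg_left vx κx0.le
    have wy := mul_le_mul_of_nonneg_left vy κy0.le
    have f1 : ε * (1 / m x) ≤ ε / c := by rw [← mul_one_div ε c]; exact mul_le_mul_of_nonneg_left m1 hε.le
    have f2 : 0 ≤ ε * (1 / m y) := by positivity
    have f3 : 0 ≤ κy * (ε * (D * D)) := by positivity
    have f4 : 0 ≤ (ε / c) * (D * D * (κx + κy)) := by positivity
    have f5 : N * (D * D * (κx + κy)) = ε * (D * D * (κx + κy)) + CV * (D * D * (κx + κy)) + ε / c * (D * D * (κx + κy)) := by rw [hN]; ring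
    have f6 : ε / c ≤ N := by rw [hN]; linarith
    linarith
  -- conclusion
  have lip : ∀ x z : E d, el z ≤ 1 → |u (x + z) - u x| ≤ K * el z := fun x z hz => by
    have en : el (-z) = el z := by
      have := el_smul (-1) z
      simpa [show (fun i => -z i) = -z from rfl] using this
    have a := main x (-z) (by rw [en]; exact hz)
    have b := main (x + z) z hz
    rw [en] at a
    simp only [ψ, sub_neg_eq_add, add_sub_cancel_right] at a b
    have := el_nonneg z
    rw [abs_le]; constructor <;> nlinarith [sq_nonneg (el z)]
  set v : E d := fun i => p i x with hv
  have hd := h.gu.line x v 0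
  have hle := hd.le_of_lip' (C := K * el v) (mul_nonneg (by positivity) (el_nonneg _)) (by
    have c1 : Continuous fun s : ℝ => el (fun i => s * v i) := el_cont (by fun_prop)
    have e2 : ∀ᶠ s : ℝ in 𝓝 0, el (fun i => s * v i) < 1 := c1.continuousAt.eventually (gt_mem_nhds (by simp [el]))
    filter_upwards [e2] with s hs
    have := lip x (fun i => s * v i) hs.le
    rw [el_smul] at this
    simp only [zero_smul, add_zero, sub_zero, Real.norm_eq_abs]
    calc |u (x + s • v) - u x| ≤ _ := this
      _ = _ := by ring)
  simp only [zero_smul, add_zero] at hle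
  rw [show ∑ i, p i x * v i = el v * el v by rw [el_sq], Real.norm_of_nonneg (mul_nonneg (el_nonneg _) (el_nonneg _))] at hle
  by_contra hcon
  push Not at hcon
  have : 0 < el v := lt_of_le_of_lt (by positivity) hcon
  nlinarith

end MFG

end S15

section S16

open MeasureTheory Set Filter Topology

namespace MFG
variable {d : ℕ} {α : ℝ}

/-- bounded and Hölder with constant `B` -/
def BH (α B : ℝ) (f : E d → ℝ) : Prop := (∀ x, |f x| ≤ B) ∧ ∀ x y, |f x - f y| ≤ B * dist x y ^ α

theorem BH.nonneg {B : ℝ} {f : E d → ℝ} (h : BH α B f) : 0 ≤ B := (abs_nonneg _).trans (h.1 0)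

theorem BH.mono {A B : ℝ} {f : E d → ℝ} (h : BH α A f) (hAB : A ≤ B) : BH α B f :=
  ⟨fun x => (h.1 x).trans hAB, fun x y => (h.2 x y).trans (mul_le_mul_of_nonneg_right hAB (by positivity))⟩

theorem BH.add {A B : ℝ} {f g : E d → ℝ} (hf : BH α A f) (hg : BH α B g) : BH α (A + B) fun x => f x + g x :=
  ⟨fun x => (abs_add_le _ _).trans (add_le_add (hf.1 x) (hg.1 x)), fun x y => by
    rw [show f x + g x - (f y + g y) = (f x - f y) + (g x - g y) by ring, add_mul]
    exact (abs_add_le _ _).trans (add_le_add (hf.2 x y) (hg.2 x y))⟩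

theorem BH.mul {A B : ℝ} {f g : E d → ℝ} (hf : BH α A f) (hg : BH α B g) : BH α (2 * A * B) fun x => f x * g x := by
  refine ⟨fun x => ?_, mul_hol hf.1 hg.1 hf.2 hg.2⟩
  rw [abs_mul]
  have := mul_le_mul (hf.1 x) (hg.1 x) (abs_nonneg _) hf.nonneg
  nlinarith [mul_nonneg hf.nonneg hg.nonneg]

theorem BH.const (c : ℝ) : BH α |c| fun _ : E d => c := ⟨fun x => le_rfl, fun x y => by
  rw [sub_self, abs_zero]; positivity⟩

theorem BH.sum {B : ℝ} {f : Fin d → E d → ℝ} (h : ∀ i, BH α B (f i)) : BH α (d * B) fun x => ∑ i, f i x := by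
  have key : ∀ a : Fin d → ℝ, ∀ c, (∀ i, |a i| ≤ c) → |∑ i, a i| ≤ d * c := fun a c ha => by
    refine (Finset.abs_sum_le_sum_abs _ _).trans ((Finset.sum_le_card_nsmul _ _ c fun i _ => ha i).trans ?_)
    simp
  refine ⟨fun x => key _ _ fun i => (h i).1 x, fun x y => ?_⟩
  rw [← Finset.sum_sub_distrib, mul_assoc]
  exact key _ _ fun i => (h i).2 x y

theorem BH.of_lip (hα : 0 < α) (hα1 : α < 1) {L S : ℝ} {f : E d → ℝ} (hL : 0 ≤ L) (hS : ∀ x, |f x| ≤ S)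
    (h : ∀ x y, |f x - f y| ≤ L * dist x y) : BH α (L + 2 * S) f := by
  have hS0 : 0 ≤ S := (abs_nonneg _).trans (hS 0)
  exact ⟨fun x => (hS x).trans (by linarith), hol_of_lip hα hα1.le hL hS h⟩

/-- the (rescaled) system -/
structure Sys (α c K ε ρ : ℝ) (w : E d → ℝ) (p : Fin d → E d → ℝ) (q : Fin d → Fin d → E d → ℝ) (m μ : E d → ℝ)
    (b : Fin d → E d → ℝ) : Prop where
  gp : ∀ i, HasGrad (p i) (q i)
  sym : ∀ i j x, q i j x = q j i x
  hol : ∃ H, ∀ i j x y, |q i j x - q i j y| ≤ H * dist x y ^ α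
  gw : HasGrad w fun i x => ∑ j, p j x * q j i x + ρ * (ε * p i x + b i x)
  gm : HasGrad m fun i x => μ x * (∑ j, p j x * q j i x + ρ * (ε * p i x + b i x))
  bp : ∀ i x, |p i x| ≤ K
  bb : ∀ i, BH α K (b i)
  mlo : ∀ x, c ≤ m x
  mhi : ∀ x, m x ≤ K
  μlo : ∀ x, c ≤ μ x
  μhi : ∀ x, μ x ≤ K
  μhol : ∀ x y, |μ x - μ y| ≤ K * |w x - w y| ^ α
  eq : ∀ x, ∑ i, (m x * q i i x + μ x * (∑ j, p j x * q j i x + ρ * (ε * p i x + b i x)) * p i x) = ρ * (ε * (m x - 1))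

theorem Sys.scale (hα : 0 < α) {c K ε : ℝ} {w : E d → ℝ} {p q} {m μ : E d → ℝ} {b} (h : Sys α c K ε 1 w p q m μ b) (x0 : E d) {r : ℝ} (hr : 0 < r) (hr1 : r ≤ 1) :
    Sys α c K ε r (fun z => w (x0 + r • z)) (fun i z => p i (x0 + r • z)) (fun i j z => r * q i j (x0 + r • z)) (fun z => m (x0 + r • z))
      (fun z => μ (x0 + r • z)) (fun i z => b i (x0 + r • z)) where
  gp i := (h.gp i).affine x0 r
  sym i j x := by rw [h.sym]
  hol := by
    obtain ⟨H, hH⟩ := h.hol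
    refine ⟨|H|, fun i j x y => ?_⟩
    rw [← mul_sub, abs_mul, abs_of_pos hr]
    have h1 := hH i j (x0 + r • x) (x0 + r • y)
    rw [dist_add_left, dist_smul₀, Real.norm_of_nonneg hr.le] at h1
    have h2 : (r * dist x y) ^ α ≤ dist x y ^ α := Real.rpow_le_rpow (by positivity) (mul_le_of_le_one_left dist_nonneg hr1) hα.le
    calc r * _ ≤ 1 * (|H| * dist x y ^ α) := mul_le_mul hr1 (h1.trans (mul_le_mul (le_abs_self _) h2 (by positivity) (abs_nonneg _)))
          (abs_nonneg _) zero_le_one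
      _ = _ := one_mul _
  gw := (h.gw.affine x0 r).congr fun i x => by
    simp only [mul_add, Finset.mul_sum]; congr 1
    · exact Finset.sum_congr rfl fun j _ => by ring
    · ring
  gm := (h.gm.affine x0 r).congr fun i x => by
    simp only [mul_add, Finset.mul_sum]; congr 1
    · exact Finset.sum_congr rfl fun j _ => by ring
    · ring
  bp i x := h.bp i _
  bb i := ⟨fun x => (h.bb i).1 _, fun x y => by
    refine ((h.bb i).2 _ _).trans (mul_le_mul_of_nonneg_left ?_ (h.bb i).nonneg)
    rw [dist_add_left, dist_smul₀, Real.norm_of_nonneg hr.le]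
    exact Real.rpow_le_rpow (by positivity) (mul_le_of_le_one_left dist_nonneg hr1) hα.le⟩
  mlo x := h.mlo _
  mhi x := h.mhi _
  μlo x := h.μlo _
  μhi x := h.μhi _
  μhol x y := h.μhol _ _
  eq x := by
    have := congrArg (r * ·) (h.eq (x0 + r • x))
    simp only [one_mul, Finset.mul_sum] at this
    rw [← this]
    refine Finset.sum_congr rfl fun i _ => ?_
    have e : ∑ j, p j (x0 + r • x) * (r * q j i (x0 + r • x)) = r * ∑ j, p j (x0 + r • x) * q j i (x0 + r • x) := by
      rw [Finset.mul_sum]; exact Finset.sum_congr rfl fun j _ => by ring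
    rw [e]; ring

theorem Sys.bh (hα : 0 < α) (hα1 : α < 1) {c K ε ρ : ℝ} (hc : 0 < c) (hK : 1 ≤ K) (hρ0 : 0 ≤ ρ) (hρ : ρ ≤ 1) {w : E d → ℝ} {p q} {m μ : E d → ℝ} {b}
    (h : Sys α c K ε ρ w p q m μ b) (hq : ∀ i j x, |q i j x| ≤ 1) :
    (∀ i, BH α (d + 2 * K) (p i)) ∧ BH α (d * (K * (d * K + (|ε| * K + K))) + 2 * K) m ∧ BH α (K * (d * (d * K + (|ε| * K + K))) ^ α + K) μ := by
  have hd : (0:ℝ) ≤ d := Nat.cast_nonneg d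
  have hG : ∀ i x, |∑ j, p j x * q j i x + ρ * (ε * p i x + b i x)| ≤ d * K + (|ε| * K + K) := fun i x => by
    refine (abs_add_le _ _).trans (add_le_add ?_ ?_)
    · refine (Finset.abs_sum_le_sum_abs _ _).trans ((Finset.sum_le_card_nsmul _ _ K fun j _ => ?_).trans (by simp))
      rw [abs_mul]
      calc _ ≤ K * 1 := mul_le_mul (h.bp j x) (hq j i x) (abs_nonneg _) (by linarith)
        _ = K := mul_one _
    · rw [abs_mul, abs_of_nonneg hρ0]
      have e1 : |ε * p i x + b i x| ≤ |ε| * K + K := (abs_add_le _ _).trans (add_le_add (by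
        rw [abs_mul]; exact mul_le_mul_of_nonneg_left (h.bp i x) (abs_nonneg _)) ((h.bb i).1 x))
      calc _ ≤ 1 * (|ε| * K + K) := mul_le_mul hρ e1 (abs_nonneg _) zero_le_one
        _ = _ := one_mul _
  have hμ : ∀ x, |μ x| ≤ K := fun x => abs_le.2 ⟨by linarith [h.μlo x], h.μhi x⟩
  have hm : ∀ x, |m x| ≤ K := fun x => abs_le.2 ⟨by linarith [h.mlo x], h.mhi x⟩
  refine ⟨fun i => ?_, ?_, ?_⟩
  · exact BH.of_lip hα hα1 hd (h.bp i) fun x y => by simpa using (h.gp i).lip zero_le_one (hq i) x y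
  · refine BH.of_lip hα hα1 (by positivity) hm (h.gm.lip (by positivity) fun i x => ?_)
    rw [abs_mul]
    exact mul_le_mul (hμ x) (hG i x) (abs_nonneg _) (by linarith)
  · have e0 : 0 ≤ K * (d * (d * K + (|ε| * K + K))) ^ α := by positivity
    refine ⟨fun x => (hμ x).trans (by linarith), fun x y => ?_⟩
    have h1 := h.gw.lip (by positivity) hG x y
    calc _ ≤ K * |w x - w y| ^ α := h.μhol x y
      _ ≤ K * (d * (d * K + (|ε| * K + K)) * dist x y) ^ α := by
        refine mul_le_mul_of_nonneg_left (Real.rpow_le_rpow (abs_nonneg _) h1 hα.le) (by linarith)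
      _ = K * (d * (d * K + (|ε| * K + K))) ^ α * dist x y ^ α := by rw [Real.mul_rpow (by positivity) dist_nonneg]; ring
      _ ≤ _ := mul_le_mul_of_nonneg_right (by linarith) (by positivity)

theorem rank1_sum (m μ : ℝ) (p : Fin d → ℝ) (a : Fin d → Fin d → ℝ) :
    ∑ i, ∑ j, (m * (if i = j then 1 else 0) + μ * p i * p j) * a i j = m * ∑ i, a i i + μ * ∑ i, (∑ j, p j * a i j) * p i := by
  rw [← sum_delta, Finset.mul_sum, Finset.mul_sum, ← Finset.sum_add_distrib]
  refine Finset.sum_congr rfl fun i _ => ?_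
  rw [Finset.mul_sum, Finset.sum_mul, Finset.mul_sum, ← Finset.sum_add_distrib]
  exact Finset.sum_congr rfl fun j _ => by ring

/-- ellipticity -/
theorem ell_rank1 {c m μ : ℝ} (hc : c ≤ m) (hμ : 0 ≤ μ) (p ξ : Fin d → ℝ) :
    c * ∑ i, ξ i ^ 2 ≤ ∑ i, ∑ j, (m * (if i = j then 1 else 0) + μ * p i * p j) * ξ j * ξ i := by
  have e : ∑ i, ∑ j, (m * (if i = j then 1 else 0) + μ * p i * p j) * ξ j * ξ i = m * ∑ i, ξ i ^ 2 + μ * ((∑ i, p i * ξ i) * ∑ i, p i * ξ i) := by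
    simp only [mul_assoc _ (ξ _) (ξ _)]
    rw [rank1_sum m μ p fun i j => ξ j * ξ i, Finset.mul_sum _ _ (∑ i, p i * ξ i)]
    congr 2
    · exact Finset.sum_congr rfl fun i _ => by ring
    · exact Finset.sum_congr rfl fun i _ => by
        simp only [← mul_assoc, ← Finset.sum_mul]; ring
  rw [e]
  have := mul_le_mul_of_nonneg_right hc (Finset.sum_nonneg fun i (_ : i ∈ Finset.univ) => sq_nonneg (ξ i))
  nlinarith [mul_nonneg hμ (mul_self_nonneg (∑ i, p i * ξ i))]

theorem BH.of_aa {A : ℝ} {m μ : E d → ℝ} {p : Fin d → E d → ℝ} (hm : BH α A m) (hμ : BH α A μ) (hp : ∀ i, BH α A (p i)) (i j : Fin d) :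
    BH α (2 * A * 1 + 2 * (2 * A * A) * A) fun x => m x * (if i = j then 1 else 0) + μ x * p i x * p j x := by
  refine (hm.mul ((BH.const (if i = j then (1:ℝ) else 0)).mono ?_)).add ((hμ.mul (hp i)).mul (hp j))
  split_ifs <;> simp

theorem sys_schauder (d : ℕ) (hα : 0 < α) (hα1 : α < 1) {c K : ℝ} (ε : ℝ) (hc : 0 < c) (hK : 1 ≤ K) : ∃ C, 0 ≤ C ∧
    ∀ ρ (w : E d → ℝ) p q (m μ : E d → ℝ) b, 0 ≤ ρ → ρ ≤ 1 → Sys α c K ε ρ w p q m μ b → (∀ i j x, |q i j x| ≤ 1) →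
    ∀ i j x y, |q i j x - q i j y| ≤ C * dist x y ^ α := by
  set A : ℝ := (d + 2 * K) + (d * (K * (d * K + (|ε| * K + K))) + 2 * K) + (K * (d * (d * K + (|ε| * K + K))) ^ α + K) with hA
  have a1 : (0:ℝ) ≤ d + 2 * K := by positivity
  have a2 : (0:ℝ) ≤ d * (K * (d * K + (|ε| * K + K))) + 2 * K := by positivity
  have a3 : (0:ℝ) ≤ K * (d * (d * K + (|ε| * K + K))) ^ α + K := by positivity
  have A0 : 0 ≤ A := by positivity
  set F : ℝ := 2 * |ε| * (A + |(-1:ℝ)|) + 2 * |(-1:ℝ)| * (d * (2 * (2 * A * (2 * |ε| * A + K)) * A)) with hF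
  set Lam : ℝ := (2 * A * 1 + 2 * (2 * A * A) * A) + F
  have F0 : 0 ≤ F := by positivity
  have hLam : 0 ≤ Lam := by positivity
  obtain ⟨C, hC0, hC⟩ := schauder d hα hα1 hc hLam
  refine ⟨C, hC0, fun ρ w p q m μ b hρ0 hρ h hq => ?_⟩
  obtain ⟨h1, h2, h3⟩ := h.bh hα hα1 hc hK hρ0 hρ hq
  have g1 : ∀ i, BH α A (p i) := fun i => (h1 i).mono (by linarith)
  have g2 : BH α A m := h2.mono (by linarith)
  have g3 : BH α A μ := h3.mono (by linarith)
  have hAA : ∀ i j, BH α Lam fun x => m x * (if i = j then 1 else 0) + μ x * p i x * p j x := fun i j =>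
    (BH.of_aa g2 g3 g1 i j).mono (by simp only [Lam]; linarith)
  have hf : BH α F fun x => ε * (m x + -1) + -1 * ∑ i, μ x * (ε * p i x + b i x) * p i x :=
    ((BH.const ε).mul (g2.add (BH.const (-1)))).add ((BH.const (-1)).mul (BH.sum fun i => (g3.mul (((BH.const ε).mul (g1 i)).add (h.bb i))).mul (g1 i)))
  refine hC p q _ (fun x => ρ * (ε * (m x + -1) + -1 * ∑ i, μ x * (ε * p i x + b i x) * p i x)) h.gp h.sym hq h.hol
    (fun x ξ => ell_rank1 (h.mlo x) (hc.le.trans (h.μlo x)) (fun i => p i x) ξ) (fun i j => (hAA i j).1) (fun i j => (hAA i j).2)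
    (fun x => ?_) (fun x y => ?_)
  · have e := h.eq x
    rw [rank1_sum (m x) (μ x) (fun i => p i x) fun i j => q i j x]
    have e2 : ∑ i, (m x * q i i x + μ x * (∑ j, p j x * q j i x + ρ * (ε * p i x + b i x)) * p i x) =
        (m x * ∑ i, q i i x + μ x * ∑ i, (∑ j, p j x * q i j x) * p i x) + ρ * ∑ i, μ x * (ε * p i x + b i x) * p i x := by
      rw [Finset.mul_sum, Finset.mul_sum, Finset.mul_sum, ← Finset.sum_add_distrib, ← Finset.sum_add_distrib]
      refine Finset.sum_congr rfl fun i _ => ?_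
      rw [Finset.sum_congr rfl fun j _ => show p j x * q j i x = p j x * q i j x by rw [h.sym]]
      ring
    rw [e2] at e
    linarith
  · rw [← mul_sub, abs_mul, abs_of_nonneg hρ0]
    calc ρ * _ ≤ 1 * (F * dist x y ^ α) := mul_le_mul hρ (hf.2 x y) (abs_nonneg _) zero_le_one
      _ ≤ _ := by
        rw [one_mul]; refine mul_le_mul_of_nonneg_right ?_ (by positivity)
        simp only [Lam]; nlinarith [mul_nonneg (mul_nonneg A0 A0) A0]

/-- the limit system is rigid -/
theorem limit_rigid {c K : ℝ} (hc : 0 < c) {p : Fin d → E d → ℝ} {q : Fin d → Fin d → E d → ℝ} {m μ : E d → ℝ} (gp : ∀ i, HasGrad (p i) (q i))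
    (sym : ∀ i j x, q i j x = q j i x) (cq : ∀ i j, Continuous (q i j)) (cμ : Continuous μ)
    (gm : HasGrad m fun i x => μ x * (∑ j, p j x * q j i x)) (bp : ∀ i x, |p i x| ≤ K)
    (mlo : ∀ x, c ≤ m x) (mhi : ∀ x, m x ≤ K) (μlo : ∀ x, c ≤ μ x) (μhi : ∀ x, μ x ≤ K)
    (eq : ∀ x, ∑ i, (m x * q i i x + μ x * (∑ j, p j x * q j i x) * p i x) = 0) (i j : Fin d) (x : E d) : q i j x = 0 := by
  have hK : 0 ≤ K := hc.le.trans ((mlo x).trans (mhi x))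
  have cp : ∀ i, Continuous (p i) := fun i => (gp i).continuous
  have cm := gm.continuous
  have hX : ∀ i, HasGrad (fun x => m x * p i x) fun k x => m x * q i k x + μ x * (∑ j, p j x * q j k x) * p i x := fun i =>
    (gm.mul (gp i)).congr fun k x => by ring
  have cX : ∀ i k, Continuous fun x => m x * q i k x + μ x * (∑ j, p j x * q j k x) * p i x := fun i k => by fun_prop
  have hw : WeakSol c (K + K * K * K) (fun i j x => m x * (if i = j then 1 else 0) + μ x * p i x * p j x) (p i) (q i) := by
    refine ⟨gp i, cq i, fun i j => by fun_prop, fun x ξ => ell_rank1 (mlo x) (hc.le.trans (μlo x)) (fun i => p i x) ξ, fun a b x => ?_,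
      fun φ Q hφ cQ hs => ?_⟩
    · refine (abs_add_le _ _).trans (add_le_add ?_ ?_)
      · have := mlo x; have := mhi x
        split_ifs
        · rw [mul_one, abs_of_nonneg (by linarith)]; assumption
        · simpa using hK
      · rw [abs_mul, abs_mul]
        exact mul_le_mul (mul_le_mul (abs_le.2 ⟨by linarith [μlo x], μhi x⟩) (bp a x) (abs_nonneg _) hK) (bp b x) (abs_nonneg _) (by positivity)
    · have e1 : ∀ x, ∑ a, ∑ b, (m x * (if a = b then 1 else 0) + μ x * p a x * p b x) * q i b x * Q a x =
        ∑ a, (m x * q a i x + μ x * (∑ j, p j x * q j i x) * p a x) * Q a x := fun x => by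
        simp only [mul_assoc _ (q _ _ _) (Q _ _)]
        rw [rank1_sum (m x) (μ x) (fun i => p i x) fun a b => q i b x * Q a x, Finset.mul_sum, Finset.mul_sum, ← Finset.sum_add_distrib]
        refine Finset.sum_congr rfl fun a _ => ?_
        simp only [← mul_assoc, ← Finset.sum_mul]
        rw [sym i a, Finset.sum_congr rfl fun j _ => show p j x * q j i x = p j x * q i j x by rw [sym]]
        ring
      have cs : ∀ a, HasCompactSupport (Q a) := fun a => grad_compact hφ hs a
      have int : ∀ (f : E d → ℝ) a, Continuous f → Integrable fun x => f x * Q a x := fun f a hf =>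
        (hf.mul (cQ a)).integrable_of_hasCompactSupport ((cs a).mul_left)
      simp only [e1]
      rw [integral_finsetSum _ fun a _ => int _ a (cX a i)]
      rw [Finset.sum_congr rfl fun a _ => commute_pd (hX a) (cX a) hφ cQ hs i a]
      rw [← integral_finsetSum _ fun a _ => int _ i (cX a a)]
      simp only [← Finset.sum_mul, eq, zero_mul, integral_zero]
  have hconst := liouville hc hw (bp i)
  have : HasGrad (p i) fun _ _ => 0 := by
    have : p i = fun _ => p i 0 := funext fun y => hconst y 0
    rw [this]; exact hasGrad_const _
  rw [← (gp i).pd j, this.pd j]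

end MFG

end S16

section S17

open MeasureTheory Set Filter Topology

namespace MFG
variable {d : ℕ} {α : ℝ}

theorem sys_hess (d : ℕ) (hα : 0 < α) (hα1 : α < 1) {c K : ℝ} (ε : ℝ) (hc : 0 < c) (hK : 1 ≤ K) : ∃ K2, 1 ≤ K2 ∧
    ∀ (w : E d → ℝ) p q (m μ : E d → ℝ) b, Sys α c K ε 1 w p q m μ b → (∃ B, ∀ i j x, |q i j x| ≤ B) → ∀ i j x, |q i j x| ≤ K2 := by
  by_contra hcon
  push Not at hcon
  obtain ⟨C, hC0, hC⟩ := sys_schauder d hα hα1 ε hc hK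
  -- a rescaled sequence
  have step : ∀ n : ℕ, ∃ (ρ : ℝ) (w : E d → ℝ) (p : Fin d → E d → ℝ) (q : Fin d → Fin d → E d → ℝ) (m μ : E d → ℝ) (b : Fin d → E d → ℝ),
      0 ≤ ρ ∧ ρ ≤ 1 / ((n:ℝ) + 1) ∧ ρ ≤ 1 ∧ Sys α c K ε ρ w p q m μ b ∧ (∀ i j x, |q i j x| ≤ 1) ∧ 1 / 2 ≤ ∑ i, ∑ j, |q i j 0| := fun n => by
    have hn : (0:ℝ) ≤ n := Nat.cast_nonneg n
    obtain ⟨w, p, q, m, μ, b, hs, ⟨B, hB⟩, i0, j0, x0, h0⟩ := hcon (n + 1) (by linarith)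
    obtain ⟨N, hN, hN2, ⟨⟨i1, j1, x1⟩, h1⟩⟩ := near_max (g := fun s : Fin d × Fin d × E d => |q s.1 s.2.1 s.2.2|) (by linarith : (0:ℝ) ≤ n + 1)
      (fun s => hB _ _ _) (i0 := (i0, j0, x0)) h0
    have N0 : 0 < N := by linarith
    have N1 : 1 / N ≤ 1 := by rw [div_le_one N0]; linarith
    refine ⟨1 / N, _, _, _, _, _, _, by positivity, one_div_le_one_div_of_le (by linarith) hN.le, N1,
      hs.scale hα x1 (by positivity) N1, fun i j x => ?_, ?_⟩
    · rw [abs_mul, abs_of_pos (by positivity : 0 < 1 / N), div_mul_eq_mul_div, one_mul, div_le_one N0]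
      exact hN2 (i, j, _)
    · have e : ∀ i j, |1 / N * q i j (x1 + (1 / N) • 0)| = 1 / N * |q i j x1| := fun i j => by
        rw [abs_mul, abs_of_pos (by positivity : 0 < 1 / N), smul_zero, add_zero]
      have : 1 / 2 ≤ 1 / N * |q i1 j1 x1| := by
        rw [div_mul_eq_mul_div, one_mul, le_div_iff₀ N0]; simp only at h1; linarith
      refine this.trans ?_
      rw [← e]
      refine (Finset.single_le_sum (f := fun j => |1 / N * q i1 j (x1 + (1 / N) • 0)|) (fun _ _ => abs_nonneg _) (Finset.mem_univ j1)).trans ?_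
      exact Finset.single_le_sum (f := fun i => ∑ j, |1 / N * q i j (x1 + (1 / N) • 0)|) (fun _ _ => Finset.sum_nonneg fun _ _ => abs_nonneg _)
        (Finset.mem_univ i1)
  choose ρ w p q m μ b hρ0 hρ hρ1 hs hq hq0 using step
  have hbh := fun n => (hs n).bh hα hα1 hc hK (hρ0 n) (hρ1 n) (hq n)
  have hqh := fun n => hC _ _ _ _ _ _ _ (hρ0 n) (hρ1 n) (hs n) (hq n)
  have hne : Nonempty (Fin d) := by
    by_contra hemp
    rw [not_nonempty_iff] at hemp
    have := hq0 0
    simp only [Finset.univ_eq_empty, Finset.sum_empty] at this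
    norm_num at this
  have tρ : Tendsto ρ uf (𝓝 0) := by
    refine squeeze_zero hρ0 hρ ?_
    exact tendsto_one_div_add_atTop_nhds_zero_nat.mono_left uf_le
  have tp : ∀ i x, Tendsto (fun n => p n i x) uf (𝓝 (ulim fun n => p n i x)) := fun i x => tendsto_ulim fun n => (hs n).bp i x
  have tq : ∀ i j x, Tendsto (fun n => q n i j x) uf (𝓝 (ulim fun n => q n i j x)) := fun i j x => tendsto_ulim fun n => hq n i j x
  have tm : ∀ x, Tendsto (fun n => m n x) uf (𝓝 (ulim fun n => m n x)) := fun x => tendsto_ulim fun n => (hbh n).2.1.1 x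
  have tμ : ∀ x, Tendsto (fun n => μ n x) uf (𝓝 (ulim fun n => μ n x)) := fun x => tendsto_ulim fun n => (hbh n).2.2.1 x
  set p' : Fin d → E d → ℝ := fun i x => ulim fun n => p n i x with hp'
  set q' : Fin d → Fin d → E d → ℝ := fun i j x => ulim fun n => q n i j x with hq'
  set m' : E d → ℝ := fun x => ulim fun n => m n x with hm'
  set μ' : E d → ℝ := fun x => ulim fun n => μ n x with hμ'
  have tb : ∀ i x, Tendsto (fun n => ρ n * (ε * p n i x + b n i x)) uf (𝓝 0) := fun i x => by
    have tb1 := tendsto_ulim (a := fun n => b n i x) fun n => ((hs n).bb i).1 x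
    simpa using tρ.mul (((tp i x).const_mul ε).add tb1)
  have tG : ∀ i x, Tendsto (fun n => ∑ j, p n j x * q n j i x + ρ n * (ε * p n i x + b n i x)) uf (𝓝 (∑ j, p' j x * q' j i x)) := fun i x => by
    simpa using (tendsto_finsetSum Finset.univ fun j _ => (tp j x).mul (tq j i x)).add (tb i x)
  have bhq : ∀ n i j, BH α (C + 1) (q n i j) := fun n i j => ⟨fun x => (hq n i j x).trans (by linarith),
    fun x y => (hqh n i j x y).trans (mul_le_mul_of_nonneg_right (by linarith) (by positivity))⟩
  have bhρ : ∀ n, BH α 1 fun _ : E d => ρ n := fun n => (BH.const (ρ n)).mono (by rw [abs_of_nonneg (hρ0 n)]; exact hρ1 n)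
  have bhG := fun n i => (hbh n).2.2.mul ((BH.sum fun j => ((hbh n).1 j).mul (bhq n j i)).add ((bhρ n).mul (((BH.const ε).mul ((hbh n).1 i)).add ((hs n).bb i))))
  have gp : ∀ i, HasGrad (p' i) (q' i) := fun i => HasGrad.of_tendsto hC0 hα (fun n => (hs n).gp i) (fun n j => hqh n i j) (tp i) (tq i)
  have gm : HasGrad m' fun i x => μ' x * (∑ j, p' j x * q' j i x) :=
    HasGrad.of_tendsto (bhG 0 hne.some).nonneg hα (fun n => (hs n).gm) (fun n i => (bhG n i).2) tm (fun i x => (tμ x).mul (tG i x))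
  have hz := limit_rigid (c := c) (K := K) hc gp (fun i j x => tendsto_nhds_unique (tq i j x) ((tq j i x).congr fun n => (hs n).sym _ _ _))
    (fun i j => holder_continuous hα (holder_of_tendsto (fun n => hqh n i j) (tq i j)))
    (holder_continuous hα (holder_of_tendsto (fun n => (hbh n).2.2.2) tμ)) gm
    (fun i x => le_of_tendsto (tp i x).abs (Eventually.of_forall fun n => (hs n).bp i x))
    (fun x => ge_of_tendsto (tm x) (Eventually.of_forall fun n => (hs n).mlo x))
    (fun x => le_of_tendsto (tm x) (Eventually.of_forall fun n => (hs n).mhi x))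
    (fun x => ge_of_tendsto (tμ x) (Eventually.of_forall fun n => (hs n).μlo x))
    (fun x => le_of_tendsto (tμ x) (Eventually.of_forall fun n => (hs n).μhi x))
    (fun x => by
      have t1 := tendsto_finsetSum Finset.univ fun i (_ : i ∈ Finset.univ) =>
        ((tm x).mul (tq i i x)).add (((tμ x).mul (tG i x)).mul (tp i x))
      have t2 := tρ.mul (((tm x).sub_const 1).const_mul ε)
      rw [zero_mul] at t2
      exact tendsto_nhds_unique t1 (t2.congr fun n => ((hs n).eq x).symm))
  have t3 := tendsto_finsetSum Finset.univ fun i (_ : i ∈ Finset.univ) => tendsto_finsetSum Finset.univ fun j (_ : j ∈ Finset.univ) => (tq i j 0).abs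
  have : 1 / 2 ≤ ∑ i, ∑ j, |q' i j 0| := ge_of_tendsto t3 (Eventually.of_forall hq0)
  simp only [hz, abs_zero, Finset.sum_const_zero] at this
  norm_num at this

theorem sys_full (d : ℕ) (hα : 0 < α) (hα1 : α < 1) {c K : ℝ} (ε : ℝ) (hc : 0 < c) (hK : 1 ≤ K) : ∃ K2, 0 ≤ K2 ∧
    ∀ (w : E d → ℝ) p q (m μ : E d → ℝ) b, Sys α c K ε 1 w p q m μ b → (∃ B, ∀ i j x, |q i j x| ≤ B) → ∀ i j, BH α K2 (q i j) := by
  obtain ⟨K2, hK2, h2⟩ := sys_hess d hα hα1 ε hc hK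
  obtain ⟨C, hC0, hC⟩ := sys_schauder d hα hα1 ε hc hK
  have K0 : 0 < K2 := by linarith
  have e0 : 0 ≤ K2 * C * K2 ^ α := by positivity
  refine ⟨K2 + K2 * C * K2 ^ α, by positivity, fun w p q m μ b hs hB i j => ?_⟩
  have hq := h2 _ _ _ _ _ _ hs hB
  refine ⟨fun x => (hq i j x).trans (by linarith), fun x y => ?_⟩
  have r1 : 1 / K2 ≤ 1 := by rw [div_le_one K0]; linarith
  have := hC _ _ _ _ _ _ _ (by positivity) r1 (hs.scale hα 0 (by positivity) r1) (fun i j x => by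
    rw [abs_mul, abs_of_pos (by positivity : 0 < 1 / K2), div_mul_eq_mul_div, one_mul, div_le_one K0]
    exact hq i j _) i j (K2 • x) (K2 • y)
  rw [smul_smul, smul_smul, one_div_mul_cancel K0.ne', one_smul, one_smul, zero_add, zero_add, ← mul_sub, abs_mul,
    abs_of_pos (by positivity : 0 < 1 / K2), dist_smul₀, Real.norm_of_nonneg K0.le, Real.mul_rpow K0.le dist_nonneg, div_mul_eq_mul_div,
    one_mul, div_le_iff₀ K0] at this
  have e1 : 0 ≤ K2 * dist x y ^ α := by positivity
  linarith

end MFG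

end S17

section S18

open MeasureTheory Set Filter Topology

namespace MFG
variable {d : ℕ} {α : ℝ}

/-- bounds for the potential -/
structure VD (α KV Osc : ℝ) (V : E d → ℝ) (Vp : Fin d → E d → ℝ) : Prop where
  g : HasGrad V Vp
  per : ZPer d V
  bd : ∀ x, |V x| ≤ KV
  osc : ∀ x y, V x - V y ≤ Osc
  bh : ∀ i, BH α KV (Vp i)
  el : ∀ x, el (fun i => Vp i x) ≤ KV

/-- bounds for the polynomial -/
structure Cls (α a b s1 c0 c1 Kp : ℝ) (P : Polynomial ℝ) : Prop where
  p0 : ∀ s ∈ Icc a b, c0 ≤ P.eval s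
  p1 : ∀ s ∈ Icc a b, P.eval s ≤ Kp
  d0 : ∀ s ∈ Icc a b, c1 ≤ P.derivative.eval s
  d1 : ∀ s ∈ Icc a b, P.derivative.eval s ≤ Kp
  hol : ∀ s ∈ Icc a b, ∀ s' ∈ Icc a b, |P.derivative.eval s - P.derivative.eval s'| ≤ Kp * |s - s'| ^ α
  one : P.eval s1 = 1

theorem ap1 {a b s1 c0 c1 Kp KV Osc ε t : ℝ} {P : Polynomial ℝ} (hP : Cls α a b s1 c0 c1 Kp P) (hc0 : 0 < c0) (hc1 : 0 < c1) (hs1 : s1 ∈ Icc a b)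
    {V : E d → ℝ} {Vp} (hV : VD α KV Osc V Vp) (hε : 0 < ε) (ht0 : 0 ≤ t) (ht1 : t ≤ 1) {u : E d → ℝ} {p q}
    (h : PSol P ε t V Vp α u p q) (hw : ∀ x, WW ε t V u p x ∈ Icc a b) :
    (∀ x, s1 - Osc ≤ WW ε t V u p x) ∧ (∀ x, |ε * u x| ≤ |s1| + KV) ∧ ∀ x y, u x - u y ≤ Osc / ε := by
  have hmono : StrictMonoOn (fun s => P.eval s) (Icc a b) := by
    refine strictMonoOn_of_deriv_pos (convex_Icc a b) P.continuous.continuousOn fun s hs => ?_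
    rw [interior_Icc] at hs
    rw [Polynomial.deriv]
    exact hc1.trans_le (hP.d0 s (Ioo_subset_Icc_self hs))
  obtain ⟨x0, _, hx0⟩ := ZPer.exists_max h.c2.per h.c2.gu.continuous
  obtain ⟨y0, _, hy0⟩ := ZPer.exists_min h.c2.per h.c2.gu.continuous
  have px : ∀ i, p i x0 = 0 := fun i => grad_zero_of_max h.c2.gu (Eventually.of_forall hx0) i
  have py : ∀ i, p i y0 = 0 := fun i => by
    have := grad_zero_of_max h.c2.gu.neg (x := y0) (Eventually.of_forall fun y => neg_le_neg (hy0 y)) i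
    linarith
  have tx : ∑ i, q i i x0 ≤ 0 := Finset.sum_nonpos fun i _ => trace_nonpos h.c2.gu h.c2.gp (Eventually.of_forall hx0) i
  have ty : 0 ≤ ∑ i, q i i y0 := Finset.sum_nonneg fun i _ => by
    have := trace_nonpos h.c2.gu.neg (fun i => (h.c2.gp i).neg) (x := y0) (Eventually.of_forall fun y => neg_le_neg (hy0 y)) i
    linarith
  have ex := h.eq x0
  have ey := h.eq y0
  simp only [px, mul_zero, add_zero, ← Finset.mul_sum] at ex
  simp only [py, mul_zero, add_zero, ← Finset.mul_sum] at ey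
  have bx := hc0.trans_le (hP.p0 _ (hw x0))
  have by' := hc0.trans_le (hP.p0 _ (hw y0))
  have wx : WW ε t V u p x0 ≤ s1 := by
    rw [← hmono.le_iff_le (hw x0) hs1]
    simp only [hP.one]
    have : ε * (P.eval (WW ε t V u p x0) - 1) ≤ 0 := by nlinarith
    by_contra hcon
    push Not at hcon
    nlinarith
  have wy : s1 ≤ WW ε t V u p y0 := by
    rw [← hmono.le_iff_le hs1 (hw y0)]
    simp only [hP.one]
    have : 0 ≤ ε * (P.eval (WW ε t V u p y0) - 1) := by nlinarith
    by_contra hcon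
    push Not at hcon
    nlinarith
  simp only [WW, px, mul_zero, Finset.sum_const_zero, add_zero] at wx
  simp only [WW, py, mul_zero, Finset.sum_const_zero, add_zero] at wy
  have hosc : 0 ≤ Osc := by have := hV.osc 0 0; linarith
  have tV : ∀ x y, t * (V x - V y) ≤ Osc := fun x y => by
    have := hV.osc x y
    have := mul_le_mul_of_nonneg_left this ht0
    nlinarith
  have tB : ∀ x, |t * V x| ≤ KV := fun x => by
    rw [abs_mul, abs_of_nonneg ht0]
    have := hV.bd x
    nlinarith [abs_nonneg (V x)]
  have up : ∀ x, ε * u x ≤ s1 - t * V x0 := fun x => by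
    have := mul_le_mul_of_nonneg_left (hx0 x) hε.le
    linarith
  have lo : ∀ x, s1 - t * V y0 ≤ ε * u x := fun x => by
    have := mul_le_mul_of_nonneg_left (hy0 x) hε.le
    linarith
  refine ⟨fun x => ?_, fun x => ?_, fun x y => ?_⟩
  · have := tV y0 x
    have h2 : 0 ≤ ∑ i, p i x * p i x := Finset.sum_nonneg fun i _ => mul_self_nonneg _
    have := lo x
    simp only [WW]; linarith
  · have h1 := up x; have h2 := lo x
    have h3 := abs_le.1 (tB x0); have h4 := abs_le.1 (tB y0)
    have h5 := le_abs_self s1; have h6 := neg_abs_le s1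
    exact abs_le.2 ⟨by linarith, by linarith⟩
  · rw [le_div_iff₀ hε]
    have := up x; have := lo y; have := tV y0 x0
    linarith

/-- the Lipschitz constant -/
noncomputable def KL (c0 KV Osc ε : ℝ) : ℝ := Osc / ε + (ε + KV + ε / c0) + 1
/-- the upper bound for `w` -/
noncomputable def W0 (s1 c0 KV Osc ε : ℝ) : ℝ := |s1| + KV + 1 / 2 * (KL c0 KV Osc ε * KL c0 KV Osc ε) + KV

theorem ap2 {a b s1 c0 c1 Kp KV Osc ε t : ℝ} {P : Polynomial ℝ} (hP : Cls α a b s1 c0 c1 Kp P) (hα : 0 < α) (hc0 : 0 < c0) (hc1 : 0 < c1) (hs1 : s1 ∈ Icc a b)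
    {V : E d → ℝ} {Vp} (hV : VD α KV Osc V Vp) (hε : 0 < ε) (ht0 : 0 ≤ t) (ht1 : t ≤ 1) {u : E d → ℝ} {p q}
    (h : PSol P ε t V Vp α u p q) (hw : ∀ x, WW ε t V u p x ∈ Icc a b) :
    (∀ i x, |p i x| ≤ KL c0 KV Osc ε) ∧ ∀ x, WW ε t V u p x ≤ W0 s1 c0 KV Osc ε := by
  obtain ⟨h1, h2, h3⟩ := ap1 hP hc0 hc1 hs1 hV hε ht0 ht1 h hw
  have hl := lip_est h.c2 hα hε ht0 ht1 hV.el hc0 (fun x => hP.p0 _ (hw x)) (fun x => hc1.trans_le (hP.d0 _ (hw x))) h.eq h3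
  have hl' : ∀ x, el (fun i => p i x) ≤ KL c0 KV Osc ε := hl
  have hsq : ∀ x, ∑ i, p i x * p i x ≤ KL c0 KV Osc ε * KL c0 KV Osc ε := fun x => by
    rw [← el_sq fun i => p i x]
    exact mul_self_le_mul_self (el_nonneg _) (hl' x)
  have k0 : 0 ≤ KL c0 KV Osc ε := (el_nonneg _).trans (hl' 0)
  refine ⟨fun i x => ?_, fun x => ?_⟩
  · have := Finset.single_le_sum (f := fun i => p i x * p i x) (fun i _ => mul_self_nonneg _) (Finset.mem_univ i)
    exact abs_le_of_sq_le_sq (by rw [sq, sq]; exact this.trans (hsq x)) k0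
  · have e1 := (abs_le.1 (h2 x)).2
    have e2 : t * V x ≤ KV := by
      have a1 := (abs_le.1 (hV.bd x)).2
      have a2 := abs_nonneg (V x); have a3 := hV.bd x
      nlinarith
    have e3 := hsq x
    simp only [WW, W0]; linarith

theorem psol_full {a b s1 c0 c1 Kp KV Osc ε : ℝ} (hα : 0 < α) (hα1 : α < 1) (hc0 : 0 < c0) (hc1 : 0 < c1) (hs1 : s1 ∈ Icc a b)
    {V : E d → ℝ} {Vp} (hV : VD α KV Osc V Vp) (hε : 0 < ε) : ∃ KK, ∀ P t (u : E d → ℝ) p q, Cls α a b s1 c0 c1 Kp P → 0 ≤ t → t ≤ 1 →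
    PSol P ε t V Vp α u p q → (∀ x, WW ε t V u p x ∈ Icc a b) →
    (∀ x, |u x| ≤ KK) ∧ (∀ i x, |p i x| ≤ KK) ∧ ∀ i j, BH α KK (q i j) := by
  set k := KL c0 KV Osc ε with hk
  have KV0 : 0 ≤ KV := (abs_nonneg _).trans (hV.bd 0)
  have hosc : 0 ≤ Osc := by have := hV.osc 0 0; linarith
  have k0 : 0 ≤ k := by rw [hk, KL]; positivity
  obtain ⟨K2, hK2, hfull⟩ := sys_full d hα hα1 (c := min c0 c1) (K := 1 + k + KV + |Kp|) ε (lt_min hc0 hc1)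
    (by have := abs_nonneg Kp; linarith)
  have q0 : 0 ≤ (|s1| + KV) / ε := by positivity
  refine ⟨(|s1| + KV) / ε + k + K2, fun P t u p q hP ht0 ht1 h hw => ?_⟩
  obtain ⟨h1, h2, h3⟩ := ap1 hP hc0 hc1 hs1 hV hε ht0 ht1 h hw
  obtain ⟨h4, h5⟩ := ap2 hP hα hc0 hc1 hs1 hV hε ht0 ht1 h hw
  have hq := hfull (WW ε t V u p) p q (fun x => P.eval (WW ε t V u p x)) (fun x => P.derivative.eval (WW ε t V u p x)) (fun i x => t * Vp i x)
    { gp := h.c2.gp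
      sym := h.c2.sym
      hol := h.c2.hol
      gw := (WW_grad hV.g h.c2.gu h.c2.gp).congr fun i x => by simp only [WG]; ring
      gm := ((WW_grad hV.g h.c2.gu h.c2.gp).comp (F := fun s => P.eval s) (F' := fun s => P.derivative.eval s) fun x => P.hasDerivAt _).congr
        fun i x => by simp only [WG]; ring
      bp := fun i x => (h4 i x).trans (by have := abs_nonneg Kp; linarith)
      bb := fun i => by
        have hm := abs_nonneg Kp
        refine ⟨fun x => ?_, fun x y => ?_⟩
        · rw [abs_mul, abs_of_nonneg ht0]
          have := (hV.bh i).1 x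
          nlinarith [abs_nonneg (Vp i x)]
        · rw [← mul_sub, abs_mul, abs_of_nonneg ht0]
          have e1 := (hV.bh i).2 x y
          have e2 : 0 ≤ (1 + k + |Kp|) * dist x y ^ α := by positivity
          nlinarith [abs_nonneg (Vp i x - Vp i y)]
      mlo := fun x => (min_le_left _ _).trans (hP.p0 _ (hw x))
      mhi := fun x => (hP.p1 _ (hw x)).trans (by have := le_abs_self Kp; linarith)
      μlo := fun x => (min_le_right _ _).trans (hP.d0 _ (hw x))
      μhi := fun x => (hP.d1 _ (hw x)).trans (by have := le_abs_self Kp; linarith)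
      μhol := fun x y => (hP.hol _ (hw x) _ (hw y)).trans (mul_le_mul_of_nonneg_right (by have := le_abs_self Kp; linarith) (by positivity))
      eq := fun x => by
        have := h.eq x
        rw [sub_eq_zero] at this
        rw [one_mul, this]
        refine Finset.sum_congr rfl fun i _ => by simp only [WG]; ring } (by
    choose B hB using fun s : Fin d × Fin d => ZPer.bounded (h.c2.perq s.1 s.2) (h.c2.cq hα s.1 s.2)
    refine ⟨∑ s, |B s|, fun i j x => ((hB (i, j)).2 x).trans ((le_abs_self _).trans ?_)⟩
    exact Finset.single_le_sum (f := fun s => |B s|) (fun _ _ => abs_nonneg _) (Finset.mem_univ (i, j)))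
  refine ⟨fun x => ?_, fun i x => (h4 i x).trans (by linarith), fun i j => (hq i j).mono (by linarith)⟩
  have := h2 x
  rw [abs_mul, abs_of_pos hε, mul_comm, ← le_div_iff₀ hε] at this
  linarith

end MFG

end S18

section S19

open MeasureTheory Set Filter Topology

namespace MFG
variable {d : ℕ} {α : ℝ}

/-- limits of `WW` -/
theorem tendsto_WW {ε : ℝ} {V : E d → ℝ} {t : ℕ → ℝ} {u : ℕ → E d → ℝ} {p : ℕ → Fin d → E d → ℝ} {t' : ℝ} {u' : E d → ℝ} {p' : Fin d → E d → ℝ}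
    (ht : Tendsto t uf (𝓝 t')) (hu : ∀ x, Tendsto (fun n => u n x) uf (𝓝 (u' x))) (hp : ∀ i x, Tendsto (fun n => p n i x) uf (𝓝 (p' i x))) (x : E d) :
    Tendsto (fun n => WW ε (t n) V (u n) (p n) x) uf (𝓝 (WW ε t' V u' p' x)) :=
  (((hu x).const_mul ε).add ((tendsto_finsetSum Finset.univ fun i _ => (hp i x).mul (hp i x)).const_mul (1/2))).add (ht.mul_const (V x))

theorem tendsto_WG {ε : ℝ} {Vp : Fin d → E d → ℝ} {t : ℕ → ℝ} {p : ℕ → Fin d → E d → ℝ} {q : ℕ → Fin d → Fin d → E d → ℝ} {t' : ℝ}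
    {p' : Fin d → E d → ℝ} {q' : Fin d → Fin d → E d → ℝ}
    (ht : Tendsto t uf (𝓝 t')) (hp : ∀ i x, Tendsto (fun n => p n i x) uf (𝓝 (p' i x)))
    (hq : ∀ i j x, Tendsto (fun n => q n i j x) uf (𝓝 (q' i j x))) (i : Fin d) (x : E d) :
    Tendsto (fun n => WG ε (t n) Vp (p n) (q n) i x) uf (𝓝 (WG ε t' Vp p' q' i x)) :=
  (((hp i x).const_mul ε).add (tendsto_finsetSum Finset.univ fun j _ => (hp j x).mul (hq j i x))).add (ht.mul_const (Vp i x))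

theorem psol_exists {a b s1 c0 c1 Kp KV Osc ε : ℝ} (hα : 0 < α) (hα1 : α < 1) (hc0 : 0 < c0) (hc1 : 0 < c1)
    (ha : a < s1 - Osc) (hb : W0 s1 c0 KV Osc ε < b) (hs1 : s1 ≤ b)
    {V : E d → ℝ} {Vp} (hV : VD α KV Osc V Vp) (hε : 0 < ε) {P : Polynomial ℝ} (hP : Cls α a b s1 c0 c1 Kp P) :
    ∃ (u : E d → ℝ) (p : Fin d → E d → ℝ) (q : Fin d → Fin d → E d → ℝ), PSol P ε 1 V Vp α u p q ∧ ∀ x, WW ε 1 V u p x ∈ Icc a b := by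
  have hosc : 0 ≤ Osc := by have := hV.osc 0 0; linarith
  have s1m : s1 ∈ Icc a b := ⟨by linarith, hs1⟩
  obtain ⟨KK, hKK⟩ := psol_full (Kp := Kp) hα hα1 hc0 hc1 s1m hV hε
  let S : Set ℝ := {t | ∃ (u : E d → ℝ) (p : Fin d → E d → ℝ) (q : Fin d → Fin d → E d → ℝ), PSol P ε t V Vp α u p q ∧ ∀ x, WW ε t V u p x ∈ Icc a b}
  suffices hS : Icc (0:ℝ) 1 ⊆ S from hS ⟨zero_le_one, le_rfl⟩
  refine IsClosed.Icc_subset_of_forall_mem_nhdsWithin ?_ ?_ ?_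
  · refine IsSeqClosed.isClosed fun t t' ht htt => ?_
    choose u p q hs hw using fun n => (ht n).1
    have hk := fun n => hKK P (t n) (u n) (p n) (q n) hP (ht n).2.1 (ht n).2.2 (hs n) (hw n)
    obtain ⟨u', p', q', hC, tu, tp, tq⟩ := C2A.of_tendsto hα (fun n => (hs n).c2) (fun n => (hk n).1) (fun n => (hk n).2.1)
      (fun n i j => ((hk n).2.2 i j).1) (fun n i j => ((hk n).2.2 i j).2)
    have tt := htt.mono_left uf_le
    have tW := tendsto_WW (ε := ε) (V := V) tt tu tp
    have tG := tendsto_WG (ε := ε) (Vp := Vp) tt tp tq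
    refine ⟨⟨u', p', q', ⟨hC, fun x => ?_⟩, fun x => ?_⟩, isClosed_Icc.mem_of_tendsto htt (Eventually.of_forall fun n => (ht n).2)⟩
    · have tP := (P.continuous.tendsto _).comp (tW x)
      have tP' := (P.derivative.continuous.tendsto _).comp (tW x)
      have := ((tP.sub_const 1).const_mul ε).sub (tendsto_finsetSum Finset.univ fun i (_ : i ∈ Finset.univ) => (tP.mul (tq i i x)).add ((tP'.mul (tG i x)).mul (tp i x)))
      exact tendsto_nhds_unique this (tendsto_const_nhds.congr fun n => ((hs n).eq x).symm)
    · exact isClosed_Icc.mem_of_tendsto (tW x) (Eventually.of_forall fun n => hw n x)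
  · refine ⟨fun _ => s1 / ε, fun _ _ => 0, fun _ _ _ => 0, ⟨⟨fun _ _ => rfl, hasGrad_const _, fun _ => hasGrad_const _, fun _ _ _ => rfl, 0, fun i j x y => by simp⟩,
      fun x => ?_⟩, fun x => ?_⟩
    · have : WW ε 0 V (fun _ => s1 / ε) (fun _ _ => 0) x = s1 := by simp [WW]; field_simp
      rw [this, hP.one]; simp
    · have : WW ε 0 V (fun _ => s1 / ε) (fun _ _ => 0) x = s1 := by simp [WW]; field_simp
      rw [this]; exact s1m
  · rintro t ⟨⟨u, p, q, hs, hw⟩, ht0, ht1⟩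
    obtain ⟨h1, -, -⟩ := ap1 hP hc0 hc1 s1m hV hε ht0 ht1.le hs hw
    obtain ⟨-, h5⟩ := ap2 hP hα hc0 hc1 s1m hV hε ht0 ht1.le hs hw
    have hη : 0 < min (s1 - Osc - a) (b - W0 s1 c0 KV Osc ε) := lt_min (by linarith) (by linarith)
    have := open_step hα hα1 hε hV.g hV.per (fun i => (hV.bh i).2) hs (fun x => hc0.trans_le (hP.p0 _ (hw x)))
      (fun x => hc1.trans_le (hP.d0 _ (hw x))) hη
    refine Filter.mem_of_superset (this.filter_mono nhdsWithin_le_nhds) ?_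
    rintro t' ⟨u', p', q', hs', hx⟩
    refine ⟨u', p', q', hs', fun x => ?_⟩
    have e1 := abs_lt.1 (lt_of_lt_of_le (hx x) (min_le_left _ _))
    have e2 := abs_lt.1 (lt_of_lt_of_le (hx x) (min_le_right _ _))
    exact ⟨by linarith [h1 x], by linarith [h5 x]⟩

end MFG

end S19

section S20

open MeasureTheory Set Filter Topology

namespace MFG
variable {d : ℕ} {α : ℝ}

theorem poly_anti (Q : Polynomial ℝ) : ∃ P : Polynomial ℝ, P.derivative = Q := by
  induction Q using Polynomial.induction_on' with
  | add p q hp hq =>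
    obtain ⟨P, hP⟩ := hp
    obtain ⟨R, hR⟩ := hq
    exact ⟨P + R, by simp [hP, hR]⟩
  | monomial n a =>
    refine ⟨Polynomial.monomial (n + 1) (a / (n + 1)), ?_⟩
    rw [Polynomial.derivative_monomial]
    have : (n:ℝ) + 1 ≠ 0 := by positivity
    simp; field_simp

theorem poly_anti' (Q : Polynomial ℝ) (s y : ℝ) : ∃ P : Polynomial ℝ, P.derivative = Q ∧ P.eval s = y := by
  obtain ⟨P, hP⟩ := poly_anti Q
  exact ⟨P + Polynomial.C (y - P.eval s), by simp [hP], by simp⟩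

theorem steklov (hα : 0 < α) {C h : ℝ} (hh : 0 < h) (hC : 0 ≤ C) {f : ℝ → ℝ} (hf : ∀ s s', |f s - f s'| ≤ C * |s - s'| ^ α) :
    ∃ F : ℝ → ℝ, (∀ s, HasDerivAt F (h⁻¹ * (f (s + h) - f s)) s) ∧ (∀ s, |F s - f s| ≤ C * h ^ α) ∧ ∀ s s', |F s - F s'| ≤ C * |s - s'| ^ α := by
  have cf : Continuous f := holder_continuous hα (B := C) fun x y => by rw [Real.dist_eq]; exact hf x y
  have e : ∀ s, h⁻¹ * ((∫ r in (0:ℝ)..(s + h), f r) - ∫ r in (0:ℝ)..s, f r) = ∫ r in (0:ℝ)..1, f (s + h * r) := fun s => by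
    rw [intervalIntegral.integral_interval_sub_left (cf.intervalIntegrable _ _) (cf.intervalIntegrable _ _),
      intervalIntegral.integral_comp_add_mul (f := f) hh.ne' s]
    simp
  have ci : ∀ s, IntervalIntegrable (fun r => f (s + h * r)) volume 0 1 := fun s => (by fun_prop : Continuous fun r => f (s + h * r)).intervalIntegrable _ _
  refine ⟨fun s => ∫ r in (0:ℝ)..1, f (s + h * r), fun s => ?_, fun s => ?_, fun s s' => ?_⟩
  · have d1 : ∀ s, HasDerivAt (fun s => ∫ r in (0:ℝ)..s, f r) (f s) s := fun s => (cf.integral_hasStrictDerivAt 0 s).hasDerivAt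
    have d2 := ((d1 (s + h)).comp_add_const s h).sub (d1 s) |>.const_mul h⁻¹
    exact d2.congr_of_eventuallyEq (Eventually.of_forall fun s => (e s).symm)
  · have : (∫ r in (0:ℝ)..1, f (s + h * r)) - f s = ∫ r in (0:ℝ)..1, (f (s + h * r) - f s) := by
      rw [intervalIntegral.integral_sub (ci s) (by simp)]; simp
    rw [this]
    have := intervalIntegral.norm_integral_le_of_norm_le_const (a := (0:ℝ)) (b := 1) (C := C * h ^ α) (f := fun r => f (s + h * r) - f s) fun r hr => by
      rw [uIoc_of_le zero_le_one] at hr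
      refine (hf _ _).trans (mul_le_mul_of_nonneg_left (Real.rpow_le_rpow (abs_nonneg _) ?_ hα.le) hC)
      rw [add_sub_cancel_left, abs_of_pos (mul_pos hh hr.1)]
      exact mul_le_of_le_one_right hh.le hr.2
    simpa using this
  · dsimp only
    rw [← intervalIntegral.integral_sub (ci s) (ci s')]
    have := intervalIntegral.norm_integral_le_of_norm_le_const (a := (0:ℝ)) (b := 1) (C := C * |s - s'| ^ α) (f := fun r => f (s + h * r) - f (s' + h * r)) fun r hr => by
      refine (hf _ _).trans (le_of_eq ?_)
      rw [add_sub_add_right_eq_sub]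
    simpa using this

theorem poly_approx (hα : 0 < α) (hα1 : α < 1) {C a b s1 η : ℝ} (hC : 0 ≤ C) (hab : a ≤ b) (hη : 0 < η) {f : ℝ → ℝ} (hf : ∀ s s', |f s - f s'| ≤ C * |s - s'| ^ α) :
    ∃ P : Polynomial ℝ, (∀ s ∈ Icc a b, |P.derivative.eval s - f s| ≤ η) ∧
      (∀ s ∈ Icc a b, ∀ s' ∈ Icc a b, |P.derivative.eval s - P.derivative.eval s'| ≤ (C + 1) * |s - s'| ^ α) ∧ P.eval s1 = 1 := by
  have cf : Continuous f := holder_continuous hα (B := C) fun x y => by rw [Real.dist_eq]; exact hf x y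
  obtain ⟨h, hh, hh2⟩ : ∃ h : ℝ, 0 < h ∧ C * h ^ α ≤ η / 2 := by
    refine ⟨(η / 2 / (C + 1)) ^ (α⁻¹), by positivity, ?_⟩
    rw [← Real.rpow_mul (by positivity), inv_mul_cancel₀ hα.ne', Real.rpow_one, mul_div_assoc', div_le_iff₀ (by positivity)]
    nlinarith
  obtain ⟨F, F1, F2, F3⟩ := steklov hα hh hC hf
  have l0 : 0 < 1 + 2 * (b - a) := by linarith
  set δ := min 1 (η / 2) / (1 + 2 * (b - a)) with hδ
  have m0 : 0 < min 1 (η / 2) := lt_min one_pos (by linarith)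
  have δ0 : 0 < δ := by positivity
  have δ1 : δ + 2 * (δ * (b - a)) = min 1 (η / 2) := by rw [hδ]; field_simp
  obtain ⟨Q, hQ⟩ := exists_polynomial_near_of_continuousOn a b (fun s => h⁻¹ * (f (s + h) - f s)) (by fun_prop) δ δ0
  obtain ⟨R, hR, hRa⟩ := poly_anti' Q a (F a)
  obtain ⟨P, hP, hP1⟩ := poly_anti' R s1 1
  have hlip : ∀ s ∈ Icc a b, ∀ s' ∈ Icc a b, |(R.eval s - F s) - (R.eval s' - F s')| ≤ δ * |s - s'| := fun s hs s' hs' => by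
    have := Convex.norm_image_sub_le_of_norm_hasDerivWithin_le (f := fun s => R.eval s - F s) (C := δ) (s := Icc a b)
      (fun x hx => ((R.hasDerivAt x).sub (F1 x)).hasDerivWithinAt) (fun x hx => by rw [hR]; exact (hQ x hx).le) (convex_Icc a b) hs' hs
    simpa using this
  have hsup : ∀ s ∈ Icc a b, |R.eval s - F s| ≤ δ * (b - a) := fun s hs => by
    have := hlip s hs a ⟨le_rfl, hab⟩
    rw [hRa, sub_self, sub_zero] at this
    refine this.trans (mul_le_mul_of_nonneg_left ?_ δ0.le)
    rw [abs_of_nonneg (by linarith [hs.1])]; linarith [hs.2]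
  rw [← hP] at hlip hsup
  refine ⟨P, fun s hs => ?_, fun s hs s' hs' => ?_, hP1⟩
  · have := (abs_add_le (P.derivative.eval s - F s) (F s - f s)).trans (add_le_add (hsup s hs) ((F2 s).trans hh2))
    rw [sub_add_sub_cancel] at this
    have : min 1 (η / 2) ≤ η / 2 := min_le_right _ _
    have : 0 ≤ δ * (b - a) := mul_nonneg δ0.le (by linarith)
    linarith
  · have e1 := hol_of_lip (X := Icc a b) (v := fun s => P.derivative.eval (s : ℝ) - F s) (S := δ * (b - a)) hα hα1.le δ0.le (fun s => hsup s s.2)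
      (fun s s' => hlip s s.2 s' s'.2) ⟨s, hs⟩ ⟨s', hs'⟩
    rw [δ1, Subtype.dist_eq, Real.dist_eq] at e1
    dsimp only at e1
    have e2 := (abs_add_le _ _).trans (add_le_add e1 (F3 s s'))
    rw [show P.derivative.eval s - F s - (P.derivative.eval s' - F s') + (F s - F s') = P.derivative.eval s - P.derivative.eval s' by ring] at e2
    refine e2.trans ?_
    rw [← add_mul]
    refine mul_le_mul_of_nonneg_right ?_ (by positivity)
    have : min 1 (η / 2) ≤ 1 := min_le_left _ _
    linarith

end MFG

end S20

section S21

open MeasureTheory Set Filter Topology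

namespace MFG
variable {d : ℕ} {α : ℝ}

/-- the local inverse of `g` -/
structure Inv (α : ℝ) (g : ℝ → ℝ) (ml mh : ℝ) (N f : ℝ → ℝ) (c k C : ℝ) : Prop where
  c0 : 0 < c
  C0 : 0 ≤ C
  lo : ∀ z ∈ Icc ml mh, c ≤ deriv g z
  hi : ∀ z ∈ Icc ml mh, deriv g z ≤ k
  mem : ∀ s, N s ∈ Icc ml mh
  left : ∀ z ∈ Icc ml mh, N (g z) = z
  right : ∀ s ∈ Icc (g ml) (g mh), g (N s) = s
  fdef : ∀ s, f s = 1 / deriv g (N s)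
  lip : ∀ s s', |N s - N s'| ≤ 1 / c * |s - s'|
  hol : ∀ s s', |f s - f s'| ≤ C * |s - s'| ^ α
  der : ∀ s ∈ Ioo (g ml) (g mh), HasDerivAt N (f s) s

theorem inv_exists (hα : 0 < α) {g : ℝ → ℝ} (hg : Ghyp α g) (hd : ∀ z, 0 < z → 0 < deriv g z) {ml mh : ℝ}
    (h0 : 0 < ml) (hlt : ml < mh) : ∃ N f c k C, Inv α g ml mh N f c k C := by
  obtain ⟨hmono, hcont, hdiff, hloc⟩ := hg
  have hpos : ∀ z ∈ Icc ml mh, 0 < z := fun z hz => h0.trans_le hz.1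
  have hsub : Icc ml mh ⊆ Ici 0 := fun z hz => (hpos z hz).le
  obtain ⟨Cg, hCg, hH⟩ := hloc (Icc ml mh) isCompact_Icc hpos
  have hdc : ContinuousOn (deriv g) (Icc ml mh) := by
    intro x hx
    rw [ContinuousWithinAt, tendsto_iff_dist_tendsto_zero]
    have hl : Tendsto (fun y => Cg * dist y x ^ α) (𝓝[Icc ml mh] x) (𝓝 0) := by
      have : Continuous fun y : ℝ => Cg * dist y x ^ α := by
        refine continuous_const.mul (Continuous.rpow_const (by fun_prop) fun _ => Or.inr hα.le)
      have h2 := (this.tendsto x).mono_left (nhdsWithin_le_nhds (s := Icc ml mh))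
      simpa [Real.zero_rpow hα.ne'] using h2
    refine squeeze_zero' (Eventually.of_forall fun _ => dist_nonneg) ?_ hl
    filter_upwards [self_mem_nhdsWithin] with y hy
    rw [Real.dist_eq]
    exact hH y hy x hx
  have hne : (Icc ml mh).Nonempty := nonempty_Icc.2 hlt.le
  obtain ⟨z0, hz0, hmin⟩ := isCompact_Icc.exists_isMinOn hne hdc
  obtain ⟨z1, hz1, hmax⟩ := isCompact_Icc.exists_isMaxOn hne hdc
  set c := deriv g z0 with hc
  have c0 : 0 < c := hd _ (hpos _ hz0)
  have lo : ∀ z ∈ Icc ml mh, c ≤ deriv g z := fun z hz => hmin hz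
  have hab : g ml ≤ g mh := hmono.monotoneOn h0.le (h0.trans hlt).le hlt.le
  have hproj : ∀ s, max (g ml) (min s (g mh)) ∈ Icc (g ml) (g mh) := fun s =>
    ⟨le_max_left _ _, max_le hab (min_le_right _ _)⟩
  have hsurj : ∀ s, ∃ z ∈ Icc ml mh, g z = max (g ml) (min s (g mh)) := fun s =>
    intermediate_value_Icc hlt.le (hcont.mono hsub) (hproj s)
  choose N mem hN using hsurj
  have fix : ∀ s ∈ Icc (g ml) (g mh), max (g ml) (min s (g mh)) = s := fun s hs => by
    rw [min_eq_left hs.2, max_eq_right hs.1]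
  have right : ∀ s ∈ Icc (g ml) (g mh), g (N s) = s := fun s hs => by rw [hN, fix s hs]
  have gm : ∀ z ∈ Icc ml mh, g z ∈ Icc (g ml) (g mh) := fun z hz =>
    ⟨hmono.monotoneOn h0.le (hsub hz) hz.1, hmono.monotoneOn (hsub hz) (h0.trans hlt).le hz.2⟩
  have left : ∀ z ∈ Icc ml mh, N (g z) = z := fun z hz =>
    hmono.injOn (hsub (mem _)) (hsub hz) (right _ (gm z hz))
  have mvt : ∀ x ∈ Icc ml mh, ∀ y ∈ Icc ml mh, x ≤ y → c * (y - x) ≤ g y - g x := by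
    refine (convex_Icc ml mh).mul_sub_le_image_sub_of_le_deriv (hcont.mono hsub)
      (fun x hx => ?_) (fun x hx => ?_)
    · exact hdiff.mono (fun z hz => hpos z (interior_subset hz)) x hx
    · exact lo _ (interior_subset hx)
  have pl : ∀ s s' : ℝ, |max (g ml) (min s (g mh)) - max (g ml) (min s' (g mh))| ≤ |s - s'| := fun s s' => by
    refine (abs_max_sub_max_le_max _ _ _ _).trans ?_
    rw [sub_self, abs_zero]
    refine max_le (abs_nonneg _) ((abs_min_sub_min_le_max _ _ _ _).trans ?_)
    rw [sub_self, abs_zero]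
    exact max_le le_rfl (abs_nonneg _)
  have lip : ∀ s s', |N s - N s'| ≤ 1 / c * |s - s'| := fun s s' => by
    have h1 := pl s s'
    rw [← hN, ← hN] at h1
    have h2 : c * |N s - N s'| ≤ |g (N s) - g (N s')| := by
      rcases le_total (N s) (N s') with h | h
      · rw [abs_sub_comm (N s), abs_sub_comm (g _), abs_of_nonneg (sub_nonneg.2 h)]
        exact (mvt _ (mem s) _ (mem s') h).trans (le_abs_self _)
      · rw [abs_of_nonneg (sub_nonneg.2 h)]
        exact (mvt _ (mem s') _ (mem s) h).trans (le_abs_self _)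
    rw [one_div, ← div_eq_inv_mul, le_div_iff₀ c0]
    linarith
  refine ⟨N, fun s => 1 / deriv g (N s), c, deriv g z1, Cg * (1 / c) ^ α / (c * c), c0, by positivity, lo,
    fun z hz => hmax hz, mem, left, right, fun _ => rfl, lip, fun s s' => ?_, fun s hs => ?_⟩
  · have a1 := lo _ (mem s)
    have a2 := lo _ (mem s')
    have p1 := c0.trans_le a1
    have p2 := c0.trans_le a2
    have e : 1 / deriv g (N s) - 1 / deriv g (N s') = (deriv g (N s') - deriv g (N s)) / (deriv g (N s) * deriv g (N s')) := by
      field_simp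
    rw [e, abs_div, abs_of_pos (mul_pos p1 p2), div_mul_eq_mul_div]
    have h1 := hH _ (mem s') _ (mem s)
    have h2 : dist (N s') (N s) ^ α ≤ (1 / c) ^ α * |s - s'| ^ α := by
      rw [← Real.mul_rpow (by positivity) (abs_nonneg _)]
      refine Real.rpow_le_rpow dist_nonneg ?_ hα.le
      rw [dist_comm, Real.dist_eq]
      exact lip s s'
    refine div_le_div₀ (by positivity) (h1.trans ?_) (by positivity) (mul_le_mul a1 a2 c0.le p1.le)
    rw [mul_assoc]
    exact mul_le_mul_of_nonneg_left h2 hCg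
  · have hNs : 0 < N s := hpos _ (mem s)
    have hder : HasDerivAt g (deriv g (N s)) (N s) :=
      (hdiff.differentiableAt (Ioi_mem_nhds hNs)).hasDerivAt
    have hcN : ContinuousAt N s := by
      refine LipschitzWith.continuous (K := ⟨1 / c, by positivity⟩) (LipschitzWith.of_dist_le_mul fun x y => ?_) |>.continuousAt
      rw [Real.dist_eq, Real.dist_eq]; exact lip x y
    rw [one_div]
    refine HasDerivAt.of_local_left_inverse hcN hder (hd _ hNs).ne' ?_
    filter_upwards [Ioo_mem_nhds hs.1 hs.2] with y hy using right y (Ioo_subset_Icc_self hy)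

/-- `g` is coercive under (A2) -/
theorem g_coercive {g : ℝ → ℝ} (hg : Ghyp α g) {C₁ β : ℝ} (hC : 0 < C₁)
    (h : ∀ z : ℝ, 0 < z → C₁ * z ^ β ≤ deriv g z) (M : ℝ) : ∃ z, 1 < z ∧ M < g z := by
  obtain ⟨hmono, hcont, hdiff, hloc⟩ := hg
  have hlog : ∀ z, 0 < z → HasDerivAt (fun y => g y - C₁ * Real.log y) (deriv g z - C₁ * z⁻¹) z := fun z hz =>
    ((hdiff.differentiableAt (Ioi_mem_nhds hz)).hasDerivAt).sub ((Real.hasDerivAt_log hz.ne').const_mul C₁)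
  have hβ : -1 ≤ β := by
    by_contra hβ
    push Not at hβ
    -- on `(0,1]`, `g y - C₁ log y` is monotone
    have mono : MonotoneOn (fun y => g y - C₁ * Real.log y) (Ioc 0 1) := by
      refine monotoneOn_of_deriv_nonneg (convex_Ioc 0 1) (fun x hx => (hlog x hx.1).continuousAt.continuousWithinAt)
        (fun x hx => (hlog x (interior_subset hx).1).differentiableAt.differentiableWithinAt) fun x hx => ?_
      have hx' := interior_subset hx
      rw [(hlog x hx'.1).deriv, sub_nonneg, ← Real.rpow_neg_one]
      refine le_trans (mul_le_mul_of_nonneg_left ?_ hC.le) (h x hx'.1)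
      exact Real.rpow_le_rpow_of_exponent_ge hx'.1 hx'.2 hβ.le
    set r := (g 1 - g 0 + 1) / C₁ with hr
    have h01 : g 0 < g 1 := hmono (by simp) (by simp) one_pos
    have r0 : 0 < r := by rw [hr]; apply div_pos <;> linarith
    have hz : Real.exp (-r) ∈ Ioc (0:ℝ) 1 := ⟨Real.exp_pos _, Real.exp_le_one_iff.2 (by linarith)⟩
    have h1 := mono hz (right_mem_Ioc.2 one_pos) hz.2
    simp only [Real.log_exp, Real.log_one] at h1
    have h2 : g 0 < g (Real.exp (-r)) := hmono (by simp) (Real.exp_pos _).le (Real.exp_pos _)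
    have h3 : C₁ * r = g 1 - g 0 + 1 := by rw [hr]; field_simp
    nlinarith
  have mono : MonotoneOn (fun y => g y - C₁ * Real.log y) (Ici 1) := by
    refine monotoneOn_of_deriv_nonneg (convex_Ici 1)
      (fun x hx => (hlog x (one_pos.trans_le hx)).continuousAt.continuousWithinAt)
      (fun x hx => (hlog x (one_pos.trans_le (interior_subset hx))).differentiableAt.differentiableWithinAt) fun x hx => ?_
    have hx' : (1:ℝ) ≤ x := interior_subset hx
    have x0 : 0 < x := one_pos.trans_le hx'
    rw [(hlog x x0).deriv, sub_nonneg, ← Real.rpow_neg_one]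
    refine le_trans (mul_le_mul_of_nonneg_left ?_ hC.le) (h x x0)
    exact Real.rpow_le_rpow_of_exponent_le hx' hβ
  set r := (|M - g 1| + 1) / C₁ with hr
  have r0 : 0 < r := by rw [hr]; positivity
  have hz : 1 < Real.exp r := Real.one_lt_exp_iff.2 r0
  refine ⟨Real.exp r, hz, ?_⟩
  have h1 := mono (Set.mem_Ici.2 le_rfl) hz.le hz.le
  simp only [Real.log_exp, Real.log_one] at h1
  have h3 : C₁ * r = |M - g 1| + 1 := by rw [hr]; field_simp
  have := le_abs_self (M - g 1)
  linarith

/-- the data `VD` from `Vhyp` -/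
theorem vd_of_hyp {V : E d → ℝ} (hV : Vhyp d α V) : ∃ KV, VD α KV (oscV d V) V (fun i => pd d i V) := by
  obtain ⟨hper, hC, hH⟩ := hV
  have hgr : HasGrad V (fun i => pd d i V) := HasGrad.of_diff (hC.differentiable one_ne_zero)
  obtain ⟨C, hC0, hCb⟩ := ZPer.bounded hper hgr.continuous
  have hcp : ∀ i, Continuous (pd d i V) := fun i => ContDiff.continuous_pd hC i
  choose B hB0 hB using fun i => ZPer.bounded (hgr.zper hper i) (hcp i)
  choose H hH0 hHH using hH
  have hel : Continuous fun x => el (fun i => pd d i V x) := by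
    refine Real.continuous_sqrt.comp ?_
    exact continuous_finsetSum _ fun i _ => (hcp i).mul (hcp i)
  obtain ⟨D, hD0, hD⟩ := ZPer.bounded (u := fun x => el (fun i => pd d i V x))
    (fun x k => by simp only [hgr.zper hper _ x k]) hel
  have sB : 0 ≤ ∑ i, B i := Finset.sum_nonneg fun i _ => hB0 i
  have sH : 0 ≤ ∑ i, H i := Finset.sum_nonneg fun i _ => hH0 i
  refine ⟨C + ∑ i, B i + ∑ i, H i + D, hgr, hper, fun x => (hCb x).trans (by linarith), fun x y => ?_, fun i => ?_, fun x => ?_⟩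
  · obtain ⟨x', hx', ex⟩ := ZPer.exists_rep hper x
    obtain ⟨y', hy', ey⟩ := ZPer.exists_rep hper y
    rw [← ex, ← ey, oscV]
    have hK : IsCompact (V '' Icc (0 : E d) 1) := isCompact_Icc.image hgr.continuous
    have a1 := le_csSup hK.bddAbove (mem_image_of_mem V hx')
    have a2 := csInf_le hK.bddBelow (mem_image_of_mem V hy')
    linarith
  · have b1 := Finset.single_le_sum (f := B) (fun i _ => hB0 i) (Finset.mem_univ i)
    have b2 := Finset.single_le_sum (f := H) (fun i _ => hH0 i) (Finset.mem_univ i)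
    refine ⟨fun x => (hB i x).trans (by linarith), fun x y => (hHH i x y).trans (mul_le_mul_of_nonneg_right (by linarith) (by positivity))⟩
  · exact (le_abs_self _).trans ((hD x).trans (by linarith))

end MFG

end S21

section S22

open MeasureTheory Set Filter Topology

namespace MFG
variable {d : ℕ} {α : ℝ}

theorem cls_exists (hα : 0 < α) (hα1 : α < 1) {g N f : ℝ → ℝ} {ml mh c k C η : ℝ} (h0 : 0 < ml) (hI : Inv α g ml mh N f c k C)
    (h1 : 1 ∈ Icc ml mh) (hab : g ml ≤ g mh) (h1m : g 1 ∈ Icc (g ml) (g mh)) (hη : 0 < η) :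
    ∃ P, Cls α (g ml) (g mh) (g 1) (ml / 2) (1 / (2 * k)) (mh + ml + 1 / c + C + 2) P ∧
      (∀ s ∈ Icc (g ml) (g mh), |P.eval s - N s| ≤ η) ∧ ∀ s ∈ Icc (g ml) (g mh), |P.derivative.eval s - f s| ≤ η := by
  have c0 := hI.c0
  have C0 := hI.C0
  have k0 : 0 < k := c0.trans_le ((hI.lo 1 h1).trans (hI.hi 1 h1))
  have mh0 : 0 < mh := h0.trans_le (h1.1.trans h1.2)
  set T := g mh - g ml + 1 with hT
  have T0 : 0 < T := by linarith
  set δ := min (min η 1) (min (1 / (2 * k)) (min η (ml / 2) / T)) with hδ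
  have δ0 : 0 < δ := by simp only [hδ, lt_min_iff]; refine ⟨⟨hη, one_pos⟩, by positivity, ?_⟩; apply div_pos (lt_min hη (by positivity)) T0
  have δη : δ ≤ η := (min_le_left _ _).trans (min_le_left _ _)
  have δ1 : δ ≤ 1 := (min_le_left _ _).trans (min_le_right _ _)
  have δk : δ ≤ 1 / (2 * k) := (min_le_right _ _).trans (min_le_left _ _)
  have δT : δ * T ≤ min η (ml / 2) := (le_div_iff₀ T0).1 ((min_le_right _ _).trans (min_le_right _ _))
  obtain ⟨P, hP1, hP2, hP3⟩ := poly_approx hα hα1 (s1 := g 1) C0 hab δ0 hI.hol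
  have cN : Continuous N := by
    refine LipschitzWith.continuous (K := ⟨1 / c, by positivity⟩) (LipschitzWith.of_dist_le_mul fun x y => ?_)
    rw [Real.dist_eq, Real.dist_eq]; exact hI.lip x y
  have hder : ∀ s ∈ interior (Icc (g ml) (g mh)), HasDerivAt (fun s => P.eval s - N s) (P.derivative.eval s - f s) s := fun s hs => by
    rw [interior_Icc] at hs
    exact (P.hasDerivAt s).sub (hI.der s hs)
  have cc : ContinuousOn (fun s => P.eval s - N s) (Icc (g ml) (g mh)) := (P.continuous.sub cN).continuousOn
  have dd : DifferentiableOn ℝ (fun s => P.eval s - N s) (interior (Icc (g ml) (g mh))) := fun s hs =>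
    (hder s hs).differentiableAt.differentiableWithinAt
  have up := (convex_Icc (g ml) (g mh)).image_sub_le_mul_sub_of_deriv_le cc dd (C := δ) fun s hs => by
    rw [(hder s hs).deriv]; exact (abs_le.1 (hP1 s (interior_subset hs))).2
  have dn := (convex_Icc (g ml) (g mh)).mul_sub_le_image_sub_of_le_deriv cc dd (C := -δ) fun s hs => by
    rw [(hder s hs).deriv]; exact (abs_le.1 (hP1 s (interior_subset hs))).1
  have hN1 : N (g 1) = 1 := hI.left 1 h1
  have err : ∀ s ∈ Icc (g ml) (g mh), |P.eval s - N s| ≤ min η (ml / 2) := fun s hs => by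
    refine le_trans ?_ δT
    have hb := hs.1; have hb2 := hs.2; have hb3 := h1m.1; have hb4 := h1m.2
    rcases le_total s (g 1) with h | h
    · have u1 := up s hs _ h1m h
      have u2 := dn s hs _ h1m h
      simp only [hP3, hN1] at u1 u2
      rw [abs_le]; constructor <;> nlinarith
    · have u1 := up _ h1m s hs h
      have u2 := dn _ h1m s hs h
      simp only [hP3, hN1] at u1 u2
      rw [abs_le]; constructor <;> nlinarith
  have ic : 0 < 1 / c := by positivity
  have flo : ∀ s, 1 / k ≤ f s := fun s => by
    rw [hI.fdef]; exact one_div_le_one_div_of_le (c0.trans_le (hI.lo _ (hI.mem s))) (hI.hi _ (hI.mem s))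
  have fhi : ∀ s, f s ≤ 1 / c := fun s => by
    rw [hI.fdef]; exact one_div_le_one_div_of_le c0 (hI.lo _ (hI.mem s))
  have e2 : 1 / k = 1 / (2 * k) + 1 / (2 * k) := by field_simp; norm_num
  refine ⟨P, ⟨fun s hs => ?_, fun s hs => ?_, fun s hs => ?_, fun s hs => ?_, fun s hs s' hs' => ?_, hP3⟩,
    fun s hs => (err s hs).trans (min_le_left _ _), fun s hs => (hP1 s hs).trans δη⟩
  · have := (abs_le.1 ((err s hs).trans (min_le_right _ _))).1
    have := (hI.mem s).1
    linarith
  · have := (abs_le.1 ((err s hs).trans (min_le_right _ _))).2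
    have := (hI.mem s).2
    linarith
  · have := (abs_le.1 (hP1 s hs)).1
    have := flo s
    linarith
  · have := (abs_le.1 (hP1 s hs)).2
    have := fhi s
    linarith
  · exact (hP2 s hs s' hs').trans (mul_le_mul_of_nonneg_right (by linarith) (by positivity))

theorem BH.sum' {f : Fin d → E d → ℝ} (h : ∀ i, ∃ B, BH α B (f i)) : ∃ B, BH α B fun x => ∑ i, f i x := by
  choose B hB using h
  exact ⟨_, BH.sum (B := ∑ i, B i) fun i => (hB i).mono
    (Finset.single_le_sum (f := B) (fun i _ => (hB i).nonneg) (Finset.mem_univ i))⟩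

theorem BH.of_per (hα : 0 < α) {f : E d → ℝ} (hf : ZPer d f) {H : ℝ} (hH : ∀ x y, |f x - f y| ≤ H * dist x y ^ α) : ∃ B, BH α B f := by
  obtain ⟨C, C0, hC⟩ := ZPer.bounded hf (holder_continuous hα hH)
  refine ⟨C + |H|, fun x => (hC x).trans (by have := abs_nonneg H; linarith), fun x y => (hH x y).trans
    (mul_le_mul_of_nonneg_right (by have := le_abs_self H; linarith) (by positivity))⟩

theorem BH.of_grad (hα : 0 < α) (hα1 : α < 1) {f : E d → ℝ} {p : Fin d → E d → ℝ} (hf : ZPer d f) (hg : HasGrad f p)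
    (hp : ∀ i, Continuous (p i)) : ∃ B, BH α B f := by
  obtain ⟨C, C0, hC⟩ := ZPer.bounded hf hg.continuous
  choose B hB0 hB using fun i => ZPer.bounded (hg.zper hf i) (hp i)
  have sB : 0 ≤ ∑ i, B i := Finset.sum_nonneg fun i _ => hB0 i
  exact ⟨_, BH.of_lip hα hα1 (by positivity) hC (hg.lip sB fun i x => (hB i x).trans
    (Finset.single_le_sum (f := B) (fun i _ => hB0 i) (Finset.mem_univ i)))⟩

/-- existence -/
theorem sol_exists (hα : 0 < α) (hα1 : α < 1) {g : ℝ → ℝ} {V : E d → ℝ} (hg : Ghyp α g) (hV : Vhyp d α V) (hA1 : A1 d g V) (hA2 : A2 g)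
    {ε : ℝ} (hε : 0 < ε) : ∃ u m : E d → ℝ, DiscSol d α g V ε u m ∧ ∀ x, 0 < m x := by
  obtain ⟨m0, m00, hm0⟩ := hA1
  obtain ⟨C₁, C₂, β, hC1, -, hA, -⟩ := hA2
  have hd : ∀ z, 0 < z → 0 < deriv g z := fun z hz => lt_of_lt_of_le (by positivity) (hA z hz)
  obtain ⟨KV, hVD⟩ := vd_of_hyp hV
  set Vp : Fin d → E d → ℝ := fun i => pd d i V with hVp
  set Osc := oscV d V with hOsc
  have m00' : 0 < m0 := m00
  have hosc : 0 ≤ Osc := by have := hVD.osc 0 0; linarith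
  have hm1 : m0 ≤ 1 := by
    by_contra hc
    push Not at hc
    have := hg.1 (show (1:ℝ) ∈ Ici 0 by simp) (show m0 ∈ Ici 0 from m00'.le) hc
    linarith
  set ml := m0 / 2 with hml
  have ml0 : 0 < ml := by positivity
  obtain ⟨mh, hmh1, hmh⟩ := g_coercive hg hC1 hA (max (W0 (g 1) (ml / 2) KV Osc ε) (g 1))
  have hlt : ml < mh := by linarith
  have hal : g ml < g 1 - Osc := by
    rw [← hm0]; exact hg.1 ml0.le m00'.le (by linarith)
  have hb : W0 (g 1) (ml / 2) KV Osc ε < g mh := (le_max_left _ _).trans_lt hmh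
  have hb1 : g 1 ≤ g mh := ((le_max_right _ _).trans_lt hmh).le
  have s1m : g 1 ∈ Icc (g ml) (g mh) := ⟨by linarith, hb1⟩
  have h1m : (1:ℝ) ∈ Icc ml mh := ⟨by linarith, hmh1.le⟩
  obtain ⟨N, f, c, k, C, hI⟩ := inv_exists hα hg hd ml0 hlt
  have k0 : 0 < k := hI.c0.trans_le ((hI.lo 1 h1m).trans (hI.hi 1 h1m))
  have hη : ∀ n : ℕ, (0:ℝ) < 1 / ((n:ℝ) + 1) := fun n => by positivity
  choose P hP hPN hPf using fun n : ℕ => cls_exists hα hα1 ml0 hI h1m (s1m.1.trans s1m.2) s1m (hη n)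
  have hc0 : 0 < ml / 2 := by positivity
  have hc1 : 0 < 1 / (2 * k) := by positivity
  choose u p q hS hW using fun n => psol_exists hα hα1 hc0 hc1 hal hb hb1 hVD hε (hP n)
  obtain ⟨KK, hKK⟩ := psol_full hα hα1 hc0 hc1 s1m hVD hε (Kp := mh + ml + 1 / c + C + 2)
  have hF := fun n => hKK (P n) 1 (u n) (p n) (q n) (hP n) zero_le_one le_rfl (hS n) (hW n)
  obtain ⟨U, p', q', hC2, tu, tp, tq⟩ := C2A.of_tendsto hα (fun n => (hS n).c2) (fun n => (hF n).1) (fun n => (hF n).2.1)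
    (fun n i j => ((hF n).2.2 i j).1) (fun n i j => ((hF n).2.2 i j).2)
  have tw := tendsto_WW (ε := ε) (V := V) (t := fun _ => 1) (t' := 1) tendsto_const_nhds tu tp
  have tg := tendsto_WG (ε := ε) (Vp := Vp) (t := fun _ => 1) (t' := 1) tendsto_const_nhds tp tq
  set w := WW ε 1 V U p' with hw
  have wlo : ∀ x, g 1 - Osc ≤ w x := fun x => ge_of_tendsto (tw x) (Eventually.of_forall fun n =>
    (ap1 (hP n) hc0 hc1 s1m hVD hε zero_le_one le_rfl (hS n) (hW n)).1 x)
  have whi : ∀ x, w x ≤ W0 (g 1) (ml / 2) KV Osc ε := fun x => le_of_tendsto (tw x) (Eventually.of_forall fun n =>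
    (ap2 (hP n) hα hc0 hc1 s1m hVD hε zero_le_one le_rfl (hS n) (hW n)).2 x)
  have wI : ∀ x, w x ∈ Ioo (g ml) (g mh) := fun x => ⟨hal.trans_le (wlo x), (whi x).trans_lt hb⟩
  have cN : Continuous N := by
    refine LipschitzWith.continuous (K := ⟨1 / c, by have := hI.c0; positivity⟩) (LipschitzWith.of_dist_le_mul fun x y => ?_)
    rw [Real.dist_eq, Real.dist_eq]; exact hI.lip x y
  have cf : Continuous f := holder_continuous hα (B := C) fun x y => by rw [Real.dist_eq]; exact hI.hol x y
  have t0 : Tendsto (fun n : ℕ => 1 / ((n:ℝ) + 1)) uf (𝓝 0) := tendsto_one_div_add_atTop_nhds_zero_nat.mono_left uf_le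
  have lim : ∀ (a : ℕ → ℝ) (b : ℕ → ℝ) (l : ℝ), (∀ n : ℕ, |a n - b n| ≤ 1 / ((n:ℝ) + 1)) → Tendsto b uf (𝓝 l) → Tendsto a uf (𝓝 l) :=
    fun a b l h hb => by
      have : Tendsto (fun n => a n - b n) uf (𝓝 0) := squeeze_zero_norm (fun n => by rw [Real.norm_eq_abs]; exact h n) t0
      simpa using this.add hb
  have tP : ∀ x, Tendsto (fun n => (P n).eval (WW ε 1 V (u n) (p n) x)) uf (𝓝 (N (w x))) := fun x =>
    lim _ _ _ (fun n => hPN n _ (hW n x)) ((cN.tendsto _).comp (tw x))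
  have tD : ∀ x, Tendsto (fun n => (P n).derivative.eval (WW ε 1 V (u n) (p n) x)) uf (𝓝 (f (w x))) := fun x =>
    lim _ _ _ (fun n => hPf n _ (hW n x)) ((cf.tendsto _).comp (tw x))
  have heq : ∀ x, ε * (N (w x) - 1) - ∑ i, (N (w x) * q' i i x + f (w x) * WG ε 1 Vp p' q' i x * p' i x) = 0 := fun x => by
    have h1 : Tendsto (fun n => ε * ((P n).eval (WW ε 1 V (u n) (p n) x) - 1) - ∑ i, ((P n).eval (WW ε 1 V (u n) (p n) x) * q n i i x +
        (P n).derivative.eval (WW ε 1 V (u n) (p n) x) * WG ε 1 Vp (p n) (q n) i x * p n i x)) uf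
        (𝓝 (ε * (N (w x) - 1) - ∑ i, (N (w x) * q' i i x + f (w x) * WG ε 1 Vp p' q' i x * p' i x))) :=
      (((tP x).sub_const 1).const_mul ε).sub (tendsto_finsetSum Finset.univ fun i _ =>
        ((tP x).mul (tq i i x)).add (((tD x).mul (tg i x)).mul (tp i x)))
    refine tendsto_nhds_unique h1 ?_
    exact tendsto_const_nhds.congr fun n => ((hS n).eq x).symm
  have gw : HasGrad w (WG ε 1 Vp p' q') := WW_grad hVD.g hC2.gu hC2.gp
  have gm : HasGrad (fun x => N (w x)) (fun i x => f (w x) * WG ε 1 Vp p' q' i x) := gw.comp fun x => hI.der _ (wI x)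
  have pw : ZPer d w := fun x k => by
    simp only [hw, WW, hC2.per x k, fun i => hC2.perp i x k, hVD.per x k]
  -- regularity
  obtain ⟨Hq, hHq⟩ := hC2.hol
  have bq : ∀ i j, ∃ B, BH α B (q' i j) := fun i j => BH.of_per hα (hC2.perq i j) (hHq i j)
  have bp : ∀ i, ∃ B, BH α B (p' i) := fun i => BH.of_grad hα hα1 (hC2.perp i) (hC2.gp i) (fun j => hC2.cq hα i j)
  have bG : ∀ i, ∃ B, BH α B (WG ε 1 Vp p' q' i) := fun i => by
    obtain ⟨B1, h1⟩ := bp i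
    obtain ⟨B2, h2⟩ := BH.sum' (α := α) (f := fun j x => p' j x * q' j i x) fun j => by
      obtain ⟨A, hA⟩ := bp j
      obtain ⟨A', hA'⟩ := bq j i
      exact ⟨_, hA.mul hA'⟩
    exact ⟨_, (((BH.const ε).mul h1).add h2).add ((BH.const 1).mul (hVD.bh i))⟩
  have cG : ∀ i, Continuous (WG ε 1 Vp p' q' i) := fun i => by
    obtain ⟨B, hB⟩ := bG i
    exact holder_continuous hα hB.2
  obtain ⟨Bw, hBw⟩ : ∃ L, ∀ x y, |w x - w y| ≤ L * dist x y := by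
    choose B hB0 hB using fun i => ZPer.bounded (gw.zper pw i) (cG i)
    exact ⟨_, gw.lip (Finset.sum_nonneg fun i (_ : i ∈ Finset.univ) => hB0 i) fun i x => (hB i x).trans
      (Finset.single_le_sum (f := B) (fun i _ => hB0 i) (Finset.mem_univ i))⟩
  obtain ⟨Bf, hBf⟩ : ∃ B, BH α B (fun x => f (w x)) := by
    refine BH.of_per hα (H := C * |Bw| ^ α) (fun x k => by simp only [pw x k]) fun x y => (hI.hol _ _).trans ?_
    rw [mul_assoc, ← Real.mul_rpow (abs_nonneg _) dist_nonneg]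
    refine mul_le_mul_of_nonneg_left (Real.rpow_le_rpow (abs_nonneg _) ((hBw x y).trans ?_) hα.le) hI.C0
    exact mul_le_mul_of_nonneg_right (le_abs_self _) dist_nonneg
  have mpos : ∀ x, 0 < N (w x) := fun x => ml0.trans_le (hI.mem _).1
  have pdU : ∀ i, pd d i U = p' i := fun i => hC2.gu.pd i
  refine ⟨U, fun x => N (w x), ⟨hC2.per, fun x k => by simp only [pw x k], ⟨?_, fun i j => ?_⟩, ⟨?_, fun i => ?_⟩,
    fun x => (mpos x).le, fun x => ?_, fun x => ?_⟩, mpos⟩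
  · exact hC2.gu.contDiff_two fun i => (hC2.gp i).contDiff_one fun j => hC2.cq hα i j
  · rw [pdU, (hC2.gp j).pd i]
    obtain ⟨B, hB⟩ := bq j i
    exact ⟨B, hB.nonneg, hB.2⟩
  · exact gm.contDiff_one fun i => (cf.comp gw.continuous).mul (cG i)
  · rw [gm.pd i]
    obtain ⟨B, hB⟩ := bG i
    have := hBf.mul hB
    exact ⟨_, this.nonneg, this.2⟩
  · rw [hI.right _ (Ioo_subset_Icc_self (wI x)), hw, WW, gradSq]
    simp only [pdU, sq, one_mul]
  · have hdiv : divUp d (fun x => N (w x)) U x = ∑ i, (N (w x) * q' i i x + f (w x) * WG ε 1 Vp p' q' i x * p' i x) := by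
      rw [divUp]
      refine Finset.sum_congr rfl fun i _ => ?_
      rw [pdU, (gm.mul (hC2.gp i)).pd i]
      ring
    rw [hdiv]
    have := heq x
    linarith

end MFG

end S22

section S23

open MeasureTheory Set Filter Topology

namespace MFG
variable {d : ℕ} {α : ℝ}

theorem sol_unique {g : ℝ → ℝ} {V : E d → ℝ} (hg : Ghyp α g) (hV : Vhyp d α V) {ε : ℝ} (hε : 0 < ε)
    {u m u' m' : E d → ℝ} (h : DiscSol d α g V ε u m) (h' : DiscSol d α g V ε u' m') (hm : ∀ x, 0 < m x) : u' = u ∧ m' = m := by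
  have key : ∀ {u m : E d → ℝ}, DiscSol d α g V ε u m → HasGrad u (fun i => pd d i u) ∧ (∀ i, Continuous (pd d i u)) ∧
      (∀ i, HasGrad (pd d i u) (fun j => pd d j (pd d i u))) ∧ (∀ i j, Continuous (pd d j (pd d i u))) ∧
      HasGrad m (fun i => pd d i m) ∧ (∀ i, Continuous (pd d i m)) ∧
      ∀ x, divUp d m u x = ∑ i, (pd d i m x * pd d i u x + m x * pd d i (pd d i u) x) := by
    intro u m h
    have c1 : ∀ i, ContDiff ℝ 1 (pd d i u) := fun i => ContDiff.pd_one h.reg_u.1 i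
    have gu : HasGrad u (fun i => pd d i u) := HasGrad.of_diff (h.reg_u.1.differentiable two_ne_zero)
    have gp : ∀ i, HasGrad (pd d i u) (fun j => pd d j (pd d i u)) := fun i => HasGrad.of_diff ((c1 i).differentiable one_ne_zero)
    have gm : HasGrad m (fun i => pd d i m) := HasGrad.of_diff (h.reg_m.1.differentiable one_ne_zero)
    refine ⟨gu, fun i => (c1 i).continuous, gp, fun i j => ContDiff.continuous_pd (c1 i) j, gm,
      fun i => ContDiff.continuous_pd h.reg_m.1 i, fun x => ?_⟩
    rw [divUp]
    refine Finset.sum_congr rfl fun i _ => ?_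
    rw [(gm.mul (gp i)).pd i]
  obtain ⟨gu, cp, gp, cq, gm, cm, hdiv⟩ := key h
  obtain ⟨gu', cp', gp', cq', gm', cm', hdiv'⟩ := key h'
  have pF : ∀ i, ZPer d (fun x => (u x - u' x) * (m x * pd d i u x - m' x * pd d i u' x)) := fun i x k => by
    simp only [h.per_u x k, h'.per_u x k, h.per_m x k, h'.per_m x k, gu.zper h.per_u i x k, gu'.zper h'.per_u i x k]
  have gF := fun i => (gu.sub gu').mul ((gm.mul (gp i)).sub (gm'.mul (gp' i)))
  have cu := gu.continuous
  have cu' := gu'.continuous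
  have cmm := gm.continuous
  have cmm' := gm'.continuous
  have hIntg := fun i => torus_int_pd (gF i) (fun j => by
    have := cp j; have := cp' j; have := cq i j; have := cq' i j; have := cm j; have := cm' j; have := cp i; have := cp' i
    fun_prop) (pF i) i
  set G : E d → ℝ := fun x => (m x - m' x) * (g (m x) - g (m' x)) + 1 / 2 * (m x + m' x) * ∑ i, (pd d i u x - pd d i u' x) ^ 2 with hG
  have hGeq : ∀ x, G x = ∑ i, ((pd d i u x - pd d i u' x) * (m x * pd d i u x - m' x * pd d i u' x) +
      (u x - u' x) * ((pd d i m x * pd d i u x + m x * pd d i (pd d i u) x) - (pd d i m' x * pd d i u' x + m' x * pd d i (pd d i u') x))) := fun x => by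
    rw [Finset.sum_add_distrib, ← Finset.mul_sum, Finset.sum_sub_distrib, ← hdiv x, ← hdiv' x]
    have e1 := h.fp x
    have e2 := h'.fp x
    have e3 := h.hj x
    have e4 := h'.hj x
    have e5 : ∑ i, (pd d i u x - pd d i u' x) * (m x * pd d i u x - m' x * pd d i u' x) =
        1 / 2 * (m x + m' x) * ∑ i, (pd d i u x - pd d i u' x) ^ 2 + 1 / 2 * (m x - m' x) * (gradSq d u x - gradSq d u' x) := by
      rw [gradSq, gradSq, ← Finset.sum_sub_distrib, Finset.mul_sum, Finset.mul_sum, ← Finset.sum_add_distrib]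
      exact Finset.sum_congr rfl fun i _ => by ring
    rw [e5, hG]
    simp only [← e3, ← e4]
    have e6 : divUp d m u x - divUp d m' u' x = ε * (m x - m' x) := by linarith
    rw [e6]; ring
  have cG : Continuous G := by
    rw [show G = _ from funext hGeq]
    have cqi : ∀ i, Continuous (pd d i (pd d i u)) := fun i => cq i i
    have cqi' : ∀ i, Continuous (pd d i (pd d i u')) := fun i => cq' i i
    fun_prop
  have G1 : ∀ x, 0 ≤ (m x - m' x) * (g (m x) - g (m' x)) := fun x => by
    rcases le_total (m x) (m' x) with hh | hh
    · have := hg.1.monotoneOn (h.m_nonneg x) (h'.m_nonneg x) hh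
      nlinarith
    · have := hg.1.monotoneOn (h'.m_nonneg x) (h.m_nonneg x) hh
      nlinarith
  have S0 : ∀ x, 0 ≤ ∑ i, (pd d i u x - pd d i u' x) ^ 2 := fun x => Finset.sum_nonneg fun _ _ => sq_nonneg _
  have G2 : ∀ x, 0 ≤ 1 / 2 * (m x + m' x) * ∑ i, (pd d i u x - pd d i u' x) ^ 2 := fun x => by
    have := hm x; have := h'.m_nonneg x; have := S0 x
    positivity
  have pG : ZPer d G := fun x k => by
    simp only [hG, h.per_m x k, h'.per_m x k, fun i => gu.zper h.per_u i x k, fun i => gu'.zper h'.per_u i x k]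
  have iG : ∫ x in Icc (0 : E d) 1, G x = 0 := by
    rw [show G = _ from funext hGeq, integral_finsetSum]
    · exact Finset.sum_eq_zero fun i _ => hIntg i
    · intro i _
      refine Continuous.integrableOn_Icc ?_
      have := cq i i; have := cq' i i; have := cm i; have := cm' i; have := cp i; have := cp' i
      fun_prop
  have G0 := int_zero cG (fun x => add_nonneg (G1 x) (G2 x)) pG iG
  have hmm : ∀ x, m' x = m x := fun x => by
    have h1 : (m x - m' x) * (g (m x) - g (m' x)) = 0 := le_antisymm (by have := G0 x; have := G2 x; simp only [hG] at *; linarith) (G1 x)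
    rcases mul_eq_zero.1 h1 with h2 | h2
    · linarith
    · exact (hg.1.injOn (h.m_nonneg x) (h'.m_nonneg x) (by linarith)).symm
  have hpp : ∀ x i, pd d i u x = pd d i u' x := fun x i => by
    have h1 : 1 / 2 * (m x + m' x) * ∑ i, (pd d i u x - pd d i u' x) ^ 2 = 0 :=
      le_antisymm (by have := G0 x; have := G1 x; simp only [hG] at *; linarith) (G2 x)
    have h2 : 0 < 1 / 2 * (m x + m' x) := by have := hm x; have := h'.m_nonneg x; positivity
    have h3 := (mul_eq_zero.1 h1).resolve_left h2.ne'
    have h4 := (Finset.sum_eq_zero_iff_of_nonneg fun i _ => sq_nonneg _).1 h3 i (Finset.mem_univ i)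
    have := pow_eq_zero_iff (two_ne_zero) |>.1 h4
    linarith
  refine ⟨funext fun x => ?_, funext hmm⟩
  have e3 := h.hj x
  have e4 := h'.hj x
  have e5 : gradSq d u x = gradSq d u' x := by simp only [gradSq, hpp]
  rw [hmm, ← e3, e5] at e4
  exact mul_left_cancel₀ hε.ne' (by linarith)

end MFG

end S23

theorem stmt7 (d : ℕ) (α : ℝ) (hα0 : 0 < α) (hα1 : α < 1)
    (g : ℝ → ℝ) (V : (Fin d → ℝ) → ℝ) (hg : Ghyp α g) (hV : Vhyp d α V)
    (hA1 : A1 d g V) (hA2 : A2 g) (ε : ℝ) (hε : 0 < ε) :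
    ∃ u m : (Fin d → ℝ) → ℝ, DiscSol d α g V ε u m ∧ (∀ x, 0 < m x) ∧
      ∀ u' m' : (Fin d → ℝ) → ℝ, DiscSol d α g V ε u' m' → u' = u ∧ m' = m := by
  obtain ⟨u, m, h, hm⟩ := MFG.sol_exists hα0 hα1 hg hV hA1 hA2 hε
  exact ⟨u, m, h, hm, fun u' m' h' => MFG.sol_unique hg hV hε h h' hm⟩
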